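/- Let m₀ be an odd square-free positive integer and let ι > 0. Then there exist c > 0 and y₀ such that for all y ≥ y₀, the number of primes q ≤ y such that (q − 1)/2 is an odd square-free integer with at least two prime factors, every prime factor of (q − 1)/2 is at least y^(1/6 − ι), and m₀ is a quadratic residue modulo q, is at least c · y / (log y)³. -/

import Mathlib

namespace SPC
open Finset

/-- additive character -/
noncomputable def ee (x : ℝ) : ℂ := Complex.exp (2 * Real.pi * Complex.I * x)

lemma ee_add (x y : ℝ) : ee (x + y) = ee x * ee y := by
  unfold ee; rw [← Complex.exp_add]; congr 1; push_cast; ring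

lemma ee_nat_mul (n : ℕ) (x : ℝ) : ee (n * x) = ee x ^ n := by
  unfold ee; rw [← Complex.exp_nat_mul]; congr 1; push_cast; ring

lemma norm_ee (x : ℝ) : ‖ee x‖ = 1 := by
  unfold ee
  have : (2 * Real.pi * Complex.I * x : ℂ) = ((2 * Real.pi * x : ℝ) : ℂ) * Complex.I := by push_cast; ring
  rw [this, Complex.norm_exp_ofReal_mul_I]

lemma ee_int (n : ℤ) : ee n = 1 := by
  unfold ee
  rw [Complex.exp_eq_one_iff]
  exact ⟨n, by push_cast; ring⟩

lemma conj_ee (x : ℝ) : (starRingEnd ℂ) (ee x) = ee (-x) := by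
  unfold ee; rw [← Complex.exp_conj]; congr 1; simp [Complex.conj_ofNat]

lemma ee_periodic (x : ℝ) (n : ℤ) : ee (x - n) = ee x := by
  have := ee_add (x - n) n
  rw [ee_int, mul_one] at this
  rw [← this]; congr 1; ring

noncomputable def Dk (L : ℕ) (x : ℝ) : ℂ := ∑ a ∈ range L, ee (a * x)

lemma norm_Dk_le (L : ℕ) (x : ℝ) : ‖Dk L x‖ ≤ L := by
  unfold Dk
  refine (norm_sum_le _ _).trans ?_
  simp [norm_ee]

lemma norm_ee_sub_one (x : ℝ) : ‖ee x - 1‖ = 2 * |Real.sin (Real.pi * x)| := by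
  have := Complex.norm_exp_I_mul_ofReal_sub_one (2 * Real.pi * x)
  have h2 : ee x = Complex.exp (Complex.I * ((2 * Real.pi * x : ℝ) : ℂ)) := by
    unfold ee; congr 1; push_cast; ring
  rw [h2, this]
  rw [show 2 * Real.pi * x / 2 = Real.pi * x by ring]
  simp [Real.norm_eq_abs]

lemma norm_ee_sub_one_ge (x : ℝ) (hx : |x| ≤ 1 / 2) : 4 * |x| ≤ ‖ee x - 1‖ := by
  rw [norm_ee_sub_one]
  have h := Real.mul_abs_le_abs_sin (x := Real.pi * x) (by
    rw [abs_mul, abs_of_pos Real.pi_pos]; nlinarith [Real.pi_pos])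
  rw [abs_mul, abs_of_pos Real.pi_pos] at h
  have : 2 / Real.pi * (Real.pi * |x|) = 2 * |x| := by
    field_simp
  linarith

lemma norm_Dk_le' (L : ℕ) (x : ℝ) (hx : |x| ≤ 1 / 2) : 2 * |x| * ‖Dk L x‖ ≤ 1 := by
  have h1 : (ee x - 1) * Dk L x = ee x ^ L - 1 := by
    unfold Dk
    rw [← mul_geom_sum]
    simp_rw [ee_nat_mul]
  have h2 : ‖ee x - 1‖ * ‖Dk L x‖ ≤ 2 := by
    rw [← norm_mul, h1]
    refine (norm_sub_le _ _).trans ?_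
    rw [norm_pow, norm_ee]; norm_num
  have := norm_ee_sub_one_ge x hx
  nlinarith [norm_nonneg (Dk L x)]

lemma Dk_periodic (L : ℕ) (x : ℝ) (n : ℤ) : Dk L (x - n) = Dk L x := by
  unfold Dk
  refine sum_congr rfl fun a _ => ?_
  have : (a : ℝ) * (x - n) = a * x - ((a * n : ℤ) : ℝ) := by push_cast; ring
  rw [this, ee_periodic]

lemma sum_inv_sq_le (K : ℕ) : ∑ k ∈ range K, (1 : ℝ) / ((k : ℝ) + 1) ^ 2 ≤ 2 := by
  have key : ∀ K : ℕ, ∑ k ∈ range (K + 1), (1 : ℝ) / ((k : ℝ) + 1) ^ 2 ≤ 2 - 1 / ((K : ℝ) + 1) := by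
    intro K
    induction K with
    | zero => norm_num
    | succ K ih =>
      rw [sum_range_succ]
      have h : (1 : ℝ) / (((K + 1 : ℕ) : ℝ) + 1) ^ 2 ≤ 1 / ((K : ℝ) + 1) - 1 / (((K + 1 : ℕ) : ℝ) + 1) := by
        push_cast
        rw [div_sub_div _ _ (by positivity) (by positivity), div_le_div_iff₀ (by positivity) (by positivity)]
        nlinarith [(Nat.cast_nonneg K : (0:ℝ) ≤ K)]
      linarith
  rcases Nat.eq_zero_or_pos K with h0 | h0
  · subst h0; norm_num
  · obtain ⟨k, rfl⟩ : ∃ k, K = k + 1 := ⟨K - 1, by omega⟩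
    refine (key k).trans ?_
    have : (0 : ℝ) ≤ 1 / ((k : ℝ) + 1) := by positivity
    linarith

lemma half_row {κ : Type*} (t : Finset κ) (x W : κ → ℝ) (δ A : ℝ) (hδ : 0 < δ) (hA : 0 ≤ A)
    (hx : ∀ i ∈ t, 0 ≤ x i) (sep : ∀ i ∈ t, ∀ j ∈ t, i ≠ j → δ ≤ |x i - x j|)
    (hW : ∀ i ∈ t, 0 ≤ W i) (hWA : ∀ i ∈ t, W i ≤ A) (hWx : ∀ i ∈ t, 4 * x i ^ 2 * W i ≤ 1) :
    ∑ i ∈ t, W i ≤ A + 1 / (2 * δ ^ 2) := by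
  classical
  let w : ℕ → ℝ := fun k => if k = 0 then A else 1 / (4 * δ ^ 2) * (1 / (k : ℝ) ^ 2)
  have hw0 : ∀ k, 0 ≤ w k := by
    intro k; simp only [w]; split_ifs <;> positivity
  have hinj : Set.InjOn (fun i => ⌊x i / δ⌋₊) (t : Set κ) := by
    intro i hi j hj hij
    by_contra hne
    have hs := sep i hi j hj hne
    simp only at hij
    have h1 := Nat.floor_le (div_nonneg (hx i hi) hδ.le)
    have h2 := Nat.lt_floor_add_one (x i / δ)
    have h3 := Nat.floor_le (div_nonneg (hx j hj) hδ.le)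
    have h4 := Nat.lt_floor_add_one (x j / δ)
    rw [hij] at h1 h2
    have h5 : |x i / δ - x j / δ| < 1 := by rw [abs_lt]; constructor <;> linarith
    rw [← sub_div, abs_div, abs_of_pos hδ, div_lt_one hδ] at h5
    linarith
  have hle : ∀ i ∈ t, W i ≤ w ⌊x i / δ⌋₊ := by
    intro i hi
    simp only [w]
    split_ifs with h
    · exact hWA i hi
    · have hk : (0 : ℝ) < (⌊x i / δ⌋₊ : ℝ) := by exact_mod_cast Nat.pos_of_ne_zero h
      have h1 := Nat.floor_le (div_nonneg (hx i hi) hδ.le)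
      rw [le_div_iff₀ hδ] at h1
      have h2 : (⌊x i / δ⌋₊ * δ) ^ 2 ≤ x i ^ 2 := by gcongr
      have h3 := hWx i hi
      have h4 := hW i hi
      rw [show 1 / (4 * δ ^ 2) * (1 / (⌊x i / δ⌋₊ : ℝ) ^ 2) = 1 / (4 * (⌊x i / δ⌋₊ * δ) ^ 2) by
        field_simp, le_div_iff₀ (by positivity)]
      nlinarith
  let K := t.sup (fun i => ⌊x i / δ⌋₊)
  calc ∑ i ∈ t, W i ≤ ∑ i ∈ t, w ⌊x i / δ⌋₊ := sum_le_sum hle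
    _ = ∑ k ∈ t.image (fun i => ⌊x i / δ⌋₊), w k := by rw [sum_image hinj]
    _ ≤ ∑ k ∈ range (K + 1), w k := by
        apply sum_le_sum_of_subset_of_nonneg
        · intro k hk
          simp only [mem_image] at hk
          obtain ⟨i, hi, rfl⟩ := hk
          simp only [mem_range]
          exact Nat.lt_succ_of_le (le_sup (f := fun i => ⌊x i / δ⌋₊) hi)
        · intros; exact hw0 _
    _ = (∑ k ∈ range K, 1 / (4 * δ ^ 2) * (1 / ((k : ℝ) + 1) ^ 2)) + A := by
        rw [sum_range_succ']
        simp [w]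
    _ ≤ _ := by
        rw [← mul_sum]
        have := sum_inv_sq_le K
        have h5 : 1 / (4 * δ ^ 2) * ∑ k ∈ range K, 1 / ((k : ℝ) + 1) ^ 2 ≤ 1 / (4 * δ ^ 2) * 2 := by
          gcongr
        have h6 : 1 / (4 * δ ^ 2) * 2 = 1 / (2 * δ ^ 2) := by field_simp; norm_num
        linarith

lemma row_sum {κ : Type*} (s : Finset κ) (β : κ → ℝ) (δ : ℝ) (hδ : 0 < δ)
    (hβ : ∀ i ∈ s, |β i| ≤ 1 / 2) (sep : ∀ i ∈ s, ∀ j ∈ s, i ≠ j → δ ≤ |β i - β j|) (L : ℕ) :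
    ∑ i ∈ s, ‖Dk L (β i)‖ ^ 2 ≤ 2 * (L : ℝ) ^ 2 + 1 / δ ^ 2 := by
  classical
  rw [← sum_filter_add_sum_filter_not s (fun i => 0 ≤ β i)]
  have hq : ∀ i ∈ s, 4 * (β i) ^ 2 * ‖Dk L (β i)‖ ^ 2 ≤ 1 := by
    intro i hi
    have h1 := norm_Dk_le' L (β i) (hβ i hi)
    have h2 : 0 ≤ 2 * |β i| * ‖Dk L (β i)‖ := by positivity
    have h3 : (2 * |β i| * ‖Dk L (β i)‖) ^ 2 ≤ 1 := by nlinarith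
    rw [mul_pow, mul_pow, sq_abs] at h3
    linarith
  have hq2 : ∀ i ∈ s, ‖Dk L (β i)‖ ^ 2 ≤ (L : ℝ) ^ 2 := by
    intro i hi
    have := norm_Dk_le L (β i)
    gcongr
  have A1 := half_row (s.filter (fun i => 0 ≤ β i)) β (fun i => ‖Dk L (β i)‖ ^ 2) δ (L ^ 2) hδ (by positivity)
    (fun i hi => (mem_filter.1 hi).2) (fun i hi j hj => sep i (mem_filter.1 hi).1 j (mem_filter.1 hj).1)
    (fun i hi => by positivity) (fun i hi => hq2 i (mem_filter.1 hi).1) (fun i hi => hq i (mem_filter.1 hi).1)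
  have A2 := half_row (s.filter (fun i => ¬ 0 ≤ β i)) (fun i => - β i) (fun i => ‖Dk L (β i)‖ ^ 2) δ (L ^ 2) hδ (by positivity)
    (fun i hi => by have := (mem_filter.1 hi).2; linarith)
    (fun i hi j hj hij => by
      have := sep i (mem_filter.1 hi).1 j (mem_filter.1 hj).1 hij
      rw [show - β i - - β j = -(β i - β j) by ring, abs_neg]; exact this)
    (fun i hi => by positivity) (fun i hi => hq2 i (mem_filter.1 hi).1)
    (fun i hi => by have := hq i (mem_filter.1 hi).1; rw [neg_sq]; exact this)
  have : 1 / (2 * δ ^ 2) + 1 / (2 * δ ^ 2) = 1 / δ ^ 2 := by field_simp; norm_num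
  linarith

/-- dual large sieve, with points separated mod 1 -/
lemma dual_ls {κ : Type*} (s : Finset κ) (α : κ → ℝ) (δ : ℝ) (hδ : 0 < δ)
    (sep : ∀ i ∈ s, ∀ j ∈ s, i ≠ j → ∀ n : ℤ, δ ≤ |α i - α j - n|) (c : κ → ℂ) (N : ℕ) (hN : 0 < N) :
    ∑ n ∈ Icc 1 N, ‖∑ i ∈ s, c i * ee (n * α i)‖ ^ 2 ≤ (8 * N + 1 / (δ ^ 2 * N)) * ∑ i ∈ s, ‖c i‖ ^ 2 := by
  classical
  set f : ℝ → ℂ := fun x => ∑ i ∈ s, c i * ee (x * α i) with hf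
  have hrow : ∀ i ∈ s, ∑ j ∈ s, ‖Dk (2 * N) (α i - α j)‖ ^ 2 ≤ 2 * ((2 * N : ℕ) : ℝ) ^ 2 + 1 / δ ^ 2 := by
    intro i hi
    have := row_sum s (fun j => (α i - α j) - round (α i - α j)) δ hδ (fun j _ => abs_sub_round _)
      (fun j hj k hk hjk => by
        have := sep k hk j hj (Ne.symm hjk) (round (α i - α j) - round (α i - α k))
        refine this.trans (le_of_eq ?_)
        congr 1; push_cast; ring) (2 * N)
    simp_rw [Dk_periodic] at this
    exact this
  have hcomp : ∑ a ∈ range (2 * N), ∑ b ∈ range (2 * N), ‖f ((a : ℝ) - b)‖ ^ 2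
      ≤ (2 * ((2 * N : ℕ) : ℝ) ^ 2 + 1 / δ ^ 2) * ∑ i ∈ s, ‖c i‖ ^ 2 := by
    have h1 : ((∑ a ∈ range (2 * N), ∑ b ∈ range (2 * N), ‖f ((a : ℝ) - b)‖ ^ 2 : ℝ) : ℂ)
        = ∑ i ∈ s, ∑ j ∈ s, c i * (starRingEnd ℂ) (c j) * ((‖Dk (2 * N) (α i - α j)‖ ^ 2 : ℝ) : ℂ) := by
      push_cast
      have e1 : ∀ a b : ℕ, ((‖f ((a : ℝ) - b)‖ : ℂ)) ^ 2 = ∑ i ∈ s, ∑ j ∈ s, c i * (starRingEnd ℂ) (c j) *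
          (ee (a * (α i - α j)) * ee (-(b * (α i - α j)))) := by
        intro a b
        rw [← Complex.mul_conj', hf]
        simp only [map_sum, map_mul]
        rw [sum_mul_sum]
        refine sum_congr rfl fun i _ => sum_congr rfl fun j _ => ?_
        rw [conj_ee, ← ee_add, mul_mul_mul_comm, ← ee_add]
        congr 2; ring
      simp_rw [e1]
      have e2 : ∀ x : ℝ, ((‖Dk (2 * N) x‖ : ℂ)) ^ 2 = ∑ a ∈ range (2 * N), ∑ b ∈ range (2 * N), (ee (a * x) * ee (-(b * x))) := by
        intro x
        rw [← Complex.mul_conj']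
        unfold Dk
        rw [map_sum, sum_mul_sum]
        simp_rw [conj_ee]
      simp_rw [e2, mul_sum]
      rw [sum_comm' (t' := range (2 * N)) (s' := fun _ => range (2 * N)) (by simp)]
      rw [sum_congr rfl (fun b _ => sum_comm)]
      rw [sum_comm]
      refine sum_congr rfl fun i _ => ?_
      rw [sum_congr rfl (fun b _ => sum_comm)]
      rw [sum_comm]
      refine sum_congr rfl fun j _ => ?_
      rw [sum_comm]
    have h2 : (∑ a ∈ range (2 * N), ∑ b ∈ range (2 * N), ‖f ((a : ℝ) - b)‖ ^ 2 : ℝ)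
        ≤ ∑ i ∈ s, ∑ j ∈ s, ‖c i‖ * ‖c j‖ * ‖Dk (2 * N) (α i - α j)‖ ^ 2 := by
      have h3 : (∑ a ∈ range (2 * N), ∑ b ∈ range (2 * N), ‖f ((a : ℝ) - b)‖ ^ 2 : ℝ)
        = ‖((∑ a ∈ range (2 * N), ∑ b ∈ range (2 * N), ‖f ((a : ℝ) - b)‖ ^ 2 : ℝ) : ℂ)‖ := by
        rw [Complex.norm_real, Real.norm_of_nonneg]
        positivity
      rw [h3, h1]
      refine (norm_sum_le _ _).trans (sum_le_sum fun i _ => (norm_sum_le _ _).trans (sum_le_sum fun j _ => ?_))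
      rw [norm_mul, norm_mul, RCLike.norm_conj, Complex.norm_real, Real.norm_of_nonneg (by positivity)]
    have hsym : ∀ i j, ‖Dk (2 * N) (α i - α j)‖ = ‖Dk (2 * N) (α j - α i)‖ := by
      intro i j
      have : Dk (2 * N) (α j - α i) = (starRingEnd ℂ) (Dk (2 * N) (α i - α j)) := by
        unfold Dk
        rw [map_sum]
        refine sum_congr rfl fun a _ => ?_
        rw [conj_ee]; congr 1; ring
      rw [this, RCLike.norm_conj]
    have h4 : ∑ i ∈ s, ∑ j ∈ s, ‖c i‖ * ‖c j‖ * ‖Dk (2 * N) (α i - α j)‖ ^ 2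
        ≤ ∑ i ∈ s, ∑ j ∈ s, (‖c i‖ ^ 2 / 2 * ‖Dk (2 * N) (α i - α j)‖ ^ 2 + ‖c j‖ ^ 2 / 2 * ‖Dk (2 * N) (α j - α i)‖ ^ 2) := by
      refine sum_le_sum fun i _ => sum_le_sum fun j _ => ?_
      rw [← hsym i j, ← add_mul]
      gcongr
      nlinarith [sq_nonneg (‖c i‖ - ‖c j‖)]
    have h5 : ∑ i ∈ s, ∑ j ∈ s, ‖c i‖ ^ 2 / 2 * ‖Dk (2 * N) (α i - α j)‖ ^ 2 ≤
        ∑ i ∈ s, ‖c i‖ ^ 2 / 2 * (2 * ((2 * N : ℕ) : ℝ) ^ 2 + 1 / δ ^ 2) := by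
      refine sum_le_sum fun i hi => ?_
      rw [← mul_sum]
      have := hrow i hi
      gcongr
    simp_rw [sum_add_distrib] at h4
    rw [sum_comm (f := fun i j => ‖c j‖ ^ 2 / 2 * ‖Dk (2 * N) (α j - α i)‖ ^ 2)] at h4
    rw [← sum_mul, ← sum_div] at h5
    linarith
  have hlow : (N : ℝ) * ∑ n ∈ Icc 1 N, ‖f (n : ℝ)‖ ^ 2 ≤
      ∑ a ∈ range (2 * N), ∑ b ∈ range (2 * N), ‖f ((a : ℝ) - b)‖ ^ 2 := by
    calc (N : ℝ) * ∑ n ∈ Icc 1 N, ‖f (n : ℝ)‖ ^ 2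
        = ∑ b ∈ range N, ∑ n ∈ Icc 1 N, ‖f (n : ℝ)‖ ^ 2 := by simp
      _ ≤ ∑ b ∈ range N, ∑ a ∈ range (2 * N), ‖f ((a : ℝ) - b)‖ ^ 2 := by
          refine sum_le_sum fun b hb => ?_
          have hb' := mem_range.1 hb
          have e : ∑ n ∈ Icc 1 N, ‖f (n : ℝ)‖ ^ 2 = ∑ a ∈ (Icc 1 N).image (fun n => n + b), ‖f ((a : ℝ) - b)‖ ^ 2 := by
            rw [sum_image (by intro x _ y _ h; simpa using h)]
            refine sum_congr rfl fun n _ => ?_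
            push_cast; simp
          rw [e]
          apply sum_le_sum_of_subset_of_nonneg
          · intro a ha
            simp only [mem_image, mem_Icc, mem_range] at ha ⊢
            obtain ⟨n, hn, rfl⟩ := ha
            omega
          · intros; positivity
      _ ≤ ∑ b ∈ range (2 * N), ∑ a ∈ range (2 * N), ‖f ((a : ℝ) - b)‖ ^ 2 := by
          apply sum_le_sum_of_subset_of_nonneg
          · intro a; simp only [mem_range]; omega
          · intros; positivity
      _ = _ := sum_comm
  have hNr : (0 : ℝ) < N := by exact_mod_cast hN
  have h7 := hlow.trans hcomp
  have h8 : (2 * ((2 * N : ℕ) : ℝ) ^ 2 + 1 / δ ^ 2) = N * (8 * N + 1 / (δ ^ 2 * N)) := by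
    push_cast; field_simp; ring
  rw [h8, mul_assoc] at h7
  exact le_of_mul_le_mul_left h7 hNr

lemma add_ls {κ : Type*} (s : Finset κ) (α : κ → ℝ) (δ : ℝ) (hδ : 0 < δ)
    (sep : ∀ i ∈ s, ∀ j ∈ s, i ≠ j → ∀ n : ℤ, δ ≤ |α i - α j - n|) (a : ℕ → ℂ) (N : ℕ) (hN : 0 < N) :
    ∑ i ∈ s, ‖∑ n ∈ Icc 1 N, a n * ee (n * α i)‖ ^ 2 ≤ (8 * N + 1 / (δ ^ 2 * N)) * ∑ n ∈ Icc 1 N, ‖a n‖ ^ 2 := by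
  classical
  set S : κ → ℂ := fun i => ∑ n ∈ Icc 1 N, a n * ee (n * α i) with hS
  set T : ℝ := ∑ i ∈ s, ‖S i‖ ^ 2 with hT
  have hd := dual_ls s α δ hδ sep (fun i => (starRingEnd ℂ) (S i)) N hN
  simp only [RCLike.norm_conj] at hd
  have h1 : (T : ℂ) = ∑ n ∈ Icc 1 N, a n * ∑ i ∈ s, (starRingEnd ℂ) (S i) * ee (n * α i) := by
    simp_rw [hT, mul_sum]
    push_cast
    rw [sum_comm]
    refine sum_congr rfl fun i _ => ?_
    rw [← Complex.conj_mul']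
    conv_lhs => rw [hS]
    simp only
    rw [mul_sum]
    refine sum_congr rfl fun n _ => ?_
    ring
  have hT0 : 0 ≤ T := by positivity
  have h2 : T ≤ ∑ n ∈ Icc 1 N, ‖a n‖ * ‖∑ i ∈ s, (starRingEnd ℂ) (S i) * ee (n * α i)‖ := by
    calc T = ‖(T : ℂ)‖ := by rw [Complex.norm_real, Real.norm_of_nonneg hT0]
      _ ≤ _ := by
        rw [h1]
        refine (norm_sum_le _ _).trans (le_of_eq ?_)
        simp_rw [norm_mul]
  have h3 := sum_mul_sq_le_sq_mul_sq (Icc 1 N) (fun n => ‖a n‖) (fun n => ‖∑ i ∈ s, (starRingEnd ℂ) (S i) * ee (n * α i)‖)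
  have h4 : T ^ 2 ≤ (∑ n ∈ Icc 1 N, ‖a n‖ ^ 2) * ((8 * N + 1 / (δ ^ 2 * N)) * T) := by
    refine (pow_le_pow_left₀ hT0 h2 2).trans (h3.trans ?_)
    gcongr
  rcases hT0.eq_or_lt with h0 | h0
  · rw [← h0]; positivity
  · have h5 : T * T ≤ ((8 * N + 1 / (δ ^ 2 * N)) * ∑ n ∈ Icc 1 N, ‖a n‖ ^ 2) * T := by nlinarith
    exact le_of_mul_le_mul_right h5 h0

open Classical in
noncomputable def prim (r : ℕ) : Finset (DirichletCharacter ℂ r) := univ.filter (fun χ => χ.IsPrimitive)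

lemma mem_prim {r : ℕ} {χ : DirichletCharacter ℂ r} : χ ∈ prim r ↔ χ.IsPrimitive := by
  simp [prim]

lemma parseval_add (r : ℕ) [NeZero r] (g : ZMod r → ℂ) :
    ∑ n : ZMod r, ‖∑ a, g a * ZMod.stdAddChar (n * a)‖ ^ 2 = r * ∑ a, ‖g a‖ ^ 2 := by
  have : ((∑ n : ZMod r, ‖∑ a, g a * ZMod.stdAddChar (n * a)‖ ^ 2 : ℝ) : ℂ) = ((r * ∑ a, ‖g a‖ ^ 2 : ℝ) : ℂ) := by
    push_cast
    have e1 : ∀ n : ZMod r, (‖∑ a, g a * ZMod.stdAddChar (n * a)‖ : ℂ) ^ 2 =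
        ∑ a, ∑ b, g a * (starRingEnd ℂ) (g b) * ZMod.stdAddChar (n * (a - b)) := by
      intro n
      rw [← Complex.mul_conj', map_sum, sum_mul_sum]
      refine sum_congr rfl fun a _ => sum_congr rfl fun b _ => ?_
      rw [map_mul (starRingEnd ℂ), ← AddChar.map_neg_eq_conj, mul_mul_mul_comm, ← AddChar.map_add_eq_mul]
      congr 2; ring
    simp_rw [e1]
    rw [sum_comm, mul_sum]
    refine sum_congr rfl fun a _ => ?_
    rw [sum_comm]
    simp_rw [← mul_sum, AddChar.sum_mulShift _ (ZMod.isPrimitive_stdAddChar r), sub_eq_zero]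
    rw [sum_eq_single a]
    · simp only [if_true, ZMod.card]
      rw [Complex.mul_conj']; ring
    · intro b _ hb; simp [Ne.symm hb]
    · simp
  exact_mod_cast this

lemma parseval_mul (r : ℕ) [NeZero r] (g : ZMod r → ℂ) :
    ∑ χ : DirichletCharacter ℂ r, ‖∑ a, χ⁻¹ a * g a‖ ^ 2 = r.totient * ∑ a : (ZMod r)ˣ, ‖g a‖ ^ 2 := by
  have h0 : ∀ χ : DirichletCharacter ℂ r, ∑ a, χ⁻¹ a * g a = ∑ a : (ZMod r)ˣ, χ (a : ZMod r)⁻¹ * g a := by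
    intro χ
    have : ∑ a : (ZMod r)ˣ, χ (a : ZMod r)⁻¹ * g a = ∑ a : (ZMod r)ˣ, χ⁻¹ (a : ZMod r) * g a := by
      refine sum_congr rfl fun a _ => ?_
      congr 1
      rw [MulChar.inv_apply, ZMod.inv_coe_unit, Ring.inverse_unit]
    rw [this]
    rw [← sum_subset (subset_univ (univ.image (fun a : (ZMod r)ˣ => (a : ZMod r))))]
    · rw [sum_image]
      intro x _ y _ h; exact Units.ext h
    · intro a _ ha
      rw [MulChar.map_nonunit, zero_mul]
      rintro ⟨u, rfl⟩
      exact ha (mem_image_of_mem _ (mem_univ u))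
  simp_rw [h0]
  have : ((∑ χ : DirichletCharacter ℂ r, ‖∑ a : (ZMod r)ˣ, χ (a : ZMod r)⁻¹ * g a‖ ^ 2 : ℝ) : ℂ) =
      ((r.totient * ∑ a : (ZMod r)ˣ, ‖g a‖ ^ 2 : ℝ) : ℂ) := by
    push_cast
    have e1 : ∀ χ : DirichletCharacter ℂ r, (‖∑ a : (ZMod r)ˣ, χ (a : ZMod r)⁻¹ * g a‖ : ℂ) ^ 2 =
        ∑ a : (ZMod r)ˣ, ∑ b : (ZMod r)ˣ, g a * (starRingEnd ℂ) (g b) * (χ (a : ZMod r)⁻¹ * χ b) := by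
      intro χ
      rw [← Complex.mul_conj', map_sum, sum_mul_sum]
      refine sum_congr rfl fun a _ => sum_congr rfl fun b _ => ?_
      have : (starRingEnd ℂ) (χ (b : ZMod r)⁻¹) = χ b := by
        rw [starRingEnd_apply, MulChar.star_apply', MulChar.inv_apply]
        rw [ZMod.inv_coe_unit, Ring.inverse_unit, inv_inv]
      rw [map_mul, this]; ring
    simp_rw [e1]
    rw [sum_comm, mul_sum]
    refine sum_congr rfl fun a _ => ?_
    rw [sum_comm]
    simp_rw [← mul_sum]
    have e2 : ∀ b : (ZMod r)ˣ, ∑ χ : DirichletCharacter ℂ r, χ (a : ZMod r)⁻¹ * χ b = if a = b then (r.totient : ℂ) else 0 := by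
      intro b
      rw [DirichletCharacter.sum_char_inv_mul_char_eq ℂ a.isUnit]
      simp [Units.ext_iff]
    simp_rw [e2]
    rw [sum_eq_single a]
    · simp only [if_true]
      rw [Complex.mul_conj']; ring
    · intro b _ hb; simp [Ne.symm hb]
    · simp
  exact_mod_cast this

lemma gauss_norm (r : ℕ) [NeZero r] (χ : DirichletCharacter ℂ r) (hχ : χ.IsPrimitive) :
    ‖gaussSum χ ZMod.stdAddChar‖ ^ 2 = r := by
  have h1 := parseval_add r (fun a => χ a)
  have h2 : ∀ n : ZMod r, ∑ a, χ a * ZMod.stdAddChar (n * a) = χ⁻¹ n * gaussSum χ ZMod.stdAddChar := by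
    intro n
    rw [← gaussSum_mulShift_of_isPrimitive _ hχ]
    simp [gaussSum, AddChar.mulShift_apply]
  simp_rw [h2, norm_mul, mul_pow] at h1
  rw [← sum_mul] at h1
  have h3 : ∀ n : ZMod r, ‖χ⁻¹ n‖ = ‖χ n‖ := by
    intro n
    rw [← MulChar.star_apply', norm_star]
  simp_rw [h3] at h1
  have h4 : 0 < ∑ a, ‖χ a‖ ^ 2 := by
    have : ‖χ 1‖ ^ 2 ≤ ∑ a, ‖χ a‖ ^ 2 := single_le_sum (f := fun a => ‖χ a‖ ^ 2) (fun a _ => by positivity) (mem_univ 1)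
    simp only [map_one, norm_one] at this
    linarith
  rw [mul_comm] at h1
  exact mul_right_cancel₀ h4.ne' h1

lemma prim_inv {r : ℕ} {χ : DirichletCharacter ℂ r} (h : χ.IsPrimitive) : χ⁻¹.IsPrimitive := by
  unfold DirichletCharacter.IsPrimitive at *
  refine Eq.trans ?_ h
  unfold DirichletCharacter.conductor
  congr 1
  ext d
  simp only [DirichletCharacter.mem_conductorSet_iff]
  constructor
  · rintro ⟨hd, χ₀, h⟩
    exact ⟨hd, χ₀⁻¹, by rw [map_inv, ← h, inv_inv]⟩
  · rintro ⟨hd, χ₀, h⟩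
    exact ⟨hd, χ₀⁻¹, by rw [map_inv, ← h]⟩

lemma prim_sum_le (r : ℕ) [NeZero r] (s : Finset ℕ) (a : ℕ → ℂ) :
    (r : ℝ) * ∑ χ ∈ prim r, ‖∑ n ∈ s, a n * χ n‖ ^ 2 ≤
      r.totient * ∑ b : (ZMod r)ˣ, ‖∑ n ∈ s, a n * ZMod.stdAddChar ((n : ZMod r) * (b : ZMod r))‖ ^ 2 := by
  rw [← parseval_mul r (fun b => ∑ n ∈ s, a n * ZMod.stdAddChar ((n : ZMod r) * b)), mul_sum]
  refine (sum_le_sum fun χ hχ => le_of_eq ?_).trans (sum_le_sum_of_subset_of_nonneg (subset_univ (prim r)) (fun _ _ _ => by positivity))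
  have hp := prim_inv (mem_prim.1 hχ)
  rw [← gauss_norm r χ⁻¹ hp, ← mul_pow, ← norm_mul]
  congr 2
  simp_rw [mul_sum]
  rw [sum_comm]
  refine sum_congr rfl fun n _ => ?_
  have h2 : ∑ x, χ⁻¹ x * ZMod.stdAddChar ((n : ZMod r) * x) = χ n * gaussSum χ⁻¹ ZMod.stdAddChar := by
    have := gaussSum_mulShift_of_isPrimitive ZMod.stdAddChar hp (n : ZMod r)
    rw [inv_inv] at this
    rw [← this]
    simp [gaussSum, AddChar.mulShift_apply]
  calc _ = a n * (χ n * gaussSum χ⁻¹ ZMod.stdAddChar) := by ring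
    _ = _ := by rw [← h2, mul_sum]; refine sum_congr rfl fun x _ => by ring

lemma stdAddChar_ee (r : ℕ) [NeZero r] (n : ℕ) (b : ZMod r) :
    ZMod.stdAddChar ((n : ZMod r) * b) = ee (n * ((b.val : ℝ) / r)) := by
  have : (n : ZMod r) * b = (((n * b.val : ℕ) : ℤ) : ZMod r) := by
    push_cast; rw [ZMod.natCast_zmod_val]
  rw [this, ZMod.stdAddChar_coe]
  unfold ee
  congr 1; push_cast; ring

lemma units_sum (r : ℕ) [NeZero r] (F : ℕ → ℝ) :
    ∑ b : (ZMod r)ˣ, F (b : ZMod r).val = ∑ b ∈ (range r).filter (fun b => b.Coprime r), F b := by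
  symm
  refine sum_bij' (i := fun b hb => ZMod.unitOfCoprime b (mem_filter.1 hb).2) (j := fun b _ => (b : ZMod r).val) ?_ ?_ ?_ ?_ ?_
  · simp
  · intro b _
    simp only [mem_filter, mem_range]
    exact ⟨ZMod.val_lt _, ZMod.val_coe_unit_coprime b⟩
  · intro b hb
    simp only [mem_filter, mem_range] at hb
    simp [ZMod.val_natCast, Nat.mod_eq_of_lt hb.1]
  · intro b _
    ext; simp
  · intro b hb
    simp only [mem_filter, mem_range] at hb
    simp [ZMod.val_natCast, Nat.mod_eq_of_lt hb.1]

lemma farey_sep (R : ℕ) {r a s b : ℕ} (hr : 1 ≤ r) (hrR : r ≤ R) (hs : 1 ≤ s) (hsR : s ≤ R) (ha : a < r) (hb : b < s)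
    (har : a.Coprime r) (hbs : b.Coprime s) (hne : ¬ (r = s ∧ a = b)) (n : ℤ) :
    1 / (R : ℝ) ^ 2 ≤ |(a : ℝ) / r - (b : ℝ) / s - n| := by
  have hr0 : (0 : ℝ) < r := by exact_mod_cast hr
  have hs0 : (0 : ℝ) < s := by exact_mod_cast hs
  have e : (a : ℝ) / r - (b : ℝ) / s - n = ((a * s - b * r - n * (r * s) : ℤ) : ℝ) / (r * s) := by
    push_cast; field_simp
  have hz : (a * s - b * r - n * (r * s) : ℤ) ≠ 0 := by
    intro h
    apply hne
    have h1 : (r : ℤ) ∣ a * s := ⟨b + n * s, by linarith⟩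
    have h2 : (s : ℤ) ∣ b * r := ⟨a - n * r, by linarith⟩
    have h1' : r ∣ s := by
      have : r ∣ a * s := by exact_mod_cast h1
      exact (Nat.Coprime.dvd_of_dvd_mul_left har.symm this)
    have h2' : s ∣ r := by
      have : s ∣ b * r := by exact_mod_cast h2
      exact (Nat.Coprime.dvd_of_dvd_mul_left hbs.symm this)
    have hrs := Nat.dvd_antisymm h1' h2'
    subst hrs
    refine ⟨rfl, ?_⟩
    have h3 : ((a : ℤ) - b - n * r) * r = 0 := by linarith
    have h4 : (a : ℤ) - b - n * r = 0 := by
      rcases mul_eq_zero.1 h3 with h | h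
      · exact h
      · exfalso; have : r = 0 := by exact_mod_cast h
        omega
    have hn : n = 0 := by
      by_contra hn
      rcases lt_or_gt_of_ne hn with h | h
      · have : n * r ≤ -1 * r := by gcongr; omega
        omega
      · have : 1 * (r : ℤ) ≤ n * r := by gcongr; omega
        omega
    subst hn
    omega
  rw [e, abs_div, abs_of_pos (mul_pos hr0 hs0)]
  have h1 : (1 : ℝ) ≤ |((a * s - b * r - n * (r * s) : ℤ) : ℝ)| := by
    rw [← Int.cast_abs]; exact_mod_cast Int.one_le_abs hz
  have h2 : (r : ℝ) * s ≤ R ^ 2 := by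
    rw [sq]; gcongr
  gcongr

theorem mult_ls (N R : ℕ) (hN : 0 < N) (hR : 0 < R) (a : ℕ → ℂ) :
    ∑ r ∈ Icc 1 R, ((r : ℝ) / r.totient) * ∑ χ ∈ prim r, ‖∑ n ∈ Icc 1 N, a n * χ n‖ ^ 2 ≤
      9 * (N + (R : ℝ) ^ 2) * ∑ n ∈ Icc 1 N, ‖a n‖ ^ 2 := by
  classical
  set N' := max N (R ^ 2) with hN'
  set a' : ℕ → ℂ := fun n => if n ≤ N then a n else 0 with ha'
  have hext : ∀ f : ℕ → ℂ, ∑ n ∈ Icc 1 N, a n * f n = ∑ n ∈ Icc 1 N', a' n * f n := by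
    intro f
    rw [← sum_subset (s₁ := Icc 1 N) (s₂ := Icc 1 N')]
    · refine sum_congr rfl fun n hn => ?_
      simp [ha', (mem_Icc.1 hn).2]
    · exact Icc_subset_Icc_right (le_max_left _ _)
    · intro n hn hn2
      simp only [mem_Icc, not_and, not_le] at hn hn2
      have := hn2 hn.1
      simp [ha', not_le.2 this]
  have hext2 : ∑ n ∈ Icc 1 N', ‖a' n‖ ^ 2 = ∑ n ∈ Icc 1 N, ‖a n‖ ^ 2 := by
    rw [← sum_subset (s₁ := Icc 1 N) (s₂ := Icc 1 N')]
    · refine sum_congr rfl fun n hn => ?_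
      simp [ha', (mem_Icc.1 hn).2]
    · exact Icc_subset_Icc_right (le_max_left _ _)
    · intro n hn hn2
      simp only [mem_Icc, not_and, not_le] at hn hn2
      have := hn2 hn.1
      simp [ha', not_le.2 this]
  have hRr : (0 : ℝ) < R := by exact_mod_cast hR
  have hN0 : 0 < N' := lt_of_lt_of_le hN (le_max_left _ _)
  have key := add_ls ((Icc 1 R).sigma (fun r => (range r).filter (fun b => b.Coprime r)))
    (fun p => (p.2 : ℝ) / p.1) (1 / (R : ℝ) ^ 2) (by positivity) (by
      rintro ⟨r, b⟩ h1 ⟨s, c⟩ h2 hne n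
      simp only [mem_sigma, mem_Icc, mem_filter, mem_range] at h1 h2
      refine farey_sep R h1.1.1 h1.1.2 h2.1.1 h2.1.2 h1.2.1 h2.2.1 h1.2.2 h2.2.2 ?_ n
      rintro ⟨rfl, rfl⟩; exact hne rfl) a' N' hN0
  rw [sum_sigma] at key
  have step : ∑ r ∈ Icc 1 R, ((r : ℝ) / r.totient) * ∑ χ ∈ prim r, ‖∑ n ∈ Icc 1 N, a n * χ n‖ ^ 2 ≤
      ∑ r ∈ Icc 1 R, ∑ b ∈ (range r).filter (fun b => b.Coprime r), ‖∑ n ∈ Icc 1 N', a' n * ee (n * ((b : ℝ) / r))‖ ^ 2 := by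
    refine sum_le_sum fun r hr => ?_
    have hr1 := (mem_Icc.1 hr).1
    have : NeZero r := ⟨by omega⟩
    have h := prim_sum_le r (Icc 1 N) a
    have hphi : (0 : ℝ) < r.totient := by exact_mod_cast Nat.totient_pos.2 hr1
    rw [div_mul_eq_mul_div, div_le_iff₀ hphi]
    refine h.trans (le_of_eq ?_)
    rw [mul_comm]
    congr 1
    rw [← units_sum r (fun b => ‖∑ n ∈ Icc 1 N', a' n * ee (n * ((b : ℝ) / r))‖ ^ 2)]
    refine sum_congr rfl fun b _ => ?_
    rw [hext]
    simp_rw [stdAddChar_ee]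
  refine step.trans (key.trans ?_)
  rw [hext2]
  have hN'r : (0 : ℝ) < N' := by exact_mod_cast hN0
  have h1 : (N' : ℝ) ≤ N + (R : ℝ) ^ 2 := by
    rw [hN']; push_cast
    apply max_le
    · have : (0 : ℝ) ≤ (R : ℝ) ^ 2 := by positivity
      linarith
    · have : (0 : ℝ) ≤ N := by positivity
      linarith
  have h2 : (R : ℝ) ^ 2 ≤ N' := by rw [hN']; push_cast; exact le_max_right _ _
  have h3 : 1 / ((1 / (R : ℝ) ^ 2) ^ 2 * N') ≤ N' := by
    rw [div_le_iff₀ (by positivity)]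
    have : (R : ℝ) ^ 2 * (1 / (R : ℝ) ^ 2) = 1 := by field_simp
    have h5 : 1 ≤ N' * (1 / (R : ℝ) ^ 2) := by
      calc (1:ℝ) = (R : ℝ) ^ 2 * (1 / (R : ℝ) ^ 2) := this.symm
        _ ≤ _ := by gcongr
    nlinarith
  gcongr
  linarith

end SPC

namespace SPC
open Finset MeasureTheory

noncomputable def tri (u : ℝ) : ℝ := max (1 - u) 0

noncomputable def ker (σ t : ℝ) : ℂ := 1 / ((σ + t * Complex.I) * (σ + t * Complex.I + 1))

lemma ker_norm (σ t : ℝ) (hσ : 1 / 2 ≤ σ) : ‖ker σ t‖ ≤ 2 * (1 + t ^ 2)⁻¹ := by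
  unfold ker
  rw [norm_div, norm_one, norm_mul]
  have h1 : Real.sqrt (1 + t ^ 2) / 2 ≤ ‖(σ + t * Complex.I : ℂ)‖ := by
    rw [Complex.norm_add_mul_I, div_le_iff₀ (by norm_num)]
    rw [show Real.sqrt (σ ^ 2 + t ^ 2) * 2 = Real.sqrt ((σ ^ 2 + t ^ 2) * 4) by
      rw [Real.sqrt_mul (by positivity), show (4 : ℝ) = 2 ^ 2 by norm_num, Real.sqrt_sq (by norm_num)]]
    apply Real.sqrt_le_sqrt
    nlinarith [sq_nonneg t]
  have h2 : Real.sqrt (1 + t ^ 2) ≤ ‖(σ + t * Complex.I + 1 : ℂ)‖ := by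
    rw [show (σ + t * Complex.I + 1 : ℂ) = ((σ + 1 : ℝ) : ℂ) + t * Complex.I by push_cast; ring, Complex.norm_add_mul_I]
    apply Real.sqrt_le_sqrt
    nlinarith [sq_nonneg t]
  have h3 : 0 < Real.sqrt (1 + t ^ 2) := by positivity
  have h4 : Real.sqrt (1 + t ^ 2) ^ 2 = 1 + t ^ 2 := Real.sq_sqrt (by positivity)
  have h5 : (1 + t ^ 2) / 2 ≤ ‖(σ + t * Complex.I : ℂ)‖ * ‖(σ + t * Complex.I + 1 : ℂ)‖ := by
    calc (1 + t ^ 2) / 2 = Real.sqrt (1 + t ^ 2) / 2 * Real.sqrt (1 + t ^ 2) := by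
          rw [div_mul_eq_mul_div, ← sq, h4]
      _ ≤ _ := by gcongr
  calc _ ≤ 1 / ((1 + t ^ 2) / 2) := by gcongr
    _ = _ := by field_simp

lemma line_ne (σ t : ℝ) (hσ : 0 < σ) : (σ + t * Complex.I : ℂ) ≠ 0 := by
  intro h
  have := congrArg Complex.re h
  simp at this; linarith

lemma line_ne' (σ t : ℝ) (hσ : 0 < σ) : (σ + t * Complex.I + 1 : ℂ) ≠ 0 := by
  intro h
  have := congrArg Complex.re h
  simp at this; linarith

lemma ker_cont (σ : ℝ) (hσ : 0 < σ) : Continuous (ker σ) := by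
  unfold ker
  apply Continuous.div
  · fun_prop
  · fun_prop
  · intro t; exact mul_ne_zero (line_ne σ t hσ) (line_ne' σ t hσ)

lemma ker_integrable (σ : ℝ) (hσ : 1 / 2 ≤ σ) : Integrable (ker σ) := by
  refine Integrable.mono' (integrable_inv_one_add_sq.const_mul 2) (ker_cont σ (by linarith)).aestronglyMeasurable ?_
  exact Filter.Eventually.of_forall fun t => ker_norm σ t hσ

lemma tri_mellin (σ : ℝ) (hσ : 1 / 2 ≤ σ) (u : ℝ) (hu : 0 < u) :
    ((tri u : ℝ) : ℂ) = (1 / (2 * Real.pi) : ℝ) * ∫ t : ℝ, (u : ℂ) ^ (-(σ + t * Complex.I)) * ker σ t := by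
  have hm : ∀ s : ℂ, 0 < s.re → HasMellin (fun u : ℝ => Set.indicator (Set.Ioc 0 1) (fun _ => 1 : ℝ → ℂ) u -
      Set.indicator (Set.Ioc 0 1) (fun t => (t : ℂ) ^ (1 : ℂ) : ℝ → ℂ) u) s (1 / s - 1 / (s + 1)) := by
    intro s hs
    have h1 := hasMellin_one_Ioc hs
    have h2 := hasMellin_cpow_Ioc 1 (s := s) (by simp; linarith)
    have h3 := hasMellin_sub h1.1 h2.1
    rw [h1.2, h2.2] at h3
    exact h3
  set f : ℝ → ℂ := fun u : ℝ => Set.indicator (Set.Ioc 0 1) (fun _ => 1 : ℝ → ℂ) u -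
      Set.indicator (Set.Ioc 0 1) (fun t => (t : ℂ) ^ (1 : ℂ) : ℝ → ℂ) u with hf
  have hft : ∀ x : ℝ, 0 < x → f x = ((tri x : ℝ) : ℂ) := by
    intro x hx
    simp only [hf, tri, Set.indicator, Set.mem_Ioc, Complex.cpow_one]
    by_cases h : x ≤ 1
    · simp [hx, h]
    · simp [h, (not_le.1 h).le]
  have hk : ∀ t : ℝ, mellin f (σ + t * Complex.I) = ker σ t := by
    intro t
    rw [(hm (σ + t * Complex.I) (by simp; linarith)).2]
    unfold ker
    have := line_ne σ t (by linarith)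
    have := line_ne' σ t (by linarith)
    field_simp
    ring
  have hinv := mellinInv_mellin_eq σ f hu (hm σ (by simp; linarith)).1 (by
    unfold Complex.VerticalIntegrable
    refine (ker_integrable σ hσ).congr ?_
    exact Filter.Eventually.of_forall fun t => (hk t).symm) (by
    have : ContinuousAt (fun x : ℝ => ((tri x : ℝ) : ℂ)) u := by
      unfold tri; fun_prop
    refine this.congr ?_
    filter_upwards [lt_mem_nhds hu] with x hx
    exact (hft x hx).symm)
  rw [← hft u hu, ← hinv, mellinInv]
  simp_rw [hk, smul_eq_mul, Complex.real_smul]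

lemma cpow_line_norm (u σ t : ℝ) (hu : 0 < u) : ‖(u : ℂ) ^ (-(σ + t * Complex.I))‖ = u ^ (-σ) := by
  rw [Complex.norm_cpow_eq_rpow_re_of_pos hu]; simp

lemma cpow_line_cont (u σ : ℝ) (hu : 0 < u) : Continuous (fun t : ℝ => (u : ℂ) ^ (-(σ + t * Complex.I))) := by
  refine Continuous.const_cpow (by fun_prop) (Or.inl ?_)
  exact_mod_cast hu.ne'

lemma cpow_ker_integrable (u σ : ℝ) (hu : 0 < u) (hσ : 1 / 2 ≤ σ) :
    Integrable (fun t : ℝ => (u : ℂ) ^ (-(σ + t * Complex.I)) * ker σ t) := by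
  refine Integrable.bdd_mul (c := u ^ (-σ)) (ker_integrable σ hσ) (cpow_line_cont u σ hu).aestronglyMeasurable ?_
  exact Filter.Eventually.of_forall fun t => (cpow_line_norm u σ t hu).le

lemma ker_norm_int (σ : ℝ) (hσ : 1 / 2 ≤ σ) : ∫ t, ‖ker σ t‖ ≤ 2 * Real.pi := by
  rw [← integral_univ_inv_one_add_sq, ← integral_const_mul]
  refine integral_mono (ker_integrable σ hσ).norm (integrable_inv_one_add_sq.const_mul 2) ?_
  intro t; exact ker_norm σ t hσ

theorem mellin_fin {κ ν : Type*} (X : Finset κ) (w : κ → ℝ) (hw : ∀ x ∈ X, 0 ≤ w x) (K : Finset ν) (c : κ → ν → ℂ)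
    (u : ν → ℝ) (hu : ∀ k ∈ K, 0 < u k) (σ : ℝ) (hσ : 1 / 2 ≤ σ) (B : ℝ)
    (H : ∀ t : ℝ, ∑ x ∈ X, w x * ‖∑ k ∈ K, c x k * (u k : ℂ) ^ (-(σ + t * Complex.I))‖ ≤ B) :
    ∑ x ∈ X, w x * ‖∑ k ∈ K, c x k * ((tri (u k) : ℝ) : ℂ)‖ ≤ B := by
  have hpi := Real.pi_pos
  have hB : 0 ≤ B := le_trans (sum_nonneg fun x hx => mul_nonneg (hw x hx) (norm_nonneg _)) (H 0)
  have hcont : ∀ x, Continuous (fun t : ℝ => ∑ k ∈ K, c x k * (u k : ℂ) ^ (-(σ + t * Complex.I))) := by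
    intro x
    refine continuous_finsetSum _ fun k hk => ?_
    exact continuous_const.mul (cpow_line_cont _ _ (hu k hk))
  have hintg : ∀ x, Integrable (fun t : ℝ => (∑ k ∈ K, c x k * (u k : ℂ) ^ (-(σ + t * Complex.I))) * ker σ t) := by
    intro x
    simp_rw [sum_mul, mul_assoc]
    exact integrable_finsetSum _ fun k hk => (cpow_ker_integrable _ _ (hu k hk) hσ).const_mul _
  have e : ∀ x, ∑ k ∈ K, c x k * ((tri (u k) : ℝ) : ℂ) =
      (1 / (2 * Real.pi) : ℝ) * ∫ t : ℝ, (∑ k ∈ K, c x k * (u k : ℂ) ^ (-(σ + t * Complex.I))) * ker σ t := by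
    intro x
    simp_rw [sum_mul, mul_assoc]
    rw [integral_finsetSum _ fun k hk => (cpow_ker_integrable _ _ (hu k hk) hσ).const_mul _, mul_sum]
    refine sum_congr rfl fun k hk => ?_
    rw [tri_mellin σ hσ (u k) (hu k hk), integral_const_mul]
    ring
  have e2 : ∀ x ∈ X, w x * ‖∑ k ∈ K, c x k * ((tri (u k) : ℝ) : ℂ)‖ ≤
      (1 / (2 * Real.pi)) * ∫ t : ℝ, w x * ‖(∑ k ∈ K, c x k * (u k : ℂ) ^ (-(σ + t * Complex.I))) * ker σ t‖ := by
    intro x hx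
    rw [e, norm_mul, Complex.norm_real, Real.norm_of_nonneg (by positivity), integral_const_mul]
    have := norm_integral_le_integral_norm (μ := volume) (fun t : ℝ => (∑ k ∈ K, c x k * (u k : ℂ) ^ (-(σ + t * Complex.I))) * ker σ t)
    have h0 := hw x hx
    calc _ = (1 / (2 * Real.pi)) * (w x * ‖∫ t : ℝ, (∑ k ∈ K, c x k * (u k : ℂ) ^ (-(σ + t * Complex.I))) * ker σ t‖) := by ring
      _ ≤ _ := by gcongr
  refine (sum_le_sum e2).trans ?_
  rw [← mul_sum, ← integral_finsetSum _ fun x _ => ((hintg x).norm.const_mul _)]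
  have h3 : ∫ t : ℝ, ∑ x ∈ X, w x * ‖(∑ k ∈ K, c x k * (u k : ℂ) ^ (-(σ + t * Complex.I))) * ker σ t‖ ≤ ∫ t, B * ‖ker σ t‖ := by
    refine integral_mono (integrable_finsetSum _ fun x _ => ((hintg x).norm.const_mul _)) ((ker_integrable σ hσ).norm.const_mul B) ?_
    intro t
    simp only [norm_mul, ← mul_assoc]
    rw [← sum_mul]
    exact mul_le_mul_of_nonneg_right (H t) (norm_nonneg _)
  rw [integral_const_mul] at h3
  have h4 := ker_norm_int σ hσ
  calc _ ≤ 1 / (2 * Real.pi) * (B * (2 * Real.pi)) := by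
        gcongr
        exact h3.trans (by gcongr)
    _ = B := by field_simp

lemma sqrt_ker_integrable : Integrable (fun t : ℝ => (1 + |t|) ^ (1 / 2 : ℝ) * (1 + t ^ 2)⁻¹) := by
  have h := integrable_one_add_norm (μ := (volume : Measure ℝ)) (E := ℝ) (r := 3 / 2) (by simp; norm_num)
  refine Integrable.mono' (h.const_mul 2) ?_ ?_
  · apply Continuous.aestronglyMeasurable
    apply Continuous.mul
    · apply Continuous.rpow_const
      · fun_prop
      · intro x; right; norm_num
    · apply Continuous.inv₀
      · fun_prop
      · intro x; positivity
  · refine Filter.Eventually.of_forall fun t => ?_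
    rw [Real.norm_of_nonneg (by positivity)]
    have h1 : (0 : ℝ) < 1 + |t| := by positivity
    have h2 : (1 + |t|) ^ (1 / 2 : ℝ) = (1 + |t|) ^ (-(3 / 2) : ℝ) * (1 + |t|) ^ 2 := by
      rw [← Real.rpow_natCast, ← Real.rpow_add h1]; norm_num
    rw [h2, Real.norm_eq_abs, mul_assoc, mul_comm 2]
    gcongr
    rw [← div_eq_mul_inv, div_le_iff₀ (by positivity)]
    nlinarith [sq_nonneg (|t| - 1), sq_abs t]

theorem mellin_tsum : ∃ C : ℝ, 0 < C ∧ ∀ (c : ℕ → ℂ) (σ B : ℝ) (y : ℕ), 1 / 2 ≤ σ → 0 < y → c 0 = 0 →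
    Summable (fun n : ℕ => ‖c n‖ * (n : ℝ) ^ (-σ)) →
    (∀ t : ℝ, ‖∑' n : ℕ, c n * (n : ℂ) ^ (-(σ + t * Complex.I))‖ ≤ B * (1 + |t|) ^ (1 / 2 : ℝ)) →
    ‖∑ n ∈ Icc 1 y, c n * ((tri (n / y) : ℝ) : ℂ)‖ ≤ C * B * (y : ℝ) ^ σ := by
  set C := ∫ t : ℝ, (1 + |t|) ^ (1 / 2 : ℝ) * (1 + t ^ 2)⁻¹ with hC
  have hC0 : 0 ≤ C := integral_nonneg fun t => by positivity
  refine ⟨C + 1, by linarith, ?_⟩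
  intro c σ B y hσ hy hc0 hsum hB
  have hy' : (0 : ℝ) < y := by exact_mod_cast hy
  have hpi := Real.pi_gt_three
  have hB0 : 0 ≤ B := by
    have := (norm_nonneg _).trans (hB 0)
    simpa using this
  set F : ℕ → ℝ → ℂ := fun n t => (c n * (n : ℂ) ^ (-(σ + t * Complex.I))) * ((y : ℂ) ^ (σ + t * Complex.I) * ker σ t) with hF
  have hyc : ∀ t : ℝ, ‖(y : ℂ) ^ (σ + t * Complex.I)‖ = (y : ℝ) ^ σ := by
    intro t
    rw [show (y : ℂ) = ((y : ℝ) : ℂ) by simp, Complex.norm_cpow_eq_rpow_re_of_pos hy']; simp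
  have hyk : Integrable (fun t : ℝ => (y : ℂ) ^ (σ + t * Complex.I) * ker σ t) := by
    refine Integrable.bdd_mul (c := (y : ℝ) ^ σ) (ker_integrable σ hσ) ?_ ?_
    · apply Continuous.aestronglyMeasurable
      refine Continuous.const_cpow (by fun_prop) (Or.inl ?_)
      exact_mod_cast hy.ne'
    · exact Filter.Eventually.of_forall fun t => (hyc t).le
  have hcn : ∀ n : ℕ, ∀ t : ℝ, ‖c n * (n : ℂ) ^ (-(σ + t * Complex.I))‖ = ‖c n‖ * (n : ℝ) ^ (-σ) := by
    intro n t
    rcases Nat.eq_zero_or_pos n with h | h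
    · subst h; simp [hc0]
    · rw [norm_mul, show (n : ℂ) = ((n : ℝ) : ℂ) by simp, cpow_line_norm _ _ _ (by exact_mod_cast h)]
  have hccont : ∀ n : ℕ, Continuous fun t : ℝ => c n * (n : ℂ) ^ (-(σ + t * Complex.I)) := by
    intro n
    rcases Nat.eq_zero_or_pos n with h | h
    · subst h; simp [hc0]; fun_prop
    · refine continuous_const.mul ?_
      have := cpow_line_cont n σ (by exact_mod_cast h)
      simpa using this
  have hFi : ∀ n, Integrable (F n) := by
    intro n
    refine Integrable.bdd_mul (c := ‖c n‖ * (n : ℝ) ^ (-σ)) hyk (hccont n).aestronglyMeasurable ?_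
    exact Filter.Eventually.of_forall fun t => (hcn n t).le
  have hFn : ∀ n, ∫ t, ‖F n t‖ = (‖c n‖ * (n : ℝ) ^ (-σ)) * ∫ t : ℝ, ‖(y : ℂ) ^ (σ + t * Complex.I) * ker σ t‖ := by
    intro n
    rw [← integral_const_mul]
    refine integral_congr_ae (Filter.Eventually.of_forall fun t => ?_)
    simp only [hF]
    rw [norm_mul, hcn]
  have hFs : Summable (fun n => ∫ t, ‖F n t‖) := by
    simp_rw [hFn]; exact hsum.mul_right _
  have hswap := hasSum_integral_of_summable_integral_norm hFi hFs
  have hFint : ∀ n, (1 / (2 * Real.pi) : ℝ) * ∫ t, F n t = c n * ((tri (n / y) : ℝ) : ℂ) := by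
    intro n
    rcases Nat.eq_zero_or_pos n with h | h
    · subst h; simp [hc0, hF]
    · have hn : (0 : ℝ) < n := by exact_mod_cast h
      rw [tri_mellin σ hσ (n / y) (by positivity)]
      rw [mul_left_comm]
      refine congrArg _ ?_
      rw [← integral_const_mul]
      refine integral_congr_ae (Filter.Eventually.of_forall fun t => ?_)
      simp only [hF]
      have : (((n / y : ℝ)) : ℂ) ^ (-(σ + t * Complex.I)) = (n : ℂ) ^ (-(σ + t * Complex.I)) * (y : ℂ) ^ (σ + t * Complex.I) := by
        rw [div_eq_mul_inv, Complex.ofReal_mul, Complex.mul_cpow_ofReal_nonneg hn.le (by positivity)]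
        congr 1
        rw [Complex.ofReal_inv, Complex.inv_cpow, Complex.cpow_neg, inv_inv]
        · simp
        · rw [Complex.arg_ofReal_of_nonneg hy'.le]; exact Real.pi_pos.ne
      rw [this]; ring
  have htot : ∑ n ∈ Icc 1 y, c n * ((tri (n / y) : ℝ) : ℂ) = (1 / (2 * Real.pi) : ℝ) * ∫ t, ∑' n, F n t := by
    have h1 := hswap.mul_left (((1 / (2 * Real.pi) : ℝ)) : ℂ)
    simp_rw [hFint] at h1
    rw [← h1.tsum_eq]
    symm
    apply tsum_eq_sum
    intro n hn
    simp only [mem_Icc, not_and, not_le] at hn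
    rcases Nat.eq_zero_or_pos n with h | h
    · subst h; simp [hc0]
    · have h2 := hn h
      have : (1 : ℝ) ≤ n / y := by
        rw [le_div_iff₀ hy']; rw [one_mul]; exact_mod_cast h2.le
      simp [tri, this]
  rw [htot, norm_mul, Complex.norm_real, Real.norm_of_nonneg (by positivity)]
  have hFt : ∀ t : ℝ, ‖∑' n, F n t‖ ≤ (2 * B * (y : ℝ) ^ σ) * ((1 + |t|) ^ (1 / 2 : ℝ) * (1 + t ^ 2)⁻¹) := by
    intro t
    simp only [hF]
    rw [tsum_mul_right, norm_mul, norm_mul, hyc]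
    have h1 := hB t
    have h2 := ker_norm σ t hσ
    calc _ ≤ (B * (1 + |t|) ^ (1 / 2 : ℝ)) * ((y : ℝ) ^ σ * (2 * (1 + t ^ 2)⁻¹)) := by gcongr
      _ = _ := by ring
  have hle : ‖∫ t, ∑' n, F n t‖ ≤ (2 * B * (y : ℝ) ^ σ) * C := by
    rw [hC, ← integral_const_mul]
    exact norm_integral_le_of_norm_le (sqrt_ker_integrable.const_mul _) (Filter.Eventually.of_forall hFt)
  calc _ ≤ 1 / (2 * Real.pi) * ((2 * B * (y : ℝ) ^ σ) * C) := by gcongr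
    _ = (B * (y : ℝ) ^ σ * C) / Real.pi := by field_simp
    _ ≤ (B * (y : ℝ) ^ σ * C) / 1 := by gcongr; linarith
    _ ≤ _ := by
      have : 0 ≤ B * (y : ℝ) ^ σ := by positivity
      nlinarith

end SPC

namespace SPC
open Finset

lemma char_partial (r : ℕ) [NeZero r] (χ : DirichletCharacter ℂ r) (hχ : χ ≠ 1) (n : ℕ) :
    ‖∑ i ∈ range n, χ (i : ZMod r)‖ ≤ r := by
  have hper : ∑ i ∈ range r, χ (i : ZMod r) = 0 := by
    rw [← MulChar.sum_eq_zero_of_ne_one hχ]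
    refine sum_bij' (i := fun i _ => (i : ZMod r)) (j := fun a _ => a.val) ?_ ?_ ?_ ?_ ?_
    · simp
    · intro a _; simp [ZMod.val_lt]
    · intro i hi; simp [ZMod.val_natCast, Nat.mod_eq_of_lt (mem_range.1 hi)]
    · intro a _; simp
    · simp
  induction n using Nat.strong_induction_on with
  | _ n ih =>
    rcases lt_or_ge n r with h | h
    · refine (norm_sum_le _ _).trans ?_
      refine (sum_le_sum fun i _ => χ.norm_le_one _).trans ?_
      simp; exact h.le
    · have : n = r + (n - r) := by omega
      rw [this, sum_range_add, hper, zero_add]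
      have h2 := ih (n - r) (by have := NeZero.pos r; omega)
      simpa using h2

lemma sum_Icc_one_range {E : Type*} [AddCommMonoid E] (f : ℕ → E) (n : ℕ) : ∑ i ∈ Icc 1 n, f i = ∑ k ∈ range n, f (k + 1) := by
  induction n with
  | zero => simp
  | succ n ih => rw [sum_Icc_succ_top (by omega), ih, sum_range_succ]

lemma char_partial' (r : ℕ) [NeZero r] (hr : 1 < r) (χ : DirichletCharacter ℂ r) (hχ : χ ≠ 1) (n : ℕ) :
    ‖∑ i ∈ Icc 1 n, χ (i : ZMod r)‖ ≤ r := by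
  have h := char_partial r χ hχ (n + 1)
  rw [sum_range_succ'] at h
  have : Fact (1 < r) := ⟨hr⟩
  have h0 : χ ((0 : ℕ) : ZMod r) = 0 := by
    rw [Nat.cast_zero]; exact χ.map_zero
  rw [h0, add_zero] at h
  rw [sum_Icc_one_range]
  exact h

/-- Abel summation, antitone weight -/
lemma abel_anti (c : ℕ → ℂ) (g : ℕ → ℝ) (B : ℝ) (N : ℕ) (hg : ∀ i, 1 ≤ i → i < N → g (i + 1) ≤ g i) (hg0 : ∀ i, 1 ≤ i → i ≤ N → 0 ≤ g i)
    (hB : ∀ n ≤ N, ‖∑ i ∈ Icc 1 n, c i‖ ≤ B) (hN : 1 ≤ N) :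
    ‖∑ i ∈ Icc 1 N, c i * g i‖ ≤ B * g 1 := by
  have hB0 : 0 ≤ B := (norm_nonneg _).trans (hB 0 (Nat.zero_le _))
  have key : ∀ n, 1 ≤ n → n ≤ N → ‖∑ i ∈ Icc 1 n, c i * g i - (∑ i ∈ Icc 1 n, c i) * g n‖ ≤ B * (g 1 - g n) := by
    intro n hn
    induction n, hn using Nat.le_induction with
    | base => intro _; simp
    | succ n hn ih =>
      intro hnN
      have ih := ih (by omega)
      rw [sum_Icc_succ_top (by omega), sum_Icc_succ_top (by omega)]
      have e : ∑ i ∈ Icc 1 n, c i * (g i : ℂ) + c (n + 1) * g (n + 1) - (∑ i ∈ Icc 1 n, c i + c (n + 1)) * g (n + 1)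
        = (∑ i ∈ Icc 1 n, c i * (g i : ℂ) - (∑ i ∈ Icc 1 n, c i) * g n) + (∑ i ∈ Icc 1 n, c i) * ((g n - g (n + 1) : ℝ) : ℂ) := by
        push_cast; ring
      rw [e]
      refine (norm_add_le _ _).trans ?_
      rw [norm_mul, Complex.norm_real, Real.norm_of_nonneg (by linarith [hg n hn (by omega)])]
      have := hB n (by omega)
      have h2 := hg n hn (by omega)
      nlinarith
  have h1 := key N hN le_rfl
  have h2 := hB N le_rfl
  have h3 := hg0 N hN le_rfl
  calc ‖∑ i ∈ Icc 1 N, c i * (g i : ℂ)‖ = ‖(∑ i ∈ Icc 1 N, c i * (g i : ℂ) - (∑ i ∈ Icc 1 N, c i) * g N) + (∑ i ∈ Icc 1 N, c i) * g N‖ := by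
        congr 1; ring
    _ ≤ B * (g 1 - g N) + B * g N := by
        refine (norm_add_le _ _).trans (add_le_add h1 ?_)
        rw [norm_mul, Complex.norm_real, Real.norm_of_nonneg h3]
        gcongr
    _ = _ := by ring

/-- Abel summation, monotone weight -/
lemma abel_mono (c : ℕ → ℂ) (g : ℕ → ℝ) (B : ℝ) (N : ℕ) (hg : ∀ i, 1 ≤ i → i < N → g i ≤ g (i + 1)) (hg0 : ∀ i, 1 ≤ i → i ≤ N → 0 ≤ g i)
    (hB : ∀ n ≤ N, ‖∑ i ∈ Icc 1 n, c i‖ ≤ B) (hN : 1 ≤ N) :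
    ‖∑ i ∈ Icc 1 N, c i * g i‖ ≤ 2 * B * g N := by
  have hmono : ∀ n, 1 ≤ n → n ≤ N → g n ≤ g N := by
    intro n hn hnN
    induction N, hnN using Nat.le_induction with
    | base => exact le_rfl
    | succ m hm ih =>
      exact (ih (fun i h1 h2 => hg i h1 (by omega)) (fun i h1 h2 => hg0 i h1 (by omega)) (fun i h => hB i (by omega)) (by omega)).trans
        (hg m (by omega) (by omega))
  have h := abel_anti c (fun i => g N - g i) B N (fun i h1 h2 => by have := hg i h1 h2; linarith)
    (fun i h1 h2 => by have := hmono i h1 h2; linarith) hB hN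
  have hB0 : 0 ≤ B := (norm_nonneg _).trans (hB 0 (Nat.zero_le _))
  have e : ∑ i ∈ Icc 1 N, c i * (g i : ℂ) = (∑ i ∈ Icc 1 N, c i) * g N - ∑ i ∈ Icc 1 N, c i * ((g N - g i : ℝ) : ℂ) := by
    rw [sum_mul, ← sum_sub_distrib]
    refine sum_congr rfl fun i _ => ?_
    push_cast; ring
  rw [e]
  refine (norm_sub_le _ _).trans ?_
  rw [norm_mul, Complex.norm_real, Real.norm_of_nonneg (hg0 N hN le_rfl)]
  have h2 := hB N le_rfl
  have h3 := hg0 N hN le_rfl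
  have h4 := hg0 1 le_rfl hN
  nlinarith

/-- Convolution sums -/
lemma conv_sum (f g : ArithmeticFunction ℝ) (φ : ℕ → ℂ) (y : ℕ) (hφ : ∀ n, y < n → φ n = 0) :
    ∑ n ∈ Icc 1 y, (((f * g) n : ℝ) : ℂ) * φ n = ∑ m ∈ Icc 1 y, ∑ d ∈ Icc 1 y, (f m : ℂ) * (g d : ℂ) * φ (m * d) := by
  simp_rw [ArithmeticFunction.mul_apply]
  push_cast
  simp_rw [sum_mul]
  rw [sum_sigma', ← sum_product']
  symm
  rw [← sum_filter_add_sum_filter_not (Icc 1 y ×ˢ Icc 1 y) (fun p => p.1 * p.2 ≤ y)]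
  rw [sum_eq_zero (s := filter (fun p => ¬ p.1 * p.2 ≤ y) (Icc 1 y ×ˢ Icc 1 y)), add_zero]
  · refine sum_bij' (i := fun p _ => (⟨p.1 * p.2, p⟩ : Σ _ : ℕ, ℕ × ℕ)) (j := fun q _ => q.2) ?_ ?_ ?_ ?_ ?_
    · rintro ⟨m, d⟩ h
      simp only [mem_filter, mem_product, mem_Icc] at h
      simp only [mem_sigma, mem_Icc, Nat.mem_divisorsAntidiagonal, true_and]
      have : 0 < m * d := Nat.mul_pos h.1.1.1 h.1.2.1
      omega
    · rintro ⟨n, m, d⟩ h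
      simp only [mem_sigma, mem_Icc, Nat.mem_divisorsAntidiagonal] at h
      obtain ⟨⟨h1, h2⟩, rfl, h3⟩ := h
      have hm : 0 < m := Nat.pos_of_ne_zero (by rintro rfl; simp at h3)
      have hd : 0 < d := Nat.pos_of_ne_zero (by rintro rfl; simp at h3)
      simp only [mem_filter, mem_product, mem_Icc]
      refine ⟨⟨⟨hm, ?_⟩, hd, ?_⟩, h2⟩
      · nlinarith
      · nlinarith
    · simp
    · rintro ⟨n, m, d⟩ h
      simp only [mem_sigma, mem_Icc, Nat.mem_divisorsAntidiagonal] at h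
      obtain ⟨_, rfl, _⟩ := h
      rfl
    · simp
  · intro p hp
    rw [hφ _ (not_le.1 (mem_filter.1 hp).2), mul_zero]

/-- truncations -/
noncomputable def lo (U : ℕ) (f : ArithmeticFunction ℝ) : ArithmeticFunction ℝ := ⟨fun n => if n ≤ U then f n else 0, by simp⟩
noncomputable def hi (U : ℕ) (f : ArithmeticFunction ℝ) : ArithmeticFunction ℝ := ⟨fun n => if n ≤ U then 0 else f n, by simp⟩

lemma lo_apply (U n : ℕ) (f : ArithmeticFunction ℝ) : lo U f n = if n ≤ U then f n else 0 := rfl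
lemma hi_apply (U n : ℕ) (f : ArithmeticFunction ℝ) : hi U f n = if n ≤ U then 0 else f n := rfl

lemma lo_add_hi (U : ℕ) (f : ArithmeticFunction ℝ) : lo U f + hi U f = f := by
  ext n
  simp only [ArithmeticFunction.add_apply, lo_apply, hi_apply]
  split_ifs <;> simp

noncomputable abbrev muR : ArithmeticFunction ℝ := ((ArithmeticFunction.moebius : ArithmeticFunction ℤ) : ArithmeticFunction ℝ)
noncomputable abbrev zetaR : ArithmeticFunction ℝ := ((ArithmeticFunction.zeta : ArithmeticFunction ℕ) : ArithmeticFunction ℝ)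

lemma vaughan (U : ℕ) : ArithmeticFunction.vonMangoldt =
    lo U ArithmeticFunction.vonMangoldt + lo U muR * ArithmeticFunction.log
      - (lo U muR * lo U ArithmeticFunction.vonMangoldt) * zetaR
      + hi U ArithmeticFunction.vonMangoldt * (hi U muR * zetaR) := by
  have h1 : muR * ArithmeticFunction.log = ArithmeticFunction.vonMangoldt := ArithmeticFunction.moebius_mul_log_eq_vonMangoldt
  have h2 : ArithmeticFunction.vonMangoldt * zetaR = ArithmeticFunction.log := ArithmeticFunction.vonMangoldt_mul_zeta
  have h3 : muR * zetaR = 1 := ArithmeticFunction.coe_moebius_mul_coe_zeta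
  have h4 := lo_add_hi U muR
  have h5 := lo_add_hi U ArithmeticFunction.vonMangoldt
  have h6 : hi U muR = muR - lo U muR := by
    rw [eq_sub_iff_add_eq', h4]
  have h7 : hi U ArithmeticFunction.vonMangoldt = ArithmeticFunction.vonMangoldt - lo U ArithmeticFunction.vonMangoldt := by
    rw [eq_sub_iff_add_eq', h5]
  rw [h6, h7]
  linear_combination (lo U muR) * h2 - (ArithmeticFunction.vonMangoldt - lo U ArithmeticFunction.vonMangoldt) * h3

lemma tri_nonneg (u : ℝ) : 0 ≤ tri u := le_max_right _ _
lemma tri_le_one {u : ℝ} (hu : 0 ≤ u) : tri u ≤ 1 := by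
  unfold tri; exact max_le (by linarith) (by norm_num)
lemma tri_anti {u v : ℝ} (h : u ≤ v) : tri v ≤ tri u := by
  unfold tri; exact max_le_max (by linarith) le_rfl
lemma tri_zero {u : ℝ} (h : 1 ≤ u) : tri u = 0 := by
  unfold tri; exact max_eq_right (by linarith)

lemma typeI (r : ℕ) [NeZero r] (hr : 1 < r) (χ : DirichletCharacter ℂ r) (hχ : χ ≠ 1) (y d : ℕ) (hy : 1 ≤ y)
    (f : ℕ → ℝ) (hf : ∀ i, 1 ≤ i → i < y → f i ≤ f (i + 1)) (hf0 : ∀ i, 1 ≤ i → i ≤ y → 0 ≤ f i) :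
    ‖∑ m ∈ Icc 1 y, χ (m : ZMod r) * (f m : ℂ) * ((tri ((d * m : ℕ) / y) : ℝ) : ℂ)‖ ≤ 2 * r * f y := by
  have hmono : ∀ n, 1 ≤ n → n ≤ y → f n ≤ f y := by
    intro n hn hny
    clear hf0 hy
    induction y, hny using Nat.le_induction with
    | base => exact le_rfl
    | succ m hm ih =>
      exact (ih (fun i h1 h2 => hf i h1 (by omega))).trans (hf m (by omega) (by omega))
  have hfy := hf0 y hy le_rfl
  have h1 : ∀ n ≤ y, ‖∑ m ∈ Icc 1 n, χ (m : ZMod r) * (f m : ℂ)‖ ≤ 2 * r * f y := by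
    intro n hn
    rcases Nat.eq_zero_or_pos n with h | h
    · subst h; simp; positivity
    · refine (abel_mono (fun m => χ (m : ZMod r)) f r n (fun i h1 h2 => hf i h1 (by omega))
        (fun i h1 h2 => hf0 i h1 (by omega)) (fun m _ => char_partial' r hr χ hχ m) h).trans ?_
      have := hmono n h hn
      gcongr
  refine (abel_anti (fun m => χ (m : ZMod r) * (f m : ℂ)) (fun m => tri ((d * m : ℕ) / y)) _ y ?_ (fun _ _ _ => tri_nonneg _) h1 hy).trans ?_
  · intro i _ _
    apply tri_anti
    gcongr
    omega
  · have : tri ((d * 1 : ℕ) / y) ≤ 1 := tri_le_one (by positivity)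
    have h0 : 0 ≤ 2 * r * f y := by positivity
    nlinarith

lemma conv_le (F G : ℕ → ℝ) (hF : ∀ n, 0 ≤ F n) (hG : ∀ n, 0 ≤ G n) (y : ℕ) :
    ∑ n ∈ Icc 1 y, ∑ p ∈ n.divisorsAntidiagonal, F p.1 * G p.2 ≤ (∑ n ∈ Icc 1 y, F n) * ∑ n ∈ Icc 1 y, G n := by
  classical
  rw [sum_mul_sum, ← sum_product', sum_sigma']
  have hinj : Set.InjOn (fun q : Σ _ : ℕ, ℕ × ℕ => q.2) (((Icc 1 y).sigma (fun n => n.divisorsAntidiagonal) : Finset (Σ _ : ℕ, ℕ × ℕ)) : Set (Σ _ : ℕ, ℕ × ℕ)) := by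
    rintro ⟨n, p⟩ h1 ⟨m, q⟩ h2 h
    simp only [coe_sigma, Set.mem_sigma_iff, mem_coe, Nat.mem_divisorsAntidiagonal] at h1 h2
    simp only at h
    subst h
    have : n = m := h1.2.1.symm.trans h2.2.1
    subst this; rfl
  rw [← sum_image (f := fun p : ℕ × ℕ => F p.1 * G p.2) hinj]
  apply sum_le_sum_of_subset_of_nonneg
  · rintro ⟨a, b⟩ h
    simp only [mem_image, mem_sigma, mem_Icc, Nat.mem_divisorsAntidiagonal, Sigma.exists] at h
    obtain ⟨n, ⟨a', b'⟩, ⟨⟨h1, h2⟩, h3, h4⟩, h5⟩ := h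
    simp only [Prod.mk.injEq] at h5
    obtain ⟨rfl, rfl⟩ := h5
    simp only at h3
    have ha : 0 < a' := Nat.pos_of_ne_zero (by rintro rfl; simp at h3; omega)
    have hb : 0 < b' := Nat.pos_of_ne_zero (by rintro rfl; simp at h3; omega)
    simp only [mem_product, mem_Icc]
    refine ⟨⟨ha, ?_⟩, hb, ?_⟩ <;> nlinarith
  · intro p _ _; exact mul_nonneg (hF _) (hG _)

lemma sum_inv_le (y : ℕ) : ∑ n ∈ Icc 1 y, (1 : ℝ) / n ≤ 1 + Real.log y := by
  have := harmonic_le_one_add_log y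
  rw [harmonic_eq_sum_Icc] at this
  push_cast at this
  simpa using this

lemma sum_tau_le (y : ℕ) : ∑ n ∈ Icc 1 y, (n.divisors.card : ℝ) / n ≤ (1 + Real.log y) ^ 2 := by
  have h := conv_le (fun n => 1 / (n : ℝ)) (fun n => 1 / (n : ℝ)) (fun n => by positivity) (fun n => by positivity) y
  have h2 := sum_inv_le y
  have h0 : 0 ≤ ∑ n ∈ Icc 1 y, (1 : ℝ) / n := sum_nonneg fun n _ => by positivity
  calc _ ≤ ∑ n ∈ Icc 1 y, ∑ p ∈ n.divisorsAntidiagonal, 1 / (p.1 : ℝ) * (1 / (p.2 : ℝ)) := by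
        refine sum_le_sum fun n hn => le_of_eq ?_
        rw [sum_congr rfl (g := fun _ => 1 / (n : ℝ))]
        · rw [sum_const, ← Nat.map_div_right_divisors, card_map]; simp [div_eq_mul_inv]
        · intro p hp
          rw [← (Nat.mem_divisorsAntidiagonal.1 hp).1]; push_cast
          rw [one_div_mul_one_div]
    _ ≤ _ := h
    _ ≤ _ := by rw [sq]; gcongr

lemma tau_mul_le (a b : ℕ) : (a * b).divisors.card ≤ a.divisors.card * b.divisors.card := by
  classical
  rw [Nat.divisors_mul]; exact card_mul_le

lemma sum_tau_sq_le (y : ℕ) : ∑ n ∈ Icc 1 y, (n.divisors.card : ℝ) ^ 2 / n ≤ (1 + Real.log y) ^ 4 := by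
  have h := conv_le (fun n => (n.divisors.card : ℝ) / n) (fun n => (n.divisors.card : ℝ) / n) (fun n => by positivity) (fun n => by positivity) y
  have h2 := sum_tau_le y
  have h0 : 0 ≤ ∑ n ∈ Icc 1 y, (n.divisors.card : ℝ) / n := sum_nonneg fun n _ => by positivity
  calc _ ≤ ∑ n ∈ Icc 1 y, ∑ p ∈ n.divisorsAntidiagonal, (p.1.divisors.card : ℝ) / p.1 * ((p.2.divisors.card : ℝ) / p.2) := by
        refine sum_le_sum fun n hn => ?_
        have e : (n.divisors.card : ℝ) ^ 2 / n = ∑ p ∈ n.divisorsAntidiagonal, (n.divisors.card : ℝ) / n := by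
          rw [sum_const, ← Nat.map_div_right_divisors, card_map]; simp; ring
        rw [e]
        refine sum_le_sum fun p hp => ?_
        rw [← (Nat.mem_divisorsAntidiagonal.1 hp).1, div_mul_div_comm]
        push_cast
        gcongr
        exact_mod_cast tau_mul_le _ _
    _ ≤ _ := h
    _ ≤ (1 + Real.log y) ^ 2 * (1 + Real.log y) ^ 2 := by gcongr
    _ = _ := by ring

lemma card_prim_le (r : ℕ) [NeZero r] : (prim r).card ≤ r.totient := by
  classical
  have := DirichletCharacter.card_eq_totient_of_hasEnoughRootsOfUnity ℂ r
  rw [← this, Nat.card_eq_fintype_card]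
  exact card_le_univ _

/-- bilinear large sieve with the triangular weight -/
lemma bilinear (a b : ℕ → ℂ) (M N R y : ℕ) (hM : 0 < M) (hN : 0 < N) (hR : 0 < R) (hy : 0 < y) :
    ∑ r ∈ Icc R (2 * R), (1 / (r.totient : ℝ)) * ∑ χ ∈ prim r,
      ‖∑ m ∈ Icc 1 M, ∑ n ∈ Icc 1 N, a m * b n * (χ m * χ n) * ((tri ((m * n : ℕ) / y) : ℝ) : ℂ)‖ ≤
    9 / R * Real.sqrt y * Real.sqrt ((M + 4 * (R : ℝ) ^ 2) * (N + 4 * (R : ℝ) ^ 2)) *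
      Real.sqrt ((∑ m ∈ Icc 1 M, ‖a m‖ ^ 2 / m) * (∑ n ∈ Icc 1 N, ‖b n‖ ^ 2 / n)) := by
  classical
  have hyr : (0 : ℝ) < y := by exact_mod_cast hy
  have hRr : (0 : ℝ) < R := by exact_mod_cast hR
  set X : Finset (Σ r : ℕ, DirichletCharacter ℂ r) := (Icc R (2 * R)).sigma (fun r => prim r) with hX
  have h := mellin_fin X (fun x => 1 / (x.1.totient : ℝ)) (fun x _ => by positivity) (Icc 1 M ×ˢ Icc 1 N)
    (fun x p => a p.1 * b p.2 * (x.2 p.1 * x.2 p.2)) (fun p => ((p.1 * p.2 : ℕ) : ℝ) / y) (by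
      rintro ⟨m, n⟩ h
      simp only [mem_product, mem_Icc] at h
      have : 0 < m * n := Nat.mul_pos h.1.1 h.2.1
      have : (0 : ℝ) < ((m * n : ℕ) : ℝ) := by exact_mod_cast this
      positivity) (1 / 2) le_rfl
    (9 / R * Real.sqrt y * Real.sqrt ((M + 4 * (R : ℝ) ^ 2) * (N + 4 * (R : ℝ) ^ 2)) *
      Real.sqrt ((∑ m ∈ Icc 1 M, ‖a m‖ ^ 2 / m) * (∑ n ∈ Icc 1 N, ‖b n‖ ^ 2 / n))) ?_
  · rw [hX, sum_sigma] at h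
    refine le_trans (le_of_eq ?_) h
    refine sum_congr rfl fun r _ => ?_
    rw [mul_sum]
    refine sum_congr rfl fun χ _ => ?_
    rw [sum_product]
  intro t
  set s : ℂ := -(((1 / 2 : ℝ) : ℂ) + t * Complex.I) with hs
  set a' : ℕ → ℂ := fun m => a m * (m : ℂ) ^ s with ha'
  set b' : ℕ → ℂ := fun m => b m * (m : ℂ) ^ s with hb'
  have hns : ∀ m : ℕ, 1 ≤ m → ‖(m : ℂ) ^ s‖ ^ 2 = 1 / m := by
    intro m hm
    have hm' : (0 : ℝ) < m := by exact_mod_cast hm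
    rw [show (m : ℂ) = ((m : ℝ) : ℂ) by simp, hs, cpow_line_norm _ _ _ hm', ← Real.rpow_natCast, ← Real.rpow_mul hm'.le]
    norm_num
    rw [Real.rpow_neg_one]
  have hfac : ∀ x : Σ r : ℕ, DirichletCharacter ℂ r,
      ‖∑ p ∈ Icc 1 M ×ˢ Icc 1 N, a p.1 * b p.2 * (x.2 p.1 * x.2 p.2) * ((((p.1 * p.2 : ℕ) : ℝ) / y : ℝ) : ℂ) ^ s‖ =
      Real.sqrt y * (‖∑ m ∈ Icc 1 M, a' m * x.2 m‖ * ‖∑ n ∈ Icc 1 N, b' n * x.2 n‖) := by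
    intro x
    have hy2 : ‖((y : ℝ) : ℂ) ^ (-s)‖ = Real.sqrt y := by
      rw [Complex.norm_cpow_eq_rpow_re_of_pos hyr, hs, Real.sqrt_eq_rpow]; simp
    rw [← hy2, ← norm_mul, ← norm_mul, sum_mul_sum, ← sum_product', mul_sum]
    congr 1
    refine sum_congr rfl fun p hp => ?_
    simp only [mem_product, mem_Icc] at hp
    have h1 : (((p.1 * p.2 : ℕ) : ℝ) / y : ℝ) = (p.1 : ℝ) * ((p.2 : ℝ) * (y : ℝ)⁻¹) := by push_cast; ring
    rw [h1]
    rw [Complex.ofReal_mul, Complex.mul_cpow_ofReal_nonneg (by positivity) (by positivity),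
      Complex.ofReal_mul, Complex.mul_cpow_ofReal_nonneg (by positivity) (by positivity)]
    have h2 : (((y : ℝ)⁻¹ : ℝ) : ℂ) ^ s = ((y : ℝ) : ℂ) ^ (-s) := by
      rw [Complex.ofReal_inv, Complex.inv_cpow _ s, Complex.cpow_neg _ s]
      rw [Complex.arg_ofReal_of_nonneg hyr.le]; exact Real.pi_pos.ne
    rw [h2]
    simp only [ha', hb', Complex.ofReal_natCast]
    ring
  simp_rw [hfac]
  have hLS : ∀ (c : ℕ → ℂ) (K : ℕ), 0 < K → ∑ x ∈ X, ((x.1 : ℝ) / x.1.totient) * ‖∑ m ∈ Icc 1 K, (c m * (m : ℂ) ^ s) * x.2 m‖ ^ 2 ≤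
      9 * (K + 4 * (R : ℝ) ^ 2) * ∑ m ∈ Icc 1 K, ‖c m‖ ^ 2 / m := by
    intro c K hK
    have h1 := mult_ls K (2 * R) hK (by omega) (fun m => c m * (m : ℂ) ^ s)
    have h2 : ∑ x ∈ X, ((x.1 : ℝ) / x.1.totient) * ‖∑ m ∈ Icc 1 K, (c m * (m : ℂ) ^ s) * x.2 m‖ ^ 2 ≤
        ∑ r ∈ Icc 1 (2 * R), ((r : ℝ) / r.totient) * ∑ χ ∈ prim r, ‖∑ n ∈ Icc 1 K, (c n * (n : ℂ) ^ s) * χ n‖ ^ 2 := by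
      rw [hX, sum_sigma]
      simp_rw [mul_sum]
      apply sum_le_sum_of_subset_of_nonneg
      · apply Icc_subset_Icc_left; omega
      · intros; positivity
    refine h2.trans (h1.trans (le_of_eq ?_))
    have e1 : ∀ m ∈ Icc 1 K, ‖c m * (m : ℂ) ^ s‖ ^ 2 = ‖c m‖ ^ 2 / m := by
      intro m hm
      rw [norm_mul, mul_pow, hns m (mem_Icc.1 hm).1]; ring
    rw [sum_congr rfl e1]
    push_cast; ring
  have hCS := Real.sum_mul_le_sqrt_mul_sqrt X (fun x => Real.sqrt ((x.1 : ℝ) / x.1.totient) * ‖∑ m ∈ Icc 1 M, a' m * x.2 m‖)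
    (fun x => Real.sqrt ((x.1 : ℝ) / x.1.totient) * ‖∑ n ∈ Icc 1 N, b' n * x.2 n‖)
  simp only [mul_pow] at hCS
  have hsq : ∀ x : Σ r : ℕ, DirichletCharacter ℂ r, Real.sqrt ((x.1 : ℝ) / x.1.totient) ^ 2 = (x.1 : ℝ) / x.1.totient :=
    fun x => Real.sq_sqrt (by positivity)
  simp_rw [hsq] at hCS
  have hA := hLS a M hM
  have hB := hLS b N hN
  set SA := ∑ m ∈ Icc 1 M, ‖a m‖ ^ 2 / m with hSA
  set SB := ∑ n ∈ Icc 1 N, ‖b n‖ ^ 2 / n with hSB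
  have hSA0 : 0 ≤ SA := sum_nonneg fun m _ => by positivity
  have hSB0 : 0 ≤ SB := sum_nonneg fun m _ => by positivity
  have hCS2 : ∑ x ∈ X, ((x.1 : ℝ) / x.1.totient) * (‖∑ m ∈ Icc 1 M, a' m * x.2 m‖ * ‖∑ n ∈ Icc 1 N, b' n * x.2 n‖) ≤
      9 * (Real.sqrt ((M + 4 * (R : ℝ) ^ 2) * (N + 4 * (R : ℝ) ^ 2)) * Real.sqrt (SA * SB)) := by
    calc _ = ∑ x ∈ X, (Real.sqrt ((x.1 : ℝ) / x.1.totient) * ‖∑ m ∈ Icc 1 M, a' m * x.2 m‖) * (Real.sqrt ((x.1 : ℝ) / x.1.totient) * ‖∑ n ∈ Icc 1 N, b' n * x.2 n‖) := by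
          refine sum_congr rfl fun x _ => ?_
          conv_lhs => rw [← hsq x]
          ring
      _ ≤ _ := hCS
      _ ≤ Real.sqrt (9 * (M + 4 * (R : ℝ) ^ 2) * SA) * Real.sqrt (9 * (N + 4 * (R : ℝ) ^ 2) * SB) := by
          gcongr
      _ = Real.sqrt (9 ^ 2 * (((M + 4 * (R : ℝ) ^ 2) * (N + 4 * (R : ℝ) ^ 2)) * (SA * SB))) := by
          rw [← Real.sqrt_mul (by positivity)]; congr 1; ring
      _ = _ := by
          rw [Real.sqrt_mul (by positivity), Real.sqrt_sq (by norm_num), Real.sqrt_mul (by positivity)]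
  have hw : ∀ x ∈ X, 1 / (x.1.totient : ℝ) * (Real.sqrt y * (‖∑ m ∈ Icc 1 M, a' m * x.2 m‖ * ‖∑ n ∈ Icc 1 N, b' n * x.2 n‖)) ≤
      Real.sqrt y / R * (((x.1 : ℝ) / x.1.totient) * (‖∑ m ∈ Icc 1 M, a' m * x.2 m‖ * ‖∑ n ∈ Icc 1 N, b' n * x.2 n‖)) := by
    intro x hx
    have hxr : (R : ℝ) ≤ x.1 := by
      have := (mem_sigma.1 hx).1
      exact_mod_cast (mem_Icc.1 this).1
    have h1 : 1 ≤ (x.1 : ℝ) / R := by rw [le_div_iff₀ hRr]; linarith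
    have h0 : 0 ≤ 1 / (x.1.totient : ℝ) * (Real.sqrt y * (‖∑ m ∈ Icc 1 M, a' m * x.2 m‖ * ‖∑ n ∈ Icc 1 N, b' n * x.2 n‖)) := by positivity
    calc _ ≤ ((x.1 : ℝ) / R) * (1 / (x.1.totient : ℝ) * (Real.sqrt y * (‖∑ m ∈ Icc 1 M, a' m * x.2 m‖ * ‖∑ n ∈ Icc 1 N, b' n * x.2 n‖))) := by nlinarith
      _ = _ := by ring
  refine (sum_le_sum hw).trans ?_
  rw [← mul_sum]
  calc _ ≤ Real.sqrt y / R * (9 * (Real.sqrt ((M + 4 * (R : ℝ) ^ 2) * (N + 4 * (R : ℝ) ^ 2)) * Real.sqrt (SA * SB))) := by gcongr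
    _ = _ := by ring

/-- test function -/
noncomputable def phiT {r : ℕ} (χ : DirichletCharacter ℂ r) (y k n : ℕ) : ℂ :=
  χ (n : ZMod r) * ((Real.log n ^ k * tri (n / y) : ℝ) : ℂ)

/-- the twisted weighted prime sum -/
noncomputable def TT {r : ℕ} (χ : DirichletCharacter ℂ r) (y k : ℕ) : ℂ :=
  ∑ n ∈ Icc 1 y, ((ArithmeticFunction.vonMangoldt n : ℝ) : ℂ) * phiT χ y k n

lemma phiT_zero {r : ℕ} (χ : DirichletCharacter ℂ r) (y k n : ℕ) (hy : 1 ≤ y) (hn : y < n) : phiT χ y k n = 0 := by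
  have hyr : (0 : ℝ) < y := by exact_mod_cast hy
  have : tri (n / y) = 0 := tri_zero (by rw [le_div_iff₀ hyr]; exact_mod_cast (by omega : 1 * y ≤ n))
  simp [phiT, this]

lemma phiT_norm {r : ℕ} (χ : DirichletCharacter ℂ r) (y k n : ℕ) (hn : 1 ≤ n) (hny : n ≤ y) :
    ‖phiT χ y k n‖ ≤ (1 + Real.log y) ^ k := by
  have h0 : 0 ≤ Real.log n := Real.log_natCast_nonneg n
  have h1 : Real.log n ≤ 1 + Real.log y := by
    have : Real.log n ≤ Real.log y := Real.log_le_log (by exact_mod_cast hn) (by exact_mod_cast hny)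
    linarith
  have h2 := tri_nonneg ((n : ℝ) / y)
  have h3 : tri ((n : ℝ) / y) ≤ 1 := tri_le_one (by positivity)
  unfold phiT
  rw [norm_mul, Complex.norm_real, Real.norm_of_nonneg (by positivity)]
  have h4 : ‖χ (n : ZMod r)‖ ≤ 1 := χ.norm_le_one _
  calc _ ≤ 1 * ((1 + Real.log y) ^ k * 1) := by gcongr
    _ = _ := by ring

lemma typeI_conv (r : ℕ) [NeZero r] (hr : 1 < r) (χ : DirichletCharacter ℂ r) (hχ : χ ≠ 1) (y k E : ℕ) (hy : 1 ≤ y)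
    (f g : ArithmeticFunction ℝ) (A : ℝ) (hA : ∀ n, 1 ≤ n → n ≤ y → |f n| ≤ A) (hE : ∀ n, E < n → f n = 0)
    (hg : ∀ i, 1 ≤ i → g i ≤ g (i + 1)) (hg0 : ∀ i, 1 ≤ i → 0 ≤ g i) :
    ‖∑ n ∈ Icc 1 y, (((f * g) n : ℝ) : ℂ) * phiT χ y k n‖ ≤ E * (A * (2 * r * (g y * (2 * (1 + Real.log y)) ^ k))) := by
  have hL : 0 ≤ Real.log y := Real.log_natCast_nonneg y
  have hA0 : 0 ≤ A := (abs_nonneg _).trans (hA 1 le_rfl hy)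
  have hgy := hg0 y hy
  rw [conv_sum f g _ y (fun n hn => phiT_zero χ y k n hy hn)]
  have key : ∀ m ∈ Icc 1 y, ‖∑ d ∈ Icc 1 y, (f m : ℂ) * (g d : ℂ) * phiT χ y k (m * d)‖ ≤
      if m ≤ E then A * (2 * r * (g y * (2 * (1 + Real.log y)) ^ k)) else 0 := by
    intro m hm
    rw [mem_Icc] at hm
    split_ifs with h
    · have hm1 : (1 : ℝ) ≤ m := by exact_mod_cast hm.1
      have h1 := typeI r hr χ hχ y m hy (fun d => g d * Real.log ((m * d : ℕ)) ^ k) (by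
        intro i hi _
        have h2 : Real.log ((m * i : ℕ)) ≤ Real.log ((m * (i + 1) : ℕ)) := by
          apply Real.log_le_log
          · exact_mod_cast Nat.mul_pos hm.1 hi
          · exact_mod_cast Nat.mul_le_mul_left _ (by omega)
        have h3 := Real.log_natCast_nonneg (m * i)
        have := hg i hi
        have := hg0 i hi
        have := hg0 (i + 1) (by omega)
        gcongr) (by
        intro i hi _
        have h3 := Real.log_natCast_nonneg (m * i)
        have := hg0 i hi
        positivity)
      have e : ∑ d ∈ Icc 1 y, (f m : ℂ) * (g d : ℂ) * phiT χ y k (m * d) =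
          ((f m : ℂ) * χ (m : ZMod r)) * ∑ d ∈ Icc 1 y, χ (d : ZMod r) * ((g d * Real.log ((m * d : ℕ)) ^ k : ℝ) : ℂ) * ((tri ((m * d : ℕ) / y) : ℝ) : ℂ) := by
        rw [mul_sum]
        refine sum_congr rfl fun d _ => ?_
        unfold phiT
        rw [Nat.cast_mul m d, map_mul]
        push_cast
        ring
      rw [e, norm_mul, norm_mul, Complex.norm_real, Real.norm_eq_abs]
      have h4 : ‖χ (m : ZMod r)‖ ≤ 1 := χ.norm_le_one _
      have h5 : Real.log ((m * y : ℕ)) ≤ 2 * (1 + Real.log y) := by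
        have hyr : (0 : ℝ) < y := by exact_mod_cast hy
        rw [Nat.cast_mul, Real.log_mul (by positivity) (by positivity)]
        have : Real.log m ≤ Real.log y := Real.log_le_log (by positivity) (by exact_mod_cast hm.2)
        linarith
      have h6 := Real.log_natCast_nonneg (m * y)
      calc _ ≤ A * 1 * (2 * r * (g y * Real.log ((m * y : ℕ)) ^ k)) := by
            gcongr
            exact hA m hm.1 hm.2
        _ ≤ A * 1 * (2 * r * (g y * (2 * (1 + Real.log y)) ^ k)) := by gcongr
        _ = _ := by ring
    · rw [hE m (by omega)]; simp
  refine (norm_sum_le _ _).trans ((sum_le_sum key).trans ?_)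
  rw [← sum_filter, sum_const, nsmul_eq_mul]
  gcongr
  calc _ ≤ (Icc 1 E).card := by
        apply card_le_card
        intro m hm
        rw [mem_filter, mem_Icc] at hm
        rw [mem_Icc]; exact ⟨hm.1.1, hm.2⟩
    _ = E := by simp

lemma vM_le_log (n : ℕ) : |ArithmeticFunction.vonMangoldt n| ≤ Real.log n := by
  rw [abs_of_nonneg ArithmeticFunction.vonMangoldt_nonneg]; exact ArithmeticFunction.vonMangoldt_le_log

lemma abs_muR (n : ℕ) : |muR n| ≤ 1 := by
  have h := ArithmeticFunction.abs_moebius_le_one (n := n)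
  have : (|ArithmeticFunction.moebius n| : ℝ) ≤ 1 := by exact_mod_cast h
  simpa [muR] using this

lemma abs_lo (U n : ℕ) (f : ArithmeticFunction ℝ) : |lo U f n| ≤ |f n| := by
  rw [lo_apply]; split_ifs <;> simp
lemma abs_hi (U n : ℕ) (f : ArithmeticFunction ℝ) : |hi U f n| ≤ |f n| := by
  rw [hi_apply]; split_ifs <;> simp

lemma coefS2 (U n : ℕ) : |(lo U muR * lo U ArithmeticFunction.vonMangoldt) n| ≤ Real.log n := by
  rw [ArithmeticFunction.mul_apply]
  refine (abs_sum_le_sum_abs _ _).trans ?_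
  rw [← ArithmeticFunction.vonMangoldt_sum, Nat.sum_divisorsAntidiagonal' (f := fun a b => |lo U muR a * lo U ArithmeticFunction.vonMangoldt b|)]
  refine sum_le_sum fun i _ => ?_
  rw [abs_mul]
  have h1 := (abs_lo U (n / i) muR).trans (abs_muR _)
  have h2 := abs_lo U i ArithmeticFunction.vonMangoldt
  rw [abs_of_nonneg (a := ArithmeticFunction.vonMangoldt i) ArithmeticFunction.vonMangoldt_nonneg] at h2
  have := abs_nonneg (lo U ArithmeticFunction.vonMangoldt i)
  nlinarith

lemma coefS2_zero (U n : ℕ) (hn : U ^ 2 < n) : (lo U muR * lo U ArithmeticFunction.vonMangoldt) n = 0 := by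
  rw [ArithmeticFunction.mul_apply]
  refine sum_eq_zero fun p hp => ?_
  rw [lo_apply, lo_apply]
  have := (Nat.mem_divisorsAntidiagonal.1 hp).1
  by_cases h1 : p.1 ≤ U
  · by_cases h2 : p.2 ≤ U
    · have := Nat.mul_le_mul h1 h2
      rw [sq] at hn; omega
    · simp [h2]
  · simp [h1]

lemma coefB (U n : ℕ) : |(hi U muR * zetaR) n| ≤ n.divisors.card := by
  rw [ArithmeticFunction.mul_apply]
  refine (abs_sum_le_sum_abs _ _).trans ?_
  rw [Nat.sum_divisorsAntidiagonal (f := fun a b => |hi U muR a * zetaR b|), card_eq_sum_ones]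
  push_cast
  refine sum_le_sum fun i hi' => ?_
  rw [abs_mul]
  have h1 := (abs_hi U i muR).trans (abs_muR _)
  have h2 : |zetaR (n / i)| ≤ 1 := by
    simp only [zetaR, ArithmeticFunction.natCoe_apply, ArithmeticFunction.zeta_apply]
    split_ifs <;> simp
  have := abs_nonneg (hi U muR i)
  nlinarith [abs_nonneg (zetaR (n / i))]

lemma coefB_zero (U n : ℕ) (hn : n ≤ U) : (hi U muR * zetaR) n = 0 := by
  rw [ArithmeticFunction.mul_apply]
  refine sum_eq_zero fun p hp => ?_
  rw [hi_apply]
  have h := Nat.mem_divisorsAntidiagonal.1 hp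
  have : p.1 ≤ n := Nat.le_of_dvd (Nat.pos_of_ne_zero h.2) (Dvd.intro _ h.1)
  rw [if_pos (by omega)]; simp

/-- the Type I part of the twisted sum -/
lemma typeI_total (r : ℕ) [NeZero r] (hr : 1 < r) (χ : DirichletCharacter ℂ r) (hχ : χ ≠ 1) (y k U : ℕ) (hy : 1 ≤ y) (hU : 1 ≤ U) :
    ‖TT χ y k - ∑ n ∈ Icc 1 y, (((hi U ArithmeticFunction.vonMangoldt * (hi U muR * zetaR)) n : ℝ) : ℂ) * phiT χ y k n‖ ≤
      5 * r * (U : ℝ) ^ 2 * (2 * (1 + Real.log y)) ^ (k + 1) := by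
  have hL : 0 ≤ Real.log y := Real.log_natCast_nonneg y
  set L := 1 + Real.log y with hLd
  have hU1 : (1 : ℝ) ≤ U := by exact_mod_cast hU
  have hr1 : (1 : ℝ) ≤ r := by exact_mod_cast hr.le
  have e : TT χ y k - ∑ n ∈ Icc 1 y, (((hi U ArithmeticFunction.vonMangoldt * (hi U muR * zetaR)) n : ℝ) : ℂ) * phiT χ y k n =
      ∑ n ∈ Icc 1 y, ((lo U ArithmeticFunction.vonMangoldt n : ℝ) : ℂ) * phiT χ y k n +
      ∑ n ∈ Icc 1 y, (((lo U muR * ArithmeticFunction.log) n : ℝ) : ℂ) * phiT χ y k n -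
      ∑ n ∈ Icc 1 y, ((((lo U muR * lo U ArithmeticFunction.vonMangoldt) * zetaR) n : ℝ) : ℂ) * phiT χ y k n := by
    rw [TT, ← sum_sub_distrib, ← sum_add_distrib, ← sum_sub_distrib]
    refine sum_congr rfl fun n _ => ?_
    have v : ArithmeticFunction.vonMangoldt + (lo U muR * lo U ArithmeticFunction.vonMangoldt) * zetaR =
        lo U ArithmeticFunction.vonMangoldt + lo U muR * ArithmeticFunction.log
          + hi U ArithmeticFunction.vonMangoldt * (hi U muR * zetaR) := by linear_combination vaughan U
    have := congrArg (fun f : ArithmeticFunction ℝ => ((f n : ℝ) : ℂ)) v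
    simp only [ArithmeticFunction.add_apply] at this
    push_cast at this
    linear_combination phiT χ y k n * this
  rw [e]
  have h0 : ‖∑ n ∈ Icc 1 y, ((lo U ArithmeticFunction.vonMangoldt n : ℝ) : ℂ) * phiT χ y k n‖ ≤ U * L ^ (k + 1) := by
    have key : ∀ n ∈ Icc 1 y, ‖((lo U ArithmeticFunction.vonMangoldt n : ℝ) : ℂ) * phiT χ y k n‖ ≤ if n ≤ U then L ^ (k + 1) else 0 := by
      intro n hn
      rw [mem_Icc] at hn
      rw [lo_apply]
      split_ifs with h
      · rw [norm_mul, Complex.norm_real, Real.norm_eq_abs]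
        have h1 := vM_le_log n
        have h2 : Real.log n ≤ Real.log y := Real.log_le_log (by exact_mod_cast hn.1) (by exact_mod_cast hn.2)
        calc _ ≤ L * L ^ k := by
              gcongr
              · linarith
              · exact phiT_norm χ y k n hn.1 hn.2
          _ = _ := by ring
      · simp
    refine (norm_sum_le _ _).trans ((sum_le_sum key).trans ?_)
    rw [← sum_filter, sum_const, nsmul_eq_mul]
    gcongr
    calc _ ≤ (Icc 1 U).card := by
          apply card_le_card
          intro m hm
          rw [mem_filter, mem_Icc] at hm
          rw [mem_Icc]; exact ⟨hm.1.1, hm.2⟩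
      _ = U := by simp
  have h1 := typeI_conv r hr χ hχ y k U hy (lo U muR) ArithmeticFunction.log 1 (fun n _ _ => (abs_lo U n _).trans (abs_muR n))
    (fun n hn => by rw [lo_apply, if_neg (by omega)]) (fun i hi => by
      rw [ArithmeticFunction.log_apply, ArithmeticFunction.log_apply]
      apply Real.log_le_log (by exact_mod_cast hi)
      push_cast; linarith) (fun i hi => Real.log_natCast_nonneg i)
  have h2 := typeI_conv r hr χ hχ y k (U ^ 2) hy (lo U muR * lo U ArithmeticFunction.vonMangoldt) zetaR L
    (fun n h1 h2 => (coefS2 U n).trans (by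
      have : Real.log n ≤ Real.log y := Real.log_le_log (by exact_mod_cast h1) (by exact_mod_cast h2)
      linarith)) (coefS2_zero U) (fun i hi => by
        simp [zetaR, ArithmeticFunction.zeta_apply, show i ≠ 0 by omega]) (fun i hi => by
        simp only [zetaR, ArithmeticFunction.natCoe_apply]; positivity)
  have hz : zetaR y = 1 := by simp [zetaR, ArithmeticFunction.zeta_apply, show y ≠ 0 by omega]
  rw [hz] at h2
  rw [ArithmeticFunction.log_apply] at h1
  refine (norm_sub_le _ _).trans ((add_le_add ((norm_add_le _ _).trans (add_le_add h0 h1)) h2).trans ?_)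
  have hLL : L ≤ 2 * L := by linarith
  have hUU : (U : ℝ) ≤ (U : ℝ) ^ 2 := by nlinarith
  have hL1 : 0 ≤ L := by linarith
  have b0 : (U : ℝ) * L ^ (k + 1) ≤ r * (U : ℝ) ^ 2 * (2 * L) ^ (k + 1) := by
    calc (U : ℝ) * L ^ (k + 1) ≤ (U : ℝ) ^ 2 * (2 * L) ^ (k + 1) := by gcongr
      _ = 1 * (U : ℝ) ^ 2 * (2 * L) ^ (k + 1) := by ring
      _ ≤ _ := by gcongr
  have b1 : (U : ℝ) * (1 * (2 * r * (Real.log y * (2 * L) ^ k))) ≤ 2 * (r * (U : ℝ) ^ 2 * (2 * L) ^ (k + 1)) := by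
    calc _ ≤ (U : ℝ) ^ 2 * (1 * (2 * r * ((2 * L) * (2 * L) ^ k))) := by gcongr; linarith
      _ = _ := by ring
  have b2 : ((U ^ 2 : ℕ) : ℝ) * (L * (2 * r * (1 * (2 * L) ^ k))) ≤ 2 * (r * (U : ℝ) ^ 2 * (2 * L) ^ (k + 1)) := by
    push_cast
    calc _ ≤ (U : ℝ) ^ 2 * ((2 * L) * (2 * r * (1 * (2 * L) ^ k))) := by gcongr
      _ = _ := by ring
  linarith

noncomputable def aII (U i j m : ℕ) : ℂ := ((if Nat.log 2 m = i then hi U ArithmeticFunction.vonMangoldt m * Real.log m ^ j else 0 : ℝ) : ℂ)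
noncomputable def bII (U j d : ℕ) : ℂ := (((hi U muR * zetaR) d * Real.log d ^ j : ℝ) : ℂ)

noncomputable def BL {r : ℕ} (χ : DirichletCharacter ℂ r) (U y k i j : ℕ) : ℂ :=
  ∑ m ∈ Icc 1 (2 ^ (i + 1)), ∑ n ∈ Icc 1 (y / 2 ^ i), aII U i j m * bII U (k - j) n * (χ m * χ n) * ((tri ((m * n : ℕ) / y) : ℝ) : ℂ)

lemma typeII_decomp {r : ℕ} (χ : DirichletCharacter ℂ r) (U y k : ℕ) (hy : 1 ≤ y) :
    ∑ n ∈ Icc 1 y, (((hi U ArithmeticFunction.vonMangoldt * (hi U muR * zetaR)) n : ℝ) : ℂ) * phiT χ y k n =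
    ∑ i ∈ range (Nat.log 2 y + 1), ∑ j ∈ range (k + 1), (k.choose j : ℂ) * BL χ U y k i j := by
  rw [conv_sum _ _ _ y (fun n hn => phiT_zero χ y k n hy hn)]
  have hyr : (0 : ℝ) < y := by exact_mod_cast hy
  set F : ℕ → ℕ → ℂ := fun m d => ((hi U ArithmeticFunction.vonMangoldt m : ℝ) : ℂ) * (((hi U muR * zetaR) d : ℝ) : ℂ) * phiT χ y k (m * d) with hF
  have hF0 : ∀ m d, y < m * d → F m d = 0 := by
    intro m d h
    simp only [hF, phiT_zero χ y k _ hy h, mul_zero]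
  have hinner : ∀ i ∈ range (Nat.log 2 y + 1), ∑ j ∈ range (k + 1), (k.choose j : ℂ) * BL χ U y k i j =
      ∑ m ∈ Icc 1 (2 ^ (i + 1)), if Nat.log 2 m = i then ∑ d ∈ Icc 1 (y / 2 ^ i), F m d else 0 := by
    intro i _
    simp_rw [BL, mul_sum]
    rw [sum_comm]
    refine sum_congr rfl fun m hm => ?_
    rw [sum_comm]
    rw [mem_Icc] at hm
    split_ifs with h
    · refine sum_congr rfl fun d hd => ?_
      rw [mem_Icc] at hd
      have hm0 : (m : ℝ) ≠ 0 := by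
        have : 0 < m := hm.1
        positivity
      have hd0 : (d : ℝ) ≠ 0 := by
        have : 0 < d := hd.1
        positivity
      simp only [hF, phiT, aII, bII, if_pos h]
      rw [Nat.cast_mul m d, Nat.cast_mul m d, map_mul, Real.log_mul hm0 hd0, add_pow]
      push_cast
      simp only [sum_mul, mul_sum]
      refine sum_congr rfl fun j _ => ?_
      ring
    · refine sum_eq_zero fun d _ => sum_eq_zero fun j _ => ?_
      simp [aII, h]
  rw [sum_congr rfl hinner]
  have h1 : ∀ i ∈ range (Nat.log 2 y + 1), (∑ m ∈ Icc 1 (2 ^ (i + 1)), if Nat.log 2 m = i then ∑ d ∈ Icc 1 (y / 2 ^ i), F m d else 0) =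
      ∑ m ∈ Icc 1 y, if Nat.log 2 m = i then ∑ d ∈ Icc 1 y, F m d else 0 := by
    intro i hi'
    have hi2 : i ≤ Nat.log 2 y := by rw [mem_range] at hi'; omega
    rw [← sum_filter, ← sum_filter]
    have e1 : ∀ m, 1 ≤ m → Nat.log 2 m = i → 2 ^ i ≤ m ∧ m < 2 ^ (i + 1) := by
      intro m hm h
      rw [← h]
      exact ⟨Nat.pow_log_le_self 2 (by omega), Nat.lt_pow_succ_log_self (by norm_num) m⟩
    have e2 : ∀ m ∈ (Icc 1 (2 ^ (i + 1))).filter (fun m => Nat.log 2 m = i), ∑ d ∈ Icc 1 (y / 2 ^ i), F m d = ∑ d ∈ Icc 1 y, F m d := by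
      intro m hm
      rw [mem_filter, mem_Icc] at hm
      have := e1 m hm.1.1 hm.2
      apply sum_subset
      · apply Icc_subset_Icc_right; exact Nat.div_le_self _ _
      · intro d hd hd2
        rw [mem_Icc] at hd hd2
        apply hF0
        have h3 : y / 2 ^ i < d := by omega
        rw [Nat.div_lt_iff_lt_mul (by positivity)] at h3
        calc y < d * 2 ^ i := h3
          _ ≤ d * m := Nat.mul_le_mul_left _ this.1
          _ = m * d := mul_comm _ _
    rw [sum_congr rfl e2]
    have e3 : ∀ m, y < m → ∑ d ∈ Icc 1 y, F m d = 0 := by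
      intro m hm
      refine sum_eq_zero fun d hd => hF0 _ _ ?_
      rw [mem_Icc] at hd
      nlinarith
    symm
    apply sum_subset
    · intro m hm
      rw [mem_filter, mem_Icc] at hm ⊢
      exact ⟨⟨hm.1.1, (e1 m hm.1.1 hm.2).2.le⟩, hm.2⟩
    · intro m hm hm2
      rw [mem_filter, mem_Icc] at hm hm2
      apply e3
      by_contra h
      exact hm2 ⟨⟨hm.1.1, by omega⟩, hm.2⟩
  rw [sum_congr rfl h1, sum_comm (s := range _)]
  refine sum_congr rfl fun m hm => ?_
  rw [mem_Icc] at hm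
  rw [sum_ite_eq, if_pos]
  rw [mem_range]
  have := Nat.log_mono_right (b := 2) hm.2
  omega

lemma L_ge (y : ℕ) : 1 ≤ 1 + Real.log y := by
  have := Real.log_natCast_nonneg y
  linarith

lemma bl_bound (U y k i j R : ℕ) (hU : 1 ≤ U) (hy : 1 ≤ y) (hR : 1 ≤ R) (hi' : i ≤ Nat.log 2 y) (hj : j ≤ k) :
    ∑ r ∈ Icc R (2 * R), (1 / (r.totient : ℝ)) * ∑ χ ∈ prim r, ‖BL χ U y k i j‖ ≤
      108 * (1 + Real.log y) ^ (k + 4) * (y / R + y / Real.sqrt U + R * Real.sqrt y) := by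
  have hL := L_ge y
  set L := 1 + Real.log y with hLd
  have hyr : (0 : ℝ) < y := by exact_mod_cast hy
  have hRr : (0 : ℝ) < R := by exact_mod_cast hR
  have hUr : (0 : ℝ) < U := by exact_mod_cast hU
  have hpy : 2 ^ i ≤ y := (Nat.pow_le_pow_right (by norm_num) hi').trans (Nat.pow_log_le_self 2 (by omega))
  have hpyr : (2 : ℝ) ^ i ≤ y := by exact_mod_cast hpy
  have hBpos : 0 ≤ 108 * L ^ (k + 4) * (y / R + y / Real.sqrt U + R * Real.sqrt y) := by positivity
  by_cases h1 : 2 ^ (i + 1) ≤ U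
  · have h0 : ∀ r (χ : DirichletCharacter ℂ r), BL χ U y k i j = 0 := by
      intro r χ
      refine sum_eq_zero fun m hm => sum_eq_zero fun n _ => ?_
      rw [mem_Icc] at hm
      have : aII U i j m = 0 := by
        simp only [aII, hi_apply]
        rw [if_pos (by omega : m ≤ U)]; simp
      rw [this]; ring
    simp only [h0]
    simpa using hBpos
  by_cases h2 : y / 2 ^ i ≤ U
  · have h0 : ∀ r (χ : DirichletCharacter ℂ r), BL χ U y k i j = 0 := by
      intro r χ
      refine sum_eq_zero fun m hm => sum_eq_zero fun n hn => ?_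
      rw [mem_Icc] at hn
      have : bII U (k - j) n = 0 := by
        simp only [bII]
        rw [coefB_zero U n (by omega)]; simp
      rw [this]; ring
    simp only [h0]
    simpa using hBpos
  push Not at h1 h2
  have hN : 0 < y / 2 ^ i := by omega
  have hb := bilinear (aII U i j) (bII U (k - j)) (2 ^ (i + 1)) (y / 2 ^ i) R y (by positivity) hN hR hy
  refine hb.trans ?_
  set M : ℝ := ((2 ^ (i + 1) : ℕ) : ℝ) with hM
  set N : ℝ := ((y / 2 ^ i : ℕ) : ℝ) with hNd
  have hM2 : M = 2 * 2 ^ i := by rw [hM]; push_cast; ring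
  have hp0 : (0 : ℝ) < 2 ^ i := by positivity
  have hNle : N ≤ y / 2 ^ i := by
    rw [hNd]; refine Nat.cast_div_le.trans (le_of_eq ?_); push_cast; ring
  have hM0 : 0 < M := by rw [hM2]; positivity
  have hN0 : 0 < N := by rw [hNd]; exact_mod_cast hN
  have hMN : M * N ≤ 2 * y := by
    rw [hM2]
    have := (le_div_iff₀ hp0).1 hNle
    linarith
  have hMU : M ≤ 2 * (y / U) := by
    have h3 : (U : ℝ) ≤ N := by rw [hNd]; exact_mod_cast h2.le
    rw [← mul_div_assoc, le_div_iff₀ hUr]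
    nlinarith
  have hNU : N ≤ 2 * (y / U) := by
    have h3 : (U : ℝ) ≤ M := by rw [hM]; exact_mod_cast h1.le
    rw [← mul_div_assoc, le_div_iff₀ hUr]
    nlinarith
  -- coefficient sums
  have hSA : ∑ m ∈ Icc 1 (2 ^ (i + 1)), ‖aII U i j m‖ ^ 2 / m ≤ 2 * L * L ^ (2 * j + 2) := by
    have hlM : Real.log M ≤ L := by
      calc Real.log M ≤ Real.log (2 * y) := Real.log_le_log hM0 (by rw [hM2]; linarith)
        _ = Real.log 2 + Real.log y := Real.log_mul (by norm_num) hyr.ne'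
        _ ≤ L := by have := Real.log_two_lt_d9; linarith
    have hk : ∀ m ∈ Icc 1 (2 ^ (i + 1)), ‖aII U i j m‖ ^ 2 / m ≤ L ^ (2 * j + 2) * (1 / m) := by
      intro m hm
      rw [mem_Icc] at hm
      have hm1 : (1 : ℝ) ≤ m := by exact_mod_cast hm.1
      have hlm : Real.log m ≤ L := (Real.log_le_log (by linarith) (by rw [hM]; exact_mod_cast hm.2)).trans hlM
      have hlm0 : 0 ≤ Real.log m := Real.log_natCast_nonneg m
      have : ‖aII U i j m‖ ≤ L ^ (j + 1) := by
        simp only [aII]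
        rw [Complex.norm_real, Real.norm_eq_abs]
        split_ifs
        · rw [abs_mul, abs_of_nonneg (by positivity : (0 : ℝ) ≤ Real.log m ^ j), pow_succ']
          gcongr
          exact ((abs_hi U m _).trans (vM_le_log m)).trans hlm
        · simp; positivity
      rw [div_eq_mul_one_div]
      gcongr
      calc _ ≤ (L ^ (j + 1)) ^ 2 := by gcongr
        _ = _ := by ring
    refine (sum_le_sum hk).trans ?_
    rw [← mul_sum, mul_comm]
    gcongr
    refine (sum_inv_le _).trans ?_
    linarith
  have hSB : ∑ n ∈ Icc 1 (y / 2 ^ i), ‖bII U (k - j) n‖ ^ 2 / n ≤ L ^ (2 * (k - j) + 4) := by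
    have hk : ∀ n ∈ Icc 1 (y / 2 ^ i), ‖bII U (k - j) n‖ ^ 2 / n ≤ L ^ (2 * (k - j)) * ((n.divisors.card : ℝ) ^ 2 / n) := by
      intro n hn
      rw [mem_Icc] at hn
      have hn1 : (1 : ℝ) ≤ n := by exact_mod_cast hn.1
      have hny : n ≤ y := hn.2.trans (Nat.div_le_self _ _)
      have hln : Real.log n ≤ L := by
        have := Real.log_le_log (by linarith) (by exact_mod_cast hny : (n : ℝ) ≤ y)
        linarith
      have hln0 : 0 ≤ Real.log n := Real.log_natCast_nonneg n
      have : ‖bII U (k - j) n‖ ≤ L ^ (k - j) * n.divisors.card := by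
        simp only [bII]
        rw [Complex.norm_real, Real.norm_eq_abs, abs_mul, mul_comm, abs_of_nonneg (by positivity : (0 : ℝ) ≤ Real.log n ^ (k - j))]
        gcongr
        exact coefB U n
      rw [← mul_div_assoc]
      gcongr
      calc _ ≤ (L ^ (k - j) * n.divisors.card) ^ 2 := by gcongr
        _ = _ := by ring
    refine (sum_le_sum hk).trans ?_
    rw [← mul_sum, pow_add]
    gcongr
    refine (sum_le_sum_of_subset_of_nonneg (Icc_subset_Icc_right (Nat.div_le_self _ _)) fun _ _ _ => by positivity).trans (sum_tau_sq_le y)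
  have hS : Real.sqrt ((∑ m ∈ Icc 1 (2 ^ (i + 1)), ‖aII U i j m‖ ^ 2 / m) * (∑ n ∈ Icc 1 (y / 2 ^ i), ‖bII U (k - j) n‖ ^ 2 / n)) ≤ 2 * L ^ (k + 4) := by
    apply Real.sqrt_le_iff.2
    refine ⟨by positivity, ?_⟩
    calc _ ≤ (2 * L * L ^ (2 * j + 2)) * L ^ (2 * (k - j) + 4) := by
          gcongr
      _ = 2 * L ^ (2 * k + 7) := by
          rw [show 2 * k + 7 = 1 + (2 * j + 2) + (2 * (k - j) + 4) by omega]; ring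
      _ ≤ 4 * L ^ (2 * k + 8) := by
          have : L ^ (2 * k + 7) ≤ L ^ (2 * k + 8) := pow_le_pow_right₀ hL (by omega)
          have : 0 ≤ L ^ (2 * k + 7) := by positivity
          linarith
      _ = _ := by ring
  have hQ : Real.sqrt ((M + 4 * (R : ℝ) ^ 2) * (N + 4 * (R : ℝ) ^ 2)) ≤ 2 * Real.sqrt y + 6 * R * (Real.sqrt y / Real.sqrt U) + 4 * (R : ℝ) ^ 2 := by
    set P := Real.sqrt y
    have hP2 : P ^ 2 = y := Real.sq_sqrt hyr.le
    have hP0 : 0 ≤ P := Real.sqrt_nonneg _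
    have hW2 : (P / Real.sqrt U) ^ 2 = y / U := by rw [div_pow, hP2, Real.sq_sqrt hUr.le]
    have hW0 : 0 ≤ P / Real.sqrt U := by positivity
    set W := P / Real.sqrt U
    apply Real.sqrt_le_iff.2
    refine ⟨by positivity, ?_⟩
    rw [← hW2] at hMU hNU
    rw [← hP2] at hMN
    have t1 : 0 ≤ P * (R * W) := by positivity
    have t2 : 0 ≤ P * (R : ℝ) ^ 2 := by positivity
    have t3 : 0 ≤ R * W * (R : ℝ) ^ 2 := by positivity
    have t4 : M * (R : ℝ) ^ 2 ≤ 2 * W ^ 2 * (R : ℝ) ^ 2 := by gcongr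
    have t5 : N * (R : ℝ) ^ 2 ≤ 2 * W ^ 2 * (R : ℝ) ^ 2 := by gcongr
    have t6 : 0 ≤ W ^ 2 * (R : ℝ) ^ 2 := by positivity
    nlinarith
  calc _ ≤ 9 / R * Real.sqrt y * (2 * Real.sqrt y + 6 * R * (Real.sqrt y / Real.sqrt U) + 4 * (R : ℝ) ^ 2) * (2 * L ^ (k + 4)) := by gcongr
    _ = 9 * L ^ (k + 4) * (4 * (Real.sqrt y ^ 2 / R) + 12 * (Real.sqrt y ^ 2 / Real.sqrt U) + 8 * (R * Real.sqrt y)) := by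
        field_simp; ring
    _ ≤ _ := by
        rw [Real.sq_sqrt hyr.le]
        have t1 : 0 ≤ (y : ℝ) / R := by positivity
        have t2 : 0 ≤ (y : ℝ) / Real.sqrt U := by positivity
        have t3 : 0 ≤ R * Real.sqrt y := by positivity
        calc _ ≤ 9 * L ^ (k + 4) * (12 * (y / R) + 12 * (y / Real.sqrt U) + 12 * (R * Real.sqrt y)) := by gcongr <;> linarith
          _ = _ := by ring

/-- Vaughan / large sieve dyadic bound -/
theorem V_main (U y k R : ℕ) (hU : 1 ≤ U) (hy : 1 ≤ y) (hR : 2 ≤ R) :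
    ∑ r ∈ Icc R (2 * R), (1 / (r.totient : ℝ)) * ∑ χ ∈ prim r, ‖TT χ y k‖ ≤
      300 * 2 ^ k * (1 + Real.log y) ^ (k + 5) * (y / R + y / Real.sqrt U + R * Real.sqrt y + (R : ℝ) ^ 2 * (U : ℝ) ^ 2) := by
  have hL := L_ge y
  set L := 1 + Real.log y with hLd
  have hyr : (0 : ℝ) < y := by exact_mod_cast hy
  have hRr : (0 : ℝ) < R := by exact_mod_cast (by omega : 0 < R)
  have hUr : (0 : ℝ) < U := by exact_mod_cast hU
  have hT : ∀ r ∈ Icc R (2 * R), (1 / (r.totient : ℝ)) * ∑ χ ∈ prim r, ‖TT χ y k‖ ≤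
      10 * R * (U : ℝ) ^ 2 * (2 * L) ^ (k + 1) +
      ∑ i ∈ range (Nat.log 2 y + 1), ∑ j ∈ range (k + 1), (k.choose j : ℝ) * ((1 / (r.totient : ℝ)) * ∑ χ ∈ prim r, ‖BL χ U y k i j‖) := by
    intro r hr
    rw [mem_Icc] at hr
    have : NeZero r := ⟨by omega⟩
    have hphi : (0 : ℝ) < r.totient := by exact_mod_cast Nat.totient_pos.2 (by omega)
    have hχ : ∀ χ ∈ prim r, ‖TT χ y k‖ ≤ 10 * R * (U : ℝ) ^ 2 * (2 * L) ^ (k + 1) +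
        ∑ i ∈ range (Nat.log 2 y + 1), ∑ j ∈ range (k + 1), (k.choose j : ℝ) * ‖BL χ U y k i j‖ := by
      intro χ hχ
      have hne : χ ≠ 1 := by
        rintro rfl
        rw [mem_prim, DirichletCharacter.isPrimitive_def, DirichletCharacter.conductor_one] at hχ
        omega
      have h1 := typeI_total r (by omega) χ hne y k U hy hU
      rw [typeII_decomp χ U y k hy] at h1
      have h2 : ‖∑ i ∈ range (Nat.log 2 y + 1), ∑ j ∈ range (k + 1), (k.choose j : ℂ) * BL χ U y k i j‖ ≤
          ∑ i ∈ range (Nat.log 2 y + 1), ∑ j ∈ range (k + 1), (k.choose j : ℝ) * ‖BL χ U y k i j‖ := by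
        refine (norm_sum_le _ _).trans (sum_le_sum fun i _ => (norm_sum_le _ _).trans (sum_le_sum fun j _ => ?_))
        rw [norm_mul, Complex.norm_natCast]
      have h3 := norm_add_le (TT χ y k - ∑ i ∈ range (Nat.log 2 y + 1), ∑ j ∈ range (k + 1), (k.choose j : ℂ) * BL χ U y k i j)
        (∑ i ∈ range (Nat.log 2 y + 1), ∑ j ∈ range (k + 1), (k.choose j : ℂ) * BL χ U y k i j)
      rw [sub_add_cancel] at h3
      refine h3.trans (add_le_add (h1.trans ?_) h2)
      have : (r : ℝ) ≤ 2 * R := by exact_mod_cast hr.2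
      rw [← hLd]
      calc _ ≤ 5 * (2 * R) * (U : ℝ) ^ 2 * (2 * L) ^ (k + 1) := by gcongr
        _ = _ := by ring
    calc _ ≤ (1 / (r.totient : ℝ)) * ∑ χ ∈ prim r, (10 * R * (U : ℝ) ^ 2 * (2 * L) ^ (k + 1) +
        ∑ i ∈ range (Nat.log 2 y + 1), ∑ j ∈ range (k + 1), (k.choose j : ℝ) * ‖BL χ U y k i j‖) := by
          gcongr with χ h; exact hχ χ h
      _ = (1 / (r.totient : ℝ)) * ((prim r).card * (10 * R * (U : ℝ) ^ 2 * (2 * L) ^ (k + 1))) +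
          ∑ i ∈ range (Nat.log 2 y + 1), ∑ j ∈ range (k + 1), (k.choose j : ℝ) * ((1 / (r.totient : ℝ)) * ∑ χ ∈ prim r, ‖BL χ U y k i j‖) := by
          rw [sum_add_distrib, sum_const, nsmul_eq_mul, mul_add]
          congr 1
          rw [sum_comm, mul_sum]
          refine sum_congr rfl fun i _ => ?_
          rw [sum_comm, mul_sum]
          refine sum_congr rfl fun j _ => ?_
          rw [← mul_sum]; ring
      _ ≤ _ := by
          refine add_le_add ?_ le_rfl
          have hc : ((prim r).card : ℝ) ≤ r.totient := by exact_mod_cast card_prim_le r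
          calc _ ≤ (1 / (r.totient : ℝ)) * (r.totient * (10 * R * (U : ℝ) ^ 2 * (2 * L) ^ (k + 1))) := by gcongr
            _ = _ := by field_simp
  refine (sum_le_sum hT).trans ?_
  rw [sum_add_distrib, sum_const, nsmul_eq_mul]
  have hcard : ((Icc R (2 * R)).card : ℝ) ≤ 2 * R := by
    rw [Nat.card_Icc]; exact_mod_cast (by omega : 2 * R + 1 - R ≤ 2 * R)
  set E := (y : ℝ) / R + y / Real.sqrt U + R * Real.sqrt y with hE
  have hE0 : 0 ≤ E := by positivity
  have hII : ∑ r ∈ Icc R (2 * R), ∑ i ∈ range (Nat.log 2 y + 1), ∑ j ∈ range (k + 1), (k.choose j : ℝ) * ((1 / (r.totient : ℝ)) * ∑ χ ∈ prim r, ‖BL χ U y k i j‖) ≤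
      216 * 2 ^ k * L ^ (k + 5) * E := by
    rw [sum_comm]
    have h1 : ∀ i ∈ range (Nat.log 2 y + 1), ∑ r ∈ Icc R (2 * R), ∑ j ∈ range (k + 1), (k.choose j : ℝ) * ((1 / (r.totient : ℝ)) * ∑ χ ∈ prim r, ‖BL χ U y k i j‖) ≤
        2 ^ k * (108 * L ^ (k + 4) * E) := by
      intro i hi'
      rw [mem_range] at hi'
      rw [sum_comm]
      calc _ ≤ ∑ j ∈ range (k + 1), (k.choose j : ℝ) * (108 * L ^ (k + 4) * E) := by
            refine sum_le_sum fun j hj => ?_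
            rw [mem_range] at hj
            rw [← mul_sum]
            gcongr
            exact bl_bound U y k i j R hU hy (by omega) (by omega) (by omega)
        _ = _ := by
            rw [← sum_mul]
            congr 1
            exact_mod_cast Nat.sum_range_choose k
    refine (sum_le_sum h1).trans ?_
    rw [sum_const, card_range, nsmul_eq_mul]
    have hJ : ((Nat.log 2 y + 1 : ℕ) : ℝ) ≤ 2 * L := by
      have h2 : (2 : ℝ) ^ (Nat.log 2 y) ≤ y := by exact_mod_cast Nat.pow_log_le_self 2 (by omega)
      have h3 := Real.log_le_log (by positivity) h2
      rw [Real.log_pow] at h3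
      have h4 := Real.log_two_gt_d9
      have h5 : (0 : ℝ) ≤ Nat.log 2 y := by positivity
      push_cast
      nlinarith
    calc _ ≤ (2 * L) * (2 ^ k * (108 * L ^ (k + 4) * E)) := by gcongr
      _ = _ := by ring
  calc _ ≤ (2 * R) * (10 * R * (U : ℝ) ^ 2 * (2 * L) ^ (k + 1)) + 216 * 2 ^ k * L ^ (k + 5) * E := by gcongr
    _ = 40 * 2 ^ k * L ^ (k + 1) * ((R : ℝ) ^ 2 * (U : ℝ) ^ 2) + 216 * 2 ^ k * L ^ (k + 5) * E := by rw [mul_pow]; ring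
    _ ≤ 300 * 2 ^ k * L ^ (k + 5) * ((R : ℝ) ^ 2 * (U : ℝ) ^ 2) + 300 * 2 ^ k * L ^ (k + 5) * E := by
        have := pow_le_pow_right₀ hL (by omega : k + 1 ≤ k + 5)
        gcongr <;> norm_num
    _ = _ := by ring

lemma log_pow_le (δ : ℝ) (hδ : 0 < δ) (hδ1 : δ ≤ 1) (j : ℕ) : ∃ K : ℝ, 1 ≤ K ∧ ∀ i ≤ j, ∀ x : ℝ, 1 ≤ x → Real.log x ^ i ≤ K * x ^ δ := by
  set d := δ / (j + 1) with hd
  have hd0 : 0 < d := by positivity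
  have hd1 : d ≤ 1 := by
    rw [hd, div_le_one (by positivity)]
    have : (0 : ℝ) ≤ j := by positivity
    linarith
  have hK : 1 ≤ 1 / d := by rw [le_div_iff₀ hd0]; linarith
  refine ⟨(1 / d) ^ j, one_le_pow₀ hK, ?_⟩
  intro i hi x hx
  have h1 : Real.log x ≤ x ^ d / d := Real.log_le_rpow_div (by linarith) hd0
  have h0 : 0 ≤ Real.log x := Real.log_nonneg hx
  calc Real.log x ^ i ≤ (x ^ d / d) ^ i := by gcongr
    _ = (1 / d) ^ i * x ^ (d * i) := by
        rw [Real.rpow_mul (by linarith), Real.rpow_natCast, ← mul_pow]; congr 1; ring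
    _ ≤ (1 / d) ^ j * x ^ δ := by
        gcongr
        · calc d * i ≤ d * (j + 1) := by
                gcongr
                have : (i : ℝ) ≤ j := by exact_mod_cast hi
                linarith
            _ = δ := by rw [hd]; field_simp

noncomputable def hh (j : ℕ) (s : ℂ) (x : ℝ) : ℂ := ((Real.log x ^ j : ℝ) : ℂ) * (x : ℂ) ^ (-s)

lemma hh_norm (j : ℕ) (s : ℂ) (x : ℝ) (hx : 1 ≤ x) : ‖hh j s x‖ = Real.log x ^ j * x ^ (-s.re) := by
  have h0 : 0 ≤ Real.log x := Real.log_nonneg hx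
  unfold hh
  rw [norm_mul, Complex.norm_real, Real.norm_of_nonneg (by positivity), Complex.norm_cpow_eq_rpow_re_of_pos (by linarith), Complex.neg_re]

lemma hh_deriv (j : ℕ) (s : ℂ) (hs : s ≠ 0) (x : ℝ) (hx : 0 < x) :
    HasDerivAt (hh j s) (((j * Real.log x ^ (j - 1) * x⁻¹ : ℝ) : ℂ) * (x : ℂ) ^ (-s) + ((Real.log x ^ j : ℝ) : ℂ) * (-s * (x : ℂ) ^ (-s - 1))) x := by
  have h1 : HasDerivAt (fun x : ℝ => ((Real.log x ^ j : ℝ) : ℂ)) (((j * Real.log x ^ (j - 1) * x⁻¹ : ℝ) : ℂ)) x :=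
    ((Real.hasDerivAt_log hx.ne').pow j).ofReal_comp
  have h2 : HasDerivAt (fun x : ℝ => (x : ℂ) ^ (-s)) (-s * (x : ℂ) ^ (-s - 1)) x := by
    have := hasDerivAt_ofReal_cpow_const' (x := x) hx.ne' (r := -s - 1) (by
      intro h
      apply hs
      linear_combination -h)
    have h3 := this.const_mul (-s)
    have hne : -s ≠ 0 := neg_ne_zero.2 hs
    have e : (fun x : ℝ => (x : ℂ) ^ (-s)) = fun y : ℝ => -s * ((y : ℂ) ^ (-s - 1 + 1) / (-s - 1 + 1)) := by
      funext u
      simp only [sub_add_cancel]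
      field_simp
    rw [e]
    exact h3
  exact h1.mul h2

lemma hh_diff (δ : ℝ) (hδ : 0 < δ) (hδ1 : δ ≤ 1) (j : ℕ) : ∃ K : ℝ, 1 ≤ K ∧
    (∀ s : ℂ, 1 ≤ s.re → ∀ x : ℝ, 1 ≤ x → ‖hh j s x‖ ≤ K * x ^ (δ - 1)) ∧
    (∀ s : ℂ, 1 ≤ s.re → ∀ a b : ℝ, 1 ≤ a → a ≤ b → b ≤ a + 1 → ‖hh j s b - hh j s a‖ ≤ K * (1 + ‖s‖) * a ^ (δ - 2)) := by
  obtain ⟨K, hK1, hK⟩ := log_pow_le δ hδ hδ1 j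
  refine ⟨K * (j + 1), ?_, ?_, ?_⟩
  · have : (0 : ℝ) ≤ j := by positivity
    nlinarith
  · intro s hs x hx
    rw [hh_norm j s x hx]
    have hx0 : 0 < x := by linarith
    calc _ ≤ K * x ^ δ * x ^ (-1 : ℝ) := by
          gcongr
          exact hK j le_rfl x hx
      _ = K * 1 * x ^ (δ - 1) := by rw [mul_assoc, ← Real.rpow_add hx0]; ring_nf
      _ ≤ _ := by
          gcongr
          have : (0 : ℝ) ≤ j := by positivity
          linarith
  · intro s hs a b ha hab hb1
    have hs0 : s ≠ 0 := by rintro rfl; simp at hs; linarith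
    have key : ∀ x ∈ Set.Icc a b, ‖((j * Real.log x ^ (j - 1) * x⁻¹ : ℝ) : ℂ) * (x : ℂ) ^ (-s) + ((Real.log x ^ j : ℝ) : ℂ) * (-s * (x : ℂ) ^ (-s - 1))‖ ≤ K * (j + 1) * (1 + ‖s‖) * a ^ (δ - 2) := by
      intro x hx
      have hx1 : 1 ≤ x := ha.trans hx.1
      have hx0 : 0 < x := by linarith
      have hl := Real.log_nonneg hx1
      have e1 : ‖(x : ℂ) ^ (-s)‖ ≤ x ^ (-1 : ℝ) := by
        rw [Complex.norm_cpow_eq_rpow_re_of_pos hx0, Complex.neg_re]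
        exact Real.rpow_le_rpow_of_exponent_le hx1 (by linarith)
      have e2 : ‖(x : ℂ) ^ (-s - 1)‖ ≤ x ^ (-2 : ℝ) := by
        rw [Complex.norm_cpow_eq_rpow_re_of_pos hx0]
        apply Real.rpow_le_rpow_of_exponent_le hx1
        simp; linarith
      have e3 : x ^ (δ - 2) ≤ a ^ (δ - 2) := Real.rpow_le_rpow_of_nonpos (by linarith) hx.1 (by linarith)
      refine (norm_add_le _ _).trans ?_
      rw [norm_mul, norm_mul, norm_mul, norm_neg, Complex.norm_real, Complex.norm_real, Real.norm_of_nonneg (by positivity), Real.norm_of_nonneg (by positivity)]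
      calc _ ≤ j * (K * x ^ δ) * x⁻¹ * x ^ (-1 : ℝ) + (K * x ^ δ) * (‖s‖ * x ^ (-2 : ℝ)) := by
            gcongr
            · exact hK _ (by omega) x hx1
            · exact hK _ le_rfl x hx1
        _ = K * (j + ‖s‖) * x ^ (δ - 2) := by
            have : x ^ (δ - 2) = x ^ δ * x ^ (-2 : ℝ) := by rw [← Real.rpow_add hx0]; ring_nf
            have h3 : x ^ (-2 : ℝ) = x⁻¹ * x⁻¹ := by
              rw [← Real.rpow_neg_one, ← Real.rpow_add hx0]; norm_num
            rw [this, h3, Real.rpow_neg_one]; ring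
        _ ≤ K * ((j + 1) * (1 + ‖s‖)) * a ^ (δ - 2) := by
            gcongr
            have : (0 : ℝ) ≤ j * ‖s‖ := by positivity
            nlinarith
        _ = _ := by ring
    have := Convex.norm_image_sub_le_of_norm_hasDerivWithin_le (f := hh j s) (s := Set.Icc a b)
      (fun x hx => (hh_deriv j s hs0 x (by linarith [hx.1])).hasDerivWithinAt) key (convex_Icc a b) (Set.left_mem_Icc.2 hab) (Set.right_mem_Icc.2 hab)
    refine this.trans ?_
    rw [Real.norm_of_nonneg (by linarith)]
    have : 0 ≤ K * (j + 1) * (1 + ‖s‖) * a ^ (δ - 2) := by positivity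
    nlinarith

lemma abel_fin (c h : ℕ → ℂ) (D : ℝ) (N0 M : ℕ) (hM : N0 ≤ M) (hc : ∀ n, ‖c n‖ ≤ 1) (hD : ∀ m, ‖∑ n ∈ Icc 1 m, c n‖ ≤ D) :
    ‖∑ n ∈ Icc 1 M, c n * h n‖ ≤ ∑ n ∈ Icc 1 N0, ‖h n‖ + 2 * D * (∑ n ∈ Ioc N0 M, ‖h n - h (n + 1)‖ + ‖h (M + 1)‖) := by
  set S : ℕ → ℂ := fun m => ∑ n ∈ Icc 1 m, c n with hS
  have id1 : ∑ n ∈ Icc 1 M, c n * h n = ∑ n ∈ Icc 1 N0, c n * h n + ∑ n ∈ Ioc N0 M, (S n - S N0) * (h n - h (n + 1)) + (S M - S N0) * h (M + 1) := by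
    induction M, hM using Nat.le_induction with
    | base => simp
    | succ m hm ih =>
      rw [sum_Icc_succ_top (by omega), ih, sum_Ioc_succ_top (by omega)]
      have : S (m + 1) = S m + c (m + 1) := by simp only [hS]; rw [sum_Icc_succ_top (by omega)]
      rw [this]; ring
  have hSS : ∀ m, ‖S m - S N0‖ ≤ 2 * D := by
    intro m
    refine (norm_sub_le _ _).trans ?_
    have := hD m
    have := hD N0
    simp only [hS]; linarith
  rw [id1, mul_add]
  refine (norm_add_le _ _).trans ?_
  rw [← add_assoc]
  refine add_le_add ((norm_add_le _ _).trans (add_le_add ?_ ?_)) ?_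
  · refine (norm_sum_le _ _).trans (sum_le_sum fun n _ => ?_)
    rw [norm_mul]
    have := hc n
    have := norm_nonneg (h n)
    nlinarith
  · rw [mul_sum]
    refine (norm_sum_le _ _).trans (sum_le_sum fun n _ => ?_)
    rw [norm_mul]
    gcongr
    exact hSS n
  · rw [norm_mul]
    gcongr
    exact hSS M

lemma summ_log (c : ℕ → ℂ) (hc : ∀ n, ‖c n‖ ≤ 1) (j : ℕ) (s : ℂ) (hs : 1 < s.re) :
    LSeriesSummable (fun n => c n * ((Real.log n ^ j : ℝ) : ℂ)) s := by
  obtain ⟨K, hK1, hK⟩ := log_pow_le (min 1 ((s.re - 1) / 2)) (by apply lt_min <;> linarith) (min_le_left _ _) j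
  refine LSeriesSummable_of_le_const_mul_rpow (x := 1 + min 1 ((s.re - 1) / 2)) (by linarith [min_le_right 1 ((s.re - 1) / 2)]) ⟨K, fun n hn => ?_⟩
  have hn1 : (1 : ℝ) ≤ n := by exact_mod_cast Nat.one_le_iff_ne_zero.2 hn
  have := Real.log_nonneg hn1
  rw [norm_mul, Complex.norm_real, Real.norm_of_nonneg (by positivity), add_sub_cancel_left]
  calc _ ≤ 1 * (K * (n : ℝ) ^ (min 1 ((s.re - 1) / 2))) := by
        gcongr
        · exact hc n
        · exact hK j le_rfl n hn1
    _ = _ := one_mul _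

lemma sum_bound_of_partial (f : ℕ → ℂ) (hf : Summable f) (hf0 : f 0 = 0) (N0 : ℕ) (B : ℝ)
    (h : ∀ M, N0 ≤ M → ‖∑ n ∈ Icc 1 M, f n‖ ≤ B) : ‖∑' n, f n‖ ≤ B := by
  have h1 := hf.hasSum.tendsto_sum_nat
  refine le_of_tendsto h1.norm ?_
  filter_upwards [Filter.eventually_ge_atTop (N0 + 1)] with m hm
  obtain ⟨M, rfl⟩ : ∃ M, m = M + 1 := ⟨m - 1, by omega⟩
  have := h M (by omega)
  rw [sum_range_succ', hf0, add_zero, ← sum_Icc_one_range]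
  exact this

lemma term_hh (c : ℕ → ℂ) (j : ℕ) (s : ℂ) (n : ℕ) (hn : n ≠ 0) :
    LSeries.term (fun n => c n * ((Real.log n ^ j : ℝ) : ℂ)) s n = c n * hh j s n := by
  rw [LSeries.term_of_ne_zero hn, hh, Complex.cpow_neg, div_eq_mul_inv, mul_assoc]; simp

lemma dir_bound (δ : ℝ) (hδ : 0 < δ) (hδ1 : δ ≤ 1 / 2) (j : ℕ) : ∃ C : ℝ, 0 < C ∧
    ∀ (c : ℕ → ℂ) (D : ℝ) (s : ℂ), 1 ≤ D → (∀ n, ‖c n‖ ≤ 1) → (∀ m, ‖∑ n ∈ Icc 1 m, c n‖ ≤ D) → 1 < s.re → s.re ≤ 2 →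
      ‖LSeries (fun n => c n * ((Real.log n ^ j : ℝ) : ℂ)) s‖ ≤ C * (D * (2 + |s.im|)) ^ (2 * δ) := by
  obtain ⟨K, hK1, hKa, hKb⟩ := hh_diff δ hδ (by linarith) j
  have hZs : Summable (fun n : ℕ => (n : ℝ) ^ (-1 - δ)) := by
    rw [Real.summable_nat_rpow]; linarith
  set Z := ∑' n : ℕ, (n : ℝ) ^ (-1 - δ) with hZ
  have hZ0 : 0 ≤ Z := tsum_nonneg fun n => by positivity
  refine ⟨(K * Z + 4 * K * Z + 2 * K) * 2 ^ (2 * δ), by positivity, ?_⟩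
  intro c D s hD hc hS hs hs2
  set X := D * (2 + |s.im|) with hX
  have ht := abs_nonneg s.im
  have hX2 : 2 ≤ X := by rw [hX]; nlinarith
  have hDX : D ≤ X := by rw [hX]; nlinarith
  set N0 := ⌈X⌉₊ with hN0
  have hN1 : X ≤ N0 := Nat.le_ceil X
  have hN2 : (N0 : ℝ) ≤ 2 * X := by
    have := Nat.ceil_lt_add_one (show 0 ≤ X by linarith)
    rw [← hN0] at this; linarith
  have hN0pos : (0 : ℝ) < N0 := by linarith
  have hns : 1 + ‖s‖ ≤ 2 * (2 + |s.im|) := by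
    have := Complex.norm_le_abs_re_add_abs_im s
    rw [abs_of_nonneg (by linarith : 0 ≤ s.re)] at this
    linarith
  have hhead : ∑ n ∈ Icc 1 N0, ‖hh j s n‖ ≤ K * Z * (N0 : ℝ) ^ (2 * δ) := by
    calc _ ≤ ∑ n ∈ Icc 1 N0, K * (N0 : ℝ) ^ (2 * δ) * (n : ℝ) ^ (-1 - δ) := by
          refine sum_le_sum fun n hn => ?_
          rw [mem_Icc] at hn
          have hn1 : (1 : ℝ) ≤ n := by exact_mod_cast hn.1
          have hn0 : (0 : ℝ) < n := by linarith
          refine (hKa s hs.le n hn1).trans ?_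
          rw [show δ - 1 = 2 * δ + (-1 - δ) by ring, Real.rpow_add hn0, mul_assoc]
          gcongr
          exact hn.2
      _ = K * (N0 : ℝ) ^ (2 * δ) * ∑ n ∈ Icc 1 N0, (n : ℝ) ^ (-1 - δ) := by rw [mul_sum]
      _ ≤ K * (N0 : ℝ) ^ (2 * δ) * Z := by
          gcongr
          exact hZs.sum_le_tsum _ (fun _ _ => by positivity)
      _ = _ := by ring
  have htail : ∀ M, N0 ≤ M → ∑ n ∈ Ioc N0 M, ‖hh j s n - hh j s ((n + 1 : ℕ) : ℝ)‖ ≤ K * (2 * (2 + |s.im|)) * (N0 : ℝ) ^ (2 * δ - 1) * Z := by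
    intro M hM
    calc _ ≤ ∑ n ∈ Ioc N0 M, K * (2 * (2 + |s.im|)) * (N0 : ℝ) ^ (2 * δ - 1) * (n : ℝ) ^ (-1 - δ) := by
          refine sum_le_sum fun n hn => ?_
          rw [mem_Ioc] at hn
          have hn1 : (1 : ℝ) ≤ n := by exact_mod_cast (by omega : 1 ≤ n)
          have hn0 : (0 : ℝ) < n := by linarith
          rw [norm_sub_rev]
          refine (hKb s hs.le n ((n + 1 : ℕ) : ℝ) hn1 (by push_cast; linarith) (by push_cast; linarith)).trans ?_
          rw [show δ - 2 = (2 * δ - 1) + (-1 - δ) by ring, Real.rpow_add hn0, ← mul_assoc]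
          have : (n : ℝ) ^ (2 * δ - 1) ≤ (N0 : ℝ) ^ (2 * δ - 1) :=
            Real.rpow_le_rpow_of_nonpos hN0pos (by exact_mod_cast hn.1.le) (by linarith)
          gcongr
      _ = K * (2 * (2 + |s.im|)) * (N0 : ℝ) ^ (2 * δ - 1) * ∑ n ∈ Ioc N0 M, (n : ℝ) ^ (-1 - δ) := by rw [mul_sum]
      _ ≤ _ := by
          gcongr
          exact hZs.sum_le_tsum _ (fun _ _ => by positivity)
  have hfin : ∀ M, N0 ≤ M → ‖∑ n ∈ Icc 1 M, c n * hh j s n‖ ≤ (K * Z + 4 * K * Z + 2 * K) * (N0 : ℝ) ^ (2 * δ) := by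
    intro M hM
    refine (abel_fin c (fun n => hh j s n) D N0 M hM hc hS).trans ?_
    have h1 := htail M hM
    have h2 : ‖hh j s ((M + 1 : ℕ) : ℝ)‖ ≤ K * (N0 : ℝ) ^ (2 * δ - 1) := by
      have hMN : (N0 : ℝ) ≤ ((M + 1 : ℕ) : ℝ) := by exact_mod_cast (by omega)
      refine (hKa s hs.le _ (by linarith)).trans ?_
      gcongr
      calc ((M + 1 : ℕ) : ℝ) ^ (δ - 1) ≤ (N0 : ℝ) ^ (δ - 1) := Real.rpow_le_rpow_of_nonpos hN0pos hMN (by linarith)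
        _ ≤ _ := Real.rpow_le_rpow_of_exponent_le (by linarith) (by linarith)
    have h3 : (N0 : ℝ) * (N0 : ℝ) ^ (2 * δ - 1) = (N0 : ℝ) ^ (2 * δ) := by
      rw [Real.rpow_sub_one hN0pos.ne']; field_simp
    have hP : 0 ≤ (N0 : ℝ) ^ (2 * δ - 1) := by positivity
    calc _ ≤ K * Z * (N0 : ℝ) ^ (2 * δ) + 2 * D * (K * (2 * (2 + |s.im|)) * (N0 : ℝ) ^ (2 * δ - 1) * Z + K * (N0 : ℝ) ^ (2 * δ - 1)) := by
          gcongr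
      _ = K * Z * (N0 : ℝ) ^ (2 * δ) + 4 * K * Z * (X * (N0 : ℝ) ^ (2 * δ - 1)) + 2 * K * (D * (N0 : ℝ) ^ (2 * δ - 1)) := by rw [hX]; ring
      _ ≤ K * Z * (N0 : ℝ) ^ (2 * δ) + 4 * K * Z * (N0 * (N0 : ℝ) ^ (2 * δ - 1)) + 2 * K * (N0 * (N0 : ℝ) ^ (2 * δ - 1)) := by
          gcongr
          linarith
      _ = _ := by rw [h3]; ring
  have hall : ‖LSeries (fun n => c n * ((Real.log n ^ j : ℝ) : ℂ)) s‖ ≤ (K * Z + 4 * K * Z + 2 * K) * (N0 : ℝ) ^ (2 * δ) := by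
    refine sum_bound_of_partial _ (summ_log c hc j s hs) (LSeries.term_zero _ _) N0 _ fun M hM => ?_
    refine le_trans (le_of_eq ?_) (hfin M hM)
    congr 1
    refine sum_congr rfl fun n hn => ?_
    rw [mem_Icc] at hn
    exact term_hh c j s n (by omega)
  refine hall.trans ?_
  rw [mul_assoc _ ((2 : ℝ) ^ (2 * δ)), ← Real.mul_rpow (by norm_num) (by linarith)]
  gcongr

/-- bound for zeta to the right of one -/
lemma zeta_bound (δ : ℝ) (hδ : 0 < δ) (hδ1 : δ ≤ 1 / 2) : ∃ C : ℝ, 0 < C ∧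
    ∀ s : ℂ, 1 < s.re → s.re ≤ 2 → ‖LSeries (fun _ => (1 : ℂ)) s‖ ≤ 1 / ‖s - 1‖ + C * (2 + |s.im|) ^ (2 * δ) := by
  obtain ⟨K, hK1, hKa, hKb⟩ := hh_diff δ hδ (by linarith) 0
  have hZs : Summable (fun n : ℕ => (n : ℝ) ^ (-1 - δ)) := by
    rw [Real.summable_nat_rpow]; linarith
  set Z := ∑' n : ℕ, (n : ℝ) ^ (-1 - δ) with hZ
  have hZ0 : 0 ≤ Z := tsum_nonneg fun n => by positivity
  refine ⟨(K * Z + 2 * K * Z + 2) * 2 ^ (2 * δ), by positivity, ?_⟩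
  intro s hs hs2
  have ht := abs_nonneg s.im
  set X := 2 + |s.im| with hX
  set N0 := ⌈X⌉₊ with hN0
  have hN1 : X ≤ N0 := Nat.le_ceil X
  have hN2 : (N0 : ℝ) ≤ 2 * X := by
    have := Nat.ceil_lt_add_one (show 0 ≤ X by linarith)
    rw [← hN0] at this; linarith
  have hN0pos : (0 : ℝ) < N0 := by linarith
  have hns : 1 + ‖s‖ ≤ 2 * X := by
    have := Complex.norm_le_abs_re_add_abs_im s
    rw [abs_of_nonneg (by linarith : 0 ≤ s.re)] at this
    linarith
  have hs1 : s - 1 ≠ 0 := by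
    intro h
    have := congrArg Complex.re h
    simp at this; linarith
  have hhs : ∀ x : ℝ, hh 0 s x = (x : ℂ) ^ (-s) := by intro x; simp [hh]
  set q : ℝ → ℂ := fun x => (x : ℂ) ^ (1 - s) / (s - 1) with hq
  have hqd : ∀ x : ℝ, 0 < x → HasDerivAt q (-(x : ℂ) ^ (-s)) x := by
    intro x hx
    have h3 := hasDerivAt_ofReal_cpow_const' (x := x) hx.ne' (r := -s) (by
      intro h; apply hs1; linear_combination -h)
    have h4 := h3.neg
    have e : q = -fun y : ℝ => (y : ℂ) ^ (-s + 1) / (-s + 1) := by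
      funext u
      simp only [hq, Pi.neg_apply]
      rw [show -s + 1 = 1 - s by ring, show (1 : ℂ) - s = -(s - 1) by ring, div_neg, neg_neg]
    rw [e]
    exact h4
  have hqn : ∀ x : ℝ, 1 ≤ x → ‖q x‖ ≤ 1 / ‖s - 1‖ := by
    intro x hx
    simp only [hq]
    rw [norm_div, Complex.norm_cpow_eq_rpow_re_of_pos (by linarith)]
    gcongr
    apply Real.rpow_le_one_of_one_le_of_nonpos hx
    simp; linarith
  have hstep : ∀ a : ℝ, 1 ≤ a → ‖(a : ℂ) ^ (-s) - (q a - q (a + 1))‖ ≤ K * (1 + ‖s‖) * a ^ (δ - 2) := by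
    intro a ha
    have := Convex.norm_image_sub_le_of_norm_hasDerivWithin_le (f := fun x : ℝ => (x : ℂ) * (a : ℂ) ^ (-s) + q x) (s := Set.Icc a (a + 1))
      (f' := fun x => 1 * (a : ℂ) ^ (-s) + -(x : ℂ) ^ (-s)) (C := K * (1 + ‖s‖) * a ^ (δ - 2)) (x := a) (y := a + 1)
      (fun x hx => (((hasDerivAt_id x).ofReal_comp.mul_const _).add (hqd x (by linarith [hx.1]))).hasDerivWithinAt) (by
        intro x hx
        have h1 := hKb s hs.le a x ha hx.1 hx.2
        rw [hhs, hhs, norm_sub_rev] at h1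
        rw [one_mul, ← sub_eq_add_neg]; exact h1) (convex_Icc _ _) (Set.left_mem_Icc.2 (by linarith)) (Set.right_mem_Icc.2 (by linarith))
    rw [add_sub_cancel_left, norm_one, mul_one] at this
    refine le_trans (le_of_eq ?_) this
    congr 1
    push_cast; ring
  have hfin : ∀ M, N0 ≤ M → ‖∑ n ∈ Icc 1 M, ((n : ℝ) : ℂ) ^ (-s) - (q ((N0 + 1 : ℕ) : ℝ) - q ((M + 1 : ℕ) : ℝ))‖ ≤ (K * Z + 2 * K * Z) * (N0 : ℝ) ^ (2 * δ) := by
    intro M hM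
    have id1 : ∑ n ∈ Icc 1 M, ((n : ℝ) : ℂ) ^ (-s) - (q ((N0 + 1 : ℕ) : ℝ) - q ((M + 1 : ℕ) : ℝ)) =
        ∑ n ∈ Icc 1 N0, ((n : ℝ) : ℂ) ^ (-s) + ∑ n ∈ Ioc N0 M, (((n : ℝ) : ℂ) ^ (-s) - (q n - q ((n : ℝ) + 1))) := by
      induction M, hM using Nat.le_induction with
      | base => simp
      | succ m hm ih =>
        rw [sum_Icc_succ_top (by omega), sum_Ioc_succ_top (by omega), ← add_assoc, ← ih]
        push_cast; ring
    rw [id1]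
    have hhead : ∑ n ∈ Icc 1 N0, ‖((n : ℝ) : ℂ) ^ (-s)‖ ≤ K * Z * (N0 : ℝ) ^ (2 * δ) := by
      calc _ ≤ ∑ n ∈ Icc 1 N0, K * (N0 : ℝ) ^ (2 * δ) * (n : ℝ) ^ (-1 - δ) := by
            refine sum_le_sum fun n hn => ?_
            rw [mem_Icc] at hn
            have hn1 : (1 : ℝ) ≤ n := by exact_mod_cast hn.1
            have hn0 : (0 : ℝ) < n := by linarith
            rw [← hhs]
            refine (hKa s hs.le n hn1).trans ?_
            rw [show δ - 1 = 2 * δ + (-1 - δ) by ring, Real.rpow_add hn0, mul_assoc]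
            gcongr
            exact hn.2
        _ = K * (N0 : ℝ) ^ (2 * δ) * ∑ n ∈ Icc 1 N0, (n : ℝ) ^ (-1 - δ) := by rw [mul_sum]
        _ ≤ K * (N0 : ℝ) ^ (2 * δ) * Z := by
            gcongr
            exact hZs.sum_le_tsum _ (fun _ _ => by positivity)
        _ = _ := by ring
    have htail : ∑ n ∈ Ioc N0 M, ‖((n : ℝ) : ℂ) ^ (-s) - (q n - q ((n : ℝ) + 1))‖ ≤ K * (2 * X) * (N0 : ℝ) ^ (2 * δ - 1) * Z := by
      calc _ ≤ ∑ n ∈ Ioc N0 M, K * (2 * X) * (N0 : ℝ) ^ (2 * δ - 1) * (n : ℝ) ^ (-1 - δ) := by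
            refine sum_le_sum fun n hn => ?_
            rw [mem_Ioc] at hn
            have hn1 : (1 : ℝ) ≤ n := by exact_mod_cast (by omega : 1 ≤ n)
            have hn0 : (0 : ℝ) < n := by linarith
            refine (hstep n hn1).trans ?_
            rw [show δ - 2 = (2 * δ - 1) + (-1 - δ) by ring, Real.rpow_add hn0, ← mul_assoc]
            have : (n : ℝ) ^ (2 * δ - 1) ≤ (N0 : ℝ) ^ (2 * δ - 1) :=
              Real.rpow_le_rpow_of_nonpos hN0pos (by exact_mod_cast hn.1.le) (by linarith)
            gcongr
        _ = K * (2 * X) * (N0 : ℝ) ^ (2 * δ - 1) * ∑ n ∈ Ioc N0 M, (n : ℝ) ^ (-1 - δ) := by rw [mul_sum]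
        _ ≤ _ := by
            gcongr
            exact hZs.sum_le_tsum _ (fun _ _ => by positivity)
    have h3 : (N0 : ℝ) * (N0 : ℝ) ^ (2 * δ - 1) = (N0 : ℝ) ^ (2 * δ) := by
      rw [Real.rpow_sub_one hN0pos.ne']; field_simp
    calc _ ≤ K * Z * (N0 : ℝ) ^ (2 * δ) + K * (2 * X) * (N0 : ℝ) ^ (2 * δ - 1) * Z :=
          (norm_add_le _ _).trans (add_le_add ((norm_sum_le _ _).trans hhead) ((norm_sum_le _ _).trans htail))
      _ ≤ K * Z * (N0 : ℝ) ^ (2 * δ) + K * (2 * N0) * (N0 : ℝ) ^ (2 * δ - 1) * Z := by gcongr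
      _ = K * Z * (N0 : ℝ) ^ (2 * δ) + 2 * K * Z * (N0 * (N0 : ℝ) ^ (2 * δ - 1)) := by ring
      _ = _ := by rw [h3]; ring
  have hq0 : Filter.Tendsto (fun M : ℕ => ‖q ((M + 1 : ℕ) : ℝ)‖) Filter.atTop (nhds 0) := by
    have h1 : Filter.Tendsto (fun M : ℕ => (((M + 1 : ℕ) : ℝ)) ^ (-(s.re - 1)) / ‖s - 1‖) Filter.atTop (nhds (0 / ‖s - 1‖)) :=
      (((tendsto_rpow_neg_atTop (by linarith : 0 < s.re - 1)).comp tendsto_natCast_atTop_atTop).comp (Filter.tendsto_add_atTop_nat 1)).div_const _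
    rw [zero_div] at h1
    refine h1.congr fun M => ?_
    simp only [hq]
    rw [norm_div, Complex.norm_cpow_eq_rpow_re_of_pos (by positivity)]
    simp
  have hsum : Summable (fun n => LSeries.term (fun _ => (1 : ℂ)) s n) := LSeriesSummable_one_iff.2 hs
  have hlim : Filter.Tendsto (fun M : ℕ => ‖∑ n ∈ Icc 1 M, ((n : ℝ) : ℂ) ^ (-s)‖) Filter.atTop (nhds ‖LSeries (fun _ => (1 : ℂ)) s‖) := by
    have h1 := (hsum.hasSum.tendsto_sum_nat.comp (Filter.tendsto_add_atTop_nat 1)).norm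
    refine h1.congr fun M => ?_
    simp only [Function.comp]
    rw [sum_range_succ', LSeries.term_zero, add_zero, ← sum_Icc_one_range]
    congr 1
    refine sum_congr rfl fun n hn => ?_
    rw [mem_Icc] at hn
    rw [LSeries.term_of_ne_zero (by omega), Complex.cpow_neg]; simp
  have hfinal : ‖LSeries (fun _ => (1 : ℂ)) s‖ ≤ (1 / ‖s - 1‖ + (K * Z + 2 * K * Z) * (N0 : ℝ) ^ (2 * δ)) + 0 := by
    refine le_of_tendsto_of_tendsto hlim (hq0.const_add _) ?_
    filter_upwards [Filter.eventually_ge_atTop N0] with M hM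
    have h1 := hfin M hM
    have h2 := hqn ((N0 + 1 : ℕ) : ℝ) (by push_cast; linarith)
    have h3 := norm_add_le (∑ n ∈ Icc 1 M, ((n : ℝ) : ℂ) ^ (-s) - (q ((N0 + 1 : ℕ) : ℝ) - q ((M + 1 : ℕ) : ℝ))) (q ((N0 + 1 : ℕ) : ℝ) - q ((M + 1 : ℕ) : ℝ))
    rw [sub_add_cancel] at h3
    have h4 := norm_sub_le (q ((N0 + 1 : ℕ) : ℝ)) (q ((M + 1 : ℕ) : ℝ))
    linarith
  rw [add_zero] at hfinal
  refine hfinal.trans ?_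
  refine add_le_add le_rfl ?_
  rw [mul_assoc _ ((2 : ℝ) ^ (2 * δ)), ← Real.mul_rpow (by norm_num) (by linarith)]
  have hA : (N0 : ℝ) ^ (2 * δ) ≤ (2 * X) ^ (2 * δ) := Real.rpow_le_rpow hN0pos.le hN2 (by linarith)
  have hK0 : 0 ≤ K * Z := by positivity
  exact mul_le_mul (by linarith) hA (by positivity) (by linarith)

lemma per_partial (r : ℕ) [NeZero r] (f : ZMod r → ℂ) (hf : ∑ a, f a = 0) (h1 : ∀ a, ‖f a‖ ≤ 1) (n : ℕ) :
    ‖∑ i ∈ range n, f (i : ZMod r)‖ ≤ r := by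
  have hper : ∑ i ∈ range r, f (i : ZMod r) = 0 := by
    rw [← hf]
    refine sum_bij' (i := fun i _ => (i : ZMod r)) (j := fun a _ => a.val) ?_ ?_ ?_ ?_ ?_
    · simp
    · intro a _; simp [ZMod.val_lt]
    · intro i hi; simp [ZMod.val_natCast, Nat.mod_eq_of_lt (mem_range.1 hi)]
    · intro a _; simp
    · simp
  induction n using Nat.strong_induction_on with
  | _ n ih =>
    rcases lt_or_ge n r with h | h
    · refine (norm_sum_le _ _).trans ?_
      refine (sum_le_sum fun i _ => h1 _).trans ?_
      simp; exact h.le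
    · have : n = r + (n - r) := by omega
      rw [this, sum_range_add, hper, zero_add]
      have h2 := ih (n - r) (by have := NeZero.pos r; omega)
      simpa using h2

lemma L_upper (δ : ℝ) (hδ : 0 < δ) (hδ1 : δ ≤ 1) : ∃ C : ℝ, 1 ≤ C ∧ ∀ (r : ℕ) [NeZero r], 1 < r →
    (∀ χ : DirichletCharacter ℂ r, χ ≠ 1 → ∀ s : ℂ, 1 < s.re → s.re ≤ 2 →
      ‖LSeries (fun n => χ (n : ZMod r)) s‖ ≤ C * (r * (2 + |s.im|)) ^ δ ∧
      ‖LSeries (LSeries.logMul (fun n => χ (n : ZMod r))) s‖ ≤ C * (r * (2 + |s.im|)) ^ δ) ∧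
    (∀ s : ℂ, 1 < s.re → s.re ≤ 2 →
      ‖LSeries (fun n => (1 : DirichletCharacter ℂ r) (n : ZMod r)) s‖ ≤ 1 / ‖s - 1‖ + C * (r * (2 + |s.im|)) ^ δ) := by
  obtain ⟨C0, hC0, h0⟩ := dir_bound (δ / 2) (by linarith) (by linarith) 0
  obtain ⟨C1, hC1, h1⟩ := dir_bound (δ / 2) (by linarith) (by linarith) 1
  obtain ⟨C2, hC2, h2⟩ := zeta_bound (δ / 2) (by linarith) (by linarith)
  rw [show 2 * (δ / 2) = δ by ring] at h0 h1 h2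
  refine ⟨1 + C0 + C1 + C2, by linarith, ?_⟩
  intro r _ hr
  have hr1 : (1 : ℝ) ≤ r := by exact_mod_cast hr.le
  constructor
  · intro χ hχ s hs hs2
    have hp : 0 ≤ ((r : ℝ) * (2 + |s.im|)) ^ δ := by positivity
    have a0 := h0 (fun n => χ (n : ZMod r)) r s hr1 (fun n => χ.norm_le_one _) (fun m => char_partial' r hr χ hχ m) hs hs2
    have a1 := h1 (fun n => χ (n : ZMod r)) r s hr1 (fun n => χ.norm_le_one _) (fun m => char_partial' r hr χ hχ m) hs hs2
    constructor
    · simp only [pow_zero, Complex.ofReal_one, mul_one] at a0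
      refine a0.trans ?_
      gcongr; linarith
    · have e : LSeries.logMul (fun n => χ (n : ZMod r)) = fun n : ℕ => χ (n : ZMod r) * ((Real.log n ^ 1 : ℝ) : ℂ) := by
        funext n
        simp only [LSeries.logMul, pow_one]
        rw [mul_comm, Complex.ofReal_log (by positivity)]; simp
      rw [e]
      refine a1.trans ?_
      gcongr; linarith
  · intro s hs hs2
    set μ : ℝ := (r.totient : ℝ) / r with hμ
    have hr0 : (0 : ℝ) < r := by linarith
    have hμ0 : 0 ≤ μ := by positivity
    have hμ1 : μ ≤ 1 := by
      rw [hμ, div_le_one hr0]; exact_mod_cast Nat.totient_le r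
    set f : ZMod r → ℂ := fun a => (1 : DirichletCharacter ℂ r) a - (μ : ℂ) with hf
    have hf0 : ∑ a, f a = 0 := by
      simp only [hf]
      rw [sum_sub_distrib, MulChar.sum_one_eq_card_units]
      simp only [sum_const, card_univ, ZMod.card, nsmul_eq_mul, ZMod.card_units_eq_totient, hμ]
      push_cast
      field_simp
      simp
    have hf1 : ∀ a, ‖f a‖ ≤ 1 := by
      intro a
      simp only [hf]
      by_cases ha : IsUnit a
      · rw [MulChar.one_apply ha, ← Complex.ofReal_one, ← Complex.ofReal_sub, Complex.norm_real, Real.norm_of_nonneg (by linarith)]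
        linarith
      · rw [MulChar.map_nonunit _ ha, zero_sub, norm_neg, Complex.norm_real, Real.norm_of_nonneg hμ0]
        exact hμ1
    have a0 := h0 (fun n => f (n : ZMod r)) r s hr1 (fun n => hf1 _) (by
      intro m
      rw [sum_Icc_one_range]
      have := per_partial r (fun a => f (a + 1)) (by
        rw [← hf0]
        exact Equiv.sum_comp (Equiv.addRight (1 : ZMod r)) f) (fun a => hf1 _) m
      simpa using this) hs hs2
    simp only [pow_zero, Complex.ofReal_one, mul_one] at a0
    have a2 := h2 s hs hs2
    have hz : LSeriesSummable (fun _ => (1 : ℂ)) s := LSeriesSummable_one_iff.2 hs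
    have hfs : LSeriesSummable (fun n : ℕ => f (n : ZMod r)) s := by
      have := summ_log (fun n : ℕ => f (n : ZMod r)) (fun n => hf1 _) 0 s hs
      simpa using this
    have e : (fun n : ℕ => (1 : DirichletCharacter ℂ r) (n : ZMod r)) = (fun n : ℕ => f (n : ZMod r)) + (μ : ℂ) • (fun _ : ℕ => (1 : ℂ)) := by
      funext n
      simp [hf]
    rw [e, LSeries_add hfs (hz.smul _), LSeries_smul]
    refine (norm_add_le _ _).trans ?_
    rw [norm_mul, Complex.norm_real, Real.norm_of_nonneg hμ0]
    have hp : (2 + |s.im|) ^ δ ≤ ((r : ℝ) * (2 + |s.im|)) ^ δ := by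
      apply Real.rpow_le_rpow (by positivity) _ hδ.le
      have := abs_nonneg s.im
      nlinarith
    have hq : 0 ≤ (2 + |s.im|) ^ δ := by positivity
    have hn := norm_nonneg (LSeries (fun _ => (1 : ℂ)) s)
    have hs0 : 0 ≤ 1 / ‖s - 1‖ := by positivity
    calc _ ≤ C0 * ((r : ℝ) * (2 + |s.im|)) ^ δ + 1 * (1 / ‖s - 1‖ + C2 * (2 + |s.im|) ^ δ) := by gcongr
      _ ≤ _ := by nlinarith

lemma L_lip (δ : ℝ) (hδ : 0 < δ) (hδ1 : δ ≤ 1) : ∃ C : ℝ, 1 ≤ C ∧ ∀ (r : ℕ) [NeZero r], 1 < r →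
    ∀ χ : DirichletCharacter ℂ r, χ ≠ 1 → ∀ T : ℝ, 0 ≤ T → ∀ s w : ℂ, 1 < s.re → s.re ≤ 2 → 1 < w.re → w.re ≤ 2 → |s.im| ≤ T → |w.im| ≤ T →
      ‖LSeries (fun n => χ (n : ZMod r)) s - LSeries (fun n => χ (n : ZMod r)) w‖ ≤ C * (r * (2 + T)) ^ δ * ‖s - w‖ := by
  obtain ⟨C, hC, h⟩ := L_upper δ hδ hδ1
  refine ⟨C, hC, ?_⟩
  intro r _ hr χ hχ T hT s w hs hs2 hw hw2 hsT hwT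
  have hconv : Convex ℝ {z : ℂ | 1 < z.re ∧ z.re ≤ 2 ∧ |z.im| ≤ T} := by
    intro a ha b hb p q hp hq hpq
    simp only [Set.mem_ofPred_eq, abs_le] at ha hb ⊢
    simp only [Complex.add_re, Complex.add_im, Complex.real_smul, Complex.mul_re, Complex.mul_im, Complex.ofReal_re, Complex.ofReal_im, zero_mul, sub_zero, add_zero]
    obtain ⟨ha1, ha2, ha3, ha4⟩ := ha
    obtain ⟨hb1, hb2, hb3, hb4⟩ := hb
    have hq' : q = 1 - p := by linarith
    subst hq'
    refine ⟨?_, by nlinarith, by nlinarith, by nlinarith⟩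
    rcases hp.eq_or_lt with h0 | h0
    · subst h0; simpa using hb1
    · nlinarith
  refine Convex.norm_image_sub_le_of_norm_hasDerivWithin_le (s := {z : ℂ | 1 < z.re ∧ z.re ≤ 2 ∧ |z.im| ≤ T})
    (f' := fun z => -LSeries (LSeries.logMul (fun n => χ (n : ZMod r))) z) ?_ ?_ hconv ⟨hw, hw2, hwT⟩ ⟨hs, hs2, hsT⟩
  · intro z hz
    refine (LSeries_hasDerivAt ?_).hasDerivWithinAt
    rw [DirichletCharacter.absicssaOfAbsConv_eq_one (by omega) χ]
    exact_mod_cast hz.1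
  · intro z hz
    rw [norm_neg]
    refine ((h r hr).1 χ hχ z hz.1 hz.2.1).2.trans ?_
    have := hz.2.2
    gcongr

/-- the abstract three-four-one argument -/
lemma abs341 (a : ℝ → ℝ) (B B' : ℝ) (hB : 1 ≤ B) (hB' : 1 ≤ B')
    (h1 : ∀ x, 0 < x → x ≤ 1 → x ^ 3 ≤ B ^ 3 * B' * a x ^ 4) (h0 : ∀ x, 0 < x → x ≤ 1 → 0 ≤ a x)
    (h2 : ∀ x x', 0 < x → x ≤ x' → x' ≤ 1 → a x' - a x ≤ B * (x' - x)) (x : ℝ) (hx : 0 < x) (hx1 : x ≤ 1) :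
    1 / (16 * B ^ 6 * B') ≤ a x := by
  have hBp : (1 : ℝ) ≤ B ^ 7 := one_le_pow₀ hB
  set x0 := 1 / (16 * B ^ 7 * B') with hx0
  have hx0p : 0 < x0 := by positivity
  have hx01 : x0 ≤ 1 := by
    rw [hx0, div_le_one (by positivity)]; nlinarith
  have he : B * x0 = 1 / (16 * B ^ 6 * B') := by
    rw [hx0]; field_simp
  have key : ∀ u, x0 ≤ u → u ≤ 1 → 2 * B * x0 ≤ a u := by
    intro u hu hu1
    have hup : 0 < u := by linarith
    have g1 := h1 u hup hu1
    have g2 : x0 ^ 3 ≤ u ^ 3 := by gcongr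
    by_contra hcon
    push Not at hcon
    have g3 : a u ^ 4 < (2 * B * x0) ^ 4 := pow_lt_pow_left₀ hcon (h0 u hup hu1) (by norm_num)
    have g4 : B ^ 3 * B' * a u ^ 4 < B ^ 3 * B' * (2 * B * x0) ^ 4 := by gcongr
    have g5 : B ^ 3 * B' * (2 * B * x0) ^ 4 = x0 ^ 3 := by
      rw [show B ^ 3 * B' * (2 * B * x0) ^ 4 = (16 * B ^ 7 * B' * x0) * x0 ^ 3 by ring, hx0]
      field_simp
    linarith
  rw [← he]
  have hBx : 0 < B * x0 := by positivity
  rcases le_total x0 x with h | h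
  · have := key x h hx1; linarith
  · have g1 := key x0 le_rfl hx01
    have g2 := h2 x x0 hx h hx01
    nlinarith

def SiegelProp : Prop := ∀ ε : ℝ, 0 < ε → ∃ c : ℝ, 0 < c ∧ ∀ (r : ℕ) [NeZero r], 1 < r → ∀ χ : DirichletCharacter ℂ r,
  χ.IsPrimitive → χ ^ 2 = 1 → c * (r : ℝ) ^ (-ε) ≤ ‖DirichletCharacter.LFunction χ 1‖

lemma three41 (r : ℕ) (χ : DirichletCharacter ℂ r) (t x B B' : ℝ) (hx : 0 < x)
    (h1 : ‖LSeries (fun n => (1 : DirichletCharacter ℂ r) (n : ZMod r)) (1 + x)‖ ≤ B / x)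
    (h2 : ‖LSeries (fun n => (χ ^ 2) (n : ZMod r)) (1 + x + 2 * Complex.I * t)‖ ≤ B') :
    x ^ 3 ≤ B ^ 3 * B' * ‖LSeries (fun n => χ (n : ZMod r)) (1 + x + Complex.I * t)‖ ^ 4 := by
  have h := DirichletCharacter.norm_LSeries_product_ge_one χ hx t
  rw [norm_mul, norm_mul, norm_pow, norm_pow] at h
  have h3 : (1 : ℝ) ≤ (B / x) ^ 3 * ‖LSeries (fun n => χ (n : ZMod r)) (1 + x + Complex.I * t)‖ ^ 4 * B' := by
    refine le_trans h ?_
    have : 0 ≤ B / x := (norm_nonneg _).trans h1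
    gcongr
  rw [div_pow, div_mul_eq_mul_div, div_mul_eq_mul_div, le_div_iff₀ (by positivity)] at h3
  linarith

lemma L_lip_one (C δ : ℝ) (r : ℕ) [NeZero r] (χ : DirichletCharacter ℂ r) (hχ : χ ≠ 1)
    (h : ∀ T : ℝ, 0 ≤ T → ∀ s w : ℂ, 1 < s.re → s.re ≤ 2 → 1 < w.re → w.re ≤ 2 → |s.im| ≤ T → |w.im| ≤ T →
      ‖LSeries (fun n => χ (n : ZMod r)) s - LSeries (fun n => χ (n : ZMod r)) w‖ ≤ C * (r * (2 + T)) ^ δ * ‖s - w‖)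
    (s : ℂ) (hs : 1 < s.re) (hs2 : s.re ≤ 2) :
    ‖LSeries (fun n => χ (n : ZMod r)) s - DirichletCharacter.LFunction χ 1‖ ≤ C * (r * (2 + |s.im|)) ^ δ * ‖s - 1‖ := by
  have hcont : Continuous (DirichletCharacter.LFunction χ) := (DirichletCharacter.differentiable_LFunction hχ).continuous
  have hseq : Filter.Tendsto (fun n : ℕ => (1 : ℂ) + ((1 / ((n : ℝ) + 1) : ℝ) : ℂ)) Filter.atTop (nhds 1) := by
    have := (Complex.continuous_ofReal.tendsto 0).comp (tendsto_one_div_add_atTop_nhds_zero_nat (𝕜 := ℝ))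
    have h2 := this.const_add (1 : ℂ)
    simpa using h2
  have hl : Filter.Tendsto (fun n : ℕ => ‖LSeries (fun n => χ (n : ZMod r)) s - DirichletCharacter.LFunction χ ((1 : ℂ) + ((1 / ((n : ℝ) + 1) : ℝ) : ℂ))‖) Filter.atTop
      (nhds ‖LSeries (fun n => χ (n : ZMod r)) s - DirichletCharacter.LFunction χ 1‖) :=
    (((hcont.tendsto 1).comp hseq).const_sub _).norm
  have hr : Filter.Tendsto (fun n : ℕ => C * (r * (2 + |s.im|)) ^ δ * ‖s - ((1 : ℂ) + ((1 / ((n : ℝ) + 1) : ℝ) : ℂ))‖) Filter.atTop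
      (nhds (C * (r * (2 + |s.im|)) ^ δ * ‖s - 1‖)) :=
    ((hseq.const_sub _).norm).const_mul _
  refine le_of_tendsto_of_tendsto' hl hr fun n => ?_
  have hp : (0 : ℝ) < 1 / ((n : ℝ) + 1) := by positivity
  have hp1 : 1 / ((n : ℝ) + 1) ≤ 1 := by
    rw [div_le_one (by positivity)]
    have : (0 : ℝ) ≤ n := by positivity
    linarith
  have hre : ((1 : ℂ) + ((1 / ((n : ℝ) + 1) : ℝ) : ℂ)).re = 1 + 1 / ((n : ℝ) + 1) := by
    rw [Complex.add_re, Complex.ofReal_re, Complex.one_re]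
  have him : ((1 : ℂ) + ((1 / ((n : ℝ) + 1) : ℝ) : ℂ)).im = 0 := by
    rw [Complex.add_im, Complex.ofReal_im, Complex.one_im, add_zero]
  rw [DirichletCharacter.LFunction_eq_LSeries χ (by rw [hre]; linarith)]
  exact h |s.im| (abs_nonneg _) s _ hs hs2 (by rw [hre]; linarith) (by rw [hre]; linarith) le_rfl (by rw [him]; simp)

set_option maxHeartbeats 1600000 in
lemma LB (hS : SiegelProp) (ε : ℝ) (hε : 0 < ε) : ∃ c : ℝ, 0 < c ∧ ∀ (r : ℕ) [NeZero r], 1 < r → ∀ χ : DirichletCharacter ℂ r, χ.IsPrimitive →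
    ∀ s : ℂ, 1 < s.re → s.re ≤ 2 → c * ((r : ℝ) * (2 + |s.im|)) ^ (-ε) ≤ ‖LSeries (fun n => χ (n : ZMod r)) s‖ := by
  set δ : ℝ := min 1 (ε / 11) with hδ
  have hδ0 : 0 < δ := by apply lt_min <;> linarith
  have hδ1 : δ ≤ 1 := min_le_left _ _
  have hδε : 11 * δ ≤ ε := by have := min_le_right 1 (ε / 11); linarith
  obtain ⟨C1, hC1, hup⟩ := L_upper δ hδ0 hδ1
  obtain ⟨C2, hC2, hlip⟩ := L_lip δ hδ0 hδ1
  obtain ⟨c0, hc0, hsie⟩ := hS δ hδ0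
  set c2 := min 1 c0 with hc2
  have hc2p : 0 < c2 := by apply lt_min <;> linarith
  have hc21 : c2 ≤ 1 := min_le_left _ _
  have hc20 : c2 ≤ c0 := min_le_right _ _
  set C := max C1 C2 with hC
  have hCa : C1 ≤ C := le_max_left _ _
  have hCb : C2 ≤ C := le_max_right _ _
  have hC1' : 1 ≤ C := by linarith
  have hCp : 0 < C := by linarith
  refine ⟨c2 ^ 4 / (40960 * C ^ 7), by positivity, ?_⟩
  intro r _ hr χ hprim s hs hs2
  have hχ : χ ≠ 1 := by
    rintro rfl
    rw [DirichletCharacter.isPrimitive_def, DirichletCharacter.conductor_one] at hprim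
    omega
  set t := s.im with ht
  have htn := abs_nonneg t
  have hr1 : (1 : ℝ) ≤ r := by exact_mod_cast hr.le
  set N : ℝ := r * (2 + |t|) with hN
  have hN1 : 1 ≤ N := by nlinarith
  have hN0 : 0 < N := by linarith
  set P := N ^ δ with hP
  have hP1 : 1 ≤ P := Real.one_le_rpow hN1 hδ0.le
  have hP0 : 0 < P := by linarith
  set B := 2 * C * P with hB
  have hCP : 1 ≤ C * P := by nlinarith
  have hB1 : 1 ≤ B := by nlinarith
  -- reduction to a power of P
  suffices hmain : c2 ^ 4 / (40960 * C ^ 7 * P ^ 11) ≤ ‖LSeries (fun n => χ (n : ZMod r)) s‖ by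
    refine le_trans ?_ hmain
    rw [← div_div (c2 ^ 4) (40960 * C ^ 7), div_eq_mul_inv _ (P ^ 11)]
    gcongr
    rw [hP, ← Real.rpow_natCast, ← Real.rpow_mul hN0.le, ← Real.rpow_neg hN0.le]
    apply Real.rpow_le_rpow_of_exponent_le hN1
    push_cast; linarith
  set a : ℝ → ℝ := fun x => ‖LSeries (fun n => χ (n : ZMod r)) (1 + x + Complex.I * t)‖ with ha
  have hss : s = 1 + ((s.re - 1 : ℝ) : ℂ) + Complex.I * t := by
    apply Complex.ext <;> simp [ht]
  have has : ‖LSeries (fun n => χ (n : ZMod r)) s‖ = a (s.re - 1) := by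
    simp only [ha]; rw [← hss]
  rw [has]
  set x := s.re - 1 with hx
  have hx0 : 0 < x := by linarith
  have hx1 : x ≤ 1 := by linarith
  have hre : ∀ u v : ℝ, ((1 : ℂ) + u + Complex.I * v).re = 1 + u := by intro u v; simp
  have him : ∀ u v : ℝ, ((1 : ℂ) + u + Complex.I * v).im = v := by intro u v; simp
  have hprin : ∀ u : ℝ, 0 < u → u ≤ 1 → ‖LSeries (fun n => (1 : DirichletCharacter ℂ r) (n : ZMod r)) (1 + u)‖ ≤ B / u := by
    intro u hu hu1
    have := (hup r hr).2 (1 + u) (by simp; linarith) (by simp; linarith)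
    refine this.trans ?_
    rw [add_sub_cancel_left, Complex.norm_real, Real.norm_of_nonneg hu.le]
    have h1 : C1 * ((r : ℝ) * (2 + |((1 : ℂ) + u).im|)) ^ δ ≤ C * P := by
      rw [hP]
      gcongr
      simp only [Complex.add_im, Complex.one_im, Complex.ofReal_im, add_zero, abs_zero, hN]
      gcongr
      linarith
    have h2 : C * P ≤ C * P / u := by rw [le_div_iff₀ hu]; nlinarith
    have h3 : 1 / u ≤ C * P / u := by gcongr
    calc _ ≤ C * P / u + C * P / u := by linarith
      _ = B / u := by rw [hB]; ring
  have hN2 : ((r : ℝ) * (2 + |2 * t|)) ^ δ ≤ 2 * P := by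
    calc ((r : ℝ) * (2 + |2 * t|)) ^ δ ≤ (2 * N) ^ δ := by
          apply Real.rpow_le_rpow (by positivity) _ hδ0.le
          rw [abs_mul, abs_two, hN]; nlinarith
      _ = 2 ^ δ * P := by rw [Real.mul_rpow (by norm_num) hN0.le]
      _ ≤ 2 ^ (1 : ℝ) * P := by gcongr; norm_num
      _ = _ := by norm_num
  have hlipx : ∀ u v : ℝ, 0 < u → u ≤ v → v ≤ 1 → a v - a u ≤ B * (v - u) := by
    intro u v hu huv hv
    have h1 := hlip r hr χ hχ |t| htn (1 + v + Complex.I * t) (1 + u + Complex.I * t) (by rw [hre]; linarith) (by rw [hre]; linarith)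
      (by rw [hre]; linarith) (by rw [hre]; linarith) (by rw [him]) (by rw [him])
    have h2 := norm_sub_norm_le (LSeries (fun n => χ (n : ZMod r)) (1 + v + Complex.I * t)) (LSeries (fun n => χ (n : ZMod r)) (1 + u + Complex.I * t))
    have h3 : ‖((1 : ℂ) + v + Complex.I * t) - (1 + u + Complex.I * t)‖ = v - u := by
      rw [show ((1 : ℂ) + v + Complex.I * t) - (1 + u + Complex.I * t) = ((v - u : ℝ) : ℂ) by push_cast; ring, Complex.norm_real, Real.norm_of_nonneg (by linarith)]
    rw [h3] at h1
    have hBP : C2 * P ≤ B := by have := mul_le_mul_of_nonneg_right hCb hP0.le; rw [hB]; linarith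
    have h4 : C2 * P * (v - u) ≤ B * (v - u) := mul_le_mul_of_nonneg_right hBP (by linarith)
    simp only [ha]
    linarith
  have h2t : ∀ u : ℝ, (1 : ℂ) + u + 2 * Complex.I * t = 1 + u + Complex.I * (2 * t : ℝ) := by intro u; push_cast; ring
  have hPp : ∀ i j : ℕ, i ≤ j → P ^ i ≤ P ^ j := fun i j hij => pow_le_pow_right₀ hP1 hij
  have hc24 : c2 ^ 4 ≤ c2 := by
    calc c2 ^ 4 ≤ c2 ^ 1 := pow_le_pow_of_le_one hc2p.le hc21 (by norm_num)
      _ = c2 := pow_one _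
  by_cases hsq : χ ^ 2 = 1
  · set B' := 10 * C * P ^ 2 / c2 with hB'
    have hCP2 : 1 ≤ C * P ^ 2 := one_le_mul_of_one_le_of_one_le hC1' (one_le_pow₀ hP1)
    have hB'1 : 1 ≤ B' := by
      rw [hB', le_div_iff₀ hc2p]; nlinarith
    have hBB : B ≤ 2 * C * P ^ 2 / c2 := by
      rw [hB, le_div_iff₀ hc2p]
      have : P ≤ P ^ 2 := by nlinarith
      calc 2 * C * P * c2 ≤ 2 * C * P ^ 2 * 1 := by gcongr
        _ = _ := by ring
    set ρ := c2 / (4 * C * P ^ 2) with hρ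
    have hρ0 : 0 < ρ := by positivity
    have hrho : 2 / ρ = 8 * C * P ^ 2 / c2 := by rw [hρ]; field_simp; norm_num
    have hsq' : ∀ u : ℝ, 0 < u → u ≤ 1 → ρ / 2 ≤ u ∨ ρ / 2 ≤ |t| → ‖LSeries (fun n => (χ ^ 2) (n : ZMod r)) (1 + u + 2 * Complex.I * t)‖ ≤ B' := by
      intro u hu hu1 hor
      rw [hsq, h2t]
      refine ((hup r hr).2 _ (by rw [hre]; linarith) (by rw [hre]; linarith)).trans ?_
      rw [him]
      have hn : ρ / 2 ≤ ‖(1 : ℂ) + u + Complex.I * (2 * t : ℝ) - 1‖ := by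
        rcases hor with h | h
        · have := Complex.abs_re_le_norm ((1 : ℂ) + u + Complex.I * (2 * t : ℝ) - 1)
          rw [Complex.sub_re, hre, Complex.one_re, add_sub_cancel_left, abs_of_pos hu] at this
          linarith
        · have := Complex.abs_im_le_norm ((1 : ℂ) + u + Complex.I * (2 * t : ℝ) - 1)
          rw [Complex.sub_im, him, Complex.one_im, sub_zero, abs_mul, abs_two] at this
          linarith
      have h1 : 1 / ‖(1 : ℂ) + u + Complex.I * (2 * t : ℝ) - 1‖ ≤ 8 * C * P ^ 2 / c2 := by
        rw [← hrho]
        calc _ ≤ 1 / (ρ / 2) := by gcongr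
          _ = 2 / ρ := by field_simp
      have h2 : C1 * ((r : ℝ) * (2 + |2 * t|)) ^ δ ≤ B := by
        calc _ ≤ C * (2 * P) := by gcongr
          _ = B := by rw [hB]; ring
      calc _ ≤ 8 * C * P ^ 2 / c2 + 2 * C * P ^ 2 / c2 := by linarith
        _ = B' := by rw [hB']; ring
    by_cases hcase : x + |t| ≤ ρ
    · have h1 := L_lip_one C2 δ r χ hχ (fun T hT s w => hlip r hr χ hχ T hT s w) s hs hs2
      have h2 := hsie r hr χ hprim hsq
      have h3 := norm_sub_norm_le (DirichletCharacter.LFunction χ 1) (LSeries (fun n => χ (n : ZMod r)) s)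
      rw [norm_sub_rev] at h3
      have h4 : ‖s - 1‖ ≤ x + |t| := by
        have := Complex.norm_le_abs_re_add_abs_im (s - 1)
        rw [Complex.sub_re, Complex.sub_im, Complex.one_re, Complex.one_im, sub_zero, abs_of_pos (by linarith)] at this
        exact this
      have h5 : c2 / P ≤ c0 * (r : ℝ) ^ (-δ) := by
        rw [div_eq_mul_inv, hP, ← Real.rpow_neg hN0.le]
        have : N ^ (-δ) ≤ (r : ℝ) ^ (-δ) := by
          apply Real.rpow_le_rpow_of_nonpos (by linarith) _ (by linarith)
          rw [hN]; nlinarith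
        gcongr
      have h6 : C2 * (r * (2 + |s.im|)) ^ δ * ‖s - 1‖ ≤ c2 / (2 * P) := by
        calc _ ≤ C * P * ρ := by
              rw [hP]
              gcongr
              linarith
          _ = c2 / (4 * P) := by rw [hρ]; field_simp
          _ ≤ c2 / (2 * P) := by gcongr; norm_num
      have h7 : c2 / P = c2 / (2 * P) + c2 / (2 * P) := by field_simp; norm_num
      have h8 : c2 / (2 * P) ≤ a x := by rw [← has]; linarith
      refine le_trans ?_ h8
      apply div_le_div₀ hc2p.le hc24 (by positivity)
      have e1 : (1 : ℝ) ≤ C ^ 7 := one_le_pow₀ hC1'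
      have e2 := hPp 1 11 (by norm_num)
      rw [pow_one] at e2
      nlinarith [mul_le_mul e1 e2 hP0.le (by positivity)]
    · push Not at hcase
      by_cases htt : ρ / 2 ≤ |t|
      · have h1 := abs341 a B B' hB1 hB'1 (fun u hu hu1 => three41 r χ t u B B' hu (hprin u hu hu1) (hsq' u hu hu1 (Or.inr htt)))
          (fun u _ _ => norm_nonneg _) hlipx x hx0 hx1
        refine le_trans ?_ h1
        rw [hB, hB']
        rw [show 1 / (16 * (2 * C * P) ^ 6 * (10 * C * P ^ 2 / c2)) = c2 / (10240 * C ^ 7 * P ^ 8) by field_simp; norm_num]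
        apply div_le_div₀ hc2p.le hc24 (by positivity)
        have := hPp 8 11 (by norm_num)
        gcongr
        norm_num
      · have hxx : ρ / 2 ≤ x := by push Not at htt; linarith
        have h1 := three41 r χ t x B B' hx0 (hprin x hx0 hx1) (hsq' x hx0 hx1 (Or.inl hxx))
        have h2 : (ρ / 2) ^ 3 ≤ x ^ 3 := by gcongr
        have h3 : (ρ / 2) ^ 3 / (B ^ 3 * B') = c2 ^ 4 / (40960 * C ^ 7 * P ^ 11) := by
          rw [hρ, hB, hB']; field_simp; norm_num
        rw [← h3, div_le_iff₀ (by positivity)]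
        have ha0 : 0 ≤ a x := norm_nonneg _
        have hBB' : 0 ≤ B ^ 3 * B' := by positivity
        rcases le_total 1 (a x) with h | h
        · have : (ρ / 2) ^ 3 ≤ 1 := by nlinarith [pow_le_one₀ hx0.le hx1 (n := 3)]
          have : 1 ≤ B ^ 3 * B' := one_le_mul_of_one_le_of_one_le (one_le_pow₀ hB1) hB'1
          nlinarith
        · have : a x ^ 4 ≤ a x := by
            calc a x ^ 4 ≤ a x ^ 1 := pow_le_pow_of_le_one ha0 h (by norm_num)
              _ = a x := pow_one _
          calc _ ≤ B ^ 3 * B' * a x ^ 4 := h2.trans h1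
            _ ≤ B ^ 3 * B' * a x := by gcongr
            _ = _ := mul_comm _ _
  · have hsq' : ∀ u : ℝ, 0 < u → u ≤ 1 → ‖LSeries (fun n => (χ ^ 2) (n : ZMod r)) (1 + u + 2 * Complex.I * t)‖ ≤ B := by
      intro u hu hu1
      rw [h2t]
      refine ((hup r hr).1 _ hsq _ (by rw [hre]; linarith) (by rw [hre]; linarith)).1.trans ?_
      rw [him]
      calc _ ≤ C * (2 * P) := by gcongr
        _ = B := by rw [hB]; ring
    have h1 := abs341 a B B hB1 hB1 (fun u hu hu1 => three41 r χ t u B B hu (hprin u hu hu1) (hsq' u hu hu1))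
      (fun u _ _ => norm_nonneg _) hlipx x hx0 hx1
    refine le_trans ?_ h1
    rw [hB, show 1 / (16 * (2 * C * P) ^ 6 * (2 * C * P)) = 1 / (2048 * C ^ 7 * P ^ 7) by congr 1; ring]
    apply div_le_div₀ zero_le_one (by linarith) (by positivity)
    have := hPp 7 11 (by norm_num)
    gcongr
    norm_num

lemma conv_id (r : ℕ) (χ : DirichletCharacter ℂ r) (k n : ℕ) :
    χ (n : ZMod r) * ((Real.log n ^ (k + 1) : ℝ) : ℂ) = ∑ j ∈ range (k + 1), (k.choose j : ℂ) *
      ∑ p ∈ n.divisorsAntidiagonal, (χ (p.1 : ZMod r) * ((Real.log p.1 ^ (k - j) : ℝ) : ℂ)) *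
        (((ArithmeticFunction.vonMangoldt p.2 : ℝ) : ℂ) * (χ (p.2 : ZMod r) * ((Real.log p.2 ^ j : ℝ) : ℂ))) := by
  simp_rw [mul_sum]
  rw [sum_comm]
  have h1 : ∀ p ∈ n.divisorsAntidiagonal, ∑ j ∈ range (k + 1), (k.choose j : ℂ) * ((χ (p.1 : ZMod r) * ((Real.log p.1 ^ (k - j) : ℝ) : ℂ)) *
        (((ArithmeticFunction.vonMangoldt p.2 : ℝ) : ℂ) * (χ (p.2 : ZMod r) * ((Real.log p.2 ^ j : ℝ) : ℂ)))) =
        χ (n : ZMod r) * ((Real.log n ^ k : ℝ) : ℂ) * ((ArithmeticFunction.vonMangoldt p.2 : ℝ) : ℂ) := by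
    intro p hp
    rw [Nat.mem_divisorsAntidiagonal] at hp
    have hp1 : p.1 ≠ 0 := by rintro h; rw [h, zero_mul] at hp; exact hp.2 hp.1.symm
    have hp2 : p.2 ≠ 0 := by rintro h; rw [h, mul_zero] at hp; exact hp.2 hp.1.symm
    have hl : Real.log n = Real.log p.2 + Real.log p.1 := by
      rw [← hp.1, Nat.cast_mul, Real.log_mul (by exact_mod_cast hp1) (by exact_mod_cast hp2), add_comm]
    have hc : χ (n : ZMod r) = χ (p.1 : ZMod r) * χ (p.2 : ZMod r) := by
      rw [← hp.1, Nat.cast_mul, map_mul]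
    rw [hl, hc, add_pow]
    push_cast
    rw [mul_sum, sum_mul]
    refine sum_congr rfl fun j _ => ?_
    ring
  rw [sum_congr rfl h1, ← mul_sum]
  have h2 : ∑ p ∈ n.divisorsAntidiagonal, ((ArithmeticFunction.vonMangoldt p.2 : ℝ) : ℂ) = ((Real.log n : ℝ) : ℂ) := by
    rw [← ArithmeticFunction.vonMangoldt_sum, Complex.ofReal_sum]
    exact Nat.sum_divisorsAntidiagonal' (fun _ b => ((ArithmeticFunction.vonMangoldt b : ℝ) : ℂ))
  rw [h2, pow_succ]
  push_cast
  ring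

lemma summ_vM (r : ℕ) (χ : DirichletCharacter ℂ r) (k : ℕ) (s : ℂ) (hs : 1 < s.re) :
    LSeriesSummable (fun n => ((ArithmeticFunction.vonMangoldt n : ℝ) : ℂ) * (χ (n : ZMod r) * ((Real.log n ^ k : ℝ) : ℂ))) s := by
  have h := summ_log (fun _ => 1) (fun _ => by simp) (k + 1) s hs
  refine Summable.of_norm_bounded h.norm fun n => ?_
  apply LSeries.norm_term_le
  have h1 : ‖χ (n : ZMod r)‖ ≤ 1 := χ.norm_le_one _
  have h2 : ArithmeticFunction.vonMangoldt n ≤ Real.log n := ArithmeticFunction.vonMangoldt_le_log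
  have h3 : 0 ≤ ArithmeticFunction.vonMangoldt n := ArithmeticFunction.vonMangoldt_nonneg
  have h4 : 0 ≤ Real.log n := h3.trans h2
  rw [norm_mul, norm_mul, norm_mul, Complex.norm_real, Complex.norm_real, Complex.norm_real, Real.norm_of_nonneg h3, Real.norm_of_nonneg (by positivity), Real.norm_of_nonneg (by positivity), norm_one, one_mul, pow_succ']
  calc _ ≤ Real.log n * (1 * Real.log n ^ k) := by gcongr
    _ = _ := by rw [one_mul]

lemma D_eq (r : ℕ) (χ : DirichletCharacter ℂ r) (k : ℕ) (s : ℂ) (hs : 1 < s.re) :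
    LSeries (fun n => χ (n : ZMod r) * ((Real.log n ^ (k + 1) : ℝ) : ℂ)) s = ∑ j ∈ range (k + 1), (k.choose j : ℂ) *
      (LSeries (fun n => χ (n : ZMod r) * ((Real.log n ^ (k - j) : ℝ) : ℂ)) s *
       LSeries (fun n => ((ArithmeticFunction.vonMangoldt n : ℝ) : ℂ) * (χ (n : ZMod r) * ((Real.log n ^ j : ℝ) : ℂ))) s) := by
  have h1 : ∀ j, LSeriesSummable (fun n => χ (n : ZMod r) * ((Real.log n ^ j : ℝ) : ℂ)) s := fun j => summ_log _ (fun n => χ.norm_le_one _) j s hs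
  have h2 := fun j => summ_vM r χ j s hs
  have e : (fun n : ℕ => χ (n : ZMod r) * ((Real.log n ^ (k + 1) : ℝ) : ℂ)) = ∑ j ∈ range (k + 1), (k.choose j : ℂ) •
      LSeries.convolution (fun n => χ (n : ZMod r) * ((Real.log n ^ (k - j) : ℝ) : ℂ))
        (fun n => ((ArithmeticFunction.vonMangoldt n : ℝ) : ℂ) * (χ (n : ZMod r) * ((Real.log n ^ j : ℝ) : ℂ))) := by
    funext n
    rw [conv_id, Finset.sum_apply]
    refine sum_congr rfl fun j _ => ?_
    rw [Pi.smul_apply, LSeries.convolution_def, smul_eq_mul]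
  rw [e, LSeries_sum (fun j _ => ((h1 _).convolution (h2 _)).smul _)]
  refine sum_congr rfl fun j _ => ?_
  rw [LSeries_smul, LSeries_convolution' (h1 _) (h2 _)]

lemma G_bound (hS : SiegelProp) (k : ℕ) : ∀ ε : ℝ, 0 < ε → ∃ C : ℝ, 0 < C ∧ ∀ (r : ℕ) [NeZero r], 1 < r → ∀ χ : DirichletCharacter ℂ r, χ.IsPrimitive →
    ∀ s : ℂ, 1 < s.re → s.re ≤ 2 →
    ‖LSeries (fun n => ((ArithmeticFunction.vonMangoldt n : ℝ) : ℂ) * (χ (n : ZMod r) * ((Real.log n ^ k : ℝ) : ℂ))) s‖ ≤ C * ((r : ℝ) * (2 + |s.im|)) ^ ε := by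
  induction k using Nat.strong_induction_on with
  | _ k ih =>
  intro ε hε
  set δ : ℝ := min 1 (ε / 3) with hδ
  have hδ0 : 0 < δ := by apply lt_min <;> linarith
  have hδ1 : δ ≤ 1 := min_le_left _ _
  have hδε : 3 * δ ≤ ε := by have := min_le_right 1 (ε / 3); linarith
  obtain ⟨c, hc, hLB⟩ := LB hS δ hδ0
  choose Cd hCd hD using dir_bound (δ / 2) (by linarith) (by linarith)
  rw [show 2 * (δ / 2) = δ by ring] at hD
  have ih' : ∀ j, ∃ C : ℝ, 0 < C ∧ (j < k → ∀ (r : ℕ) [NeZero r], 1 < r → ∀ χ : DirichletCharacter ℂ r, χ.IsPrimitive →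
    ∀ s : ℂ, 1 < s.re → s.re ≤ 2 →
    ‖LSeries (fun n => ((ArithmeticFunction.vonMangoldt n : ℝ) : ℂ) * (χ (n : ZMod r) * ((Real.log n ^ j : ℝ) : ℂ))) s‖ ≤ C * ((r : ℝ) * (2 + |s.im|)) ^ δ) := by
    intro j
    by_cases h : j < k
    · obtain ⟨C, hC, h1⟩ := ih j h δ hδ0
      exact ⟨C, hC, fun _ => h1⟩
    · exact ⟨1, one_pos, fun h' => absurd h' h⟩
  choose Cg hCg hG using ih'
  refine ⟨(Cd (k + 1) + ∑ j ∈ range k, (k.choose j : ℝ) * (Cd (k - j) * Cg j)) / c, ?_, ?_⟩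
  · have : 0 ≤ ∑ j ∈ range k, (k.choose j : ℝ) * (Cd (k - j) * Cg j) :=
      sum_nonneg fun j _ => mul_nonneg (by positivity) (mul_nonneg (hCd _).le (hCg _).le)
    have := hCd (k + 1)
    positivity
  intro r _ hr χ hprim s hs hs2
  have hχ : χ ≠ 1 := by
    rintro rfl
    rw [DirichletCharacter.isPrimitive_def, DirichletCharacter.conductor_one] at hprim
    omega
  have hr1 : (1 : ℝ) ≤ r := by exact_mod_cast hr.le
  set N : ℝ := r * (2 + |s.im|) with hN
  have hN1 : 1 ≤ N := by have := abs_nonneg s.im; nlinarith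
  have hN0 : 0 < N := by linarith
  have hDj : ∀ j, ‖LSeries (fun n => χ (n : ZMod r) * ((Real.log n ^ j : ℝ) : ℂ)) s‖ ≤ Cd j * N ^ δ := fun j =>
    hD j (fun n => χ (n : ZMod r)) r s hr1 (fun n => χ.norm_le_one _) (fun m => char_partial' r hr χ hχ m) hs hs2
  have hid := D_eq r χ k s hs
  rw [sum_range_succ, Nat.choose_self, Nat.sub_self, Nat.cast_one, one_mul] at hid
  set G := LSeries (fun n => ((ArithmeticFunction.vonMangoldt n : ℝ) : ℂ) * (χ (n : ZMod r) * ((Real.log n ^ k : ℝ) : ℂ))) s with hGdef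
  have hlow := hLB r hr χ hprim s hs hs2
  have e0 : LSeries (fun n => χ (n : ZMod r) * ((Real.log n ^ 0 : ℝ) : ℂ)) s = LSeries (fun n => χ (n : ZMod r)) s := by simp
  rw [e0] at hid
  set D0 := LSeries (fun n => χ (n : ZMod r)) s with hD0
  have hP1 : 1 ≤ N ^ δ := Real.one_le_rpow hN1 hδ0.le
  have hprod : ‖D0 * G‖ ≤ (Cd (k + 1) + ∑ j ∈ range k, (k.choose j : ℝ) * (Cd (k - j) * Cg j)) * (N ^ δ * N ^ δ) := by
    rw [← sub_eq_iff_eq_add'] at hid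
    rw [← hid]
    refine (norm_sub_le _ _).trans ?_
    rw [add_mul]
    refine add_le_add ?_ ?_
    · refine (hDj (k + 1)).trans ?_
      have := hCd (k + 1)
      have : N ^ δ ≤ N ^ δ * N ^ δ := by nlinarith
      gcongr
    · refine (norm_sum_le _ _).trans ?_
      rw [sum_mul]
      refine sum_le_sum fun j hj => ?_
      rw [norm_mul, norm_mul, Complex.norm_natCast]
      have h1 := hDj (k - j)
      have h2 := hG j (mem_range.1 hj) r hr χ hprim s hs hs2
      calc _ ≤ (k.choose j : ℝ) * ((Cd (k - j) * N ^ δ) * (Cg j * N ^ δ)) := by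
            have := hCd (k - j)
            gcongr
        _ = _ := by ring
  rw [norm_mul] at hprod
  have h3 : c * N ^ (-δ) * ‖G‖ ≤ (Cd (k + 1) + ∑ j ∈ range k, (k.choose j : ℝ) * (Cd (k - j) * Cg j)) * (N ^ δ * N ^ δ) :=
    (mul_le_mul_of_nonneg_right hlow (norm_nonneg _)).trans hprod
  have h4 : 0 ≤ Cd (k + 1) + ∑ j ∈ range k, (k.choose j : ℝ) * (Cd (k - j) * Cg j) :=
    add_nonneg (hCd _).le (sum_nonneg fun j _ => mul_nonneg (by positivity) (mul_nonneg (hCd _).le (hCg _).le))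
  set A := Cd (k + 1) + ∑ j ∈ range k, (k.choose j : ℝ) * (Cd (k - j) * Cg j) with hA
  have h5 : ‖G‖ ≤ A / c * (N ^ δ * N ^ δ * N ^ δ) := by
    rw [Real.rpow_neg hN0.le, mul_assoc, ← div_eq_inv_mul, ← mul_div_assoc, div_le_iff₀ (by positivity)] at h3
    rw [div_mul_eq_mul_div, le_div_iff₀ hc]
    linarith
  refine h5.trans ?_
  rw [← Real.rpow_add hN0, ← Real.rpow_add hN0]
  gcongr
  linarith

lemma TT_small (hS : SiegelProp) (k : ℕ) (ε : ℝ) (hε : 0 < ε) (hε2 : ε ≤ 1 / 2) : ∃ C : ℝ, 0 < C ∧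
    ∀ (r : ℕ) [NeZero r], 1 < r → ∀ χ : DirichletCharacter ℂ r, χ.IsPrimitive →
    ∀ y : ℕ, 3 ≤ y → ‖TT χ y k‖ ≤ C * (r : ℝ) ^ ε * y := by
  obtain ⟨C1, hC1, hM⟩ := mellin_tsum
  obtain ⟨C2, hC2, hG⟩ := G_bound hS k ε hε
  refine ⟨C1 * (C2 * 2) * Real.exp 1, by positivity, ?_⟩
  intro r _ hr χ hprim y hy
  have hr1 : (1 : ℝ) ≤ r := by exact_mod_cast hr.le
  have hy3 : (3 : ℝ) ≤ y := by exact_mod_cast hy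
  have hlog : 1 ≤ Real.log y := by
    rw [Real.le_log_iff_exp_le (by linarith)]
    exact Real.exp_one_lt_three.le.trans hy3
  set σ : ℝ := 1 + 1 / Real.log y with hσ
  have hp : 0 < 1 / Real.log y := by positivity
  have hp1 : 1 / Real.log y ≤ 1 := by rw [div_le_one (by linarith)]; exact hlog
  set c : ℕ → ℂ := fun n => ((ArithmeticFunction.vonMangoldt n : ℝ) : ℂ) * (χ (n : ZMod r) * ((Real.log n ^ k : ℝ) : ℂ)) with hc
  have hc0 : c 0 = 0 := by simp [hc]
  have hterm : ∀ s : ℂ, ∀ n, LSeries.term c s n = c n * (n : ℂ) ^ (-s) := by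
    intro s n
    rcases eq_or_ne n 0 with rfl | hn
    · simp [hc0]
    · rw [LSeries.term_of_ne_zero hn, Complex.cpow_neg, div_eq_mul_inv]
  have hmain := hM c σ (C2 * 2 * (r : ℝ) ^ ε) y (by linarith) (by omega) hc0 ?_ ?_
  · have e : TT χ y k = ∑ n ∈ Icc 1 y, c n * ((tri (n / y) : ℝ) : ℂ) := by
      unfold TT phiT
      refine sum_congr rfl fun n _ => ?_
      simp only [hc]; push_cast; ring
    rw [e]
    refine hmain.trans (le_of_eq ?_)
    have : (y : ℝ) ^ σ = y * Real.exp 1 := by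
      rw [hσ, Real.rpow_add (by linarith), Real.rpow_one, Real.rpow_def_of_pos (by linarith)]
      congr 2
      field_simp
    rw [this]; ring
  · have h1 := (summ_vM r χ k (σ : ℂ) (by simp; linarith)).norm
    refine h1.congr fun n => ?_
    rw [hterm, norm_mul]
    rcases eq_or_ne n 0 with rfl | hn
    · simp [hc0]
    · rw [Complex.norm_natCast_cpow_of_pos (by omega)]; simp
  · intro t
    have hre : ((σ : ℂ) + t * Complex.I).re = σ := by simp
    have him : ((σ : ℂ) + t * Complex.I).im = t := by simp
    have h1 := hG r hr χ hprim (σ + t * Complex.I) (by rw [hre]; linarith) (by rw [hre]; linarith)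
    rw [him] at h1
    have h2 : LSeries c (σ + t * Complex.I) = ∑' n : ℕ, c n * (n : ℂ) ^ (-(σ + t * Complex.I)) := tsum_congr fun n => hterm _ n
    rw [← h2]
    refine h1.trans ?_
    have ht := abs_nonneg t
    calc C2 * ((r : ℝ) * (2 + |t|)) ^ ε ≤ C2 * ((r : ℝ) * (2 * (1 + |t|))) ^ ε := by gcongr; linarith
      _ = C2 * ((r : ℝ) ^ ε * (2 ^ ε * (1 + |t|) ^ ε)) := by
          rw [Real.mul_rpow (by positivity) (by positivity), Real.mul_rpow (by norm_num) (by positivity)]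
      _ ≤ C2 * ((r : ℝ) ^ ε * (2 ^ (1 : ℝ) * (1 + |t|) ^ (1 / 2 : ℝ))) := by
          have : (1 : ℝ) ≤ 1 + |t| := by linarith
          gcongr
          · norm_num
          · linarith
      _ = _ := by rw [Real.rpow_one]; ring

lemma cpow_diff (s : ℂ) (hs : 0 < s.re) (n : ℕ) :
    ‖((n + 1 : ℕ) : ℂ) ^ (-s) - ((n + 2 : ℕ) : ℂ) ^ (-s)‖ ≤ ‖s‖ * ((n + 1 : ℕ) : ℝ) ^ (-s.re - 1) := by
  have hs0 : s ≠ 0 := by rintro rfl; simp at hs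
  have hn : (0 : ℝ) < ((n + 1 : ℕ) : ℝ) := by positivity
  have h1 : ∀ x ∈ Set.Icc ((n + 1 : ℕ) : ℝ) ((n + 2 : ℕ) : ℝ), HasDerivWithinAt (hh 0 s) (-s * (x : ℂ) ^ (-s - 1)) (Set.Icc ((n + 1 : ℕ) : ℝ) ((n + 2 : ℕ) : ℝ)) x := by
    intro x hx
    have hx0 : 0 < x := lt_of_lt_of_le hn hx.1
    have := hh_deriv 0 s hs0 x hx0
    simp only [Nat.cast_zero, zero_mul, Complex.ofReal_zero, pow_zero, Complex.ofReal_one, one_mul, zero_add] at this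
    exact this.hasDerivWithinAt
  have h2 := Convex.norm_image_sub_le_of_norm_hasDerivWithin_le (C := ‖s‖ * ((n + 1 : ℕ) : ℝ) ^ (-s.re - 1)) h1 (fun x hx => by
    have hx0 : 0 < x := lt_of_lt_of_le hn hx.1
    rw [norm_mul, norm_neg, Complex.norm_cpow_eq_rpow_re_of_pos hx0]
    simp only [Complex.sub_re, Complex.neg_re, Complex.one_re]
    exact mul_le_mul_of_nonneg_left (Real.rpow_le_rpow_of_nonpos hn hx.1 (by linarith)) (norm_nonneg _)) (convex_Icc _ _)
    (x := ((n + 2 : ℕ) : ℝ)) (y := ((n + 1 : ℕ) : ℝ)) ⟨by push_cast; linarith, le_rfl⟩ ⟨le_rfl, by push_cast; linarith⟩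
  simp only [hh, pow_zero, Complex.ofReal_one, one_mul, Complex.ofReal_natCast] at h2
  refine h2.trans ?_
  have : ‖((n + 1 : ℕ) : ℝ) - ((n + 2 : ℕ) : ℝ)‖ = 1 := by
    push_cast
    rw [show (n : ℝ) + 1 - (n + 2) = -1 by ring]
    simp
  rw [this, mul_one]

noncomputable def AA (r : ℕ) (χ : DirichletCharacter ℂ r) (n : ℕ) (s : ℂ) : ℂ :=
  (∑ i ∈ Icc 1 (n + 1), χ (i : ZMod r)) * (((n + 1 : ℕ) : ℂ) ^ (-s) - ((n + 2 : ℕ) : ℂ) ^ (-s))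

def UU : Set ℂ := {s : ℂ | 1 / 2 < s.re} ∩ Metric.ball 0 5

lemma UU_open : IsOpen UU := (isOpen_lt continuous_const Complex.continuous_re).inter Metric.isOpen_ball

lemma UU_conv : Convex ℝ UU := (convex_halfSpace_re_gt _).inter (convex_ball _ _)

lemma AA_le (r : ℕ) [NeZero r] (hr : 1 < r) (χ : DirichletCharacter ℂ r) (hχ : χ ≠ 1) (n : ℕ) (s : ℂ) (hs : s ∈ UU) :
    ‖AA r χ n s‖ ≤ r * 5 * (((n + 1 : ℕ) : ℝ) ^ (-(3 / 2) : ℝ)) := by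
  unfold AA
  obtain ⟨h1, h2⟩ := hs
  have h1' : 1 / 2 < s.re := h1
  rw [mem_ball_zero_iff] at h2
  rw [norm_mul, mul_assoc]
  refine mul_le_mul (char_partial' r hr χ hχ _) ((cpow_diff s (by linarith) n).trans ?_) (norm_nonneg _) (by positivity)
  refine mul_le_mul h2.le (Real.rpow_le_rpow_of_exponent_le (by push_cast; linarith [Nat.cast_nonneg (α := ℝ) n]) (by linarith)) (by positivity) (by norm_num)

lemma summ32 : Summable (fun n : ℕ => (((n + 1 : ℕ) : ℝ) ^ (-(3 / 2) : ℝ))) :=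
  (summable_nat_add_iff (f := fun n : ℕ => ((n : ℝ) ^ (-(3 / 2) : ℝ))) 1).2 (Real.summable_nat_rpow.2 (by norm_num))

lemma AA_eq (r : ℕ) [NeZero r] (hr : 1 < r) (χ : DirichletCharacter ℂ r) (hχ : χ ≠ 1) (s : ℂ) (hs : s ∈ UU) (hs1 : 1 < s.re) :
    ∑' n, AA r χ n s = DirichletCharacter.LFunction χ s := by
  rw [DirichletCharacter.LFunction_eq_LSeries χ hs1]
  have hsm : Summable (fun n => AA r χ n s) :=
    Summable.of_norm_bounded (summ32.mul_left (r * 5 : ℝ)) (fun n => AA_le r hr χ hχ n s hs)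
  have hL : LSeriesSummable (fun n => χ (n : ZMod r)) s := DirichletCharacter.LSeriesSummable_of_one_lt_re χ hs1
  have t1 := hsm.hasSum.tendsto_sum_nat
  have t2 : Filter.Tendsto (fun N : ℕ => ∑ n ∈ range (N + 1), LSeries.term (fun n => χ (n : ZMod r)) s n) Filter.atTop (nhds (LSeries (fun n => χ (n : ZMod r)) s)) :=
    (hL.hasSum.tendsto_sum_nat).comp (Filter.tendsto_add_atTop_nat 1)
  have id1 : ∀ N : ℕ, ∑ n ∈ range N, AA r χ n s = ∑ n ∈ range (N + 1), LSeries.term (fun n => χ (n : ZMod r)) s n - (∑ i ∈ Icc 1 N, χ (i : ZMod r)) * ((N + 1 : ℕ) : ℂ) ^ (-s) := by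
    intro N
    induction N with
    | zero => simp
    | succ N ih =>
      rw [sum_range_succ, ih, sum_range_succ (n := N + 1), AA, sum_Icc_succ_top (by omega), LSeries.term_of_ne_zero (by omega), Complex.cpow_neg, Complex.cpow_neg]
      simp only [div_eq_mul_inv]
      ring
  have t3 : Filter.Tendsto (fun N : ℕ => (∑ i ∈ Icc 1 N, χ (i : ZMod r)) * ((N + 1 : ℕ) : ℂ) ^ (-s)) Filter.atTop (nhds 0) := by
    have hb : ∀ N : ℕ, ‖(∑ i ∈ Icc 1 N, χ (i : ZMod r)) * ((N + 1 : ℕ) : ℂ) ^ (-s)‖ ≤ r * (((N + 1 : ℕ) : ℝ) ^ (-(s.re))) := by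
      intro N
      rw [norm_mul]
      refine mul_le_mul (char_partial' r hr χ hχ _) (le_of_eq ?_) (norm_nonneg _) (by positivity)
      rw [← Complex.ofReal_natCast, Complex.norm_cpow_eq_rpow_re_of_pos (by positivity), Complex.neg_re]
    refine squeeze_zero_norm hb ?_
    rw [show (0 : ℝ) = r * 0 by simp]
    refine Filter.Tendsto.const_mul _ ?_
    exact ((tendsto_rpow_neg_atTop (by linarith : 0 < s.re)).comp tendsto_natCast_atTop_atTop).comp (Filter.tendsto_add_atTop_nat 1)
  have t4 := t2.sub t3
  rw [sub_zero] at t4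
  refine tendsto_nhds_unique t1 ?_
  refine t4.congr fun N => ?_
  rw [id1]

lemma AA_cont (r : ℕ) [NeZero r] (hr : 1 < r) (χ : DirichletCharacter ℂ r) (hχ : χ ≠ 1) (s : ℂ) (hs : s ∈ UU) :
    ∑' n, AA r χ n s = DirichletCharacter.LFunction χ s := by
  have hd : DifferentiableOn ℂ (fun s => ∑' n, AA r χ n s) UU := by
    refine Complex.differentiableOn_tsum_of_summable_norm (summ32.mul_left (r * 5 : ℝ)) (fun n => ?_) UU_open (fun n w hw => AA_le r hr χ hχ n w hw)
    unfold AA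
    refine (Differentiable.differentiableOn ?_).const_mul _
    refine Differentiable.sub ?_ ?_
    · exact fun x => (differentiableAt_id.neg).const_cpow (Or.inl (by exact_mod_cast Nat.succ_ne_zero n))
    · exact fun x => (differentiableAt_id.neg).const_cpow (Or.inl (by exact_mod_cast Nat.succ_ne_zero (n + 1)))
  have ha := hd.analyticOnNhd UU_open
  have hb : AnalyticOnNhd ℂ (DirichletCharacter.LFunction χ) UU :=
    (DirichletCharacter.differentiable_LFunction hχ).differentiableOn.analyticOnNhd UU_open
  have h2 : (2 : ℂ) ∈ UU := ⟨by show 1 / 2 < (2 : ℂ).re; norm_num, by rw [mem_ball_zero_iff]; norm_num⟩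
  refine ha.eqOn_of_preconnected_of_eventuallyEq hb UU_conv.isPreconnected h2 ?_ hs
  have ho : IsOpen (UU ∩ {s : ℂ | 1 < s.re}) := UU_open.inter (isOpen_lt continuous_const Complex.continuous_re)
  filter_upwards [ho.mem_nhds ⟨h2, by show 1 < (2 : ℂ).re; norm_num⟩] with w hw
  exact AA_eq r hr χ hχ w hw.1 hw.2

lemma L_disc : ∃ C : ℝ, 1 ≤ C ∧ ∀ (r : ℕ) [NeZero r], 1 < r → ∀ χ : DirichletCharacter ℂ r, χ ≠ 1 → ∀ s : ℂ, ‖s - 2‖ ≤ 4 / 3 →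
    ‖DirichletCharacter.LFunction χ s‖ ≤ C * r := by
  refine ⟨1 + 5 * ∑' n : ℕ, (((n + 1 : ℕ) : ℝ) ^ (-(3 / 2) : ℝ)), ?_, ?_⟩
  · have : 0 ≤ ∑' n : ℕ, (((n + 1 : ℕ) : ℝ) ^ (-(3 / 2) : ℝ)) := tsum_nonneg fun n => by positivity
    linarith
  intro r _ hr χ hχ s hs
  have hsU : s ∈ UU := by
    refine ⟨?_, ?_⟩
    · show 1 / 2 < s.re
      have := Complex.abs_re_le_norm (s - 2)
      have h3 := (abs_le.1 (this.trans hs)).1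
      simp at h3
      linarith
    · rw [mem_ball_zero_iff]
      have := norm_le_insert' s 2
      have h2 : ‖(2 : ℂ)‖ = 2 := by norm_num
      linarith
  rw [← AA_cont r hr χ hχ s hsU]
  have := tsum_of_norm_bounded (f := fun n => AA r χ n s) (summ32.mul_left (r * 5 : ℝ)).hasSum (fun n => AA_le r hr χ hχ n s hsU)
  refine this.trans ?_
  rw [tsum_mul_left]
  have : (0 : ℝ) ≤ r := by positivity
  nlinarith

lemma real_char (r : ℕ) (χ : DirichletCharacter ℂ r) (h : χ ^ 2 = 1) (a : ZMod r) : (χ a).im = 0 := by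
  have h1 : (χ ^ 2) a = (1 : DirichletCharacter ℂ r) a := by rw [h]
  rw [MulChar.pow_apply' _ (by norm_num)] at h1
  by_cases hu : IsUnit a
  · rw [MulChar.one_apply hu] at h1
    rcases sq_eq_one_iff.1 h1 with h | h <;> simp [h]
  · rw [MulChar.map_nonunit _ hu]; simp

lemma L_real (r : ℕ) [NeZero r] (hr : 1 < r) (χ : DirichletCharacter ℂ r) (hχ : χ ≠ 1) (h2 : χ ^ 2 = 1) (σ : ℝ) (h : 1 / 2 < σ) (h5 : σ < 5) :
    (DirichletCharacter.LFunction χ σ).im = 0 := by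
  have hsU : (σ : ℂ) ∈ UU := by
    refine ⟨by show 1 / 2 < (σ : ℂ).re; simpa using h, ?_⟩
    rw [mem_ball_zero_iff, Complex.norm_real, Real.norm_of_nonneg (by linarith)]
    exact h5
  rw [← AA_cont r hr χ hχ σ hsU]
  have hsm : Summable (fun n => AA r χ n σ) :=
    Summable.of_norm_bounded (summ32.mul_left (r * 5 : ℝ)) (fun n => AA_le r hr χ hχ n σ hsU)
  rw [Complex.im_tsum hsm]
  rw [show (fun n => (AA r χ n σ).im) = fun _ => 0 from ?_]
  · simp
  funext n
  unfold AA
  have e1 : ∀ m : ℕ, ((m : ℂ) ^ (-(σ : ℂ))).im = 0 := by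
    intro m
    rw [← Complex.ofReal_natCast, ← Complex.ofReal_neg, ← Complex.ofReal_cpow (by positivity)]
    simp
  rw [Complex.mul_im, Complex.sub_im, e1, e1, Complex.im_sum]
  simp [real_char r χ h2]

end SPC

namespace SPC
open Finset
open scoped ComplexOrder

lemma est_num (h : ℕ → ℝ) (A γ β X : ℝ) (hβ : 7 / 8 ≤ β) (hβ1 : β < 1) (hA : 0 ≤ A)
    (hs : HasSum (fun m => h m * (2 - β) ^ m) X) (hX : X ≤ γ / (1 - β)) (hh : ∀ m, |h m| ≤ A * (3 / 4) ^ m)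
    (h0 : 1 ≤ h 0 + γ) (hp : ∀ m, 0 ≤ h m + γ) (M : ℕ) (hM : 1 ≤ M) :
    1 - A * (32 / 5) * (27 / 32) ^ M ≤ γ * (2 - β) ^ M / (1 - β) := by
  have hu : 1 ≤ 2 - β := by linarith
  have e1 := hs.summable.sum_add_tsum_nat_add M
  rw [hs.tsum_eq] at e1
  have e2 : -(A * (32 / 5) * (27 / 32) ^ M) ≤ ∑' i, h (i + M) * (2 - β) ^ (i + M) := by
    have hb : ∀ i : ℕ, ‖h (i + M) * (2 - β) ^ (i + M)‖ ≤ A * (27 / 32) ^ M * (27 / 32) ^ i := by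
      intro i
      rw [Real.norm_eq_abs, abs_mul, abs_of_nonneg (by positivity : 0 ≤ (2 - β) ^ (i + M))]
      have h1 : (2 - β) ^ (i + M) ≤ (9 / 8) ^ (i + M) := pow_le_pow_left₀ (by linarith) (by linarith) _
      calc |h (i + M)| * (2 - β) ^ (i + M) ≤ (A * (3 / 4) ^ (i + M)) * (9 / 8) ^ (i + M) :=
            mul_le_mul (hh _) h1 (by positivity) (by positivity)
        _ = A * (27 / 32) ^ M * (27 / 32) ^ i := by
            rw [mul_assoc, ← mul_pow, pow_add]; norm_num; ring
    have hg := (hasSum_geometric_of_lt_one (by norm_num : (0 : ℝ) ≤ 27 / 32) (by norm_num)).mul_left (A * (27 / 32) ^ M)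
    have := tsum_of_norm_bounded hg hb
    have h3 := (abs_le.1 this).1
    refine le_trans (le_of_eq ?_) h3
    norm_num
    ring
  have e3 : 1 - γ * (((2 - β) ^ M - 1) / (1 - β)) ≤ ∑ i ∈ range M, h i * (2 - β) ^ i := by
    have g := geom_sum_eq (by linarith : 2 - β ≠ 1) M
    rw [show 2 - β - 1 = 1 - β by ring] at g
    rw [← g, mul_sum]
    have : 1 ≤ ∑ i ∈ range M, (h i + γ) * (2 - β) ^ i := by
      have := single_le_sum (f := fun i => (h i + γ) * (2 - β) ^ i) (s := range M) (fun i _ => mul_nonneg (hp i) (by positivity)) (mem_range.2 (by omega : 0 < M))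
      simp only [pow_zero, mul_one] at this
      linarith
    simp only [add_mul, sum_add_distrib] at this
    linarith
  have e4 : γ * (((2 - β) ^ M - 1) / (1 - β)) = γ * (2 - β) ^ M / (1 - β) - γ / (1 - β) := by ring
  linarith

noncomputable def ZZ : ℂ → ℂ := DirichletCharacter.LFunctionTrivChar₁ 1

lemma ZZ_diff : Differentiable ℂ ZZ := DirichletCharacter.differentiable_LFunctionTrivChar₁ 1

lemma ZZ_one : ZZ 1 = 1 := by
  unfold ZZ DirichletCharacter.LFunctionTrivChar₁
  rw [Function.update_self]; simp

lemma ZZ_ne (s : ℂ) (hs : s ≠ 1) : ZZ s = (s - 1) * riemannZeta s := by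
  unfold ZZ DirichletCharacter.LFunctionTrivChar₁
  rw [Function.update_of_ne hs, DirichletCharacter.LFunctionTrivChar, DirichletCharacter.LFunction_modOne_eq]

lemma estermann : ∃ c E : ℝ, 0 < c ∧ 0 < E ∧ ∀ (a : ArithmeticFunction ℂ) (g : ℂ → ℂ) (K β : ℝ), 1 ≤ K → Differentiable ℂ g →
    (∀ s : ℂ, ‖s - 2‖ ≤ 4 / 3 → ‖g s‖ ≤ K) → (∀ n, 0 ≤ a n) → a 1 = 1 →
    (∀ s : ℂ, 1 < s.re → LSeriesSummable (fun n => a n) s ∧ LSeries (fun n => a n) s = riemannZeta s * g s) →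
    7 / 8 ≤ β → β < 1 → (riemannZeta β * g β).re ≤ 0 → c * (1 - β) * K ^ (-(E * (1 - β))) ≤ ‖g 1‖ := by
  obtain ⟨B, hB⟩ : ∃ B : ℝ, ∀ s ∈ Metric.sphere (2 : ℂ) (4 / 3), ‖ZZ s‖ ≤ B :=
    (isCompact_sphere _ _).exists_bound_of_continuousOn ZZ_diff.continuous.continuousOn
  set C1 : ℝ := 3 * (|B| + 1) with hC1
  set C2 : ℝ := C1 * (32 / 5) with hC2
  have hC1p : 3 ≤ C1 := by rw [hC1]; linarith [abs_nonneg B]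
  have hC2p : 1 ≤ 2 * C2 := by rw [hC2]; linarith
  set lam : ℝ := Real.log (32 / 27) with hlam
  have hlamp : 0 < lam := Real.log_pos (by norm_num)
  set E : ℝ := 1 / lam with hE
  have hEp : 0 < E := by positivity
  refine ⟨1 / (2 * (Real.exp 1 * (2 * C2) ^ E)), E, by positivity, hEp, ?_⟩
  intro a g K β hK hg hgK ha ha1 hL hβ hβ1 hneg
  have hKC : 0 < 2 * C2 * K := by positivity
  set P : ℂ → ℂ := fun s => ZZ s * g s with hP
  have hPd : Differentiable ℂ P := ZZ_diff.mul hg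
  have hP1 : P 1 = g 1 := by simp [hP, ZZ_one]
  set H : ℂ → ℂ := dslope P 1 with hH
  have hHd : Differentiable ℂ H := by
    rw [← differentiableOn_univ, hH, Complex.differentiableOn_dslope Filter.univ_mem]
    exact hPd.differentiableOn
  have hHne : ∀ s : ℂ, s ≠ 1 → H s = (P s - g 1) / (s - 1) := by
    intro s hs
    rw [hH, dslope_of_ne _ hs, slope_def_field, hP1]
  have hHne2 : ∀ s : ℂ, s ≠ 1 → H s = riemannZeta s * g s - g 1 * (s - 1)⁻¹ := by
    intro s hs
    have : s - 1 ≠ 0 := sub_ne_zero.2 hs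
    rw [hHne s hs, hP]
    simp only
    rw [ZZ_ne s hs]
    field_simp
  have hHs : ∀ z ∈ Metric.sphere (2 : ℂ) (4 / 3), ‖H z‖ ≤ C1 * K := by
    intro z hz
    have hz' : ‖z - 2‖ = 4 / 3 := by rw [← dist_eq_norm]; exact hz
    have h13 : 1 / 3 ≤ ‖z - 1‖ := by
      have : ‖z - 2‖ ≤ ‖z - 1‖ + ‖(1 : ℂ)‖ := by
        rw [show z - 2 = (z - 1) - 1 by ring]; exact norm_sub_le _ _
      rw [norm_one] at this
      linarith
    have hz1 : z ≠ 1 := by rintro rfl; simp at h13; linarith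
    rw [hHne z hz1, norm_div, div_le_iff₀ (by linarith)]
    have h1 : ‖P z‖ ≤ |B| * K := by
      simp only [hP, norm_mul]
      exact mul_le_mul ((hB z hz).trans (le_abs_self B)) (hgK z hz'.le) (norm_nonneg _) (abs_nonneg _)
    have h2 : ‖g 1‖ ≤ K := hgK 1 (by norm_num)
    have h3 := norm_sub_le (P z) (g 1)
    have h4 : (|B| + 1) * K = C1 * K * (1 / 3) := by rw [hC1]; ring
    have h5 : C1 * K * (1 / 3) ≤ C1 * K * ‖z - 1‖ := mul_le_mul_of_nonneg_left h13 (by positivity)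
    linarith
  set hc : ℕ → ℂ := fun m => ((m.factorial : ℂ))⁻¹ * (-1) ^ m * iteratedDeriv m H 2 with hhc
  have hcb : ∀ m, |(hc m).re| ≤ C1 * K * (3 / 4) ^ m := by
    intro m
    refine (Complex.abs_re_le_norm _).trans ?_
    have := Complex.norm_iteratedDeriv_le_of_forall_mem_sphere_norm_le m (by norm_num : (0 : ℝ) < 4 / 3) hHd.diffContOnCl hHs
    have hf : (0 : ℝ) < m.factorial := by positivity
    simp only [hhc, norm_mul, norm_inv, norm_pow, norm_neg, norm_one, one_pow, mul_one, Complex.norm_natCast]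
    rw [inv_mul_le_iff₀ hf]
    refine this.trans (le_of_eq ?_)
    rw [div_eq_mul_inv, ← inv_pow]
    norm_num
    ring
  have hsum : HasSum (fun m => (hc m).re * (2 - β) ^ m) (H β).re := by
    have := Complex.hasSum_re (Complex.hasSum_taylorSeries_of_entire hHd 2 β)
    refine this.congr_fun ?_ |> fun h => h
    intro m
    have e : (((m.factorial : ℂ))⁻¹ • ((β : ℂ) - 2) ^ m • iteratedDeriv m H 2) = (((2 - β) ^ m : ℝ) : ℂ) * hc m := by
      simp only [smul_eq_mul, hhc]
      push_cast
      rw [show ((β : ℂ) - 2) = (-1) * (2 - β) by ring, mul_pow]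
      ring
    rw [e, Complex.re_ofReal_mul, mul_comm]
  have hb2 : (H β).re ≤ (g 1).re / (1 - β) := by
    have hne : (β : ℂ) ≠ 1 := by exact_mod_cast hβ1.ne
    rw [hHne2 β hne, Complex.sub_re]
    have e : g 1 * ((β : ℂ) - 1)⁻¹ = (((β - 1)⁻¹ : ℝ) : ℂ) * g 1 := by push_cast; ring
    rw [e, Complex.re_ofReal_mul]
    have : (β - 1)⁻¹ * (g 1).re = -((g 1).re / (1 - β)) := by
      rw [show β - 1 = -(1 - β) by ring, inv_neg]; ring
    linarith
  have habs : LSeries.abscissaOfAbsConv (fun n => a n) < ((2 : ℝ) : EReal) := by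
    have h1 := LSeries.abscissaOfAbsConv_le_of_forall_lt_LSeriesSummable (f := fun n => a n) (x := 1) (fun y hy => (hL y (by simpa using hy)).1)
    refine lt_of_le_of_lt h1 ?_
    exact_mod_cast (by norm_num : (1 : ℝ) < 2)
  have hev : LSeries (fun n => a n) =ᶠ[nhds 2] fun s => H s + g 1 * (1 * s - 1)⁻¹ := by
    have ho : IsOpen {s : ℂ | 1 < s.re} := isOpen_lt continuous_const Complex.continuous_re
    filter_upwards [ho.mem_nhds (show (2 : ℂ) ∈ {s : ℂ | 1 < s.re} by show 1 < (2 : ℂ).re; norm_num)] with s hs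
    have hs' : 1 < s.re := hs
    have hne : s ≠ 1 := by rintro rfl; simp at hs'
    rw [(hL s hs').2, hHne2 s hne, one_mul]
    ring
  have hpos : ∀ m, 0 ≤ (hc m).re + (g 1).re := by
    intro m
    have h1 := ArithmeticFunction.iteratedDeriv_LSeries_alternating a ha habs m
    have h2 := hev.iteratedDeriv_eq m
    have hcd : ContDiffAt ℂ m (fun s : ℂ => g 1 * (1 * s - 1)⁻¹) 2 := by
      refine contDiffAt_const.mul (ContDiffAt.inv (by fun_prop) (by norm_num))
    rw [iteratedDeriv_fun_add hHd.contDiff.contDiffAt hcd, iteratedDeriv_const_mul_field, iteratedDeriv_eq_iterate (f := fun s : ℂ => (1 * s - 1)⁻¹), iter_deriv_inv_linear_sub] at h2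
    have h3 : ((1 : ℂ) * 2 - 1) = 1 := by norm_num
    simp only [h3, one_zpow, one_pow, mul_one] at h2
    rw [Complex.ofReal_ofNat, h2] at h1
    have hf : (m.factorial : ℂ) ≠ 0 := by exact_mod_cast m.factorial_ne_zero
    have e : (-1 : ℂ) ^ m * (iteratedDeriv m H 2 + g 1 * ((-1) ^ m * (m.factorial : ℂ))) = ((m.factorial : ℝ) : ℂ) * (hc m + g 1) := by
      simp only [hhc]
      have h11 : (-1 : ℂ) ^ m * (-1) ^ m = 1 := by rw [← mul_pow]; simp
      push_cast
      have : (m.factorial : ℂ) * ((m.factorial : ℂ)⁻¹ * (-1) ^ m * iteratedDeriv m H 2 + g 1) = (-1) ^ m * iteratedDeriv m H 2 + m.factorial * g 1 := by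
        field_simp
      rw [this]
      linear_combination (g 1 * m.factorial) * h11
    rw [e] at h1
    have h4 := (Complex.le_def.1 h1).1
    rw [Complex.re_ofReal_mul, Complex.zero_re, Complex.add_re] at h4
    have hf' : (0 : ℝ) < m.factorial := by positivity
    exact nonneg_of_mul_nonneg_right h4 hf'
  have hpos0 : 1 ≤ (hc 0).re + (g 1).re := by
    have h1 : (LSeries (fun n => a n) 2) = hc 0 + g 1 := by
      have := hev.eq_of_nhds
      rw [this]
      simp only [hhc, iteratedDeriv_zero]
      norm_num
    rw [← Complex.add_re, ← h1]
    have hs2 := (hL 2 (by norm_num)).1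
    have h3 := Complex.hasSum_re hs2.hasSum
    have h4 : (LSeries (fun n => a n) 2).re = ∑' n, (LSeries.term (fun n => a n) 2 n).re := h3.tsum_eq.symm
    rw [h4]
    have h5 := h3.summable.le_tsum 1 (fun j _ => by
      have := LSeries.term_nonneg (ha j) 2
      have := (Complex.le_def.1 this).1
      simpa using this)
    refine le_trans (le_of_eq ?_) h5
    rw [LSeries.term_of_ne_zero one_ne_zero, ha1]
    simp
  set M : ℕ := ⌈Real.log (2 * C2 * K) / lam⌉₊ + 1 with hMdef
  have hmain := est_num (fun m => (hc m).re) (C1 * K) (g 1).re β (H β).re hβ hβ1 (by positivity) hsum hb2 hcb hpos0 hpos M (by omega)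
  have h1K : 1 ≤ 2 * C2 * K := by nlinarith
  have hlogn : 0 ≤ Real.log (2 * C2 * K) := Real.log_nonneg h1K
  have hM1 : Real.log (2 * C2 * K) ≤ M * lam := by
    rw [← div_le_iff₀ hlamp]
    refine (Nat.le_ceil _).trans ?_
    rw [hMdef]; push_cast; linarith
  have hM2 : (M : ℝ) ≤ Real.log (2 * C2 * K) * E + 2 := by
    rw [hMdef]; push_cast
    have := Nat.ceil_lt_add_one (div_nonneg hlogn hlamp.le)
    rw [hE, mul_one_div]
    linarith
  have hhalf : (1 : ℝ) / 2 ≤ 1 - C1 * K * (32 / 5) * (27 / 32) ^ M := by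
    have h1 : 2 * C2 * K ≤ (32 / 27) ^ M := by
      rw [← Real.log_le_log_iff hKC (by positivity), Real.log_pow]
      exact hM1
    have h2 : (27 / 32 : ℝ) ^ M * (32 / 27) ^ M = 1 := by rw [← mul_pow]; norm_num
    have h3 : (2 * C2 * K) * (27 / 32) ^ M ≤ 1 := by
      rw [← h2, mul_comm]
      exact mul_le_mul_of_nonneg_left h1 (by positivity)
    have : C1 * K * (32 / 5) = C2 * K := by rw [hC2]; ring
    rw [this]
    linarith
  have hup : (2 - β) ^ M ≤ Real.exp 1 * (2 * C2) ^ E * K ^ (E * (1 - β)) := by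
    have h1 : (2 - β) ≤ Real.exp (1 - β) := by
      have := Real.add_one_le_exp (1 - β); linarith
    have h2 : (2 - β) ^ M ≤ Real.exp ((1 - β) * M) := by
      rw [mul_comm, Real.exp_nat_mul]
      exact pow_le_pow_left₀ (by linarith) h1 _
    have h3 : (1 - β) * M ≤ 1 + Real.log (2 * C2) * E + Real.log K * (E * (1 - β)) := by
      have e1 : Real.log (2 * C2 * K) = Real.log (2 * C2) + Real.log K := Real.log_mul (by positivity) (by positivity)
      have e2 : 0 ≤ Real.log (2 * C2) * E := mul_nonneg (Real.log_nonneg hC2p) hEp.le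
      have e3 : (1 - β) * M ≤ (1 - β) * (Real.log (2 * C2 * K) * E + 2) := mul_le_mul_of_nonneg_left hM2 (by linarith)
      rw [e1] at e3
      have e4 : (1 - β) * (Real.log (2 * C2) * E) ≤ 1 * (Real.log (2 * C2) * E) := mul_le_mul_of_nonneg_right (by linarith) e2
      nlinarith
    refine h2.trans ((Real.exp_le_exp.2 h3).trans (le_of_eq ?_))
    rw [Real.exp_add, Real.exp_add, Real.rpow_def_of_pos (by positivity), Real.rpow_def_of_pos (by positivity)]
  have hγ : (g 1).re ≤ ‖g 1‖ := Complex.re_le_norm _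
  have hkey : (1 - β) / 2 ≤ ‖g 1‖ * (Real.exp 1 * (2 * C2) ^ E * K ^ (E * (1 - β))) := by
    have h1 : (1 : ℝ) / 2 ≤ (g 1).re * (2 - β) ^ M / (1 - β) := hhalf.trans hmain
    rw [le_div_iff₀ (by linarith)] at h1
    have h2 : (g 1).re * (2 - β) ^ M ≤ ‖g 1‖ * (2 - β) ^ M := mul_le_mul_of_nonneg_right hγ (pow_nonneg (by linarith) _)
    have h3 : ‖g 1‖ * (2 - β) ^ M ≤ ‖g 1‖ * (Real.exp 1 * (2 * C2) ^ E * K ^ (E * (1 - β))) := mul_le_mul_of_nonneg_left hup (norm_nonneg _)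
    linarith
  have hKp : 0 < K ^ (E * (1 - β)) := Real.rpow_pos_of_pos (by linarith) _
  rw [Real.rpow_neg (by linarith)]
  have hQ : 0 < Real.exp 1 * (2 * C2) ^ E := by positivity
  have e : 1 / (2 * (Real.exp 1 * (2 * C2) ^ E)) * (1 - β) * (K ^ (E * (1 - β)))⁻¹ = (1 - β) / 2 / (Real.exp 1 * (2 * C2) ^ E * K ^ (E * (1 - β))) := by
    field_simp
  rw [e, div_le_iff₀ (by positivity)]
  exact hkey

noncomputable def ct (r : ℕ) (χ : DirichletCharacter ℂ r) : ArithmeticFunction ℂ := ⟨fun n => if n = 0 then 0 else χ (n : ZMod r), if_pos rfl⟩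

lemma ct_apply (r : ℕ) (χ : DirichletCharacter ℂ r) {n : ℕ} (hn : n ≠ 0) : ct r χ n = χ (n : ZMod r) := if_neg hn

noncomputable def Dl (u : ArithmeticFunction ℂ) : ArithmeticFunction ℂ := ⟨fun n => u n * ((Real.log n : ℝ) : ℂ), by simp⟩

lemma Dl_apply (u : ArithmeticFunction ℂ) (n : ℕ) : Dl u n = u n * ((Real.log n : ℝ) : ℂ) := rfl

lemma Dl_mul (u v : ArithmeticFunction ℂ) : Dl (u * v) = Dl u * v + u * Dl v := by
  ext n
  rw [Dl_apply, ArithmeticFunction.add_apply, ArithmeticFunction.mul_apply, ArithmeticFunction.mul_apply, ArithmeticFunction.mul_apply, sum_mul, ← sum_add_distrib]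
  refine sum_congr rfl fun p hp => ?_
  rw [Nat.mem_divisorsAntidiagonal] at hp
  have hp1 : p.1 ≠ 0 := by rintro h; rw [h, zero_mul] at hp; exact hp.2 hp.1.symm
  have hp2 : p.2 ≠ 0 := by rintro h; rw [h, mul_zero] at hp; exact hp.2 hp.1.symm
  rw [Dl_apply, Dl_apply, ← hp.1, Nat.cast_mul, Real.log_mul (by exact_mod_cast hp1) (by exact_mod_cast hp2)]
  push_cast
  ring

noncomputable def wt (r : ℕ) (χ : DirichletCharacter ℂ r) : ArithmeticFunction ℂ :=
  ⟨fun n => ((ArithmeticFunction.vonMangoldt n : ℝ) : ℂ) * χ (n : ZMod r), by simp⟩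

lemma wt_apply (r : ℕ) (χ : DirichletCharacter ℂ r) (n : ℕ) : wt r χ n = ((ArithmeticFunction.vonMangoldt n : ℝ) : ℂ) * χ (n : ZMod r) := rfl

lemma Dl_ct (r : ℕ) (χ : DirichletCharacter ℂ r) : Dl (ct r χ) = ct r χ * wt r χ := by
  ext n
  rcases eq_or_ne n 0 with rfl | hn
  · simp
  rw [Dl_apply, ct_apply _ _ hn, ArithmeticFunction.mul_apply]
  have := conv_id r χ 0 n
  simp only [zero_add, pow_one, range_one, sum_singleton, Nat.choose_zero_right, Nat.cast_one, one_mul, pow_zero, Complex.ofReal_one, mul_one] at this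
  rw [this]
  refine sum_congr rfl fun p hp => ?_
  rw [Nat.mem_divisorsAntidiagonal] at hp
  have hp1 : p.1 ≠ 0 := by rintro h; rw [h, zero_mul] at hp; exact hp.2 hp.1.symm
  rw [ct_apply _ _ hp1, wt_apply]
  simp

lemma nonneg_of_log (a w : ArithmeticFunction ℂ) (h1 : a 1 = 1) (hd : Dl a = a * w) (hw : ∀ n, 0 ≤ w n) (hw1 : w 1 = 0) (n : ℕ) : 0 ≤ a n := by
  induction n using Nat.strong_induction_on with
  | _ n ih =>
    rcases eq_or_ne n 0 with rfl | hn0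
    · simp
    rcases eq_or_ne n 1 with rfl | hn1
    · rw [h1]; exact zero_le_one
    have h := congrArg (fun u : ArithmeticFunction ℂ => u n) hd
    simp only [Dl_apply, ArithmeticFunction.mul_apply] at h
    have hs : 0 ≤ ∑ p ∈ n.divisorsAntidiagonal, a p.1 * w p.2 := by
      refine sum_nonneg fun p hp => ?_
      rw [Nat.mem_divisorsAntidiagonal] at hp
      by_cases hp2 : p.2 = 1
      · rw [hp2, hw1, mul_zero]
      refine mul_nonneg (ih p.1 ?_) (hw _)
      have hp20 : p.2 ≠ 0 := by rintro h; rw [h, mul_zero] at hp; exact hp.2 hp.1.symm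
      have hp10 : p.1 ≠ 0 := by rintro h; rw [h, zero_mul] at hp; exact hp.2 hp.1.symm
      rw [← hp.1]
      have : 2 ≤ p.2 := by omega
      have : 1 ≤ p.1 := by omega
      nlinarith
    rw [← h] at hs
    have hl : 0 < Real.log n := Real.log_pos (by exact_mod_cast (by omega : 1 < n))
    have e : a n = (a n * ((Real.log n : ℝ) : ℂ)) * (((Real.log n)⁻¹ : ℝ) : ℂ) := by
      have : ((Real.log n : ℝ) : ℂ) ≠ 0 := by exact_mod_cast hl.ne'
      rw [Complex.ofReal_inv, mul_assoc, mul_inv_cancel₀ this, mul_one]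
    rw [e]
    refine mul_nonneg hs ?_
    rw [Complex.zero_le_real]
    positivity

lemma ct_L (r : ℕ) [NeZero r] (χ : DirichletCharacter ℂ r) (s : ℂ) (hs : 1 < s.re) :
    LSeriesSummable (fun n => ct r χ n) s ∧ LSeries (fun n => ct r χ n) s = DirichletCharacter.LFunction χ s := by
  have e : ∀ {n : ℕ}, n ≠ 0 → ct r χ n = χ (n : ZMod r) := fun hn => ct_apply r χ hn
  refine ⟨(LSeriesSummable_congr s e).2 (DirichletCharacter.LSeriesSummable_of_one_lt_re χ hs), ?_⟩
  rw [LSeries_congr e, DirichletCharacter.LFunction_eq_LSeries χ hs]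

lemma ct1_L (s : ℂ) (hs : 1 < s.re) :
    LSeriesSummable (fun n => ct 1 1 n) s ∧ LSeries (fun n => ct 1 1 n) s = riemannZeta s := by
  have := ct_L 1 1 s hs
  rwa [DirichletCharacter.LFunction_modOne_eq] at this

noncomputable def psi (r r1 : ℕ) (χ : DirichletCharacter ℂ r) (χ1 : DirichletCharacter ℂ r1) : DirichletCharacter ℂ (r * r1) :=
  DirichletCharacter.changeLevel (dvd_mul_right r r1) χ * DirichletCharacter.changeLevel (dvd_mul_left r1 r) χ1

lemma psi_apply (r r1 : ℕ) (χ : DirichletCharacter ℂ r) (χ1 : DirichletCharacter ℂ r1) (n : ℕ) :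
    psi r r1 χ χ1 (n : ZMod (r * r1)) = χ (n : ZMod r) * χ1 (n : ZMod r1) := by
  unfold psi
  rw [MulChar.mul_apply]
  by_cases hu : IsUnit (n : ZMod (r * r1))
  · obtain ⟨u, hu⟩ := hu
    rw [← hu, DirichletCharacter.changeLevel_eq_cast_of_dvd, DirichletCharacter.changeLevel_eq_cast_of_dvd, hu,
      ZMod.cast_natCast (dvd_mul_right r r1), ZMod.cast_natCast (dvd_mul_left r1 r)]
  · rw [MulChar.map_nonunit _ hu, zero_mul]
    rw [ZMod.isUnit_iff_coprime, Nat.coprime_mul_iff_right, not_and_or] at hu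
    rcases hu with hu | hu
    · rw [MulChar.map_nonunit χ (by rwa [ZMod.isUnit_iff_coprime]), zero_mul]
    · rw [MulChar.map_nonunit χ1 (by rwa [ZMod.isUnit_iff_coprime]), mul_zero]

lemma one_add_char_nonneg (r : ℕ) (χ : DirichletCharacter ℂ r) (h : χ ^ 2 = 1) (a : ZMod r) : 0 ≤ 1 + χ a := by
  have h1 : (χ ^ 2) a = (1 : DirichletCharacter ℂ r) a := by rw [h]
  rw [MulChar.pow_apply' _ (by norm_num)] at h1
  by_cases hu : IsUnit a
  · rw [MulChar.one_apply hu] at h1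
    rcases sq_eq_one_iff.1 h1 with h | h <;> rw [h] <;> norm_num
  · rw [MulChar.map_nonunit _ hu]; simp

noncomputable def a4 (r r1 : ℕ) (χ : DirichletCharacter ℂ r) (χ1 : DirichletCharacter ℂ r1) : ArithmeticFunction ℂ :=
  ct 1 1 * (ct r1 χ1 * (ct r χ * ct (r * r1) (psi r r1 χ χ1)))

lemma ct_one (r : ℕ) (χ : DirichletCharacter ℂ r) : ct r χ 1 = 1 := by
  rw [ct_apply _ _ one_ne_zero]; simp

lemma a4_one (r r1 : ℕ) (χ : DirichletCharacter ℂ r) (χ1 : DirichletCharacter ℂ r1) : a4 r r1 χ χ1 1 = 1 := by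
  unfold a4
  simp [ArithmeticFunction.mul_apply, ct_one]

lemma a4_nonneg (r r1 : ℕ) (χ : DirichletCharacter ℂ r) (χ1 : DirichletCharacter ℂ r1) (h : χ ^ 2 = 1) (h1 : χ1 ^ 2 = 1) (n : ℕ) :
    0 ≤ a4 r r1 χ χ1 n := by
  refine nonneg_of_log _ (wt 1 1 + wt r1 χ1 + wt r χ + wt (r * r1) (psi r r1 χ χ1)) (a4_one _ _ _ _) ?_ ?_ ?_ n
  · unfold a4
    simp only [Dl_mul, Dl_ct]
    ring
  · intro n
    simp only [ArithmeticFunction.add_apply, wt_apply, psi_apply]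
    have e : ((ArithmeticFunction.vonMangoldt n : ℝ) : ℂ) * (1 : DirichletCharacter ℂ 1) (n : ZMod 1) + ((ArithmeticFunction.vonMangoldt n : ℝ) : ℂ) * χ1 (n : ZMod r1) +
      ((ArithmeticFunction.vonMangoldt n : ℝ) : ℂ) * χ (n : ZMod r) + ((ArithmeticFunction.vonMangoldt n : ℝ) : ℂ) * (χ (n : ZMod r) * χ1 (n : ZMod r1)) =
      ((ArithmeticFunction.vonMangoldt n : ℝ) : ℂ) * ((1 + χ (n : ZMod r)) * (1 + χ1 (n : ZMod r1))) := by
      rw [MulChar.one_apply (isUnit_of_subsingleton _)]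
      ring
    rw [e]
    refine mul_nonneg ?_ (mul_nonneg (one_add_char_nonneg r χ h _) (one_add_char_nonneg r1 χ1 h1 _))
    rw [Complex.zero_le_real]
    exact ArithmeticFunction.vonMangoldt_nonneg
  · simp [wt_apply]

lemma a4_L (r r1 : ℕ) [NeZero r] [NeZero r1] (χ : DirichletCharacter ℂ r) (χ1 : DirichletCharacter ℂ r1) (s : ℂ) (hs : 1 < s.re) :
    LSeriesSummable (fun n => a4 r r1 χ χ1 n) s ∧ LSeries (fun n => a4 r r1 χ χ1 n) s = riemannZeta s *
      (DirichletCharacter.LFunction χ1 s * (DirichletCharacter.LFunction χ s * DirichletCharacter.LFunction (psi r r1 χ χ1) s)) := by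
  unfold a4
  have h0 := ct1_L s hs
  have h1 := ct_L r1 χ1 s hs
  have h2 := ct_L r χ s hs
  have h3 := ct_L (r * r1) (psi r r1 χ χ1) s hs
  have s1 := ArithmeticFunction.LSeriesSummable_mul h2.1 h3.1
  have s2 := ArithmeticFunction.LSeriesSummable_mul h1.1 s1
  refine ⟨ArithmeticFunction.LSeriesSummable_mul h0.1 s2, ?_⟩
  rw [ArithmeticFunction.LSeries_mul' h0.1 s2, ArithmeticFunction.LSeries_mul' h1.1 s1, ArithmeticFunction.LSeries_mul' h2.1 h3.1, h0.2, h1.2, h2.2, h3.2]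

lemma zm_L (r : ℕ) [NeZero r] (χ : DirichletCharacter ℂ r) (s : ℂ) (hs : 1 < s.re) :
    LSeriesSummable (fun n => (ct 1 1 * ct r χ) n) s ∧ LSeries (fun n => (ct 1 1 * ct r χ) n) s = riemannZeta s * DirichletCharacter.LFunction χ s := by
  have h0 := ct1_L s hs
  have h2 := ct_L r χ s hs
  refine ⟨ArithmeticFunction.LSeriesSummable_mul h0.1 h2.1, ?_⟩
  rw [ArithmeticFunction.LSeries_mul' h0.1 h2.1, h0.2, h2.2]

lemma zm_nonneg (r : ℕ) (χ : DirichletCharacter ℂ r) (h : χ ^ 2 = 1) (n : ℕ) : 0 ≤ (ct 1 1 * ct r χ) n := by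
  refine nonneg_of_log _ (wt 1 1 + wt r χ) (by simp [ArithmeticFunction.mul_apply, ct_one]) ?_ ?_ ?_ n
  · simp only [Dl_mul, Dl_ct]
    ring
  · intro n
    simp only [ArithmeticFunction.add_apply, wt_apply]
    rw [MulChar.one_apply (isUnit_of_subsingleton _), ← mul_add]
    refine mul_nonneg ?_ (one_add_char_nonneg r χ h _)
    rw [Complex.zero_le_real]
    exact ArithmeticFunction.vonMangoldt_nonneg
  · simp [wt_apply]

lemma fin_lower (N : ℕ) : ∃ c : ℝ, 0 < c ∧ ∀ (r : ℕ) [NeZero r], r ≤ N → ∀ χ : DirichletCharacter ℂ r, χ ≠ 1 → c ≤ ‖DirichletCharacter.LFunction χ 1‖ := by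
  classical
  induction N with
  | zero => exact ⟨1, one_pos, fun r _ hr => absurd (Nat.le_zero.1 hr) (NeZero.ne r)⟩
  | succ N ih =>
    obtain ⟨c, hc, h⟩ := ih
    obtain ⟨χ0, h0⟩ := Finite.exists_min (fun χ : DirichletCharacter ℂ (N + 1) => if χ = 1 then (1 : ℝ) else ‖DirichletCharacter.LFunction χ 1‖)
    have hp : 0 < (if χ0 = 1 then (1 : ℝ) else ‖DirichletCharacter.LFunction χ0 1‖) := by
      split_ifs with h1
      · exact one_pos
      · exact norm_pos_iff.2 (DirichletCharacter.LFunction_apply_one_ne_zero h1)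
    refine ⟨min c (if χ0 = 1 then (1 : ℝ) else ‖DirichletCharacter.LFunction χ0 1‖), lt_min hc hp, ?_⟩
    intro r _ hr χ hχ
    rcases Nat.lt_or_ge r (N + 1) with hlt | hge
    · exact (min_le_left _ _).trans (h r (by omega) χ hχ)
    · have : r = N + 1 := by omega
      subst this
      refine (min_le_right _ _).trans ((h0 χ).trans (le_of_eq ?_))
      simp [hχ]

lemma L_one_upper (δ : ℝ) (hδ : 0 < δ) (hδ1 : δ ≤ 1) : ∃ C : ℝ, 1 ≤ C ∧ ∀ (r : ℕ) [NeZero r], 1 < r → ∀ χ : DirichletCharacter ℂ r, χ ≠ 1 →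
    ‖DirichletCharacter.LFunction χ 1‖ ≤ C * (r : ℝ) ^ δ := by
  obtain ⟨C, hC, h⟩ := L_upper δ hδ hδ1
  obtain ⟨C', hC', h'⟩ := L_lip δ hδ hδ1
  refine ⟨2 * (C + C'), by linarith, ?_⟩
  intro r _ hr χ hχ
  have h1 := ((h r hr).1 χ hχ 2 (by norm_num) (by norm_num)).1
  have h2 := L_lip_one C' δ r χ hχ (h' r hr χ hχ) 2 (by norm_num) (by norm_num)
  have e : ((r : ℝ) * (2 + |(2 : ℂ).im|)) ^ δ ≤ 2 * (r : ℝ) ^ δ := by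
    simp only [Complex.im_ofNat, abs_zero, add_zero]
    rw [Real.mul_rpow (by positivity) (by norm_num), mul_comm]
    refine mul_le_mul_of_nonneg_right ?_ (by positivity)
    calc (2 : ℝ) ^ δ ≤ 2 ^ (1 : ℝ) := Real.rpow_le_rpow_of_exponent_le (by norm_num) hδ1
      _ = 2 := by norm_num
  have e2 : ‖(2 : ℂ) - 1‖ = 1 := by norm_num
  rw [e2, mul_one] at h2
  have h3 := norm_sub_le (LSeries (fun n => χ (n : ZMod r)) 2) (LSeries (fun n => χ (n : ZMod r)) 2 - DirichletCharacter.LFunction χ 1)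
  rw [sub_sub_cancel] at h3
  have h4 : C * ((r : ℝ) * (2 + |(2 : ℂ).im|)) ^ δ ≤ C * (2 * (r : ℝ) ^ δ) := mul_le_mul_of_nonneg_left e (by linarith)
  have h5 : C' * ((r : ℝ) * (2 + |(2 : ℂ).im|)) ^ δ ≤ C' * (2 * (r : ℝ) ^ δ) := mul_le_mul_of_nonneg_left e (by linarith)
  linarith

lemma zeta_neg : ∃ η : ℝ, 0 < η ∧ ∀ β : ℝ, 1 - η < β → β < 1 → (riemannZeta β).re ≤ 0 := by
  have hc : ContinuousAt (fun t : ℝ => (ZZ t).re) 1 :=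
    (Complex.continuous_re.comp (ZZ_diff.continuous.comp Complex.continuous_ofReal)).continuousAt
  have h1 : (0 : ℝ) < (fun t : ℝ => (ZZ t).re) 1 := by simp [ZZ_one]
  have := hc.eventually (lt_mem_nhds h1)
  rw [Metric.eventually_nhds_iff] at this
  obtain ⟨η, hη, h⟩ := this
  refine ⟨η, hη, fun β h1 h2 => ?_⟩
  have h3 := h (y := β) (by rw [Real.dist_eq, abs_lt]; constructor <;> linarith)
  have hne : (β : ℂ) ≠ 1 := by exact_mod_cast h2.ne
  rw [ZZ_ne β hne, show (β : ℂ) - 1 = ((β - 1 : ℝ) : ℂ) by push_cast; ring, Complex.re_ofReal_mul] at h3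
  nlinarith

lemma L_two_pos (r : ℕ) [NeZero r] (χ : DirichletCharacter ℂ r) (h : χ ^ 2 = 1) : 0 < (DirichletCharacter.LFunction χ 2).re := by
  have habs : LSeries.abscissaOfAbsConv (fun n => (ct 1 1 * ct r χ) n) < ((2 : ℝ) : EReal) := by
    have h1 := LSeries.abscissaOfAbsConv_le_of_forall_lt_LSeriesSummable (f := fun n => (ct 1 1 * ct r χ) n) (x := 1) (fun y hy => (zm_L r χ y (by simpa using hy)).1)
    refine lt_of_le_of_lt h1 ?_
    exact_mod_cast (by norm_num : (1 : ℝ) < 2)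
  have hp := ArithmeticFunction.LSeries_positive (a := fun n => (ct 1 1 * ct r χ) n) (fun n => zm_nonneg r χ h n) (by simp [ArithmeticFunction.mul_apply, ct_one]) habs
  have e := (zm_L r χ ((2 : ℝ) : ℂ) (by norm_num)).2
  rw [e] at hp
  have h2 := (Complex.lt_def.1 hp).1
  rw [Complex.ofReal_ofNat, riemannZeta_two, show ((Real.pi : ℂ) ^ 2 / 6) = ((Real.pi ^ 2 / 6 : ℝ) : ℂ) by push_cast; ring, Complex.re_ofReal_mul, Complex.zero_re] at h2
  exact (mul_pos_iff_of_pos_left (by positivity)).1 h2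

theorem siegel : SiegelProp := by
  intro ε hε
  obtain ⟨c, E, hc, hE, hest⟩ := estermann
  obtain ⟨C, hC, hdisc⟩ := L_disc
  obtain ⟨η, hη, hζ⟩ := zeta_neg
  obtain ⟨CU, hCU, hU⟩ := L_one_upper (min (ε / 2) 1) (by positivity) (min_le_right _ _)
  set e' : ℝ := min (min (1 / 8) (η / 2)) (ε / (4 * E)) with he'
  have he'p : 0 < e' := by positivity
  have he'1 : e' ≤ 1 / 8 := (min_le_left _ _).trans (min_le_left _ _)
  have he'2 : e' ≤ η / 2 := (min_le_left _ _).trans (min_le_right _ _)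
  have he'3 : E * e' ≤ ε / 4 := by
    have : e' ≤ ε / (4 * E) := min_le_right _ _
    rw [le_div_iff₀ (by positivity)] at this
    linarith
  set β0 : ℝ := 1 - e' with hβ0
  by_cases hcase : ∀ (r : ℕ) [NeZero r], 1 < r → ∀ χ : DirichletCharacter ℂ r, χ ≠ 1 → χ ^ 2 = 1 → 0 ≤ (DirichletCharacter.LFunction χ β0).re
  · refine ⟨c * e' * C ^ (-(E * e')), by positivity, ?_⟩
    intro r _ hr χ hprim hχ2
    have hχ1 : χ ≠ 1 := by
      rintro rfl
      rw [DirichletCharacter.isPrimitive_def, DirichletCharacter.conductor_one] at hprim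
      omega
    have hr1 : (1 : ℝ) ≤ r := by exact_mod_cast hr.le
    have hK : 1 ≤ C * r := by nlinarith
    have := hest (ct 1 1 * ct r χ) (DirichletCharacter.LFunction χ) (C * r) β0 hK (DirichletCharacter.differentiable_LFunction hχ1)
      (fun s hs => hdisc r hr χ hχ1 s hs) (fun n => zm_nonneg r χ hχ2 n) (by simp [ArithmeticFunction.mul_apply, ct_one]) (fun s hs => zm_L r χ s hs)
      (by rw [hβ0]; linarith) (by rw [hβ0]; linarith) (by
        rw [Complex.mul_re, L_real r hr χ hχ1 hχ2 β0 (by rw [hβ0]; linarith) (by rw [hβ0]; linarith), mul_zero, sub_zero]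
        exact mul_nonpos_of_nonpos_of_nonneg (hζ β0 (by rw [hβ0]; linarith) (by rw [hβ0]; linarith)) (hcase r hr χ hχ1 hχ2))
    have e1 : 1 - β0 = e' := by rw [hβ0]; ring
    rw [e1] at this
    refine le_trans ?_ this
    rw [Real.mul_rpow (by linarith) (by linarith), ← mul_assoc]
    refine mul_le_mul_of_nonneg_left ?_ (by positivity)
    exact Real.rpow_le_rpow_of_exponent_le hr1 (by linarith)
  · push Not at hcase
    obtain ⟨r1, inst1, hr1, χ1, hχ1, hχ12, hneg⟩ := hcase
    obtain ⟨β, hβm, hβz⟩ : ∃ β ∈ Set.Icc β0 2, (DirichletCharacter.LFunction χ1 β).re = 0 := by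
      have hcont : ContinuousOn (fun t : ℝ => (DirichletCharacter.LFunction χ1 t).re) (Set.Icc β0 2) :=
        (Complex.continuous_re.comp ((DirichletCharacter.differentiable_LFunction hχ1).continuous.comp Complex.continuous_ofReal)).continuousOn
      have h2 := L_two_pos r1 χ1 hχ12
      have := intermediate_value_Icc (by rw [hβ0]; linarith : β0 ≤ 2) hcont
      obtain ⟨t, ht, h⟩ := this (show (0 : ℝ) ∈ Set.Icc _ _ from ⟨hneg.le, by simpa using h2.le⟩)
      exact ⟨t, ht, h⟩
    have hβ2 : β ≤ 2 := hβm.2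
    have hβ0' : 1 - e' ≤ β := hβm.1
    have hLz : DirichletCharacter.LFunction χ1 β = 0 :=
      Complex.ext hβz (L_real r1 hr1 χ1 hχ1 hχ12 β (by linarith) (by linarith))
    have hβ1 : β < 1 := by
      by_contra hge
      push Not at hge
      exact DirichletCharacter.LFunction_ne_zero_of_one_le_re χ1 (Or.inl hχ1) (by simpa using hge) hLz
    obtain ⟨c0, hc0, hfin⟩ := fin_lower r1
    have hr1' : (1 : ℝ) ≤ r1 := by exact_mod_cast hr1.le
    set D : ℝ := ‖DirichletCharacter.LFunction χ1 1‖ with hD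
    have hDp : 0 < D := norm_pos_iff.2 (DirichletCharacter.LFunction_apply_one_ne_zero hχ1)
    set m : ℝ := min (ε / 2) 1 with hm
    have hmp : 0 < m := by positivity
    set Q : ℝ := C ^ 3 * (r1 : ℝ) ^ 2 with hQ
    have hQ1 : 1 ≤ Q := by
      have h1 : 1 ≤ C ^ 3 := one_le_pow₀ hC
      have h2 : (1 : ℝ) ≤ (r1 : ℝ) ^ 2 := one_le_pow₀ hr1'
      rw [hQ]; nlinarith
    refine ⟨min c0 (c * (1 - β) * Q ^ (-(E * e')) / (D * (CU * (r1 : ℝ) ^ m))), lt_min hc0 (by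
      have : 0 < 1 - β := by linarith
      positivity), ?_⟩
    intro r _ hr χ hprim hχ2
    have hχ1' : χ ≠ 1 := by
      rintro rfl
      rw [DirichletCharacter.isPrimitive_def, DirichletCharacter.conductor_one] at hprim
      omega
    have hrr : (1 : ℝ) ≤ r := by exact_mod_cast hr.le
    by_cases hψ : psi r r1 χ χ1 = 1
    · have hle : r ≤ r1 := by
        have h1 : DirichletCharacter.changeLevel (dvd_mul_right r r1) χ = DirichletCharacter.changeLevel (dvd_mul_left r1 r) χ1⁻¹ := by
          rw [map_inv]
          exact eq_inv_of_mul_eq_one_left hψ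
        have h2 := congrArg DirichletCharacter.conductor h1
        rw [DirichletCharacter.conductor_changeLevel, DirichletCharacter.conductor_changeLevel] at h2
        rw [DirichletCharacter.isPrimitive_def] at hprim
        rw [hprim] at h2
        rw [h2]
        exact Nat.le_of_dvd (by omega) (DirichletCharacter.conductor_dvd_level _)
      have h3 := hfin r hle χ hχ1'
      have h4 : (r : ℝ) ^ (-ε) ≤ 1 := Real.rpow_le_one_of_one_le_of_nonpos hrr (by linarith)
      have h5 : 0 < (r : ℝ) ^ (-ε) := Real.rpow_pos_of_pos (by linarith) _
      have h6 := mul_le_mul_of_nonneg_right (min_le_left c0 (c * (1 - β) * Q ^ (-(E * e')) / (D * (CU * (r1 : ℝ) ^ m)))) h5.le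
      nlinarith
    · have hrr1 : 1 < r * r1 := by nlinarith
      have hK : 1 ≤ Q * (r : ℝ) ^ 2 := by
        have : (1 : ℝ) ≤ (r : ℝ) ^ 2 := one_le_pow₀ hrr
        nlinarith
      have := hest (a4 r r1 χ χ1) (fun s => DirichletCharacter.LFunction χ1 s * (DirichletCharacter.LFunction χ s * DirichletCharacter.LFunction (psi r r1 χ χ1) s))
        (Q * (r : ℝ) ^ 2) β hK ((DirichletCharacter.differentiable_LFunction hχ1).mul ((DirichletCharacter.differentiable_LFunction hχ1').mul (DirichletCharacter.differentiable_LFunction hψ)))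
        (fun s hs => by
          have b1 := hdisc r1 hr1 χ1 hχ1 s hs
          have b2 := hdisc r hr χ hχ1' s hs
          have b3 := hdisc (r * r1) hrr1 _ hψ s hs
          rw [norm_mul, norm_mul]
          calc _ ≤ (C * r1) * ((C * r) * (C * ((r * r1 : ℕ) : ℝ))) := by gcongr
            _ = Q * (r : ℝ) ^ 2 := by rw [hQ]; push_cast; ring) (fun n => a4_nonneg r r1 χ χ1 hχ2 hχ12 n) (a4_one _ _ _ _) (fun s hs => a4_L r r1 χ χ1 s hs)
        (by linarith) hβ1 (by simp [hLz])
      simp only [norm_mul] at this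
      rw [← hD] at this
      have hu := hU (r * r1) hrr1 _ hψ
      rw [Nat.cast_mul, Real.mul_rpow (by positivity) (by positivity)] at hu
      have hK2 : Q ^ (-(E * e')) * (r : ℝ) ^ (-(ε / 2)) ≤ (Q * (r : ℝ) ^ 2) ^ (-(E * (1 - β))) := by
        have g1 : (Q * (r : ℝ) ^ 2) ^ (-(E * e')) ≤ (Q * (r : ℝ) ^ 2) ^ (-(E * (1 - β))) :=
          Real.rpow_le_rpow_of_exponent_le hK (by nlinarith)
        refine le_trans ?_ g1
        rw [Real.mul_rpow (x := Q) (y := (r : ℝ) ^ 2) (by linarith) (by positivity)]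
        refine mul_le_mul_of_nonneg_left ?_ (Real.rpow_nonneg (by linarith) _)
        rw [← Real.rpow_natCast (r : ℝ) 2, ← Real.rpow_mul (by linarith)]
        refine Real.rpow_le_rpow_of_exponent_le hrr ?_
        push_cast
        linarith
      have hrm : (r : ℝ) ^ m ≤ (r : ℝ) ^ (ε / 2) := Real.rpow_le_rpow_of_exponent_le hrr (min_le_left _ _)
      have hre : (r : ℝ) ^ (-ε) * (r : ℝ) ^ (ε / 2) = (r : ℝ) ^ (-(ε / 2)) := by
        rw [← Real.rpow_add (by linarith)]; congr 1; ring
      set X := ‖DirichletCharacter.LFunction χ 1‖ with hX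
      have hX0 : 0 ≤ X := norm_nonneg _
      have h1β : 0 < 1 - β := by linarith
      set W : ℝ := D * (CU * (r1 : ℝ) ^ m) with hW
      have hWp : 0 < W := by positivity
      have k1 : c * (1 - β) * (Q ^ (-(E * e')) * (r : ℝ) ^ (-(ε / 2))) ≤ D * (X * (CU * ((r : ℝ) ^ (ε / 2) * (r1 : ℝ) ^ m))) := by
        refine (mul_le_mul_of_nonneg_left hK2 (by positivity)).trans (this.trans ?_)
        refine mul_le_mul_of_nonneg_left (mul_le_mul_of_nonneg_left (hu.trans ?_) hX0) hDp.le
        gcongr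
      have k2 : c * (1 - β) * Q ^ (-(E * e')) * (r : ℝ) ^ (-ε) * (r : ℝ) ^ (ε / 2) ≤ X * W * (r : ℝ) ^ (ε / 2) := by
        rw [mul_assoc _ ((r : ℝ) ^ (-ε)), hre]
        refine le_trans (le_of_eq (by ring)) (k1.trans (le_of_eq (by rw [hW]; ring)))
      have k3 := le_of_mul_le_mul_right k2 (Real.rpow_pos_of_pos (by linarith) _)
      have k4 : c * (1 - β) * Q ^ (-(E * e')) / W * (r : ℝ) ^ (-ε) ≤ X := by
        rw [div_mul_eq_mul_div, div_le_iff₀ hWp]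
        exact k3
      exact (mul_le_mul_of_nonneg_right (min_le_right _ _) (by positivity)).trans k4

end SPC

namespace SPC
open Finset

lemma dyadic_sum (f : ℕ → ℝ) (hf : ∀ r, 0 ≤ f r) (B : ℝ) (hB : 0 ≤ B) (R0 N : ℕ)
    (h : ∀ R, R0 ≤ R → R ≤ N → ∑ r ∈ Icc R (2 * R), f r ≤ B) (j : ℕ) :
    ∀ R, R0 ≤ R → N < R * 2 ^ j → ∑ r ∈ Icc R N, f r ≤ j * B := by
  induction j with
  | zero =>
    intro R _ h2
    rw [Icc_eq_empty (by simp at h2; omega)]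
    simp
  | succ j ih =>
    intro R h1 h2
    by_cases hR : N < R
    · rw [Icc_eq_empty (by omega)]
      simp only [sum_empty]
      positivity
    · have h3 := ih (2 * R) (by omega) (by rw [pow_succ] at h2; linarith)
      have h4 := h R h1 (by omega)
      have hs : Icc R N ⊆ Icc R (2 * R) ∪ Icc (2 * R) N := by
        intro r hr
        simp only [mem_union, mem_Icc] at hr ⊢
        omega
      have h5 : ∑ r ∈ Icc R N, f r ≤ ∑ r ∈ Icc R (2 * R), f r + ∑ r ∈ Icc (2 * R) N, f r := by
        refine (sum_le_sum_of_subset_of_nonneg hs fun _ _ _ => hf _).trans ?_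
        rw [← sum_union_inter]
        have := sum_nonneg (s := Icc R (2 * R) ∩ Icc (2 * R) N) (fun r _ => hf r)
        linarith
      push_cast
      linarith

lemma L_pow_le (δ : ℝ) (hδ : 0 < δ) (hδ1 : δ ≤ 1) (j : ℕ) :
    ∃ K : ℝ, 1 ≤ K ∧ ∀ y : ℝ, 1 ≤ y → (1 + Real.log y) ^ j ≤ K * y ^ δ := by
  obtain ⟨K, hK, h⟩ := log_pow_le δ hδ hδ1 j
  refine ⟨3 * K, by linarith, fun y hy => ?_⟩
  have h1 := h j le_rfl (3 * y) (by linarith)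
  have h2 : 1 + Real.log y ≤ Real.log (3 * y) := by
    rw [Real.log_mul (by norm_num) (by linarith)]
    have : (1 : ℝ) ≤ Real.log 3 := by
      rw [Real.le_log_iff_exp_le (by norm_num)]
      exact Real.exp_one_lt_d9.le.trans (by norm_num)
    linarith
  have h3 : (3 * y) ^ δ ≤ 3 * y ^ δ := by
    rw [Real.mul_rpow (by norm_num) (by linarith)]
    refine mul_le_mul_of_nonneg_right ?_ (by positivity)
    calc (3 : ℝ) ^ δ ≤ 3 ^ (1 : ℝ) := Real.rpow_le_rpow_of_exponent_le (by norm_num) hδ1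
      _ = 3 := by norm_num
  have h4 : 0 ≤ Real.log y := Real.log_nonneg hy
  calc (1 + Real.log y) ^ j ≤ Real.log (3 * y) ^ j := by gcongr
    _ ≤ K * (3 * y) ^ δ := h1
    _ ≤ K * (3 * y ^ δ) := by gcongr
    _ = _ := by ring

/-- the prime-type sum over primitive characters of one modulus, weighted -/
noncomputable def fr (y r : ℕ) : ℝ := (1 / (r.totient : ℝ)) * ∑ χ ∈ prim r, ‖TT χ y 22‖

lemma fr_nonneg (y r : ℕ) : 0 ≤ fr y r :=
  mul_nonneg (by positivity) (sum_nonneg fun _ _ => norm_nonneg _)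

lemma bv_small : ∃ C : ℝ, 0 < C ∧ ∀ y : ℕ, 3 ≤ y → ∀ R0 : ℕ, (R0 : ℝ) ≤ 3 * (1 + Real.log y) ^ 11 →
    ∑ r ∈ Icc 2 R0, fr y r ≤ C * y * (1 + Real.log y) ^ 17 := by
  obtain ⟨C, hC, h⟩ := TT_small siegel 22 (1 / 2) (by norm_num) (by norm_num)
  refine ⟨6 * C, by positivity, fun y hy R0 hR => ?_⟩
  set L := 1 + Real.log y with hL
  have hL1 : 1 ≤ L := L_ge y
  have hsq : Real.sqrt R0 ≤ 2 * L ^ 6 := by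
    apply Real.sqrt_le_iff.2 ⟨by positivity, ?_⟩
    refine hR.trans ?_
    have : L ^ 11 ≤ L ^ 12 := pow_le_pow_right₀ hL1 (by norm_num)
    have h0 : 0 ≤ L ^ 12 := by positivity
    calc 3 * L ^ 11 ≤ 4 * L ^ 12 := by linarith
      _ = _ := by ring
  have h1 : ∀ r ∈ Icc 2 R0, fr y r ≤ C * (2 * L ^ 6) * y := by
    intro r hr
    rw [mem_Icc] at hr
    have : NeZero r := ⟨by omega⟩
    have hφ : 0 < (r.totient : ℝ) := by exact_mod_cast Nat.totient_pos.2 (by omega)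
    have h2 : ∑ χ ∈ prim r, ‖TT χ y 22‖ ≤ ∑ χ ∈ prim r, C * (2 * L ^ 6) * y := by
      refine sum_le_sum fun χ hχ => (h r (by omega) χ (mem_prim.1 hχ) y hy).trans ?_
      have : (r : ℝ) ^ (1 / 2 : ℝ) ≤ 2 * L ^ 6 := by
        rw [← Real.sqrt_eq_rpow]
        refine le_trans (Real.sqrt_le_sqrt ?_) hsq
        exact_mod_cast hr.2
      gcongr
    rw [sum_const, nsmul_eq_mul] at h2
    have h3 : ((prim r).card : ℝ) ≤ r.totient := by exact_mod_cast card_prim_le r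
    unfold fr
    rw [one_div, inv_mul_le_iff₀ hφ]
    refine h2.trans ?_
    gcongr
  refine (sum_le_sum h1).trans ?_
  rw [sum_const, nsmul_eq_mul, Nat.card_Icc]
  have h5 : ((R0 + 1 - 2 : ℕ) : ℝ) ≤ 3 * L ^ 11 := le_trans (by exact_mod_cast (by omega)) hR
  calc ((R0 + 1 - 2 : ℕ) : ℝ) * (C * (2 * L ^ 6) * y) ≤ 3 * L ^ 11 * (C * (2 * L ^ 6) * y) := by gcongr
    _ = _ := by ring

lemma bv_block (e M0 : ℝ) (he : 0 < e) (he1 : e ≤ 1 / 4) (hM0 : 1 ≤ M0) : ∃ C : ℝ, 0 < C ∧ ∀ y : ℕ, 3 ≤ y →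
    ∀ N : ℕ, (N : ℝ) ≤ M0 * (y : ℝ) ^ (1 / 2 - e) → ∀ R : ℕ, 2 ≤ R → (1 + Real.log y) ^ 11 ≤ R → R ≤ N →
    ∑ r ∈ Icc R (2 * R), fr y r ≤ C * y * (1 + Real.log y) ^ 16 := by
  obtain ⟨K, hK, hKK⟩ := L_pow_le (e / 4) (by linarith) (by linarith) 11
  refine ⟨300 * 2 ^ 22 * (1 + K + M0 * K + 4 * M0 ^ 2 * K), by positivity, fun y hy N hN R hR hR0 hRN => ?_⟩
  have hy1 : (1 : ℝ) ≤ y := by exact_mod_cast (by omega : 1 ≤ y)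
  have hy0 : (0 : ℝ) < y := by linarith
  have hLK := hKK y hy1
  set L := 1 + Real.log y with hL
  have hL1 : 1 ≤ L := L_ge y
  set U := ⌈(y : ℝ) ^ (e / 2)⌉₊ with hU
  have hye : (1 : ℝ) ≤ (y : ℝ) ^ (e / 2) := Real.one_le_rpow hy1 (by linarith)
  have hU1 : (y : ℝ) ^ (e / 2) ≤ U := Nat.le_ceil _
  have hU2 : (U : ℝ) ≤ 2 * (y : ℝ) ^ (e / 2) := by
    have := (Nat.ceil_lt_add_one (a := (y : ℝ) ^ (e / 2)) (by linarith)).le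
    linarith
  have hU0 : 1 ≤ U := by exact_mod_cast hye.trans hU1
  have hm := V_main U y 22 R hU0 (by omega) hR
  rw [← hL] at hm
  have hL0 : 0 < L ^ 11 := by positivity
  have hRr : (0 : ℝ) < R := by exact_mod_cast (by omega : 0 < R)
  have hRN' : (R : ℝ) ≤ M0 * (y : ℝ) ^ (1 / 2 - e) := le_trans (by exact_mod_cast hRN) hN
  have a1 : (y : ℝ) / R ≤ y / L ^ 11 := by gcongr
  -- conversion
  have hconv : ∀ a : ℝ, a ≤ -(e / 4) → (y : ℝ) * (y : ℝ) ^ a ≤ K * (y / L ^ 11) := by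
    intro a ha
    have h1 : (y : ℝ) ^ a ≤ (y : ℝ) ^ (-(e / 4)) := Real.rpow_le_rpow_of_exponent_le hy1 ha
    rw [Real.rpow_neg hy0.le] at h1
    have h2 : ((y : ℝ) ^ (e / 4))⁻¹ ≤ K / L ^ 11 := by
      rw [inv_le_comm₀ (by positivity) (by positivity), inv_div, div_le_iff₀ (by positivity)]
      linarith
    calc (y : ℝ) * (y : ℝ) ^ a ≤ y * (K / L ^ 11) := by gcongr; exact h1.trans h2
      _ = _ := by ring
  have a2 : (y : ℝ) / Real.sqrt U ≤ K * (y / L ^ 11) := by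
    refine le_trans ?_ (hconv (-(e / 4)) le_rfl)
    rw [Real.rpow_neg hy0.le, ← div_eq_mul_inv]
    refine div_le_div_of_nonneg_left hy0.le (by positivity) ?_
    refine Real.le_sqrt_of_sq_le (le_trans (le_of_eq ?_) hU1)
    rw [← Real.rpow_natCast, ← Real.rpow_mul hy0.le]
    congr 1; push_cast; ring
  have a3 : (R : ℝ) * Real.sqrt y ≤ M0 * (K * (y / L ^ 11)) := by
    refine le_trans ?_ (mul_le_mul_of_nonneg_left (hconv (-e) (by linarith)) (by linarith))
    calc (R : ℝ) * Real.sqrt y ≤ M0 * (y : ℝ) ^ (1 / 2 - e) * Real.sqrt y := by gcongr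
      _ = M0 * ((y : ℝ) ^ (1 / 2 - e) * (y : ℝ) ^ (1 / 2 : ℝ)) := by rw [Real.sqrt_eq_rpow]; ring
      _ = M0 * ((y : ℝ) ^ (1 : ℝ) * (y : ℝ) ^ (-e)) := by
        rw [← Real.rpow_add hy0, ← Real.rpow_add hy0]; congr 2; ring
      _ = _ := by rw [Real.rpow_one]
  have a4 : (R : ℝ) ^ 2 * (U : ℝ) ^ 2 ≤ 4 * M0 ^ 2 * (K * (y / L ^ 11)) := by
    refine le_trans ?_ (mul_le_mul_of_nonneg_left (hconv (-e) (by linarith)) (by positivity))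
    calc (R : ℝ) ^ 2 * (U : ℝ) ^ 2 ≤ (M0 * (y : ℝ) ^ (1 / 2 - e)) ^ 2 * (2 * (y : ℝ) ^ (e / 2)) ^ 2 := by gcongr
      _ = 4 * M0 ^ 2 * (((y : ℝ) ^ (1 / 2 - e) * (y : ℝ) ^ (e / 2)) * ((y : ℝ) ^ (1 / 2 - e) * (y : ℝ) ^ (e / 2))) := by ring
      _ = 4 * M0 ^ 2 * ((y : ℝ) ^ (1 : ℝ) * (y : ℝ) ^ (-e)) := by
        rw [← Real.rpow_add hy0, ← Real.rpow_add hy0, ← Real.rpow_add hy0]; congr 2; ring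
      _ = _ := by rw [Real.rpow_one]
  have hfin : (y : ℝ) / R + y / Real.sqrt U + R * Real.sqrt y + (R : ℝ) ^ 2 * (U : ℝ) ^ 2 ≤
      (1 + K + M0 * K + 4 * M0 ^ 2 * K) * (y / L ^ 11) := by
    refine (add_le_add (add_le_add (add_le_add a1 a2) a3) a4).trans (le_of_eq (by ring))
  unfold fr
  refine hm.trans ((mul_le_mul_of_nonneg_left hfin (by positivity)).trans (le_of_eq ?_))
  have : L ^ (22 + 5) = L ^ 16 * L ^ 11 := by rw [← pow_add]
  rw [this]
  field_simp

lemma bv_one (e M0 : ℝ) (he : 0 < e) (he1 : e ≤ 1 / 4) (hM0 : 1 ≤ M0) : ∃ C : ℝ, 0 < C ∧ ∀ y : ℕ, 3 ≤ y →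
    ∀ N : ℕ, N ≤ y → (N : ℝ) ≤ M0 * (y : ℝ) ^ (1 / 2 - e) →
    ∑ r ∈ Icc 2 N, fr y r ≤ C * y * (1 + Real.log y) ^ 17 := by
  obtain ⟨C1, hC1, h1⟩ := bv_small
  obtain ⟨C2, hC2, h2⟩ := bv_block e M0 he he1 hM0
  refine ⟨C1 + 3 * C2, by positivity, fun y hy N hNy hN => ?_⟩
  have hL1 : 1 ≤ 1 + Real.log y := L_ge y
  have k1 := h1 y hy
  have k2 := h2 y hy N hN
  have hy1 : (1 : ℝ) ≤ y := by exact_mod_cast (by omega : 1 ≤ y)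
  set L := 1 + Real.log y with hL
  set R0 := ⌈L ^ 11⌉₊ + 1 with hR0
  have hp1 : 1 ≤ L ^ 11 := one_le_pow₀ hL1
  have b1 : L ^ 11 ≤ R0 := (Nat.le_ceil _).trans (by rw [hR0]; push_cast; linarith)
  have b2 : (R0 : ℝ) ≤ 3 * L ^ 11 := by
    have := (Nat.ceil_lt_add_one (a := L ^ 11) (by linarith)).le
    rw [hR0]; push_cast; linarith
  have b3 : 2 ≤ R0 := by
    have : 0 < ⌈L ^ 11⌉₊ := Nat.ceil_pos.2 (by linarith)
    omega
  have k3 := k1 R0 b2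
  have k4 := dyadic_sum (fr y) (fr_nonneg y) (C2 * y * L ^ 16) (by positivity) R0 N
    (fun R hR hRN => k2 R (b3.trans hR) (b1.trans (by exact_mod_cast hR)) hRN) (Nat.log 2 N + 1) R0 le_rfl
    (by
      have := Nat.lt_pow_succ_log_self (b := 2) (by norm_num) N
      exact lt_of_lt_of_le this (Nat.le_mul_of_pos_left _ (by omega)))
  have hj : ((Nat.log 2 N + 1 : ℕ) : ℝ) ≤ 3 * L := by
    have h5 : (2 : ℝ) ^ Nat.log 2 y ≤ y := by exact_mod_cast Nat.pow_log_le_self 2 (by omega)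
    have h6 := Real.log_le_log (by positivity) h5
    rw [Real.log_pow] at h6
    have h7 : (Nat.log 2 N : ℝ) ≤ Nat.log 2 y := by exact_mod_cast Nat.log_mono_right hNy
    have h8 := Real.log_two_gt_d9
    have h9 : (0 : ℝ) ≤ Nat.log 2 y := by positivity
    push_cast
    nlinarith
  have hs : Icc 2 N ⊆ Icc 2 R0 ∪ Icc R0 N := by
    intro r hr
    simp only [mem_union, mem_Icc] at hr ⊢
    omega
  have h5 : ∑ r ∈ Icc 2 N, fr y r ≤ ∑ r ∈ Icc 2 R0, fr y r + ∑ r ∈ Icc R0 N, fr y r := by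
    refine (sum_le_sum_of_subset_of_nonneg hs fun _ _ _ => fr_nonneg _ _).trans ?_
    rw [← sum_union_inter]
    have := sum_nonneg (s := Icc 2 R0 ∩ Icc R0 N) (fun r _ => fr_nonneg y r)
    linarith
  have h6 : ((Nat.log 2 N + 1 : ℕ) : ℝ) * (C2 * y * L ^ 16) ≤ 3 * L * (C2 * y * L ^ 16) := by gcongr
  calc _ ≤ C1 * y * L ^ 17 + 3 * L * (C2 * y * L ^ 16) := by linarith
    _ = _ := by ring

end SPC

namespace SPC
open Finset
open ArithmeticFunction (vonMangoldt)

/-- smoothed prime weight -/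
noncomputable def WW (y n : ℕ) : ℝ := vonMangoldt n * (Real.log n ^ 22 * tri ((n : ℝ) / y))

noncomputable def X0 (y : ℕ) : ℝ := ∑ n ∈ Icc 1 y, WW y n

lemma WW_nonneg (y n : ℕ) : 0 ≤ WW y n := by
  unfold WW
  have := Real.log_natCast_nonneg n
  exact mul_nonneg ArithmeticFunction.vonMangoldt_nonneg (mul_nonneg (by positivity) (tri_nonneg _))

lemma WW_le (y n : ℕ) (hn : n ≤ y) : WW y n ≤ Real.log y ^ 23 := by
  unfold WW
  rcases Nat.eq_zero_or_pos n with h | h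
  · subst h; simp only [ArithmeticFunction.map_zero, zero_mul]
    have := Real.log_natCast_nonneg y
    positivity
  have h1 : Real.log n ≤ Real.log y := Real.log_le_log (by exact_mod_cast h) (by exact_mod_cast hn)
  have h0 := Real.log_natCast_nonneg n
  have h2 : vonMangoldt n ≤ Real.log y := ArithmeticFunction.vonMangoldt_le_log.trans h1
  have h3 : tri ((n : ℝ) / y) ≤ 1 := tri_le_one (by positivity)
  have h4 : Real.log n ^ 22 ≤ Real.log y ^ 22 := by gcongr
  have h5 : 0 ≤ Real.log y := h0.trans h1
  calc _ ≤ Real.log y * (Real.log y ^ 22 * 1) :=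
        mul_le_mul h2 (mul_le_mul h4 h3 (tri_nonneg _) (by positivity)) (mul_nonneg (by positivity) (tri_nonneg _)) h5
    _ = _ := by ring

lemma TT_eq_WW {r : ℕ} (χ : DirichletCharacter ℂ r) (y : ℕ) : TT χ y 22 = ∑ n ∈ Icc 1 y, (WW y n : ℂ) * χ (n : ZMod r) := by
  unfold TT phiT WW
  refine sum_congr rfl fun n _ => ?_
  push_cast
  ring

lemma log2_le (y : ℕ) (hy : 1 ≤ y) : ((Nat.log 2 y + 1 : ℕ) : ℝ) ≤ 3 * (1 + Real.log y) := by
  have hy1 : (1 : ℝ) ≤ y := by exact_mod_cast hy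
  have h5 : (2 : ℝ) ^ Nat.log 2 y ≤ y := by exact_mod_cast Nat.pow_log_le_self 2 (by omega)
  have h6 := Real.log_le_log (by positivity) h5
  rw [Real.log_pow] at h6
  have h8 := Real.log_two_gt_d9
  have h9 : (0 : ℝ) ≤ Nat.log 2 y := by positivity
  have h10 := Real.log_nonneg hy1
  push_cast
  nlinarith

lemma noncoprime_le (y m : ℕ) (hy : 1 ≤ y) (hm : 1 ≤ m) :
    ∑ n ∈ (Icc 1 y).filter (fun n => ¬ n.Coprime m), WW y n ≤ 3 * m * (1 + Real.log y) ^ 24 := by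
  have h1 : ∑ n ∈ (Icc 1 y).filter (fun n => ¬ n.Coprime m), WW y n =
      ∑ n ∈ ((Icc 1 y).filter (fun n => ¬ n.Coprime m)).filter (fun n => IsPrimePow n), WW y n := by
    refine (sum_filter_of_ne ?_).symm
    intro n _ hne
    by_contra hpp
    apply hne
    unfold WW
    rw [ArithmeticFunction.vonMangoldt_eq_zero_iff.2 hpp, zero_mul]
  have h2 : (((Icc 1 y).filter (fun n => ¬ n.Coprime m)).filter (fun n => IsPrimePow n)).card ≤ (Icc 1 m ×ˢ range (Nat.log 2 y + 1)).card := by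
    refine card_le_card_of_injOn (fun n => (n.minFac, n.factorization n.minFac)) ?_ ?_
    · intro n hn
      simp only [coe_filter, mem_filter, Set.mem_ofPred_eq, mem_Icc] at hn
      obtain ⟨⟨⟨hn1, hny⟩, hnc⟩, hpp⟩ := hn
      have hne : n ≠ 1 := hpp.one_lt.ne'
      have hp := Nat.minFac_prime hne
      simp only [coe_product, Set.mem_prod, coe_Icc, Set.mem_Icc, coe_range, Set.mem_Iio]
      refine ⟨⟨hp.one_lt.le, ?_⟩, ?_⟩
      · obtain ⟨q, hq, hqn, hqm⟩ := Nat.Prime.not_coprime_iff_dvd.1 hnc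
        have hmf := hpp.minFac_pow_factorization_eq
        have : q ∣ n.minFac := hq.dvd_of_dvd_pow (hmf.symm ▸ hqn)
        rw [Nat.prime_dvd_prime_iff_eq hq hp] at this
        rw [← this]
        exact Nat.le_of_dvd hm hqm
      · have hmf := hpp.minFac_pow_factorization_eq
        have h3 : 2 ^ (n.factorization n.minFac) ≤ y :=
          (Nat.pow_le_pow_left hp.two_le _).trans (hmf.le.trans hny)
        exact Nat.lt_succ_of_le (Nat.le_log_of_pow_le (by norm_num) h3)
    · intro a ha b hb hab
      simp only [coe_filter, mem_filter, Set.mem_ofPred_eq, mem_Icc] at ha hb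
      simp only [Prod.mk.injEq] at hab
      rw [← ha.2.minFac_pow_factorization_eq, ← hb.2.minFac_pow_factorization_eq, hab.2, hab.1]
  rw [card_product, Nat.card_Icc, card_range] at h2
  rw [h1]
  have hlog : 0 ≤ Real.log y := Real.log_natCast_nonneg y
  refine (sum_le_card_nsmul _ _ (Real.log y ^ 23) fun n hn => WW_le y n ?_).trans ?_
  · simp only [mem_filter, mem_Icc] at hn; exact hn.1.1.2
  rw [nsmul_eq_mul]
  have h3 : ((((Icc 1 y).filter (fun n => ¬ n.Coprime m)).filter (fun n => IsPrimePow n)).card : ℝ) ≤ m * (3 * (1 + Real.log y)) := by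
    rw [Nat.add_sub_cancel] at h2
    refine le_trans (Nat.cast_le.2 h2) ?_
    rw [Nat.cast_mul]
    exact mul_le_mul_of_nonneg_left (log2_le y hy) (by positivity)
  calc _ ≤ m * (3 * (1 + Real.log y)) * (1 + Real.log y) ^ 23 := by
        gcongr; linarith
    _ = _ := by ring

lemma prim_inj (m : ℕ) [NeZero m] (F : (Σ r : ℕ, DirichletCharacter ℂ r) → ℝ) (hF : ∀ x, 0 ≤ F x) :
    ∑ χ ∈ (univ : Finset (DirichletCharacter ℂ m)).erase 1, F ⟨χ.conductor, χ.primitiveCharacter⟩ ≤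
      ∑ r ∈ m.divisors.erase 1, ∑ χ ∈ prim r, F ⟨r, χ⟩ := by
  classical
  rw [sum_sigma']
  have hinj : Function.Injective (fun χ : DirichletCharacter ℂ m => (⟨χ.conductor, χ.primitiveCharacter⟩ : Σ r : ℕ, DirichletCharacter ℂ r)) := by
    refine Function.LeftInverse.injective (g := fun x => if h : x.1 ∣ m then DirichletCharacter.changeLevel h x.2 else 1) fun χ => ?_
    simp only
    rw [dif_pos χ.conductor_dvd_level]
    exact DirichletCharacter.changeLevel_primitiveCharacter χ
  rw [← sum_image (s := (univ : Finset (DirichletCharacter ℂ m)).erase 1) (f := F)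
    (g := fun χ : DirichletCharacter ℂ m => (⟨χ.conductor, χ.primitiveCharacter⟩ : Σ r : ℕ, DirichletCharacter ℂ r)) hinj.injOn]
  have hsub : ((univ : Finset (DirichletCharacter ℂ m)).erase 1).image (fun χ : DirichletCharacter ℂ m => (⟨χ.conductor, χ.primitiveCharacter⟩ : Σ r : ℕ, DirichletCharacter ℂ r)) ⊆ (m.divisors.erase 1).sigma prim := by
    intro x hx
    rw [mem_image] at hx
    obtain ⟨χ, hχ, rfl⟩ := hx
    rw [mem_sigma, mem_erase, Nat.mem_divisors]
    have h1 : χ.conductor ∣ m := χ.conductor_dvd_level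
    have h2 : χ.conductor ≠ 0 := fun h => NeZero.ne m (by rw [h] at h1; exact zero_dvd_iff.1 h1)
    have : NeZero χ.conductor := ⟨h2⟩
    refine ⟨⟨?_, h1, NeZero.ne m⟩, mem_prim.2 χ.primitiveCharacter_isPrimitive⟩
    intro h
    rw [mem_erase] at hχ
    exact hχ.1 (DirichletCharacter.eq_one_iff_conductor_eq_one.2 h)
  exact sum_le_sum_of_subset_of_nonneg hsub fun x _ _ => hF x

lemma char_diff (m : ℕ) [NeZero m] (y : ℕ) (χ : DirichletCharacter ℂ m) :
    ‖(∑ n ∈ Icc 1 y, (WW y n : ℂ) * χ (n : ZMod m)) - TT χ.primitiveCharacter y 22‖ ≤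
      ∑ n ∈ (Icc 1 y).filter (fun n => ¬ n.Coprime m), WW y n := by
  rw [TT_eq_WW, ← sum_sub_distrib, sum_filter]
  refine (norm_sum_le _ _).trans (sum_le_sum fun n _ => ?_)
  by_cases h : ¬ n.Coprime m
  · rw [if_pos h]
    have h1 : χ (n : ZMod m) = 0 := by
      apply MulChar.map_nonunit
      rwa [ZMod.isUnit_iff_coprime]
    rw [h1, mul_zero, zero_sub, norm_neg, norm_mul, Complex.norm_real, Real.norm_of_nonneg (WW_nonneg y n)]
    exact mul_le_of_le_one_right (WW_nonneg y n) (DirichletCharacter.norm_le_one _ _)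
  · rw [if_neg h]
    rw [not_not] at h
    have h1 := DirichletCharacter.primitiveCharacter_apply_of_isCoprime χ (a := (n : ℤ)) (Nat.isCoprime_iff_coprime.2 h)
    simp only [Int.cast_natCast] at h1
    rw [h1, sub_self, norm_zero]

lemma X0_eq (y : ℕ) (m : ℕ) [NeZero m] : TT (1 : DirichletCharacter ℂ m).primitiveCharacter y 22 = (X0 y : ℂ) := by
  rw [TT_eq_WW]
  unfold X0
  push_cast
  refine sum_congr rfl fun n _ => ?_
  have h : (1 : DirichletCharacter ℂ m).conductor = 1 := DirichletCharacter.conductor_one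
  have : (1 : DirichletCharacter ℂ m).primitiveCharacter (n : ZMod (1 : DirichletCharacter ℂ m).conductor) = 1 := by
    have h2 : (n : ZMod (1 : DirichletCharacter ℂ m).conductor) = 1 := by
      have : Subsingleton (ZMod (1 : DirichletCharacter ℂ m).conductor) := by rw [h]; infer_instance
      exact Subsingleton.elim _ _
    rw [h2, map_one]
  rw [this, mul_one]

lemma ap_char (m : ℕ) [NeZero m] (y b : ℕ) (hb : b.Coprime m) :
    |(∑ n ∈ (Icc 1 y).filter (fun n => n ≡ b [MOD m]), WW y n) - X0 y / m.totient| ≤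
      (∑ n ∈ (Icc 1 y).filter (fun n => ¬ n.Coprime m), WW y n) +
      (1 / (m.totient : ℝ)) * ∑ r ∈ m.divisors.erase 1, ∑ χ ∈ prim r, ‖TT χ y 22‖ := by
  classical
  have hφ : 0 < (m.totient : ℝ) := by exact_mod_cast Nat.totient_pos.2 (Nat.pos_of_ne_zero (NeZero.ne m))
  set Z := ∑ n ∈ (Icc 1 y).filter (fun n => ¬ n.Coprime m), WW y n with hZ
  have hu : IsUnit (b : ZMod m) := (ZMod.isUnit_iff_coprime b m).2 hb
  -- orthogonality
  have h1 : (m.totient : ℂ) * ((∑ n ∈ (Icc 1 y).filter (fun n => n ≡ b [MOD m]), WW y n : ℝ) : ℂ) =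
      ∑ χ : DirichletCharacter ℂ m, χ (b : ZMod m)⁻¹ * ∑ n ∈ Icc 1 y, (WW y n : ℂ) * χ (n : ZMod m) := by
    simp_rw [mul_sum]
    rw [sum_comm, sum_filter]
    push_cast
    rw [mul_sum]
    refine sum_congr rfl fun n _ => ?_
    have h2 := DirichletCharacter.sum_char_inv_mul_char_eq ℂ hu (n : ZMod m)
    have h3 : ∑ χ : DirichletCharacter ℂ m, χ (b : ZMod m)⁻¹ * ((WW y n : ℂ) * χ (n : ZMod m)) =
        (WW y n : ℂ) * ∑ χ : DirichletCharacter ℂ m, χ (b : ZMod m)⁻¹ * χ (n : ZMod m) := by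
      rw [mul_sum]
      exact sum_congr rfl fun χ _ => by ring
    rw [h3, h2]
    have h4 : ((b : ZMod m) = (n : ZMod m)) ↔ n ≡ b [MOD m] := by
      rw [ZMod.natCast_eq_natCast_iff]
      exact ⟨fun h => h.symm, fun h => h.symm⟩
    simp only [h4]
    split_ifs <;> push_cast <;> ring
  -- comparison with primitive characters
  have h2 : ‖(∑ χ : DirichletCharacter ℂ m, χ (b : ZMod m)⁻¹ * ∑ n ∈ Icc 1 y, (WW y n : ℂ) * χ (n : ZMod m)) - (X0 y : ℂ)‖ ≤
      m.totient * Z + ∑ χ ∈ (univ : Finset (DirichletCharacter ℂ m)).erase 1, ‖TT χ.primitiveCharacter y 22‖ := by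
    have h3 : (∑ χ : DirichletCharacter ℂ m, χ (b : ZMod m)⁻¹ * ∑ n ∈ Icc 1 y, (WW y n : ℂ) * χ (n : ZMod m)) - (X0 y : ℂ) =
        (∑ χ : DirichletCharacter ℂ m, χ (b : ZMod m)⁻¹ * ((∑ n ∈ Icc 1 y, (WW y n : ℂ) * χ (n : ZMod m)) - TT χ.primitiveCharacter y 22)) +
        ∑ χ ∈ (univ : Finset (DirichletCharacter ℂ m)).erase 1, χ (b : ZMod m)⁻¹ * TT χ.primitiveCharacter y 22 := by
      have h4 := add_sum_erase (univ : Finset (DirichletCharacter ℂ m)) (fun χ => χ (b : ZMod m)⁻¹ * TT χ.primitiveCharacter y 22) (mem_univ 1)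
      simp only [X0_eq] at h4
      have h5 : (1 : DirichletCharacter ℂ m) (b : ZMod m)⁻¹ = 1 := by
        apply MulChar.one_apply
        exact isUnit_iff_exists_inv.2 ⟨(b : ZMod m), ZMod.inv_mul_of_unit _ hu⟩
      rw [h5, one_mul] at h4
      simp_rw [mul_sub, sum_sub_distrib]
      rw [← h4]
      ring
    rw [h3]
    refine (norm_add_le _ _).trans (add_le_add ?_ ?_)
    · refine (norm_sum_le _ _).trans ?_
      have h4 : ∀ χ ∈ (univ : Finset (DirichletCharacter ℂ m)), ‖χ (b : ZMod m)⁻¹ * ((∑ n ∈ Icc 1 y, (WW y n : ℂ) * χ (n : ZMod m)) - TT χ.primitiveCharacter y 22)‖ ≤ Z := by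
        intro χ _
        rw [norm_mul]
        refine le_trans (mul_le_of_le_one_left (norm_nonneg _) (DirichletCharacter.norm_le_one _ _)) (char_diff m y χ)
      refine (sum_le_card_nsmul _ _ _ h4).trans (le_of_eq ?_)
      rw [nsmul_eq_mul, card_univ, ← Nat.card_eq_fintype_card, DirichletCharacter.card_eq_totient_of_hasEnoughRootsOfUnity]
    · refine (norm_sum_le _ _).trans (sum_le_sum fun χ _ => ?_)
      rw [norm_mul]
      exact mul_le_of_le_one_left (norm_nonneg _) (DirichletCharacter.norm_le_one _ _)
  have h3 := prim_inj m (fun x => ‖TT x.2 y 22‖) (fun x => norm_nonneg _)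
  simp only at h3
  rw [← h1] at h2
  have h4 : ‖(m.totient : ℂ) * ((∑ n ∈ (Icc 1 y).filter (fun n => n ≡ b [MOD m]), WW y n : ℝ) : ℂ) - (X0 y : ℂ)‖ =
      |m.totient * (∑ n ∈ (Icc 1 y).filter (fun n => n ≡ b [MOD m]), WW y n) - X0 y| := by
    rw [← Real.norm_eq_abs, ← Complex.norm_real]
    push_cast
    rfl
  rw [h4] at h2
  have h5 : (∑ n ∈ (Icc 1 y).filter (fun n => n ≡ b [MOD m]), WW y n) - X0 y / m.totient =
      (m.totient * (∑ n ∈ (Icc 1 y).filter (fun n => n ≡ b [MOD m]), WW y n) - X0 y) / m.totient := by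
    field_simp
  rw [h5, abs_div, abs_of_pos hφ, div_le_iff₀ hφ]
  refine (h2.trans (add_le_add le_rfl h3)).trans (le_of_eq ?_)
  field_simp

end SPC

namespace SPC
open Finset

lemma inv_totient_le (j : ℕ) (hj : 1 ≤ j) : 1 / (j.totient : ℝ) ≤ (j.divisors.card : ℝ) / j := by
  have h1 : j ≤ j.divisors.card * j.totient := by
    calc j = ∑ d ∈ j.divisors, d.totient := (Nat.sum_totient j).symm
      _ ≤ ∑ d ∈ j.divisors, j.totient := sum_le_sum fun d hd =>
        Nat.le_of_dvd (Nat.totient_pos.2 hj) (Nat.totient_dvd_of_dvd (Nat.dvd_of_mem_divisors hd))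
      _ = _ := by rw [sum_const, smul_eq_mul]
  have h2 : (0 : ℝ) < j.totient := by exact_mod_cast Nat.totient_pos.2 hj
  have h3 : (0 : ℝ) < j := by exact_mod_cast hj
  rw [div_le_div_iff₀ h2 h3, one_mul]
  exact_mod_cast h1

lemma sum_inv_totient_le (N : ℕ) : ∑ j ∈ Icc 1 N, 1 / (j.totient : ℝ) ≤ (1 + Real.log N) ^ 2 :=
  (sum_le_sum fun j hj => inv_totient_le j (mem_Icc.1 hj).1).trans (sum_tau_le N)

lemma sum_char_part (y N : ℕ) :
    ∑ m ∈ Icc 1 N, (1 / (m.totient : ℝ)) * ∑ r ∈ m.divisors.erase 1, ∑ χ ∈ prim r, ‖TT χ y 22‖ ≤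
      (∑ r ∈ Icc 2 N, fr y r) * (1 + Real.log N) ^ 2 := by
  set g : ℕ → ℝ := fun r => if r = 1 then 0 else fr y r with hg
  have hg0 : ∀ r, 0 ≤ g r := fun r => by
    simp only [hg]; split_ifs; exacts [le_rfl, fr_nonneg y r]
  have h1 := conv_le g (fun j => 1 / (j.totient : ℝ)) hg0 (fun j => by positivity) N
  have h2 : ∑ n ∈ Icc 1 N, g n = ∑ r ∈ Icc 2 N, fr y r := by
    rw [← sum_subset (s₁ := Icc 2 N) (s₂ := Icc 1 N)]
    · refine sum_congr rfl fun r hr => ?_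
      simp only [mem_Icc] at hr
      simp only [hg]
      rw [if_neg (by omega)]
    · exact Icc_subset_Icc (by norm_num) le_rfl
    · intro r hr hr2
      simp only [mem_Icc] at hr hr2
      simp only [hg]
      rw [if_pos (by omega)]
  rw [h2] at h1
  have h3 : ∑ m ∈ Icc 1 N, (1 / (m.totient : ℝ)) * ∑ r ∈ m.divisors.erase 1, ∑ χ ∈ prim r, ‖TT χ y 22‖ ≤
      ∑ n ∈ Icc 1 N, ∑ p ∈ n.divisorsAntidiagonal, g p.1 * (1 / (p.2.totient : ℝ)) := by
    refine sum_le_sum fun m hm => ?_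
    rw [mem_Icc] at hm
    rw [Nat.sum_divisorsAntidiagonal (f := fun a b => g a * (1 / (b.totient : ℝ))), mul_sum,
      ← sum_subset (s₁ := m.divisors.erase 1) (s₂ := m.divisors)]
    · refine sum_le_sum fun r hr => ?_
      rw [mem_erase, Nat.mem_divisors] at hr
      obtain ⟨hr1, ⟨j, hj⟩, hm0⟩ := hr
      have hr0 : 0 < r := Nat.pos_of_ne_zero (by rintro rfl; simp at hj; omega)
      have hj0 : 0 < j := Nat.pos_of_ne_zero (by rintro rfl; simp at hj; omega)
      have hdiv : m / r = j := by rw [hj]; exact Nat.mul_div_cancel_left j hr0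
      simp only [hg, hdiv]
      rw [if_neg hr1]
      unfold fr
      have h4 : (r.totient : ℝ) * j.totient ≤ m.totient := by
        rw [hj]; exact_mod_cast Nat.totient_super_multiplicative r j
      have h5 : (0 : ℝ) < r.totient := by exact_mod_cast Nat.totient_pos.2 hr0
      have h6 : (0 : ℝ) < j.totient := by exact_mod_cast Nat.totient_pos.2 hj0
      have h7 : 1 / (m.totient : ℝ) ≤ 1 / (r.totient : ℝ) * (1 / j.totient) := by
        rw [one_div_mul_one_div]
        exact one_div_le_one_div_of_le (by positivity) h4
      have h8 : 0 ≤ ∑ χ ∈ prim r, ‖TT χ y 22‖ := sum_nonneg fun _ _ => norm_nonneg _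
      calc _ ≤ 1 / (r.totient : ℝ) * (1 / j.totient) * ∑ χ ∈ prim r, ‖TT χ y 22‖ := by gcongr
        _ = _ := by ring
    · exact erase_subset _ _
    · intro r hr hr2
      rw [mem_erase] at hr2
      have : r = 1 := by by_contra h; exact hr2 ⟨h, hr⟩
      simp only [hg]
      rw [if_pos this, zero_mul]
  refine h3.trans (h1.trans (mul_le_mul_of_nonneg_left (sum_inv_totient_le N) (sum_nonneg fun r _ => fr_nonneg y r)))

/-- Bombieri--Vinogradov type theorem for the smoothed weight -/
theorem bv_main (e M0 : ℝ) (he : 0 < e) (he1 : e ≤ 1 / 4) (hM0 : 1 ≤ M0) : ∃ C : ℝ, 0 < C ∧ ∀ y : ℕ, 3 ≤ y →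
    ∀ N : ℕ, N ≤ y → (N : ℝ) ≤ M0 * (y : ℝ) ^ (1 / 2 - e) →
    ∀ b : ℕ → ℕ, (∀ m, 1 ≤ m → (b m).Coprime m) →
    ∑ m ∈ Icc 1 N, |(∑ n ∈ (Icc 1 y).filter (fun n => n ≡ b m [MOD m]), WW y n) - X0 y / m.totient| ≤
      C * y * (1 + Real.log y) ^ 19 := by
  obtain ⟨C1, hC1, h1⟩ := bv_one e M0 he he1 hM0
  obtain ⟨K, hK, hKK⟩ := L_pow_le (2 * e) (by linarith) (by linarith) 24
  refine ⟨C1 + 3 * M0 ^ 2 * K, by positivity, fun y hy N hNy hN b hb => ?_⟩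
  have hy1 : (1 : ℝ) ≤ y := by exact_mod_cast (by omega : 1 ≤ y)
  have hy0 : (0 : ℝ) < y := by linarith
  have k1 := h1 y hy N hNy hN
  have hL1 : 1 ≤ 1 + Real.log y := L_ge y
  have hK2 := hKK y hy1
  have hnc : ∀ m ∈ Icc 1 N, ∑ n ∈ (Icc 1 y).filter (fun n => ¬ n.Coprime m), WW y n ≤ 3 * m * (1 + Real.log y) ^ 24 :=
    fun m hm => noncoprime_le y m (by omega) (mem_Icc.1 hm).1
  set L := 1 + Real.log y with hL
  rcases Nat.eq_zero_or_pos N with h0 | hN0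
  · subst h0; simp only [Icc_eq_empty (by norm_num : ¬ 1 ≤ 0), sum_empty]; positivity
  have hLN : (1 + Real.log N) ≤ L := by
    have := Real.log_le_log (by exact_mod_cast hN0 : (0:ℝ) < N) (by exact_mod_cast hNy : (N:ℝ) ≤ y)
    linarith
  have hLN0 : 0 ≤ 1 + Real.log N := by linarith [L_ge N]
  have k2 : ∀ m ∈ Icc 1 N, |(∑ n ∈ (Icc 1 y).filter (fun n => n ≡ b m [MOD m]), WW y n) - X0 y / m.totient| ≤
      3 * N * L ^ 24 + (1 / (m.totient : ℝ)) * ∑ r ∈ m.divisors.erase 1, ∑ χ ∈ prim r, ‖TT χ y 22‖ := by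
    intro m hm
    have hm' := mem_Icc.1 hm
    have : NeZero m := ⟨by omega⟩
    refine (ap_char m y (b m) (hb m hm'.1)).trans (add_le_add_left ((hnc m hm).trans ?_) _)
    have : (m : ℝ) ≤ N := by exact_mod_cast hm'.2
    gcongr
  refine (sum_le_sum k2).trans ?_
  rw [sum_add_distrib, sum_const, Nat.card_Icc, nsmul_eq_mul, Nat.add_sub_cancel]
  have k3 : (N : ℝ) * (3 * N * L ^ 24) ≤ 3 * M0 ^ 2 * K * y := by
    calc (N : ℝ) * (3 * N * L ^ 24) ≤ (M0 * (y : ℝ) ^ (1 / 2 - e)) * (3 * (M0 * (y : ℝ) ^ (1 / 2 - e)) * (K * (y : ℝ) ^ (2 * e))) := by gcongr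
      _ = 3 * M0 ^ 2 * K * ((y : ℝ) ^ (1 / 2 - e) * (y : ℝ) ^ (1 / 2 - e) * (y : ℝ) ^ (2 * e)) := by ring
      _ = 3 * M0 ^ 2 * K * (y : ℝ) ^ (1 : ℝ) := by
        rw [← Real.rpow_add hy0, ← Real.rpow_add hy0]; congr 2; ring
      _ = _ := by rw [Real.rpow_one]
  have k4 : 3 * M0 ^ 2 * K * y ≤ 3 * M0 ^ 2 * K * y * L ^ 19 :=
    le_mul_of_one_le_right (by positivity) (one_le_pow₀ hL1)
  have k5 := sum_char_part y N
  have k6 : (∑ r ∈ Icc 2 N, fr y r) * (1 + Real.log N) ^ 2 ≤ (C1 * y * L ^ 17) * L ^ 2 := by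
    have : 0 ≤ ∑ r ∈ Icc 2 N, fr y r := sum_nonneg fun r _ => fr_nonneg y r
    gcongr
  calc _ ≤ 3 * M0 ^ 2 * K * y * L ^ 19 + (C1 * y * L ^ 17) * L ^ 2 := by linarith
    _ = _ := by ring

end SPC

namespace SPC
open Finset
open ArithmeticFunction (vonMangoldt)

lemma sum_log_bounds (n : ℕ) : n * Real.log n - n ≤ ∑ m ∈ Icc 1 n, Real.log m ∧ ∑ m ∈ Icc 1 n, Real.log m ≤ n * Real.log n := by
  induction n with
  | zero => simp
  | succ n ih =>
    rw [sum_Icc_succ_top (by omega)]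
    rcases Nat.eq_zero_or_pos n with h | h
    · subst h; simp
    have hn : (0 : ℝ) < n := by exact_mod_cast h
    have h1 : Real.log (n + 1) - Real.log n ≤ 1 / n := by
      rw [← Real.log_div (by positivity) (by positivity)]
      refine (Real.log_le_sub_one_of_pos (by positivity)).trans (le_of_eq (by field_simp; ring))
    have h2 : Real.log n ≤ Real.log (n + 1) := Real.log_le_log hn (by linarith)
    have h3 : (n : ℝ) * (Real.log (n + 1) - Real.log n) ≤ 1 := by
      calc (n : ℝ) * (Real.log (n + 1) - Real.log n) ≤ n * (1 / n) := by gcongr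
        _ = 1 := by field_simp
    have h4 : (n : ℝ) * Real.log n ≤ n * Real.log (n + 1) := by gcongr
    push_cast
    constructor <;> nlinarith [ih.1, ih.2]

lemma sum_log_eq (n : ℕ) : ∑ m ∈ Icc 1 n, Real.log m = ∑ d ∈ Icc 1 n, vonMangoldt d * ((n / d : ℕ) : ℝ) := by
  have h1 : ∑ m ∈ Icc 1 n, Real.log m = ∑ m ∈ Icc 1 n, ∑ d ∈ Icc 1 n, if d ∣ m then vonMangoldt d else 0 := by
    refine sum_congr rfl fun m hm => ?_
    rw [mem_Icc] at hm
    rw [← ArithmeticFunction.vonMangoldt_sum, ← sum_filter]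
    refine sum_congr ?_ fun _ _ => rfl
    ext d
    simp only [Nat.mem_divisors, mem_filter, mem_Icc]
    constructor
    · rintro ⟨hd, _⟩
      exact ⟨⟨Nat.pos_of_dvd_of_pos hd (by omega), (Nat.le_of_dvd (by omega) hd).trans hm.2⟩, hd⟩
    · rintro ⟨_, hd⟩
      exact ⟨hd, by omega⟩
  rw [h1, sum_comm]
  refine sum_congr rfl fun d _ => ?_
  rw [← sum_filter, sum_const, nsmul_eq_mul, mul_comm]
  congr 2
  exact Nat.Ioc_filter_dvd_card_eq_div n d

noncomputable def BMe (n : ℕ) : ℝ := ∑ m ∈ Icc 1 n, vonMangoldt m / m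

lemma BMe_bounds (n : ℕ) (hn : 1 ≤ n) : |BMe n - Real.log n| ≤ 6 := by
  have hn0 : (0 : ℝ) < n := by exact_mod_cast hn
  obtain ⟨h1, h2⟩ := sum_log_bounds n
  rw [sum_log_eq] at h1 h2
  have h3 : ∑ d ∈ Icc 1 n, vonMangoldt d * ((n / d : ℕ) : ℝ) ≤ n * BMe n := by
    unfold BMe
    rw [mul_sum]
    refine sum_le_sum fun d hd => ?_
    have := Nat.cast_div_le (α := ℝ) (m := n) (n := d)
    calc _ ≤ vonMangoldt d * ((n : ℝ) / d) := mul_le_mul_of_nonneg_left this ArithmeticFunction.vonMangoldt_nonneg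
      _ = _ := by ring
  have h4 : n * BMe n ≤ ∑ d ∈ Icc 1 n, vonMangoldt d * ((n / d : ℕ) : ℝ) + ∑ d ∈ Icc 1 n, vonMangoldt d := by
    unfold BMe
    rw [mul_sum, ← sum_add_distrib]
    refine sum_le_sum fun d hd => ?_
    rw [mem_Icc] at hd
    have h5 : (n : ℝ) / d ≤ ((n / d : ℕ) : ℝ) + 1 := by
      rw [div_le_iff₀ (by exact_mod_cast hd.1)]
      have := Nat.lt_div_mul_add (a := n) (b := d) (by omega)
      have h6 : n ≤ (n / d + 1) * d := by
        rw [add_mul, one_mul]; omega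
      exact_mod_cast h6
    calc (n : ℝ) * (vonMangoldt d / d) = vonMangoldt d * ((n : ℝ) / d) := by ring
      _ ≤ vonMangoldt d * (((n / d : ℕ) : ℝ) + 1) := mul_le_mul_of_nonneg_left h5 ArithmeticFunction.vonMangoldt_nonneg
      _ = _ := by ring
  have h5 : ∑ d ∈ Icc 1 n, vonMangoldt d ≤ 6 * n := by
    have := Chebyshev.psi_le_const_mul_self (x := n) (by positivity)
    unfold Chebyshev.psi at this
    rw [Nat.floor_natCast] at this
    refine this.trans ?_
    have : Real.log 4 ≤ 2 := by
      rw [show (4 : ℝ) = 2 ^ 2 by norm_num, Real.log_pow]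
      have := Real.log_two_lt_d9
      push_cast
      linarith
    gcongr
    linarith
  rw [abs_le]
  constructor
  · have : n * (Real.log n - 1) ≤ n * BMe n := by linarith
    have := le_of_mul_le_mul_left this hn0
    linarith
  · have : n * BMe n ≤ n * (Real.log n + 6) := by linarith
    have := le_of_mul_le_mul_left this hn0
    linarith

lemma mertens_aux (a b : ℕ) (ha : 2 ≤ a) (hab : a ≤ b) :
    ∑ m ∈ Ioc a b, vonMangoldt m / (m * Real.log m) ≤
      Real.log (Real.log b) - Real.log (Real.log a) + (BMe b - Real.log b - 6) / Real.log b + 12 / Real.log a := by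
  induction b, hab using Nat.le_induction with
  | base =>
    have h1 := (abs_le.1 (BMe_bounds a (by omega))).1
    have h2 : 0 < Real.log a := Real.log_pos (by exact_mod_cast (by omega : 1 < a))
    rw [Ioc_self, sum_empty]
    have : 0 ≤ (BMe a - Real.log a - 6 + 12) / Real.log a := div_nonneg (by linarith) h2.le
    rw [add_div] at this
    linarith
  | succ b hab ih =>
    rw [sum_Ioc_succ_top (by omega)]
    have hb1 : (1 : ℝ) < b := by exact_mod_cast (by omega : 1 < b)
    have hl : 0 < Real.log b := Real.log_pos hb1
    have hl2 : Real.log b < Real.log (b + 1) := Real.log_lt_log (by linarith) (by linarith)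
    have hB : BMe (b + 1) = BMe b + vonMangoldt (b + 1) / ((b : ℝ) + 1) := by
      unfold BMe; rw [sum_Icc_succ_top (by omega)]; push_cast; rfl
    have hR := (abs_le.1 (BMe_bounds b (by omega))).2
    set l := Real.log b with hl_def
    push_cast
    set l' := Real.log ((b : ℝ) + 1) with hl'
    have hl0 : 0 < l' := hl.trans hl2
    set v := vonMangoldt (b + 1) / ((b : ℝ) + 1) with hv
    have e1 : vonMangoldt (b + 1) / (((b : ℝ) + 1) * l') = v / l' := by rw [hv, div_div]
    rw [e1, hB]
    have e2 : (l' - l) / l' ≤ Real.log l' - Real.log l := by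
      have h := Real.one_sub_inv_le_log_of_pos (x := l' / l) (by positivity)
      rw [Real.log_div (by positivity) (by positivity), inv_div] at h
      calc (l' - l) / l' = 1 - l / l' := by field_simp
        _ ≤ _ := h
    have e3 : (BMe b - l - 6) / l ≤ (BMe b - l - 6) / l' := by
      rw [div_le_div_iff₀ hl hl0]
      nlinarith
    have e4 : (BMe b + v - l' - 6) / l' = v / l' + (BMe b - l - 6) / l' - (l' - l) / l' := by
      field_simp; ring
    rw [e4]
    linarith

lemma mertens_sum (a b : ℕ) (ha : 2 ≤ a) (hab : a ≤ b) :
    ∑ p ∈ (Ioc a b).filter Nat.Prime, 1 / (p : ℝ) ≤ Real.log (Real.log b / Real.log a) + 12 / Real.log a := by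
  have ha0 : 0 < Real.log a := Real.log_pos (by exact_mod_cast (by omega : 1 < a))
  have hb0 : 0 < Real.log b := Real.log_pos (by exact_mod_cast (by omega : 1 < b))
  have h1 := mertens_aux a b ha hab
  have h2 := (abs_le.1 (BMe_bounds b (by omega))).2
  have h3 : (BMe b - Real.log b - 6) / Real.log b ≤ 0 := div_nonpos_of_nonpos_of_nonneg (by linarith) hb0.le
  rw [Real.log_div hb0.ne' ha0.ne']
  refine le_trans ?_ (by linarith : ∑ m ∈ Ioc a b, vonMangoldt m / (m * Real.log m) ≤ _)
  rw [sum_filter]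
  refine sum_le_sum fun m hm => ?_
  rw [mem_Ioc] at hm
  split_ifs with hp
  · have hm0 : 0 < Real.log m := Real.log_pos (by exact_mod_cast (by omega : 1 < m))
    rw [ArithmeticFunction.vonMangoldt_apply_prime hp]
    refine le_of_eq ?_
    have : (m : ℝ) ≠ 0 := by exact_mod_cast (by omega : m ≠ 0)
    field_simp
  · exact div_nonneg ArithmeticFunction.vonMangoldt_nonneg (mul_nonneg (by positivity) (Real.log_natCast_nonneg m))

lemma sum_inv_sq (a b : ℕ) (ha : 1 ≤ a) (hab : a ≤ b) : ∑ m ∈ Ioc a b, 1 / (m : ℝ) ^ 2 ≤ 1 / (a : ℝ) - 1 / (b : ℝ) := by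
  induction b, hab using Nat.le_induction with
  | base => simp
  | succ b hab ih =>
    rw [sum_Ioc_succ_top (by omega)]
    have hb : (0 : ℝ) < b := by exact_mod_cast (by omega : 0 < b)
    have : 1 / ((b + 1 : ℕ) : ℝ) ^ 2 ≤ 1 / (b : ℝ) - 1 / ((b + 1 : ℕ) : ℝ) := by
      push_cast
      rw [div_sub_div _ _ (by positivity) (by positivity), div_le_div_iff₀ (by positivity) (by positivity)]
      nlinarith
    linarith

/-- Mertens product bound: for `w ≤ z` large -/
lemma mertens_prod (ε : ℝ) (hε : 0 < ε) : ∃ u0 : ℕ, 4 ≤ u0 ∧ ∀ w z : ℕ, u0 ≤ w → w ≤ z →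
    ∏ p ∈ (Icc w z).filter Nat.Prime, (1 - 1 / ((p : ℝ) - 1))⁻¹ ≤ (1 + ε) * (Real.log z / Real.log w) := by
  have hlim : Filter.Tendsto (fun w : ℕ => Real.exp (20 / Real.log ((w : ℝ) - 1))) Filter.atTop (nhds (Real.exp 0)) := by
    refine (Real.continuous_exp.tendsto 0).comp ?_
    refine Filter.Tendsto.div_atTop tendsto_const_nhds ?_
    refine Real.tendsto_log_atTop.comp ?_
    exact Filter.tendsto_atTop_add_const_right _ _ tendsto_natCast_atTop_atTop
  rw [Real.exp_zero] at hlim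
  have hev := hlim.eventually (gt_mem_nhds (by linarith : (1 : ℝ) < 1 + ε))
  obtain ⟨u1, hu1⟩ := Filter.eventually_atTop.1 hev
  refine ⟨max u1 4, le_max_right _ _, fun w z hw hwz => ?_⟩
  have hw4 : 4 ≤ w := (le_max_right _ _).trans hw
  have h1 := hu1 w ((le_max_left _ _).trans hw)
  obtain ⟨a, rfl⟩ : ∃ a, w = a + 1 := ⟨w - 1, by omega⟩
  have ha : 3 ≤ a := by omega
  have hI : Icc (a + 1) z = Ioc a z := by ext; simp only [mem_Icc, mem_Ioc]; omega
  rw [hI]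
  push_cast at h1
  rw [add_sub_cancel_right] at h1
  have ha3 : (3 : ℝ) ≤ a := by exact_mod_cast ha
  have la : 0 < Real.log a := Real.log_pos (by linarith)
  have la1 : Real.log a ≤ Real.log ((a + 1 : ℕ) : ℝ) := Real.log_le_log (by linarith) (by push_cast; linarith)
  have la0 : 0 < Real.log ((a + 1 : ℕ) : ℝ) := la.trans_le la1
  have laa : Real.log a ≤ a := (Real.log_le_sub_one_of_pos (by linarith)).trans (by linarith)
  have lz0 : 0 < Real.log z := la0.trans_le (Real.log_le_log (by positivity) (by exact_mod_cast hwz))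
  have h2 : ∏ p ∈ (Ioc a z).filter Nat.Prime, (1 - 1 / ((p : ℝ) - 1))⁻¹ ≤
      ∏ p ∈ (Ioc a z).filter Nat.Prime, Real.exp (1 / (p : ℝ) + 6 * (1 / (p : ℝ) ^ 2)) := by
    refine prod_le_prod (fun p hp => ?_) fun p hp => ?_
    · simp only [mem_filter, mem_Ioc] at hp
      have : (4 : ℝ) ≤ p := by exact_mod_cast (by omega : 4 ≤ p)
      rw [inv_nonneg, sub_nonneg, div_le_one (by linarith)]
      linarith
    · simp only [mem_filter, mem_Ioc] at hp
      have hp4 : (4 : ℝ) ≤ p := by exact_mod_cast (by omega : 4 ≤ p)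
      have e1 : (1 - 1 / ((p : ℝ) - 1))⁻¹ = 1 / (p - 2) + 1 := by
        have : (p : ℝ) - 1 ≠ 0 := by linarith
        have : (p : ℝ) - 2 ≠ 0 := by linarith
        rw [one_sub_div (by assumption), inv_div, show (p : ℝ) - 1 - 1 = p - 2 by ring]
        field_simp
        ring
      rw [e1]
      refine le_trans ?_ (Real.add_one_le_exp _)
      have e2 : 1 / ((p : ℝ) - 2) ≤ 1 / (p : ℝ) + 6 * (1 / (p : ℝ) ^ 2) := by
        have : 1 / (p : ℝ) + 6 * (1 / (p : ℝ) ^ 2) = (p + 6) / p ^ 2 := by field_simp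
        rw [this, div_le_div_iff₀ (by linarith) (by positivity)]
        nlinarith
      linarith
  rw [← Real.exp_sum, sum_add_distrib, ← mul_sum] at h2
  have h3 := mertens_sum a z (by omega) (by omega)
  have h4 : ∑ p ∈ (Ioc a z).filter Nat.Prime, 1 / (p : ℝ) ^ 2 ≤ 1 / (a : ℝ) :=
    (sum_le_sum_of_subset_of_nonneg (filter_subset _ _) fun _ _ _ => by positivity).trans
      ((sum_inv_sq a z (by omega) (by omega)).trans (by have : (0:ℝ) ≤ 1 / z := by positivity
                                                        linarith))
  have h5 : 1 / (a : ℝ) ≤ 1 / Real.log a := one_div_le_one_div_of_le la laa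
  have h6 : Real.log (Real.log z / Real.log a) ≤ Real.log (Real.log z / Real.log ((a + 1 : ℕ) : ℝ)) + 1 / Real.log a := by
    have e1 : Real.log z / Real.log a = Real.log z / Real.log ((a + 1 : ℕ) : ℝ) * (Real.log ((a + 1 : ℕ) : ℝ) / Real.log a) := by
      field_simp
    rw [e1, Real.log_mul (by positivity) (by positivity)]
    have e2 : Real.log (Real.log ((a + 1 : ℕ) : ℝ) / Real.log a) ≤ 1 / Real.log a := by
      refine (Real.log_le_sub_one_of_pos (by positivity)).trans ?_
      rw [div_sub_one la.ne']
      refine div_le_div_of_nonneg_right ?_ la.le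
      rw [← Real.log_div (by positivity) (by positivity)]
      refine (Real.log_le_sub_one_of_pos (by positivity)).trans ?_
      push_cast
      rw [add_div, div_self (by positivity)]
      have : 1 / (a : ℝ) ≤ 1 := by rw [div_le_one (by positivity)]; linarith
      linarith
    linarith
  refine h2.trans ?_
  have h7 : 12 / Real.log a + 6 * (1 / a) + 1 / Real.log a ≤ 20 / Real.log a := by
    have : 20 / Real.log a = 12 / Real.log a + 6 * (1 / Real.log a) + 1 / Real.log a + 1 / Real.log a := by field_simp; norm_num
    rw [this]
    have : 0 < 1 / Real.log a := by positivity
    linarith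
  calc _ ≤ Real.exp (Real.log (Real.log z / Real.log ((a + 1 : ℕ) : ℝ)) + 20 / Real.log a) := by
        apply Real.exp_le_exp.2
        linarith
    _ = (Real.log z / Real.log ((a + 1 : ℕ) : ℝ)) * Real.exp (20 / Real.log a) := by
        rw [Real.exp_add, Real.exp_log (by positivity)]
    _ ≤ (Real.log z / Real.log ((a + 1 : ℕ) : ℝ)) * (1 + ε) := by
        gcongr
    _ = _ := by ring

end SPC

namespace SPC
open Finset

open Classical in
/-- truncated Buchstab iteration (linear sieve); `false` lower, `true` upper -/
noncomputable def TS (P : ℕ → Prop) (A : ℕ → ℝ) : ℕ → Bool → ℝ → ℕ → ℝ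
  | 0, _, _, e => A e
  | z + 1, false, D, e => TS P A z false D e - if P z then TS P A z true (D / z) (e * z) else 0
  | z + 1, true, D, e => TS P A z true D e - if P z ∧ (z : ℝ) ^ 3 < D then TS P A z false (D / z) (e * z) else 0

open Classical in
noncomputable def SS (P : ℕ → Prop) : ℕ → Finset ℕ
  | 0 => {1}
  | z + 1 => SS P z ∪ if P z then (SS P z).image (fun d => d * z) else ∅

open Classical in
/-- the same iteration at the level of densities -/
noncomputable def TV (P : ℕ → Prop) (g : ℕ → ℝ) : ℕ → Bool → ℝ → ℝ
  | 0, _, _ => 1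
  | z + 1, false, D => TV P g z false D - if P z then g z * TV P g z true (D / z) else 0
  | z + 1, true, D => TV P g z true D - if P z ∧ (z : ℝ) ^ 3 < D then g z * TV P g z false (D / z) else 0

lemma TS_add (P : ℕ → Prop) (A B : ℕ → ℝ) (z : ℕ) : ∀ b D e, TS P (fun d => A d + B d) z b D e = TS P A z b D e + TS P B z b D e := by
  induction z with
  | zero => intro b D e; simp only [TS]
  | succ z ih =>
    intro b D e
    cases b <;> simp only [TS, ih] <;> split_ifs <;> ring

lemma TS_sum (P : ℕ → Prop) {ι : Type*} (s : Finset ι) (c : ι → ℝ) (A : ι → ℕ → ℝ) (z : ℕ) : ∀ b D e,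
    TS P (fun d => ∑ i ∈ s, c i * A i d) z b D e = ∑ i ∈ s, c i * TS P (A i) z b D e := by
  induction z with
  | zero => intro b D e; simp only [TS]
  | succ z ih =>
    intro b D e
    cases b <;> simp only [TS, ih] <;> split_ifs <;> simp [mul_sub, sum_sub_distrib]

lemma SS_mem (P : ℕ → Prop) (hP : ∀ p, P p → p.Prime) (z : ℕ) : ∀ d ∈ SS P z, 1 ≤ d ∧ ∀ p : ℕ, p.Prime → p ∣ d → P p ∧ p < z := by
  induction z with
  | zero =>
    intro d hd
    simp only [SS, mem_singleton] at hd
    subst hd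
    exact ⟨le_rfl, fun p hp h => absurd (Nat.dvd_one.1 h) hp.ne_one⟩
  | succ z ih =>
    intro d hd
    simp only [SS, mem_union] at hd
    rcases hd with hd | hd
    · obtain ⟨h1, h2⟩ := ih d hd
      exact ⟨h1, fun p hp h => ⟨(h2 p hp h).1, (h2 p hp h).2.trans (by omega)⟩⟩
    · split_ifs at hd with hz
      · rw [mem_image] at hd
        obtain ⟨d', hd', rfl⟩ := hd
        obtain ⟨h1, h2⟩ := ih d' hd'
        have hzp := hP z hz
        refine ⟨Nat.mul_pos h1 hzp.pos, fun p hp h => ?_⟩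
        rcases (Nat.Prime.dvd_mul hp).1 h with h | h
        · exact ⟨(h2 p hp h).1, (h2 p hp h).2.trans (by omega)⟩
        · rw [Nat.prime_dvd_prime_iff_eq hp hzp] at h
          subst h
          exact ⟨hz, by omega⟩
      · simp at hd

open Classical in
lemma SS_sum_succ (P : ℕ → Prop) (hP : ∀ p, P p → p.Prime) (z : ℕ) (F : ℕ → ℝ) :
    ∑ d ∈ SS P (z + 1), F d = ∑ d ∈ SS P z, F d + if P z then ∑ d ∈ SS P z, F (d * z) else 0 := by
  simp only [SS]
  split_ifs with hz
  · have hzp := hP z hz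
    rw [sum_union, sum_image]
    · intro a _ b _ hab
      exact Nat.eq_of_mul_eq_mul_right hzp.pos hab
    · rw [disjoint_left]
      intro d hd hd2
      rw [mem_image] at hd2
      obtain ⟨d', _, rfl⟩ := hd2
      have := ((SS_mem P hP z _ hd).2 z hzp (Dvd.intro_left _ rfl)).2
      omega
  · simp

lemma TS_abs (P : ℕ → Prop) (hP : ∀ p, P p → p.Prime) (A : ℕ → ℝ) (z : ℕ) : ∀ (b : Bool) (D : ℝ) (e : ℕ), 1 ≤ D →
    (b = false → (z : ℝ) ^ 2 ≤ D) → (b = true → (z : ℝ) ≤ D) →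
    |TS P A z b D e| ≤ ∑ d ∈ SS P z, if (d : ℝ) ≤ D then |A (e * d)| else 0 := by
  induction z with
  | zero =>
    intro b D e hD _ _
    simp [TS, SS, hD]
  | succ z ih =>
    intro b D e hD h1 h2
    rw [SS_sum_succ P hP]
    have hz0 : (0 : ℝ) ≤ z := by positivity
    have key : ∀ b' : Bool, P z → 1 ≤ D / z → (b' = false → (z : ℝ) ^ 2 ≤ D / z) → (b' = true → (z : ℝ) ≤ D / z) →
        |TS P A z b' (D / z) (e * z)| ≤ ∑ d ∈ SS P z, if ((d * z : ℕ) : ℝ) ≤ D then |A (e * (d * z))| else 0 := by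
      intro b' hz k1 k2 k3
      have hzp : (0 : ℝ) < z := by exact_mod_cast (hP z hz).pos
      refine (ih b' (D / z) (e * z) k1 k2 k3).trans (le_of_eq (sum_congr rfl fun d _ => ?_))
      have e1 : ((d : ℝ) ≤ D / z) ↔ ((d * z : ℕ) : ℝ) ≤ D := by rw [le_div_iff₀ hzp]; push_cast; rfl
      simp only [e1]
      rw [mul_assoc, mul_comm z d]
    have hnn : 0 ≤ ∑ d ∈ SS P z, if ((d * z : ℕ) : ℝ) ≤ D then |A (e * (d * z))| else 0 :=
      sum_nonneg fun d _ => by split_ifs <;> positivity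
    cases b
    · have hD2 := h1 rfl
      push_cast at hD2
      simp only [TS]
      have i1 := ih false D e hD (fun _ => by nlinarith) (by simp)
      split_ifs with hz
      · have hzp : (2 : ℝ) ≤ z := by exact_mod_cast (hP z hz).two_le
        have k := key true hz (by rw [le_div_iff₀ (by linarith)]; nlinarith) (by simp)
          (fun _ => by rw [le_div_iff₀ (by linarith)]; nlinarith)
        refine (abs_sub _ _).trans (add_le_add i1 k)
      · simpa using i1
    · have hD2 := h2 rfl
      push_cast at hD2
      simp only [TS]
      have i1 := ih true D e hD (by simp) (fun _ => by linarith)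
      by_cases hz : P z
      · have hzp : (2 : ℝ) ≤ z := by exact_mod_cast (hP z hz).two_le
        rw [if_pos hz]
        by_cases hc : (z : ℝ) ^ 3 < D
        · rw [if_pos ⟨hz, hc⟩]
          have k := key false hz (by rw [le_div_iff₀ (by linarith)]; linarith)
            (fun _ => by rw [le_div_iff₀ (by linarith)]; nlinarith) (by simp)
          exact (abs_sub _ _).trans (add_le_add i1 k)
        · rw [if_neg (fun h => hc h.2), sub_zero]
          linarith
      · rw [if_neg (fun h => hz h.1), if_neg hz]
        simpa using i1

lemma TS_mult (P : ℕ → Prop) (hP : ∀ p, P p → p.Prime) (G g : ℕ → ℝ) (hG : ∀ e p, P p → e.Coprime p → G (e * p) = G e * g p) (z : ℕ) :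
    ∀ (b : Bool) (D : ℝ) (e : ℕ), (∀ q < z, P q → e.Coprime q) → TS P G z b D e = G e * TV P g z b D := by
  induction z with
  | zero => intro b D e _; simp [TS, TV]
  | succ z ih =>
    intro b D e he
    have h1 : ∀ q < z, P q → e.Coprime q := fun q hq => he q (by omega)
    have h2 : P z → ∀ q < z, P q → (e * z).Coprime q := fun hz q hq hPq =>
      Nat.Coprime.mul_left (h1 q hq hPq) ((Nat.coprime_primes (hP z hz) (hP q hPq)).2 (by omega))
    cases b
    · simp only [TS, TV, ih _ _ _ h1]
      split_ifs with hz
      · rw [ih _ _ _ (h2 hz), hG e z hz (he z (by omega) hz)]; ring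
      · ring
    · simp only [TS, TV, ih _ _ _ h1]
      split_ifs with hz
      · rw [ih _ _ _ (h2 hz.1), hG e z hz.1 (he z (by omega) hz.1)]; ring
      · ring

open Classical in
noncomputable def sI (P : ℕ → Prop) (z n : ℕ) : ℝ := if ∀ q < z, P q → ¬ q ∣ n then 1 else 0

open Classical in
lemma sI_succ (P : ℕ → Prop) (z n : ℕ) : sI P (z + 1) n = sI P z n - if P z then (if z ∣ n then 1 else 0) * sI P z n else 0 := by
  unfold sI
  have h : (∀ q < z + 1, P q → ¬ q ∣ n) ↔ (∀ q < z, P q → ¬ q ∣ n) ∧ (P z → ¬ z ∣ n) := by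
    constructor
    · exact fun h => ⟨fun q hq => h q (by omega), h z (by omega)⟩
    · rintro ⟨h1, h2⟩ q hq
      rcases Nat.lt_succ_iff_lt_or_eq.1 hq with h | h
      · exact h1 q h
      · subst h; exact h2
  rw [if_congr h rfl rfl]
  by_cases h1 : ∀ q < z, P q → ¬ q ∣ n <;> by_cases h2 : P z <;> by_cases h3 : z ∣ n <;> simp [h1, h2, h3]

open Classical in
lemma TS_sieve (P : ℕ → Prop) (hP : ∀ p, P p → p.Prime) (n : ℕ) (z : ℕ) :
    ∀ (D : ℝ) (e : ℕ), (∀ q < z, P q → e.Coprime q) →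
      TS P (fun d => if d ∣ n then 1 else 0) z false D e ≤ (if e ∣ n then 1 else 0) * sI P z n ∧
      (if e ∣ n then 1 else 0) * sI P z n ≤ TS P (fun d => if d ∣ n then 1 else 0) z true D e := by
  induction z with
  | zero => intro D e _; simp [TS, sI]
  | succ z ih =>
    intro D e he
    have h1 : ∀ q < z, P q → e.Coprime q := fun q hq => he q (by omega)
    have h2 : P z → ∀ q < z, P q → (e * z).Coprime q := fun hz q hq hPq =>
      Nat.Coprime.mul_left (h1 q hq hPq) ((Nat.coprime_primes (hP z hz) (hP q hPq)).2 (by omega))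
    have hA : P z → (if e * z ∣ n then (1 : ℝ) else 0) = (if e ∣ n then 1 else 0) * (if z ∣ n then 1 else 0) := by
      intro hz
      have := he z (by omega) hz
      have h3 : e * z ∣ n ↔ e ∣ n ∧ z ∣ n := ⟨fun h => ⟨dvd_of_mul_right_dvd h, dvd_of_mul_left_dvd h⟩, fun h => this.mul_dvd_of_dvd_of_dvd h.1 h.2⟩
      rw [if_congr h3 rfl rfl]
      by_cases k1 : e ∣ n <;> by_cases k2 : z ∣ n <;> simp [k1, k2]
    rw [sI_succ]
    have i1 := ih D e h1
    have hs0 : 0 ≤ sI P z n := by unfold sI; split_ifs <;> norm_num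
    constructor
    · simp only [TS]
      by_cases hz : P z
      · have i2 := (ih (D / z) (e * z) (h2 hz)).2
        rw [hA hz] at i2
        rw [if_pos hz, if_pos hz, mul_sub, ← mul_assoc]
        linarith [i1.1]
      · rw [if_neg hz, if_neg hz, sub_zero, sub_zero]
        exact i1.1
    · simp only [TS]
      by_cases hz : P z
      · by_cases hc : (z : ℝ) ^ 3 < D
        · have i2 := (ih (D / z) (e * z) (h2 hz)).1
          rw [hA hz] at i2
          rw [if_pos (c := P z) hz, if_pos (c := P z ∧ (z : ℝ) ^ 3 < D) ⟨hz, hc⟩, mul_sub, ← mul_assoc]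
          linarith [i1.2]
        · rw [if_pos (c := P z) hz, if_neg (c := P z ∧ (z : ℝ) ^ 3 < D) (fun h => hc h.2), sub_zero, mul_sub]
          have : 0 ≤ (if e ∣ n then (1 : ℝ) else 0) * ((if z ∣ n then 1 else 0) * sI P z n) := by
            refine mul_nonneg (by split_ifs <;> norm_num) (mul_nonneg (by split_ifs <;> norm_num) hs0)
          linarith [i1.2]
      · rw [if_neg (c := P z) hz, if_neg (c := P z ∧ (z : ℝ) ^ 3 < D) (fun h => hz h.1), sub_zero, sub_zero]
        exact i1.2

open Classical in
noncomputable def gam (P : ℕ → Prop) (g : ℕ → ℝ) (w : ℕ) : ℝ := if P w then g w else 0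

noncomputable def VV (P : ℕ → Prop) (g : ℕ → ℝ) : ℕ → ℝ
  | 0 => 1
  | z + 1 => VV P g z - gam P g z * VV P g z

lemma VV_eq (P : ℕ → Prop) (g : ℕ → ℝ) (z : ℕ) : VV P g z = 1 - ∑ w ∈ range z, gam P g w * VV P g w := by
  induction z with
  | zero => simp [VV]
  | succ z ih => rw [sum_range_succ, VV]; linarith

lemma TV_false_eq (P : ℕ → Prop) (g : ℕ → ℝ) (D : ℝ) (z : ℕ) :
    TV P g z false D = 1 - ∑ w ∈ range z, gam P g w * TV P g w true (D / w) := by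
  induction z with
  | zero => simp [TV]
  | succ z ih =>
    rw [sum_range_succ, TV, ih, gam]
    split_ifs <;> ring

open Classical in
lemma TV_true_eq (P : ℕ → Prop) (g : ℕ → ℝ) (D : ℝ) (z : ℕ) :
    TV P g z true D = 1 - ∑ w ∈ range z, if (w : ℝ) ^ 3 < D then gam P g w * TV P g w false (D / w) else 0 := by
  induction z with
  | zero => simp [TV]
  | succ z ih =>
    rw [sum_range_succ, TV, ih, gam]
    by_cases h1 : P z <;> by_cases h2 : (z : ℝ) ^ 3 < D <;> simp [h1, h2]
    ring

lemma VV_pos (P : ℕ → Prop) (g : ℕ → ℝ) (hg : ∀ p, P p → 0 ≤ g p ∧ g p < 1) (z : ℕ) : 0 < VV P g z := by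
  induction z with
  | zero => simp [VV]
  | succ z ih =>
    have : gam P g z < 1 := by
      unfold gam; split_ifs with h
      · exact (hg z h).2
      · norm_num
    rw [VV]; nlinarith

lemma gam_nonneg (P : ℕ → Prop) (g : ℕ → ℝ) (hg : ∀ p, P p → 0 ≤ g p ∧ g p < 1) (z : ℕ) : 0 ≤ gam P g z := by
  unfold gam; split_ifs with h
  · exact (hg z h).1
  · norm_num

lemma abel_nonneg (δ E : ℕ → ℝ) (a z : ℕ) (haz : a ≤ z) (hδ : ∀ w, a ≤ w → w ≤ z → 0 ≤ δ w) (hE0 : ∀ w, 0 ≤ E w)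
    (hE : ∀ w, a ≤ w → w < z → E w ≤ E (w + 1)) :
    0 ≤ ∑ w ∈ Ico a z, (δ w - δ (w + 1)) * E w + δ z * E z := by
  induction z, haz using Nat.le_induction with
  | base => simpa using mul_nonneg (hδ a le_rfl le_rfl) (hE0 a)
  | succ z hz ih =>
    have i := ih (fun w h1 h2 => hδ w h1 (by omega)) (fun w h1 h2 => hE w h1 (by omega))
    rw [sum_Ico_succ_top hz]
    have := mul_le_mul_of_nonneg_left (hE z hz (by omega)) (hδ (z + 1) (by omega) le_rfl)
    linarith

lemma tele_le (f F : ℕ → ℝ) (a z : ℕ) (haz : a ≤ z) (h : ∀ w, a ≤ w → w < z → f w ≤ F (w + 1) - F w) :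
    ∑ w ∈ Ico a z, f w ≤ F z - F a := by
  induction z, haz using Nat.le_induction with
  | base => simp
  | succ z hz ih =>
    rw [sum_Ico_succ_top hz]
    have := ih (fun w h1 h2 => h w h1 (by omega))
    have := h z hz (by omega)
    linarith

/-- weighted sum over densities -/
lemma dens_sum (P : ℕ → Prop) (hP : ∀ p, P p → p.Prime) (g : ℕ → ℝ) (hg : ∀ p, P p → 0 ≤ g p ∧ g p < 1) (ε : ℝ) (hε : 0 ≤ ε)
    (H : ∀ w z : ℕ, 2 ≤ w → w ≤ z → VV P g w * Real.log w ≤ (1 + ε) * Real.log z * VV P g (z + 1))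
    (E IE : ℝ → ℝ) (hE : Antitone E) (hE0 : ∀ s, 0 ≤ E s) (hI0 : ∀ s, 0 ≤ IE s)
    (hI : ∀ t t', t ≤ t' → (t' - t) * E t' ≤ IE t - IE t') (z : ℕ) (D ℓ : ℝ) (hD : 1 < D) (hℓ : 0 < ℓ)
    (hz : ∀ w, w < z → Real.log w ≤ ℓ) :
    ∑ w ∈ range z, gam P g w * (VV P g w * E (Real.log D / Real.log w - 1)) ≤
      VV P g z * ((1 + ε) * (1 / (Real.log D / ℓ)) * IE (Real.log D / ℓ - 1) + ε * E (Real.log D / ℓ - 1)) := by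
  have hlD : 0 < Real.log D := Real.log_pos hD
  set s := Real.log D / ℓ with hs
  have hs0 : 0 < s := by positivity
  have hV := VV_pos P g hg
  have hg0 : ∀ w, w < 2 → gam P g w = 0 := by
    intro w hw
    unfold gam
    rw [if_neg]
    intro h
    have := (hP w h).two_le
    omega
  rcases Nat.lt_or_ge z 2 with h2 | h2
  · rw [sum_eq_zero (fun w hw => by rw [hg0 w (by have := mem_range.1 hw; omega), zero_mul])]
    have := hI0 (s - 1)
    have := hE0 (s - 1)
    have := (hV z).le
    positivity
  classical
  have hsplit : ∑ w ∈ range z, gam P g w * (VV P g w * E (Real.log D / Real.log w - 1)) =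
      ∑ w ∈ Ico 2 z, gam P g w * (VV P g w * E (Real.log D / Real.log w - 1)) := by
    rw [range_eq_Ico]
    symm
    apply sum_subset (Ico_subset_Ico_left (by norm_num))
    intro w h1 h3
    rw [hg0 w (by simp only [mem_Ico] at h1 h3; omega), zero_mul]
  rw [hsplit]
  set τ : ℕ → ℝ := fun w => if w < z then Real.log D / Real.log w else s with hτ
  have hτz : τ z = s := by simp [hτ]
  have hτw : ∀ w, w < z → τ w = Real.log D / Real.log w := fun w hw => by simp [hτ, hw]
  have hlog : ∀ w : ℕ, 2 ≤ w → 0 < Real.log w := fun w hw => Real.log_pos (by exact_mod_cast hw)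
  have hτa : ∀ w, 2 ≤ w → w < z → τ (w + 1) ≤ τ w := by
    intro w hw hwz
    rw [hτw w hwz]
    rcases Nat.lt_or_ge (w + 1) z with h | h
    · rw [hτw _ h]
      exact div_le_div_of_nonneg_left hlD.le (hlog w hw) (Real.log_le_log (by positivity) (by push_cast; linarith))
    · have : w + 1 = z := by omega
      rw [this, hτz]
      exact div_le_div_of_nonneg_left hlD.le (hlog w hw) (hz w hwz)
  set δ : ℕ → ℝ := fun w => (1 + ε) * (1 / s) * VV P g z * τ w - VV P g w with hδ
  have hδ0 : ∀ w, 2 ≤ w → w ≤ z → 0 ≤ δ w := by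
    intro w hw hwz
    simp only [hδ]
    rcases Nat.lt_or_ge w z with h | h
    · rw [hτw w h]
      have h1 := H w (z - 1) hw (by omega)
      rw [show z - 1 + 1 = z by omega] at h1
      have h3 := hz (z - 1) (by omega)
      have h4 : VV P g w * Real.log w ≤ (1 + ε) * ℓ * VV P g z := by
        refine h1.trans ?_
        have := (hV z).le
        gcongr
      have h5 : (1 + ε) * (1 / s) * VV P g z * (Real.log D / Real.log w) = (1 + ε) * ℓ * VV P g z / Real.log w := by
        rw [hs]; field_simp
      rw [h5, sub_nonneg, le_div_iff₀ (hlog w hw)]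
      exact h4
    · have : w = z := by omega
      subst this
      rw [hτz]
      have h5 : (1 + ε) * (1 / s) * VV P g w * s = (1 + ε) * VV P g w := by field_simp
      rw [h5]
      nlinarith [hV w]
  have hab := abel_nonneg δ (fun w => E (τ w - 1)) 2 z h2 hδ0 (fun w => hE0 _) (fun w h1 h3 => hE (by linarith [hτa w h1 h3]))
  have htel := tele_le (fun w => (τ w - τ (w + 1)) * E (τ w - 1)) (fun w => IE (τ w - 1)) 2 z h2
    (fun w h1 h3 => by
      have := hI (τ (w + 1) - 1) (τ w - 1) (by linarith [hτa w h1 h3])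
      linarith)
  simp only [hτz] at hab htel
  have hδz : δ z = ε * VV P g z := by
    simp only [hδ, hτz]; field_simp; ring
  rw [hδz] at hab
  have heq : ∑ w ∈ Ico 2 z, (δ w - δ (w + 1)) * E (τ w - 1) = (1 + ε) * (1 / s) * VV P g z * ∑ w ∈ Ico 2 z, (τ w - τ (w + 1)) * E (τ w - 1) -
      ∑ w ∈ Ico 2 z, gam P g w * (VV P g w * E (Real.log D / Real.log w - 1)) := by
    rw [mul_sum, ← sum_sub_distrib]
    refine sum_congr rfl fun w hw => ?_
    rw [← hτw w (mem_Ico.1 hw).2]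
    simp only [hδ, VV]
    ring
  rw [heq] at hab
  have h6 : (1 + ε) * (1 / s) * VV P g z * ∑ w ∈ Ico 2 z, (τ w - τ (w + 1)) * E (τ w - 1) ≤ (1 + ε) * (1 / s) * VV P g z * IE (s - 1) := by
    have := (hV z).le
    refine mul_le_mul_of_nonneg_left ?_ (by positivity)
    linarith [hI0 (τ 2 - 1)]
  linarith

/-- fundamental density bound -/
lemma TV_bound (P : ℕ → Prop) (hP : ∀ p, P p → p.Prime) (g : ℕ → ℝ) (hg : ∀ p, P p → 0 ≤ g p ∧ g p < 1) (ε : ℝ) (hε : 0 ≤ ε)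
    (H : ∀ w z : ℕ, 2 ≤ w → w ≤ z → VV P g w * Real.log w ≤ (1 + ε) * Real.log z * VV P g (z + 1))
    (E IE f If : ℝ → ℝ) (hE : Antitone E) (hE0 : ∀ s, 0 ≤ E s) (hIE0 : ∀ s, 0 ≤ IE s)
    (hIE : ∀ t t', t ≤ t' → (t' - t) * E t' ≤ IE t - IE t')
    (hf : Antitone f) (hf0 : ∀ s, 0 ≤ f s) (hIf0 : ∀ s, 0 ≤ If s)
    (hIf : ∀ t t', t ≤ t' → (t' - t) * f t' ≤ If t - If t')
    (hA : ∀ s, 2 ≤ s → (1 + ε) * (1 / s) * IE (s - 1) + ε * E (s - 1) ≤ f s)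
    (hB : ∀ s, 3 ≤ s → (1 + ε) * (1 / s) * If (s - 1) + ε * f (s - 1) ≤ E s)
    (hC : ∀ s, 1 ≤ s → s ≤ 3 → (1 + ε) * (3 / s) * (1 + ((1 + ε) * (1 / 3) * If (3 - 1) + ε * f (3 - 1))) ≤ 1 + E s)
    (z : ℕ) : ∀ D : ℝ, ((z : ℝ) ^ 2 ≤ D → VV P g z * (1 - f (Real.log D / Real.log z)) ≤ TV P g z false D) ∧
      ((z : ℝ) ≤ D → TV P g z true D ≤ VV P g z * (1 + E (Real.log D / Real.log z))) := by
  classical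
  have hV := VV_pos P g hg
  have hγ := gam_nonneg P g hg
  have hg0 : ∀ w, w < 2 → gam P g w = 0 := by
    intro w hw
    unfold gam
    rw [if_neg]
    intro h
    have := (hP w h).two_le
    omega
  induction z using Nat.strong_induction_on with
  | _ z ih =>
  intro D
  rcases Nat.lt_or_ge z 3 with hz3 | hz3
  · have hzero : ∀ F : ℕ → ℝ, ∑ w ∈ range z, gam P g w * F w = 0 := fun F =>
      sum_eq_zero (fun w hw => by rw [hg0 w (by have := mem_range.1 hw; omega), zero_mul])
    have hv1 : VV P g z = 1 := by rw [VV_eq, hzero, sub_zero]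
    have ht1 : TV P g z false D = 1 := by rw [TV_false_eq, hzero, sub_zero]
    have ht2 : TV P g z true D = 1 := by
      rw [TV_true_eq, sum_eq_zero, sub_zero]
      intro w hw
      rw [hg0 w (by have := mem_range.1 hw; omega), zero_mul, ite_self]
    rw [hv1, ht1, ht2]
    exact ⟨fun _ => by linarith [hf0 (Real.log D / Real.log z)], fun _ => by linarith [hE0 (Real.log D / Real.log z)]⟩
  have hz3' : (3 : ℝ) ≤ z := by exact_mod_cast hz3
  have hlz : 0 < Real.log z := Real.log_pos (by linarith)
  have hlogdiv : ∀ w : ℕ, 2 ≤ w → 0 < D → Real.log (D / w) / Real.log w = Real.log D / Real.log w - 1 := by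
    intro w hw hD
    have h2 : (2 : ℝ) ≤ w := by exact_mod_cast hw
    have : 0 < Real.log w := Real.log_pos (by linarith)
    rw [Real.log_div hD.ne' (by linarith)]
    field_simp
  constructor
  · intro hD
    have hD1 : 1 < D := by nlinarith
    have hlD : 0 < Real.log D := Real.log_pos hD1
    have hs2 : 2 ≤ Real.log D / Real.log z := by
      rw [le_div_iff₀ hlz]
      have := Real.log_le_log (by positivity) hD
      rw [Real.log_pow] at this
      exact_mod_cast this
    have hds := dens_sum P hP g hg ε hε H E IE hE hE0 hIE0 hIE z D (Real.log z) hD1 hlz (fun w hw => by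
      rcases Nat.eq_zero_or_pos w with h | h
      · simp only [h, Nat.cast_zero, Real.log_zero]; exact hlz.le
      · exact Real.log_le_log (by exact_mod_cast h) (by exact_mod_cast hw.le))
    have h1 := mul_le_mul_of_nonneg_left (hA _ hs2) (hV z).le
    rw [TV_false_eq]
    have h2 : ∑ w ∈ range z, gam P g w * TV P g w true (D / w) ≤ ∑ w ∈ range z, gam P g w * VV P g w +
        ∑ w ∈ range z, gam P g w * (VV P g w * E (Real.log D / Real.log w - 1)) := by
      rw [← sum_add_distrib]
      refine sum_le_sum fun w hw => ?_
      rw [mem_range] at hw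
      rcases Nat.lt_or_ge w 2 with hw2 | hw2
      · simp [hg0 w hw2]
      · rw [← mul_add]
        refine mul_le_mul_of_nonneg_left ?_ (hγ w)
        have hw2' : (2 : ℝ) ≤ w := by exact_mod_cast hw2
        have hwz : (w : ℝ) ≤ z := by exact_mod_cast hw.le
        have := (ih w hw (D / w)).2 (by rw [le_div_iff₀ (by linarith)]; nlinarith)
        rw [hlogdiv w hw2 (by linarith)] at this
        linarith
    have h3 := VV_eq P g z
    nlinarith
  · intro hD
    have hD1 : 1 < D := by linarith
    have hlD : 0 < Real.log D := Real.log_pos hD1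
    -- bound at the next level whenever all smaller w have w^3 < D
    have key : ∀ z' ≤ z, ∀ ℓ, 0 < ℓ → (∀ w, w < z' → (w : ℝ) ^ 3 < D) → (∀ w : ℕ, w < z' → Real.log w ≤ ℓ) →
        TV P g z' true D ≤ VV P g z' * (1 + ((1 + ε) * (1 / (Real.log D / ℓ)) * If (Real.log D / ℓ - 1) + ε * f (Real.log D / ℓ - 1))) := by
      intro z' hz' ℓ hℓ hcube hlog
      have hds := dens_sum P hP g hg ε hε H f If hf hf0 hIf0 hIf z' D ℓ hD1 hℓ hlog
      rw [TV_true_eq]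
      have h2 : ∑ w ∈ range z', gam P g w * VV P g w - ∑ w ∈ range z', gam P g w * (VV P g w * f (Real.log D / Real.log w - 1)) ≤
          ∑ w ∈ range z', (if (w : ℝ) ^ 3 < D then gam P g w * TV P g w false (D / w) else 0) := by
        rw [← sum_sub_distrib]
        refine sum_le_sum fun w hw => ?_
        rw [mem_range] at hw
        rw [if_pos (hcube w hw)]
        rcases Nat.lt_or_ge w 2 with hw2 | hw2
        · simp [hg0 w hw2]
        · rw [← mul_sub]
          refine mul_le_mul_of_nonneg_left ?_ (hγ w)
          have hw2' : (2 : ℝ) ≤ w := by exact_mod_cast hw2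
          have := (ih w (by omega) (D / w)).1 (by rw [le_div_iff₀ (by linarith)]; nlinarith [hcube w hw])
          rw [hlogdiv w hw2 (by linarith)] at this
          linarith
      have h3 := VV_eq P g z'
      linarith
    by_cases hc : (z : ℝ) ^ 3 ≤ D
    · have hs3 : 3 ≤ Real.log D / Real.log z := by
        rw [le_div_iff₀ hlz]
        have := Real.log_le_log (by positivity) hc
        rw [Real.log_pow] at this
        exact_mod_cast this
      refine (key z le_rfl (Real.log z) hlz (fun w hw => ?_) (fun w hw => ?_)).trans ?_
      · refine lt_of_lt_of_le ?_ hc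
        have : (w : ℝ) < z := by exact_mod_cast hw
        gcongr
      · rcases Nat.eq_zero_or_pos w with h | h
        · simp only [h, Nat.cast_zero, Real.log_zero]; exact hlz.le
        · exact Real.log_le_log (by exact_mod_cast h) (by exact_mod_cast hw.le)
      · have := (hV z).le
        have := hB _ hs3
        gcongr
    · push Not at hc
      have hs1 : 1 ≤ Real.log D / Real.log z := by
        rw [le_div_iff₀ hlz, one_mul]
        exact Real.log_le_log (by linarith) hD
      have hs3 : Real.log D / Real.log z ≤ 3 := by
        rw [div_le_iff₀ hlz]
        have := Real.log_le_log (by linarith) hc.le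
        rw [Real.log_pow] at this
        exact_mod_cast this
      have hex : ∃ z' : ℕ, D ≤ (z' : ℝ) ^ 3 := ⟨z, hc.le⟩
      set z' := Nat.find hex with hz'
      have hz'D : D ≤ (z' : ℝ) ^ 3 := Nat.find_spec hex
      have hz'z : z' ≤ z := Nat.find_min' hex hc.le
      have hlt : ∀ w, w < z' → (w : ℝ) ^ 3 < D := fun w hw => not_le.1 (Nat.find_min hex hw)
      have hz'2 : 2 ≤ z' := by
        by_contra h
        have h1 : (z' : ℝ) ≤ 1 := by exact_mod_cast (by omega : z' ≤ 1)
        have h0 : (0 : ℝ) ≤ z' := by positivity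
        nlinarith [pow_le_one₀ h0 h1 (n := 3)]
      have hz'2' : (2 : ℝ) ≤ z' := by exact_mod_cast hz'2
      have heqT : TV P g z true D = TV P g z' true D := by
        rw [TV_true_eq, TV_true_eq]
        congr 1
        symm
        apply sum_subset (range_subset_range.2 hz'z)
        intro w _ hw
        rw [mem_range, not_lt] at hw
        rw [if_neg]
        have : (z' : ℝ) ≤ w := by exact_mod_cast hw
        rw [not_lt]
        refine hz'D.trans (by gcongr)
      rw [heqT]
      have hk := key z' hz'z (Real.log D / 3) (by positivity) hlt (fun w hw => by
        rcases Nat.eq_zero_or_pos w with h | h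
        · simp only [h, Nat.cast_zero, Real.log_zero]; positivity
        · have := Real.log_le_log (by positivity) (hlt w hw).le
          rw [Real.log_pow] at this
          push_cast at this
          linarith)
      rw [show Real.log D / (Real.log D / 3) = 3 by field_simp] at hk
      have hv : VV P g z' * Real.log z' ≤ (1 + ε) * Real.log z * VV P g z := by
        rcases Nat.lt_or_ge z' z with h | h
        · have h1 := H z' (z - 1) hz'2 (by omega)
          rw [show z - 1 + 1 = z by omega] at h1
          refine h1.trans ?_
          have h5 := (hV z).le
          have h6 : Real.log ((z - 1 : ℕ) : ℝ) ≤ Real.log z :=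
            Real.log_le_log (by exact_mod_cast (by omega : 0 < z - 1)) (by exact_mod_cast (by omega : z - 1 ≤ z))
          gcongr
        · have : z' = z := by omega
          rw [this]
          have := mul_pos (hV z) hlz
          nlinarith
      have hlz' : Real.log D ≤ 3 * Real.log z' := by
        have := Real.log_le_log (by linarith) hz'D
        rw [Real.log_pow] at this
        exact_mod_cast this
      have hv2 : VV P g z' ≤ (1 + ε) * (3 / (Real.log D / Real.log z)) * VV P g z := by
        have h1 : VV P g z' * Real.log D ≤ 3 * ((1 + ε) * Real.log z * VV P g z) := by
          have := mul_le_mul_of_nonneg_left hlz' (hV z').le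
          linarith
        have h2 : (1 + ε) * (3 / (Real.log D / Real.log z)) * VV P g z = 3 * ((1 + ε) * Real.log z * VV P g z) / Real.log D := by
          field_simp
        rw [h2, le_div_iff₀ hlD]
        exact h1
      refine hk.trans ?_
      have hb0 : 0 ≤ 1 + ((1 + ε) * (1 / 3) * If (3 - 1) + ε * f (3 - 1)) := by
        have := hIf0 (3 - 1)
        have := hf0 (3 - 1)
        positivity
      refine (mul_le_mul_of_nonneg_right hv2 hb0).trans ?_
      have := mul_le_mul_of_nonneg_left (hC _ hs1 hs3) (hV z).le
      linarith

end SPC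

namespace SPC
open Finset MeasureTheory Filter

structure Gd (F : ℝ → ℝ) : Prop where
  cont : Continuous F
  anti : Antitone F
  nn : ∀ x, 0 ≤ F x
  dec : ∃ C, 0 ≤ C ∧ ∀ x, 1 ≤ x → F x ≤ C / x ^ 4

noncomputable def J (F : ℝ → ℝ) (a : ℝ) : ℝ := ∫ x in Set.Ioi a, F x

lemma int_pow3 (a : ℝ) (ha : 0 < a) : IntegrableOn (fun x : ℝ => 1 / x ^ 3) (Set.Ioi a) := by
  have := integrableOn_Ioi_rpow_of_lt (show (-3 : ℝ) < -1 by norm_num) ha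
  refine this.congr_fun (fun x hx => ?_) measurableSet_Ioi
  have hx0 : 0 < x := ha.trans hx
  simp only
  rw [Real.rpow_neg hx0.le, one_div]
  norm_cast

lemma J_pow4 (a : ℝ) (ha : 0 < a) : IntegrableOn (fun x : ℝ => 1 / x ^ 4) (Set.Ioi a) ∧ ∫ x in Set.Ioi a, 1 / x ^ 4 = 1 / (3 * a ^ 3) := by
  have h := integrableOn_Ioi_rpow_of_lt (show (-4 : ℝ) < -1 by norm_num) ha
  have h2 := integral_Ioi_rpow_of_lt (show (-4 : ℝ) < -1 by norm_num) ha
  have e : ∀ x ∈ Set.Ioi a, x ^ (-4 : ℝ) = 1 / x ^ 4 := by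
    intro x hx
    have hx0 : 0 < x := ha.trans hx
    rw [Real.rpow_neg hx0.le, one_div]
    norm_cast
  refine ⟨h.congr_fun e measurableSet_Ioi, ?_⟩
  rw [← setIntegral_congr_fun measurableSet_Ioi e, h2]
  rw [show (-4 : ℝ) + 1 = -3 by norm_num, Real.rpow_neg ha.le]
  norm_cast
  field_simp
  norm_num

lemma int_dom (G : ℝ → ℝ) (hG : Continuous G) (C : ℝ) (hC : ∀ x, 1 ≤ x → |G x| ≤ C / x ^ 3) (a : ℝ) : IntegrableOn G (Set.Ioi a) := by
  have h1 : IntegrableOn G (Set.Ioi 1) := by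
    refine ((int_pow3 1 one_pos).const_mul C).mono' hG.aestronglyMeasurable ?_
    refine (ae_restrict_iff' measurableSet_Ioi).2 (ae_of_all _ fun x hx => ?_)
    have := hC x (le_of_lt hx)
    rw [Real.norm_eq_abs]
    simpa [div_eq_mul_inv] using this
  have h2 : IntegrableOn G (Set.Icc a 1) := hG.integrableOn_Icc
  refine (h2.union h1).mono_set ?_
  intro x hx
  by_cases h : x ≤ 1
  · exact Or.inl ⟨le_of_lt hx, h⟩
  · exact Or.inr (not_le.1 h)

lemma Gd.int {F : ℝ → ℝ} (h : Gd F) (a : ℝ) : IntegrableOn F (Set.Ioi a) := by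
  obtain ⟨C, hC, hd⟩ := h.dec
  refine int_dom F h.cont C (fun x hx => ?_) a
  rw [abs_of_nonneg (h.nn x)]
  refine (hd x hx).trans ?_
  have : x ^ 3 ≤ x ^ 4 := pow_le_pow_right₀ hx (by norm_num)
  gcongr

lemma Gd.J_nn {F : ℝ → ℝ} (h : Gd F) (a : ℝ) : 0 ≤ J F a := integral_nonneg fun x => h.nn x

lemma Gd.J_sub {F : ℝ → ℝ} (h : Gd F) (a b : ℝ) : J F a - J F b = ∫ x in a..b, F x := by
  unfold J
  rw [intervalIntegral.integral_Ioi_sub_Ioi' (h.int a) (h.int b)]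

lemma Gd.J_diff {F : ℝ → ℝ} (h : Gd F) (t t' : ℝ) (ht : t ≤ t') : (t' - t) * F t' ≤ J F t - J F t' := by
  rw [h.J_sub, ← smul_eq_mul, ← intervalIntegral.integral_const]
  exact intervalIntegral.integral_mono_on ht (by simp) (h.cont.intervalIntegrable _ _) fun x hx => h.anti hx.2

lemma Gd.J_anti {F : ℝ → ℝ} (h : Gd F) : Antitone (J F) := fun a b hab => by
  have := h.J_diff a b hab
  have := mul_nonneg (sub_nonneg.2 hab) (h.nn b)
  linarith

lemma Gd.J_deriv {F : ℝ → ℝ} (h : Gd F) (a : ℝ) : HasDerivAt (J F) (-F a) a := by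
  have e : J F = fun x => J F 0 - ∫ t in (0 : ℝ)..x, F t := by
    funext x; rw [← h.J_sub]; ring
  rw [e]
  exact (intervalIntegral.integral_hasDerivAt_right (h.cont.intervalIntegrable _ _)
    (h.cont.stronglyMeasurableAtFilter _ _) h.cont.continuousAt).const_sub _

lemma Gd.J_cont {F : ℝ → ℝ} (h : Gd F) : Continuous (J F) := continuous_iff_continuousAt.2 fun a => (h.J_deriv a).continuousAt

lemma J_le_of {F : ℝ → ℝ} (h : Gd F) (C a : ℝ) (ha : 0 < a) (hd : ∀ x, a ≤ x → F x ≤ C / x ^ 4) : J F a ≤ C / (3 * a ^ 3) := by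
  obtain ⟨h1, h2⟩ := J_pow4 a ha
  have : J F a ≤ ∫ x in Set.Ioi a, C * (1 / x ^ 4) := by
    refine setIntegral_mono_on (h.int a) (h1.const_mul C) measurableSet_Ioi fun x hx => ?_
    have := hd x (le_of_lt hx)
    rw [mul_one_div]; exact this
  rw [integral_const_mul, h2, mul_one_div] at this
  exact this

lemma Gd.J_dec {F : ℝ → ℝ} (h : Gd F) : ∃ C, 0 ≤ C ∧ ∀ x, 1 ≤ x → J F x ≤ C / x ^ 3 := by
  obtain ⟨C, hC, hd⟩ := h.dec
  refine ⟨C, hC, fun x hx => (J_le_of h C x (by linarith) fun y hy => hd y (hx.trans hy)).trans ?_⟩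
  have : 0 < x ^ 3 := by positivity
  gcongr
  linarith

lemma Gd.J_int {F : ℝ → ℝ} (h : Gd F) (a : ℝ) : IntegrableOn (J F) (Set.Ioi a) := by
  obtain ⟨C, hC, hd⟩ := h.J_dec
  refine int_dom _ h.J_cont C (fun x hx => ?_) a
  rw [abs_of_nonneg (h.J_nn x)]
  exact hd x hx

lemma Gd.mul_int {F : ℝ → ℝ} (h : Gd F) (a : ℝ) : IntegrableOn (fun x => x * F x) (Set.Ioi a) := by
  obtain ⟨C, hC, hd⟩ := h.dec
  refine int_dom (fun x => x * F x) (continuous_id.mul h.cont) C (fun x hx => ?_) a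
  rw [abs_of_nonneg (mul_nonneg (by linarith) (h.nn x))]
  have : x * F x ≤ x * (C / x ^ 4) := mul_le_mul_of_nonneg_left (hd x hx) (by linarith)
  refine this.trans (le_of_eq ?_)
  have : x ≠ 0 := by linarith
  field_simp

/-- integration by parts -/
lemma Gd.ibp {F : ℝ → ℝ} (h : Gd F) (a : ℝ) : ∫ x in Set.Ioi a, J F x = (∫ x in Set.Ioi a, x * F x) - a * J F a := by
  have hd : ∀ x ∈ Set.Ioi a, HasDerivAt (fun x => (x - a) * J F x) (J F x - (x * F x - a * F x)) x := by
    intro x _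
    have := ((hasDerivAt_id x).sub_const a).mul (h.J_deriv x)
    have e : J F x - (x * F x - a * F x) = 1 * J F x + (id x - a) * -F x := by simp only [id]; ring
    rw [e]
    exact this
  have hintg : IntegrableOn (fun x => J F x - (x * F x - a * F x)) (Set.Ioi a) :=
    (h.J_int a).sub ((h.mul_int a).sub ((h.int a).const_mul a))
  have hlim : Tendsto (fun x => (x - a) * J F x) atTop (nhds 0) := by
    obtain ⟨C, hC, hdc⟩ := h.J_dec
    have h0 : Tendsto (fun x : ℝ => (1 + |a|) * C / x) atTop (nhds 0) := tendsto_const_nhds.div_atTop tendsto_id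
    refine squeeze_zero_norm' ?_ h0
    filter_upwards [eventually_ge_atTop 1] with x hx
    rw [Real.norm_eq_abs, abs_mul, abs_of_nonneg (h.J_nn x)]
    have h1 : |x - a| ≤ (1 + |a|) * x := by
      rw [abs_le]; constructor <;> cases abs_cases a <;> nlinarith
    have h2 := hdc x hx
    have h3 : |x - a| * J F x ≤ ((1 + |a|) * x) * (C / x ^ 3) := mul_le_mul h1 h2 (h.J_nn x) (by positivity)
    refine h3.trans ?_
    have : (1 + |a|) * x * (C / x ^ 3) = (1 + |a|) * C / x ^ 2 := by
      have : x ≠ 0 := by linarith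
      field_simp
    rw [this]
    have : x ≤ x ^ 2 := by nlinarith
    gcongr
  have := integral_Ioi_of_hasDerivAt_of_tendsto (f := fun x => (x - a) * J F x) (((continuous_id.sub continuous_const).mul h.J_cont).continuousWithinAt) hd hintg hlim
  have e1 : ∫ x in Set.Ioi a, (J F x - (x * F x - a * F x)) = (∫ x in Set.Ioi a, J F x) - ∫ x in Set.Ioi a, (x * F x - a * F x) :=
    integral_sub (h.J_int a) ((h.mul_int a).sub ((h.int a).const_mul a))
  have e2 : ∫ x in Set.Ioi a, (x * F x - a * F x) = (∫ x in Set.Ioi a, x * F x) - ∫ x in Set.Ioi a, a * F x :=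
    integral_sub (h.mul_int a) ((h.int a).const_mul a)
  rw [e1, e2, integral_const_mul] at this
  simp only [sub_self, zero_mul] at this
  unfold J at *
  linarith

/-- the operators -/
noncomputable def Top (c : ℝ) (F : ℝ → ℝ) (s : ℝ) : ℝ := 1 / max s 1 * J F (max s c - 1)

lemma Gd.top {F : ℝ → ℝ} (h : Gd F) (c : ℝ) (hc : 2 ≤ c) : Gd (Top c F) where
  cont := by
    unfold Top
    refine Continuous.mul (continuous_const.div (by fun_prop) fun x => ?_) (h.J_cont.comp (by fun_prop))
    have := le_max_right x 1
    linarith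
  anti := by
    intro a b hab
    unfold Top
    have h1 : J F (max b c - 1) ≤ J F (max a c - 1) := h.J_anti (by gcongr)
    have h2 : (0 : ℝ) < max a 1 := by have := le_max_right a 1; linarith
    have := h.J_nn (max b c - 1)
    have : 0 ≤ 1 / max a 1 := by positivity
    gcongr
  nn := by
    intro x
    unfold Top
    have h2 : (0 : ℝ) < max x 1 := by have := le_max_right x 1; linarith
    have := h.J_nn (max x c - 1)
    positivity
  dec := by
    obtain ⟨C, hC, hd⟩ := h.J_dec
    refine ⟨8 * C, by positivity, fun x hx => ?_⟩
    unfold Top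
    rw [max_eq_left hx]
    have h1 : x / 2 ≤ max x c - 1 := by
      rcases le_total x 2 with h | h
      · linarith [le_max_right x c]
      · linarith [le_max_left x c]
    have h2 : 1 ≤ max x c - 1 := by linarith [le_max_right x c]
    have h3 := hd _ h2
    have h4 : C / (max x c - 1) ^ 3 ≤ C / (x / 2) ^ 3 := by gcongr
    have h5 : C / (x / 2) ^ 3 = 8 * C / x ^ 3 := by field_simp; norm_num
    have h6 : 8 * C / x ^ 4 = 1 / x * (8 * C / x ^ 3) := by field_simp
    rw [h6]
    have : 0 ≤ 1 / x := by positivity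
    gcongr
    linarith

noncomputable def phi0 (s : ℝ) : ℝ := max (3 / max s 1 - 1) 0

lemma phi0_Gd : Gd phi0 where
  cont := by
    unfold phi0
    refine Continuous.max ((continuous_const.div (by fun_prop) fun x => ?_).sub continuous_const) continuous_const
    have := le_max_right x 1
    linarith
  anti := by
    intro a b hab
    unfold phi0
    have h2 : (0 : ℝ) < max a 1 := by have := le_max_right a 1; linarith
    gcongr
  nn := fun x => le_max_right _ _
  dec := by
    refine ⟨162, by norm_num, fun x hx => ?_⟩
    unfold phi0
    rw [max_eq_left hx]
    have hx0 : 0 < x := by linarith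
    refine max_le ?_ (by positivity)
    rcases le_total x 3 with h | h
    · have h1 : 3 / x ≤ 3 := by rw [div_le_iff₀ hx0]; linarith
      have h2 : x ^ 4 ≤ 81 := by
        calc x ^ 4 ≤ 3 ^ 4 := by gcongr
          _ = 81 := by norm_num
      have : 2 ≤ 162 / x ^ 4 := by rw [le_div_iff₀ (by positivity)]; linarith
      linarith
    · have h1 : 3 / x ≤ 1 := by rw [div_le_iff₀ hx0]; linarith
      have : 0 ≤ 162 / x ^ 4 := by positivity
      linarith

noncomputable def En : ℕ → ℝ → ℝ
  | 0 => phi0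
  | n + 1 => Top 3 (Top 2 (En n))

noncomputable def fn (n : ℕ) : ℝ → ℝ := Top 2 (En n)

lemma En_Gd (n : ℕ) : Gd (En n) := by
  induction n with
  | zero => exact phi0_Gd
  | succ n ih => exact (ih.top 2 le_rfl).top 3 (by norm_num)

lemma fn_Gd (n : ℕ) : Gd (fn n) := (En_Gd n).top 2 le_rfl

lemma J_shift (F : ℝ → ℝ) (a : ℝ) : ∫ x in Set.Ioi a, F (x - 1) = ∫ x in Set.Ioi (a - 1), F x := by
  have h := (measurePreserving_sub_right volume (1 : ℝ)).setIntegral_preimage_emb (MeasurableEquiv.subRight (1 : ℝ)).measurableEmbedding F (Set.Ioi (a - 1))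
  rw [← h]
  congr 2
  ext x
  simp

lemma Top_val (c : ℝ) (F : ℝ → ℝ) (s : ℝ) (hs : 1 ≤ s) : s * Top c F s = J F (max s c - 1) := by
  unfold Top
  rw [max_eq_left hs]
  have : s ≠ 0 := by linarith
  field_simp

lemma fn_val (n : ℕ) (s : ℝ) (hs : 2 ≤ s) : s * fn n s = J (En n) (s - 1) := by
  unfold fn
  rw [Top_val 2 _ s (by linarith), max_eq_left hs]

lemma En_val (n : ℕ) (s : ℝ) (hs : 1 ≤ s) : s * En (n + 1) s = J (fn n) (max s 3 - 1) := by
  rw [En, Top_val 3 _ s hs]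
  rfl

lemma B_eq (n : ℕ) : ∫ x in Set.Ioi (2 : ℝ), x * fn n x = (∫ x in Set.Ioi (1 : ℝ), x * En n x) - 2 * fn n 2 := by
  have h1 : ∫ x in Set.Ioi (2 : ℝ), x * fn n x = ∫ x in Set.Ioi (2 : ℝ), J (En n) (x - 1) :=
    setIntegral_congr_fun measurableSet_Ioi fun x hx => fn_val n x (le_of_lt hx)
  rw [h1, J_shift, show (2 : ℝ) - 1 = 1 by norm_num, (En_Gd n).ibp, fn_val n 2 le_rfl]
  norm_num

lemma A_succ (n : ℕ) : ∫ x in Set.Ioi (1 : ℝ), x * En (n + 1) x = ∫ x in Set.Ioi (2 : ℝ), x * fn n x := by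
  have hu : Set.Ioi (1 : ℝ) = Set.Ioc 1 3 ∪ Set.Ioi 3 := (Set.Ioc_union_Ioi_eq_Ioi (by norm_num)).symm
  have hi := (En_Gd (n + 1)).mul_int 1
  rw [hu, setIntegral_union (Set.Ioc_disjoint_Ioi le_rfl) measurableSet_Ioi (hi.mono_set Set.Ioc_subset_Ioi_self)
    (hi.mono_set (Set.Ioi_subset_Ioi (by norm_num)))]
  have h1 : ∫ x in Set.Ioc (1 : ℝ) 3, x * En (n + 1) x = ∫ x in Set.Ioc (1 : ℝ) 3, J (fn n) 2 :=
    setIntegral_congr_fun measurableSet_Ioc fun x hx => by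
      rw [En_val n x hx.1.le, max_eq_right hx.2]; norm_num
  have h2 : ∫ x in Set.Ioi (3 : ℝ), x * En (n + 1) x = ∫ x in Set.Ioi (3 : ℝ), J (fn n) (x - 1) :=
    setIntegral_congr_fun measurableSet_Ioi fun x hx => by
      have h3 : (3 : ℝ) < x := hx
      rw [En_val n x (by linarith), max_eq_left h3.le]
  rw [h1, h2, J_shift, show (3 : ℝ) - 1 = 2 by norm_num, (fn_Gd n).ibp, setIntegral_const]
  simp
  norm_num

lemma A_zero : ∫ x in Set.Ioi (1 : ℝ), x * En 0 x = 2 := by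
  have hu : Set.Ioi (1 : ℝ) = Set.Ioc 1 3 ∪ Set.Ioi 3 := (Set.Ioc_union_Ioi_eq_Ioi (by norm_num)).symm
  have hi := (En_Gd 0).mul_int 1
  rw [hu, setIntegral_union (Set.Ioc_disjoint_Ioi le_rfl) measurableSet_Ioi (hi.mono_set Set.Ioc_subset_Ioi_self)
    (hi.mono_set (Set.Ioi_subset_Ioi (by norm_num)))]
  have h1 : ∫ x in Set.Ioc (1 : ℝ) 3, x * En 0 x = ∫ x in Set.Ioc (1 : ℝ) 3, (3 - x) :=
    setIntegral_congr_fun measurableSet_Ioc fun x hx => by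
      have h0 : 1 < x := hx.1
      have h3 : 1 ≤ 3 / x := by rw [le_div_iff₀ (by linarith)]; linarith [hx.2]
      simp only [En, phi0]
      rw [max_eq_left h0.le, max_eq_left (by linarith)]
      have : x ≠ 0 := by linarith
      field_simp
  have h2 : ∫ x in Set.Ioi (3 : ℝ), x * En 0 x = ∫ x in Set.Ioi (3 : ℝ), (0 : ℝ) :=
    setIntegral_congr_fun measurableSet_Ioi fun x hx => by
      have h0 : 3 < x := hx
      have h3 : 3 / x ≤ 1 := by rw [div_le_iff₀ (by linarith)]; linarith
      simp only [En, phi0]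
      rw [max_eq_left (by linarith : (1 : ℝ) ≤ x), max_eq_right (by linarith : 3 / x - 1 ≤ 0), mul_zero]
  rw [h1, h2, ← intervalIntegral.integral_of_le (by norm_num), intervalIntegral.integral_sub (by simp) (by simp)]
  simp
  norm_num

lemma fn_two (N : ℕ) : ∑ n ∈ range (N + 1), 2 * fn n 2 = 2 - ∫ x in Set.Ioi (2 : ℝ), x * fn N x := by
  induction N with
  | zero => rw [sum_range_one, B_eq, A_zero]; ring
  | succ N ih =>
    rw [sum_range_succ, ih, B_eq (N + 1), A_succ]
    ring

lemma fn_sum_bound (N : ℕ) (δ : ℝ) (hδ : 0 < δ) (hδ1 : δ ≤ 1) : ∑ n ∈ range (N + 1), fn n (2 + δ) ≤ 1 - δ / 2 := by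
  have h1 : ∀ n, (2 + δ) * fn n (2 + δ) ≤ 2 * fn n 2 := by
    intro n
    rw [fn_val n _ (by linarith), fn_val n _ le_rfl]
    exact (En_Gd n).J_anti (by linarith)
  have h0 : (2 + δ) * fn 0 (2 + δ) ≤ 2 * fn 0 2 - δ / 2 := by
    rw [fn_val 0 _ (by linarith), fn_val 0 _ le_rfl]
    have h2 := (En_Gd 0).J_diff (2 - 1) (2 + δ - 1) (by linarith)
    have h3 : 1 / 2 ≤ En 0 (2 + δ - 1) := by
      simp only [En, phi0]
      rw [max_eq_left (by linarith : (1 : ℝ) ≤ 2 + δ - 1)]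
      refine le_trans ?_ (le_max_left _ _)
      have : 3 / 2 ≤ 3 / (2 + δ - 1) := by
        apply div_le_div_of_nonneg_left <;> linarith
      linarith
    rw [show 2 + δ - 1 - (2 - 1) = δ by ring] at h2
    have h4 := (mul_le_mul_of_nonneg_left h3 hδ.le).trans h2
    generalize J (En 0) (2 - 1) = a at *
    generalize J (En 0) (2 + δ - 1) = b at *
    linarith
  have h2 : ∑ n ∈ range (N + 1), (2 + δ) * fn n (2 + δ) ≤ ∑ n ∈ range (N + 1), 2 * fn n 2 - δ / 2 := by
    rw [sum_range_succ', sum_range_succ' (fun n => 2 * fn n 2)]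
    have := sum_le_sum (s := range N) fun n _ => h1 (n + 1)
    linarith
  have h3 : 0 ≤ ∫ x in Set.Ioi (2 : ℝ), x * fn N x := setIntegral_nonneg measurableSet_Ioi fun x hx =>
    mul_nonneg (by have : (2 : ℝ) < x := hx; linarith) ((fn_Gd N).nn x)
  rw [fn_two, ← mul_sum] at h2
  have h4 : (2 + δ) * ∑ n ∈ range (N + 1), fn n (2 + δ) ≤ (2 + δ) * (1 - δ / 2) := by nlinarith
  exact le_of_mul_le_mul_left h4 (by linarith)

noncomputable def hp (s : ℝ) : ℝ := min (1 / max s 1) (27 / (max s 1) ^ 4)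
noncomputable def hm (s : ℝ) : ℝ := 23.5 / (max s 1) ^ 4

lemma hp_Gd : Gd hp where
  cont := by
    unfold hp
    refine (continuous_const.div (by fun_prop) fun x => ?_).min (continuous_const.div (by fun_prop) fun x => ?_)
    · have := le_max_right x 1
      linarith
    · have := le_max_right x 1
      positivity
  anti := by
    intro a b hab
    unfold hp
    have h2 : (0 : ℝ) < max a 1 := by have := le_max_right a 1; linarith
    gcongr
  nn := by
    intro x
    unfold hp
    have h2 : (0 : ℝ) < max x 1 := by have := le_max_right x 1; linarith
    positivity
  dec := by
    refine ⟨27, by norm_num, fun x hx => ?_⟩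
    unfold hp
    rw [max_eq_left hx]
    exact min_le_right _ _

lemma hm_Gd : Gd hm where
  cont := by
    unfold hm
    refine (continuous_const.div (by fun_prop) fun x => ?_)
    have := le_max_right x 1
    positivity
  anti := by
    intro a b hab
    unfold hm
    have h2 : (0 : ℝ) < max a 1 := by have := le_max_right a 1; linarith
    gcongr
  nn := by
    intro x
    unfold hm
    have h2 : (0 : ℝ) < max x 1 := by have := le_max_right x 1; linarith
    positivity
  dec := by
    refine ⟨23.5, by norm_num, fun x hx => ?_⟩
    unfold hm
    rw [max_eq_left hx]

lemma J_hm (a : ℝ) (ha : 1 ≤ a) : J hm a ≤ 23.5 / (3 * a ^ 3) :=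
  J_le_of hm_Gd 23.5 a (by linarith) fun x hx => by unfold hm; rw [max_eq_left (ha.trans hx)]

lemma J_hp_big (a : ℝ) (ha : 1 ≤ a) : J hp a ≤ 27 / (3 * a ^ 3) :=
  J_le_of hp_Gd 27 a (by linarith) fun x hx => by unfold hp; rw [max_eq_left (ha.trans hx)]; exact min_le_right _ _

lemma J_hp_small (a : ℝ) (ha : 1 ≤ a) (ha3 : a ≤ 3) : J hp a ≤ 3 / a - 2 / 3 := by
  have h1 := J_hp_big 3 (by norm_num)
  have h2 := hp_Gd.J_sub a 3
  have h3 : ∫ x in a..3, hp x ≤ ∫ x in a..3, 3 * x ^ (-2 : ℤ) := by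
    refine intervalIntegral.integral_mono_on ha3 (hp_Gd.cont.intervalIntegrable _ _) ?_ fun x hx => ?_
    · refine ContinuousOn.intervalIntegrable ?_
      rw [Set.uIcc_of_le ha3]
      refine continuousOn_const.mul (continuousOn_id.zpow₀ _ fun x hx => Or.inl ?_)
      have := hx.1
      simp only [id]
      linarith
    · have hx1 : 1 ≤ x := ha.trans hx.1
      unfold hp
      rw [max_eq_left hx1]
      refine (min_le_left _ _).trans ?_
      rw [zpow_neg, zpow_ofNat, ← div_eq_mul_inv, div_le_div_iff₀ (by linarith) (by positivity)]
      nlinarith [hx.2]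
  rw [intervalIntegral.integral_const_mul, integral_zpow] at h3
  · norm_num at h3 h1
    have : a⁻¹ * 3 = 3 / a := by field_simp
    rw [div_eq_mul_inv]
    linarith
  · right
    refine ⟨by norm_num, ?_⟩
    rw [Set.uIcc_of_le ha3]
    intro h
    linarith [h.1]

lemma hA0 (s : ℝ) (hs : 2 ≤ s) : J hp (s - 1) ≤ s * (0.98 * hm s) := by
  unfold hm
  rw [max_eq_left (by linarith)]
  have e : s * (0.98 * (23.5 / s ^ 4)) = 23.03 / s ^ 3 := by field_simp; norm_num
  rw [e]
  have hs0 : 0 < s - 1 := by linarith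
  rcases le_total s 4 with h | h
  · refine (J_hp_small (s - 1) (by linarith) (by linarith)).trans ?_
    rw [div_sub_div _ _ (by linarith) (by norm_num), div_le_div_iff₀ (by positivity) (by positivity)]
    nlinarith [sq_nonneg (s - 3.3), mul_nonneg (sub_nonneg.2 hs) (sub_nonneg.2 h), sq_nonneg (s ^ 2 - 3.3 * s), sq_nonneg (s ^ 2 - 2.9 * s - 1.3), mul_nonneg (mul_nonneg (sub_nonneg.2 hs) (sub_nonneg.2 h)) (sq_nonneg (s - 3.3))]
  · refine (J_hp_big (s - 1) (by linarith)).trans ?_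
    rw [div_le_div_iff₀ (by positivity) (by positivity)]
    have : 0.75 * s ≤ s - 1 := by linarith
    have h3 : (0.75 * s) ^ 3 ≤ (s - 1) ^ 3 := by gcongr
    have : 0 < s ^ 3 := by positivity
    nlinarith

lemma hB0 (s : ℝ) (hs : 1 ≤ s) : J hm (max s 3 - 1) ≤ s * (0.98 * hp s) := by
  unfold hp
  rw [max_eq_left hs]
  have hs0 : 0 < s := by linarith
  rw [← mul_assoc, mul_min_of_nonneg _ _ (by positivity)]
  have e1 : s * 0.98 * (1 / s) = 0.98 := by field_simp
  have e2 : s * 0.98 * (27 / s ^ 4) = 26.46 / s ^ 3 := by field_simp; norm_num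
  rw [e1, e2]
  have h0 := J_hm 2 (by norm_num)
  norm_num at h0
  have h1 : J hm (max s 3 - 1) ≤ J hm 2 := hm_Gd.J_anti (by linarith [le_max_right s 3])
  refine le_min (by linarith) ?_
  rcases le_total s 3 with h | h
  · rw [le_div_iff₀ (by positivity)]
    have : s ^ 3 ≤ 27 := by
      calc s ^ 3 ≤ 3 ^ 3 := by gcongr
        _ = 27 := by norm_num
    have h5 : J hm (max s 3 - 1) ≤ 0.98 := by linarith
    have := hm_Gd.J_nn (max s 3 - 1)
    nlinarith
  · rw [max_eq_left h]
    refine (J_hm (s - 1) (by linarith)).trans ?_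
    have : 0 < s - 1 := by linarith
    rw [div_le_div_iff₀ (by positivity) (by positivity)]
    have h6 : 2 / 3 * s ≤ s - 1 := by linarith
    have h3 : (2 / 3 * s) ^ 3 ≤ (s - 1) ^ 3 := by gcongr
    have : 0 < s ^ 3 := by positivity
    nlinarith

lemma J_mono_mul {F G : ℝ → ℝ} (hF : Gd F) (hG : Gd G) (K a : ℝ) (h : ∀ x, a ≤ x → F x ≤ K * G x) : J F a ≤ K * J G a := by
  unfold J
  rw [← integral_const_mul]
  exact setIntegral_mono_on (hF.int a) ((hG.int a).const_mul K) measurableSet_Ioi fun x hx => h x (le_of_lt hx)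

lemma En_small (n : ℕ) : (∀ s, 1 ≤ s → En n s ≤ 6 * 0.98 ^ n * hp s) ∧ (∀ s, 2 ≤ s → fn n s ≤ 6 * 0.98 ^ n * hm s) := by
  have step : ∀ n, (∀ s, 1 ≤ s → En n s ≤ 6 * 0.98 ^ n * hp s) → (∀ s, 2 ≤ s → fn n s ≤ 6 * 0.98 ^ n * hm s) := by
    intro n h s hs
    have h1 := J_mono_mul (En_Gd n) hp_Gd _ (s - 1) (fun x hx => h x (by linarith))
    rw [← fn_val n s hs] at h1
    have h2 := hA0 s hs
    have h3 : 0 ≤ hm s := hm_Gd.nn s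
    have h4 : s * fn n s ≤ s * (6 * 0.98 ^ n * hm s) := by
      refine h1.trans ?_
      refine (mul_le_mul_of_nonneg_left h2 (by positivity)).trans ?_
      have : 0 ≤ 6 * 0.98 ^ n * s * hm s := by positivity
      nlinarith
    exact le_of_mul_le_mul_left h4 (by linarith)
  induction n with
  | zero =>
    have h0 : ∀ s, 1 ≤ s → En 0 s ≤ 6 * 0.98 ^ 0 * hp s := by
      intro s hs
      have hs0 : 0 < s := by linarith
      simp only [En, phi0, hp]
      rw [max_eq_left hs, pow_zero, mul_one, mul_min_of_nonneg _ _ (by norm_num)]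
      rcases le_total s 3 with h | h
      · have h1 : 3 / s = 3 * (1 / s) := by ring
        have h2 : 0 < 1 / s := by positivity
        refine max_le (le_min (by linarith) ?_) (by positivity)
        rw [← mul_div_assoc, le_div_iff₀ (by positivity)]
        have e : (3 / s - 1) * s ^ 4 = 3 * s ^ 3 - s ^ 4 := by field_simp
        rw [e]
        have : s ^ 3 ≤ 27 := by
          calc s ^ 3 ≤ 3 ^ 3 := by gcongr
            _ = 27 := by norm_num
        have : 0 < s ^ 4 := by positivity
        linarith
      · have h3 : 3 / s ≤ 1 := by rw [div_le_iff₀ (by linarith)]; linarith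
        rw [max_eq_right (by linarith)]
        positivity
    exact ⟨h0, step 0 h0⟩
  | succ n ih =>
    have h0 : ∀ s, 1 ≤ s → En (n + 1) s ≤ 6 * 0.98 ^ (n + 1) * hp s := by
      intro s hs
      have h1 := J_mono_mul (fn_Gd n) hm_Gd _ (max s 3 - 1) (fun x hx => ih.2 x (by linarith [le_max_right s 3]))
      rw [← En_val n s hs] at h1
      have h2 := hB0 s hs
      have h4 : s * En (n + 1) s ≤ s * (6 * 0.98 ^ (n + 1) * hp s) := by
        refine h1.trans ?_
        refine (mul_le_mul_of_nonneg_left h2 (by positivity)).trans (le_of_eq ?_)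
        rw [pow_succ]; ring
      exact le_of_mul_le_mul_left h4 (by linarith)
    exact ⟨h0, step _ h0⟩

lemma Gd.add {F G : ℝ → ℝ} (hF : Gd F) (hG : Gd G) (η : ℝ) (hη : 0 ≤ η) : Gd (fun s => F s + η * G s) where
  cont := hF.cont.add (continuous_const.mul hG.cont)
  anti := fun a b hab => add_le_add (hF.anti hab) (mul_le_mul_of_nonneg_left (hG.anti hab) hη)
  nn := fun x => add_nonneg (hF.nn x) (mul_nonneg hη (hG.nn x))
  dec := by
    obtain ⟨C, hC, h1⟩ := hF.dec
    obtain ⟨C', hC', h2⟩ := hG.dec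
    refine ⟨C + η * C', by positivity, fun x hx => ?_⟩
    have := h1 x hx
    have := mul_le_mul_of_nonneg_left (h2 x hx) hη
    rw [add_div, mul_div_assoc]
    linarith

lemma J_add {F G : ℝ → ℝ} (hF : Gd F) (hG : Gd G) (η a : ℝ) : J (fun s => F s + η * G s) a = J F a + η * J G a := by
  unfold J
  rw [integral_add (hF.int a) ((hG.int a).const_mul η), integral_const_mul]

lemma Gd_sum (F : ℕ → ℝ → ℝ) (hF : ∀ n, Gd (F n)) (N : ℕ) : Gd (fun s => ∑ n ∈ range (N + 1), F n s) ∧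
    ∀ a, J (fun s => ∑ n ∈ range (N + 1), F n s) a = ∑ n ∈ range (N + 1), J (F n) a := by
  induction N with
  | zero => simpa using hF 0
  | succ N ih =>
    have e : (fun s => ∑ n ∈ range (N + 1 + 1), F n s) = fun s => (∑ n ∈ range (N + 1), F n s) + 1 * F (N + 1) s := by
      funext s; rw [sum_range_succ, one_mul]
    rw [e]
    refine ⟨ih.1.add (hF _) 1 zero_le_one, fun a => ?_⟩
    rw [J_add ih.1 (hF _), ih.2 a, sum_range_succ _ (N + 1), one_mul]

lemma Gd.tail {F : ℝ → ℝ} (h : Gd F) : ∃ C, 0 ≤ C ∧ ∀ s, 2 ≤ s → 1 / s * J F (s - 1) + F (s - 1) ≤ C / s ^ 4 := by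
  obtain ⟨C, hC, h1⟩ := h.dec
  obtain ⟨C', hC', h2⟩ := h.J_dec
  refine ⟨8 * C' + 16 * C, by positivity, fun s hs => ?_⟩
  have h3 := h1 (s - 1) (by linarith)
  have h4 := h2 (s - 1) (by linarith)
  have hs2 : s / 2 ≤ s - 1 := by linarith
  have h5 : C / (s - 1) ^ 4 ≤ C / (s / 2) ^ 4 := by gcongr
  have h6 : C' / (s - 1) ^ 3 ≤ C' / (s / 2) ^ 3 := by gcongr
  have e1 : C / (s / 2) ^ 4 = 16 * C / s ^ 4 := by field_simp; norm_num
  have e2 : 1 / s * (C' / (s / 2) ^ 3) = 8 * C' / s ^ 4 := by field_simp; norm_num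
  have h7 : 1 / s * J F (s - 1) ≤ 1 / s * (C' / (s / 2) ^ 3) := mul_le_mul_of_nonneg_left (h4.trans h6) (by positivity)
  rw [add_div]
  linarith

lemma sieve_funcs (δ : ℝ) (hδ : 0 < δ) (hδ1 : δ ≤ 1) : ∃ ε : ℝ, 0 < ε ∧ ∃ E f : ℝ → ℝ, Gd E ∧ Gd f ∧
    (∀ s, 2 ≤ s → (1 + ε) * (1 / s) * J E (s - 1) + ε * E (s - 1) ≤ f s) ∧
    (∀ s, 3 ≤ s → (1 + ε) * (1 / s) * J f (s - 1) + ε * f (s - 1) ≤ E s) ∧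
    (∀ s, 1 ≤ s → s ≤ 3 → (1 + ε) * (3 / s) * (1 + ((1 + ε) * (1 / 3) * J f (3 - 1) + ε * f (3 - 1))) ≤ 1 + E s) ∧
    f (2 + δ) ≤ 1 - δ / 4 := by
  set η := δ / 6 with hη
  have hη0 : 0 < η := by positivity
  obtain ⟨N, hN⟩ : ∃ N : ℕ, (0.98 : ℝ) ^ N < 0.01 * η / 6 := exists_pow_lt_of_lt_one (by positivity) (by norm_num)
  have hN1 : 6 * (0.98 : ℝ) ^ (N + 1) ≤ 0.01 * η := by
    rw [pow_succ]
    have : (0 : ℝ) < 0.98 ^ N := by positivity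
    linarith
  obtain ⟨gE, jE⟩ := Gd_sum En En_Gd N
  obtain ⟨gf, jf⟩ := Gd_sum fn fn_Gd N
  set E : ℝ → ℝ := fun s => (∑ n ∈ range (N + 1), En n s) + η * hp s with hE
  set f : ℝ → ℝ := fun s => (∑ n ∈ range (N + 1), fn n s) + η * hm s with hf
  have GE : Gd E := gE.add hp_Gd η hη0.le
  have Gf : Gd f := gf.add hm_Gd η hη0.le
  have JE : ∀ a, J E a = ∑ n ∈ range (N + 1), J (En n) a + η * J hp a := fun a => by rw [hE, J_add gE hp_Gd, jE]
  have Jf : ∀ a, J f a = ∑ n ∈ range (N + 1), J (fn n) a + η * J hm a := fun a => by rw [hf, J_add gf hm_Gd, jf]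
  obtain ⟨C1, hC1, t1⟩ := GE.tail
  obtain ⟨C2, hC2, t2⟩ := Gf.tail
  have hQ := Gf.J_nn 2
  have hf2 := Gf.nn 2
  set Z := 1 + C1 + C2 + 3 + 3 * J f 2 + 6 * f 2 with hZ
  have hZ0 : 1 ≤ Z := by rw [hZ]; linarith
  set ε := min 1 (0.01 * η / Z) with hε
  have hε0 : 0 < ε := by rw [hε]; positivity
  have hε1 : ε ≤ 1 := min_le_left _ _
  have hεZ : ε * Z ≤ 0.01 * η := by
    have : ε ≤ 0.01 * η / Z := min_le_right _ _
    rwa [le_div_iff₀ (by linarith)] at this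
  have hεC1 : ε * C1 ≤ 0.01 * η := le_trans (mul_le_mul_of_nonneg_left (by rw [hZ]; linarith) hε0.le) hεZ
  have hεC2 : ε * C2 ≤ 0.01 * η := le_trans (mul_le_mul_of_nonneg_left (by rw [hZ]; linarith) hε0.le) hεZ
  have hεC3 : ε * (3 + 3 * J f 2 + 6 * f 2) ≤ 0.01 * η := le_trans (mul_le_mul_of_nonneg_left (by rw [hZ]; linarith) hε0.le) hεZ
  have star : ∀ s, 1 ≤ s → J f (max s 3 - 1) ≤ s * (E s - phi0 s - 0.01 * η * hp s) := by
    intro s hs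
    rw [Jf]
    have e1 : ∑ n ∈ range (N + 1), J (fn n) (max s 3 - 1) = s * ∑ n ∈ range (N + 1), En (n + 1) s := by
      rw [mul_sum]
      exact sum_congr rfl fun n _ => (En_val n s hs).symm
    have e2 : ∑ n ∈ range (N + 1), En (n + 1) s = ∑ n ∈ range (N + 1), En n s - phi0 s + En (N + 1) s := by
      have h1 := sum_range_succ' (fun n => En n s) (N + 1)
      rw [sum_range_succ] at h1
      simp only [En] at h1 ⊢
      linarith
    rw [e1, e2]
    have h1 := mul_le_mul_of_nonneg_left (hB0 s hs) hη0.le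
    have h2 := (En_small (N + 1)).1 s hs
    have h3 := mul_le_mul_of_nonneg_right hN1 (hp_Gd.nn s)
    have h4 : s * En (N + 1) s ≤ s * (0.01 * η * hp s) := mul_le_mul_of_nonneg_left (h2.trans h3) (by linarith)
    simp only [hE]
    linarith
  refine ⟨ε, hε0, E, f, GE, Gf, fun s hs => ?_, fun s hs => ?_, fun s hs hs3 => ?_, ?_⟩
  · have hs0 : 0 < s := by linarith
    have h1 : 1 / s * J E (s - 1) ≤ ∑ n ∈ range (N + 1), fn n s + η * (0.98 * hm s) := by
      rw [one_div, inv_mul_le_iff₀ hs0, JE, mul_add, mul_sum]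
      refine add_le_add (le_of_eq (sum_congr rfl fun n _ => (fn_val n s hs).symm)) ?_
      have := mul_le_mul_of_nonneg_left (hA0 s hs) hη0.le
      linarith
    have h2 := mul_le_mul_of_nonneg_left (t1 s hs) hε0.le
    have h3 : ε * (C1 / s ^ 4) ≤ 0.02 * η * hm s := by
      unfold hm
      rw [max_eq_left (by linarith), ← mul_div_assoc, ← mul_div_assoc]
      exact div_le_div_of_nonneg_right (by linarith) (by positivity)
    simp only [hf]
    linarith
  · have hs0 : 0 < s := by linarith
    have h0 := star s (by linarith)
    rw [max_eq_left hs] at h0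
    have hphi : phi0 s = 0 := by
      unfold phi0
      rw [max_eq_left (by linarith : (1 : ℝ) ≤ s), max_eq_right]
      have : 3 / s ≤ 1 := by rw [div_le_iff₀ hs0]; linarith
      linarith
    rw [hphi] at h0
    have h1 : 1 / s * J f (s - 1) ≤ E s - 0.01 * η * hp s := by
      rw [one_div, inv_mul_le_iff₀ hs0]; linarith
    have h2 := mul_le_mul_of_nonneg_left (t2 s (by linarith)) hε0.le
    have h3 : ε * (C2 / s ^ 4) ≤ 0.01 * η * hp s := by
      unfold hp
      rw [max_eq_left (by linarith), min_eq_right, ← mul_div_assoc, ← mul_div_assoc]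
      · exact div_le_div_of_nonneg_right (by linarith) (by positivity)
      · rw [div_le_div_iff₀ (by positivity) hs0]
        have : 3 ^ 3 ≤ s ^ 3 := by gcongr
        nlinarith
    linarith
  · have hs0 : 0 < s := by linarith
    have h0 := star s hs
    rw [max_eq_right hs3] at h0
    norm_num at h0 ⊢
    have hphi : s * phi0 s = 3 - s := by
      unfold phi0
      have : 1 ≤ 3 / s := by rw [le_div_iff₀ hs0]; linarith
      rw [max_eq_left hs, max_eq_left (by linarith)]
      field_simp
    have hhp : s * hp s = 1 := by
      unfold hp
      rw [max_eq_left hs, min_eq_left]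
      · field_simp
      · rw [div_le_div_iff₀ hs0 (by positivity)]
        have : s ^ 3 ≤ 3 ^ 3 := by gcongr
        nlinarith
    have h1 : 3 + J f 2 + 0.01 * η ≤ s * (1 + E s) := by
      have : s * (1 / 100 * η * hp s) = 1 / 100 * η * (s * hp s) := by ring
      rw [hhp] at this
      norm_num
      linarith
    have h2 : (1 + ε) * (3 / s) * (1 + ((1 + ε) * (1 / 3) * J f 2 + ε * f 2)) = (3 + J f 2 + ε * (3 + 2 * J f 2 + ε * J f 2 + 3 * f 2 + 3 * ε * f 2)) / s := by
      field_simp; ring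
    rw [h2, div_le_iff₀ hs0]
    have h3 : ε * (3 + 2 * J f 2 + ε * J f 2 + 3 * f 2 + 3 * ε * f 2) ≤ ε * (3 + 3 * J f 2 + 6 * f 2) := by
      refine mul_le_mul_of_nonneg_left ?_ hε0.le
      nlinarith
    linarith
  · have h1 := fn_sum_bound N δ hδ hδ1
    have h2 : hm (2 + δ) ≤ 1.5 := by
      refine (hm_Gd.anti (show (2 : ℝ) ≤ 2 + δ by linarith)).trans ?_
      unfold hm
      norm_num
    simp only [hf]
    nlinarith

end SPC

namespace SPC
open Finset

noncomputable def g1 (p : ℕ) : ℝ := 1 / ((p : ℝ) - 1)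

lemma VV_one (P : ℕ → Prop) (g : ℕ → ℝ) (u : ℕ) (hu : ∀ p, P p → u ≤ p) (z : ℕ) (hz : z ≤ u) : VV P g z = 1 := by
  rw [VV_eq, sum_eq_zero, sub_zero]
  intro w hw
  rw [mem_range] at hw
  unfold gam
  rw [if_neg, zero_mul]
  intro h
  have := hu w h
  omega

lemma VV_anti (P : ℕ → Prop) (g : ℕ → ℝ) (hg : ∀ p, P p → 0 ≤ g p ∧ g p < 1) (z : ℕ) : VV P g (z + 1) ≤ VV P g z := by
  rw [VV]
  have := mul_nonneg (gam_nonneg P g hg z) (VV_pos P g hg z).le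
  linarith

lemma g1_bd (p : ℕ) (hp : 4 ≤ p) : 0 ≤ g1 p ∧ g1 p < 1 := by
  have h : (4 : ℝ) ≤ p := by exact_mod_cast hp
  unfold g1
  refine ⟨div_nonneg zero_le_one (by linarith), ?_⟩
  rw [div_lt_one (by linarith)]
  linarith

lemma VV_ratio (P : ℕ → Prop) (hP : ∀ p, P p → p.Prime ∧ 4 ≤ p) (w : ℕ) (hw : 4 ≤ w) (z : ℕ) (hz : w ≤ z) :
    VV P g1 w ≤ VV P g1 z * ∏ p ∈ (Ico w z).filter Nat.Prime, (1 - 1 / ((p : ℝ) - 1))⁻¹ := by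
  have hg : ∀ p, P p → 0 ≤ g1 p ∧ g1 p < 1 := fun p h => g1_bd p (hP p h).2
  induction z, hz using Nat.le_induction with
  | base => simp
  | succ z hz ih =>
    obtain ⟨b1, b2⟩ := g1_bd z (by omega)
    have hV := VV_pos P g1 hg z
    have hpr : 0 ≤ ∏ p ∈ (Ico w z).filter Nat.Prime, (1 - 1 / ((p : ℝ) - 1))⁻¹ := by
      refine prod_nonneg fun p hp => inv_nonneg.2 ?_
      have := (g1_bd p (by have := (mem_Ico.1 (mem_filter.1 hp).1).1; omega)).2
      unfold g1 at this
      linarith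
    have key : ∏ p ∈ (Ico w (z + 1)).filter Nat.Prime, (1 - 1 / ((p : ℝ) - 1))⁻¹ =
        (∏ p ∈ (Ico w z).filter Nat.Prime, (1 - 1 / ((p : ℝ) - 1))⁻¹) * if z.Prime then (1 - g1 z)⁻¹ else 1 := by
      rw [prod_filter, prod_filter, prod_Ico_succ_top hz]
      rfl
    have hq : 1 ≤ (1 - g1 z)⁻¹ := (one_le_inv₀ (by linarith)).2 (by linarith)
    rw [key, VV]
    refine ih.trans ?_
    have h1 : VV P g1 z ≤ (VV P g1 z - gam P g1 z * VV P g1 z) * (if z.Prime then (1 - g1 z)⁻¹ else 1) := by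
      unfold gam
      by_cases h : P z
      · rw [if_pos h, if_pos (hP z h).1]
        have : 1 - g1 z ≠ 0 := by linarith
        have e : (VV P g1 z - g1 z * VV P g1 z) * (1 - g1 z)⁻¹ = VV P g1 z := by field_simp
        rw [e]
      · rw [if_neg h, zero_mul, sub_zero]
        split_ifs
        · nlinarith
        · linarith
    calc _ ≤ ((VV P g1 z - gam P g1 z * VV P g1 z) * (if z.Prime then (1 - g1 z)⁻¹ else 1)) * ∏ p ∈ (Ico w z).filter Nat.Prime, (1 - 1 / ((p : ℝ) - 1))⁻¹ :=
          mul_le_mul_of_nonneg_right h1 hpr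
      _ = _ := by ring

theorem lin_sieve (δ : ℝ) (hδ : 0 < δ) (hδ1 : δ ≤ 1) : ∃ u0 : ℕ, 4 ≤ u0 ∧ ∃ c : ℝ, 0 < c ∧ ∀ P : ℕ → Prop, (∀ p, P p → p.Prime ∧ u0 ≤ p) →
    ∀ (z : ℕ) (D : ℝ), 2 ≤ z → (z : ℝ) ^ (2 + δ) ≤ D → c / Real.log z ≤ TV P g1 z false D := by
  obtain ⟨ε, hε, E, f, GE, Gf, hA, hB, hC, hfδ⟩ := sieve_funcs δ hδ hδ1
  obtain ⟨u0, hu0, hm⟩ := mertens_prod ε hε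
  have hl2 : 0 < Real.log 2 := Real.log_pos (by norm_num)
  refine ⟨u0, hu0, δ / 4 * (Real.log 2 / (1 + ε)), by positivity, fun P hP z D hz hD => ?_⟩
  have hP4 : ∀ p, P p → p.Prime ∧ 4 ≤ p := fun p h => ⟨(hP p h).1, hu0.trans (hP p h).2⟩
  have hg : ∀ p, P p → 0 ≤ g1 p ∧ g1 p < 1 := fun p h => g1_bd p (hP4 p h).2
  have hV := VV_pos P g1 hg
  have hone := VV_one P g1 u0 (fun p h => (hP p h).2)
  have H1 : ∀ w z : ℕ, u0 ≤ w → w ≤ z → VV P g1 w * Real.log w ≤ (1 + ε) * Real.log z * VV P g1 (z + 1) := by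
    intro w z hw hwz
    have h1 := VV_ratio P hP4 w (by omega) (z + 1) (by omega)
    have h2 := hm w z hw hwz
    have hlw : 0 < Real.log w := Real.log_pos (by exact_mod_cast (by omega : 1 < w))
    have e : Ico w (z + 1) = Icc w z := by ext; simp [Order.lt_add_one_iff]
    rw [e] at h1
    have h3 := h1.trans (mul_le_mul_of_nonneg_left h2 (hV (z + 1)).le)
    have h4 := mul_le_mul_of_nonneg_right h3 hlw.le
    refine h4.trans (le_of_eq ?_)
    field_simp
  have H : ∀ w z : ℕ, 2 ≤ w → w ≤ z → VV P g1 w * Real.log w ≤ (1 + ε) * Real.log z * VV P g1 (z + 1) := by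
    intro w z hw hwz
    have hlw : 0 < Real.log w := Real.log_pos (by exact_mod_cast (by omega : 1 < w))
    rcases le_total u0 w with h | h
    · exact H1 w z h hwz
    · rcases Nat.lt_or_ge z u0 with h' | h'
      · rw [hone w h, hone (z + 1) (by omega)]
        have : Real.log w ≤ Real.log z := Real.log_le_log (by exact_mod_cast (by omega : 0 < w)) (by exact_mod_cast hwz)
        nlinarith
      · have h1 := H1 u0 z le_rfl h'
        rw [hone u0 le_rfl] at h1
        rw [hone w h]
        have : Real.log w ≤ Real.log u0 := Real.log_le_log (by exact_mod_cast (by omega : 0 < w)) (by exact_mod_cast h)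
        linarith
  have hz1 : (1 : ℝ) < z := by exact_mod_cast (by omega : 1 < z)
  have hlz : 0 < Real.log z := Real.log_pos hz1
  have hzD : (z : ℝ) ^ 2 ≤ D := by
    refine le_trans ?_ hD
    rw [← Real.rpow_natCast]
    exact Real.rpow_le_rpow_of_exponent_le hz1.le (by push_cast; linarith)
  have hb := (TV_bound P (fun p h => (hP p h).1) g1 hg ε hε.le H E (J E) f (J f) GE.anti GE.nn GE.J_nn GE.J_diff Gf.anti Gf.nn Gf.J_nn Gf.J_diff
    hA hB hC z D).1 hzD
  have hs : 2 + δ ≤ Real.log D / Real.log z := by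
    rw [le_div_iff₀ hlz, ← Real.log_rpow (by linarith)]
    exact Real.log_le_log (Real.rpow_pos_of_pos (by linarith) _) hD
  have hf := Gf.anti hs
  have h1 : VV P g1 z * (δ / 4) ≤ TV P g1 z false D := le_trans (mul_le_mul_of_nonneg_left (by linarith) (hV z).le) hb
  refine le_trans ?_ h1
  have h2 := H 2 z le_rfl hz
  rw [hone 2 (by omega)] at h2
  have h3 := VV_anti P g1 hg z
  have h4 : Real.log 2 ≤ (1 + ε) * Real.log z * VV P g1 z := by
    refine le_trans (by push_cast at h2; linarith) (mul_le_mul_of_nonneg_left h3 (by positivity))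
  have h5 : Real.log 2 / (1 + ε) / Real.log z ≤ VV P g1 z := by
    rw [div_div, div_le_iff₀ (by positivity)]
    linarith
  calc _ = (Real.log 2 / (1 + ε) / Real.log z) * (δ / 4) := by ring
    _ ≤ _ := mul_le_mul_of_nonneg_right h5 (by positivity)

lemma qr_exists (m0 : ℕ) (hodd : Odd m0) (q : ℕ) (hq : q.Prime) (hd : 4 * m0 ∣ q + 1) : ∃ t : ℤ, (q : ℤ) ∣ t ^ 2 - (m0 : ℤ) := by
  have : Fact q.Prime := ⟨hq⟩
  have hq4 : q % 4 = 3 := by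
    have : 4 ∣ q + 1 := (Dvd.intro _ rfl : 4 ∣ 4 * m0).trans hd
    omega
  have hqo : Odd q := by rw [Nat.odd_iff]; omega
  have hjq : jacobiSym q m0 = ZMod.χ₄ m0 := by
    rw [← jacobiSym.at_neg_one hodd]
    apply jacobiSym.mod_left'
    have : (m0 : ℤ) ∣ (q : ℤ) - (-1) := by
      have : m0 ∣ q + 1 := (Dvd.intro_left _ rfl : m0 ∣ 4 * m0).trans hd
      have h2 : (m0 : ℤ) ∣ ((q + 1 : ℕ) : ℤ) := by exact_mod_cast this
      simpa using h2
    exact Int.emod_eq_emod_iff_emod_sub_eq_zero.2 (Int.emod_eq_zero_of_dvd this)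
  have hj : jacobiSym m0 q = 1 := by
    have ho := Nat.odd_iff.1 hodd
    rcases (by omega : m0 % 4 = 1 ∨ m0 % 4 = 3) with h | h
    · rw [jacobiSym.quadratic_reciprocity_one_mod_four h hqo, hjq, ZMod.χ₄_nat_one_mod_four h]
    · rw [jacobiSym.quadratic_reciprocity_three_mod_four h hq4, hjq, ZMod.χ₄_nat_three_mod_four h]
      norm_num
  rw [← jacobiSym.legendreSym.to_jacobiSym] at hj
  have hne : ((m0 : ℤ) : ZMod q) ≠ 0 := by
    intro h
    rw [← legendreSym.eq_zero_iff] at h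
    omega
  rw [legendreSym.eq_one_iff q hne] at hj
  obtain ⟨r, hr⟩ := hj
  refine ⟨(r.val : ℤ), ?_⟩
  rw [← ZMod.intCast_zmod_eq_zero_iff_dvd]
  push_cast
  rw [ZMod.natCast_zmod_val]
  push_cast at hr
  rw [hr]; ring

lemma cheb_block : ∃ n0 : ℕ, 1 ≤ n0 ∧ ∀ n : ℕ, n0 ≤ n → (n : ℝ) ≤ ∑ p ∈ (Ioc n (4 * n)).filter Nat.Prime, Real.log p := by
  have h1 := (isLittleO_log_rpow_atTop (show (0 : ℝ) < 1 / 2 by norm_num)).bound (show (0 : ℝ) < 1 / 64 by norm_num)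
  have h2 : ∀ᶠ n : ℕ in Filter.atTop, ‖Real.log ((4 * n : ℕ) : ℝ)‖ ≤ 1 / 64 * ‖((4 * n : ℕ) : ℝ) ^ (1 / 2 : ℝ)‖ := by
    have : Filter.Tendsto (fun n : ℕ => ((4 * n : ℕ) : ℝ)) Filter.atTop Filter.atTop :=
      tendsto_natCast_atTop_atTop.comp (Filter.tendsto_atTop_mono (fun n => by simp only [id]; omega) Filter.tendsto_id)
    exact this.eventually h1
  obtain ⟨n0, hn0⟩ := Filter.eventually_atTop.1 h2
  refine ⟨n0 + 1, by omega, fun n hn => ?_⟩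
  have h3 := hn0 n (by omega)
  have hn1 : (1 : ℝ) ≤ n := by exact_mod_cast (by omega : 1 ≤ n)
  have hx1 : (1 : ℝ) ≤ ((4 * n : ℕ) : ℝ) := by push_cast; linarith
  have hth := Chebyshev.theta_ge (4 * n)
  have hth2 := Chebyshev.theta_le_log4_mul_x (x := (n : ℝ)) (by positivity)
  rw [← Real.sqrt_eq_rpow, Real.norm_of_nonneg (Real.log_nonneg hx1), Real.norm_of_nonneg (Real.sqrt_nonneg _)] at h3
  set x : ℝ := ((4 * n : ℕ) : ℝ) with hx
  have hx4 : x = 4 * n := by rw [hx]; push_cast; ring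
  have hs : √x * √x = x := Real.mul_self_sqrt (by linarith)
  have hs1 : 1 ≤ √x := Real.one_le_sqrt.2 hx1
  have h4 : 2 * √x * Real.log x ≤ x / 32 := by nlinarith
  have h5 : Real.log (x + 1) ≤ x / 32 := by
    have : Real.log (x + 1) ≤ Real.log (x ^ 2) := Real.log_le_log (by linarith) (by nlinarith)
    rw [Real.log_pow] at this
    push_cast at this
    nlinarith
  have hdiff : Chebyshev.theta x = Chebyshev.theta n + ∑ p ∈ (Ioc n (4 * n)).filter Nat.Prime, Real.log p := by
    unfold Chebyshev.theta
    rw [hx, Nat.floor_natCast, Nat.floor_natCast, sum_filter, sum_filter, sum_filter]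
    rw [← Ioc_union_Ioc_eq_Ioc (Nat.zero_le n) (by omega : n ≤ 4 * n), sum_union (Ioc_disjoint_Ioc_of_le le_rfl)]
  have hl4 : Real.log 4 = 2 * Real.log 2 := by
    rw [show (4 : ℝ) = 2 ^ 2 by norm_num, Real.log_pow]; norm_num
  have := Real.log_two_gt_d9
  rw [hl4] at hth2
  have h6 : (n : ℝ) * 0.69 ≤ n * Real.log 2 := by gcongr; linarith
  rw [hx4] at hth h4 h5 hdiff
  linarith

lemma p1_sum : ∃ n0 : ℕ, 2 ≤ n0 ∧ ∀ z : ℕ, n0 ≤ z → 1 / (12 * Real.log z) ≤ ∑ p ∈ (Ioc z (4 * z)).filter Nat.Prime, 1 / ((p : ℝ) - 1) := by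
  obtain ⟨n0, hn0, hb⟩ := cheb_block
  refine ⟨n0 + 2, by omega, fun z hz => ?_⟩
  have hz2 : (2 : ℝ) ≤ z := by exact_mod_cast (by omega : 2 ≤ z)
  have h1 := hb z (by omega)
  have hlz : 0 < Real.log z := Real.log_pos (by linarith)
  have hl4 : Real.log (4 * z) ≤ 3 * Real.log z := by
    rw [← Real.log_rpow (by linarith)]
    refine Real.log_le_log (by linarith) ?_
    norm_cast
    have : 2 ≤ z := by omega
    nlinarith [Nat.mul_le_mul this this]
  have h2 : ∑ p ∈ (Ioc z (4 * z)).filter Nat.Prime, Real.log p ≤ (4 * z * (3 * Real.log z)) * ∑ p ∈ (Ioc z (4 * z)).filter Nat.Prime, 1 / ((p : ℝ) - 1) := by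
    rw [mul_sum]
    refine sum_le_sum fun p hp => ?_
    simp only [mem_filter, mem_Ioc] at hp
    have hp1 : (z : ℝ) < p := by exact_mod_cast hp.1.1
    have hp2 : (p : ℝ) ≤ 4 * z := by exact_mod_cast hp.1.2
    rw [mul_one_div, le_div_iff₀ (by linarith)]
    have : Real.log p ≤ 3 * Real.log z := (Real.log_le_log (by linarith) hp2).trans hl4
    have : 0 ≤ Real.log p := Real.log_nonneg (by linarith)
    nlinarith
  rw [div_le_iff₀ (by positivity)]
  have h3 := h1.trans h2
  have : (z : ℝ) * 1 ≤ z * ((∑ p ∈ (Ioc z (4 * z)).filter Nat.Prime, 1 / ((p : ℝ) - 1)) * (12 * Real.log z)) := by linarith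
  exact le_of_mul_le_mul_left this (by linarith)

lemma X0_ge : ∃ c : ℝ, 0 < c ∧ ∃ n0 : ℕ, ∀ y : ℕ, n0 ≤ y → c * y * Real.log y ^ 22 ≤ X0 y := by
  obtain ⟨n0, hn0, hb⟩ := cheb_block
  refine ⟨1 / 32 * (1 / 2) ^ 22, by positivity, 8 * n0 + 300, fun y hy => ?_⟩
  have hy0 : (300 : ℝ) ≤ y := by exact_mod_cast (by omega : 300 ≤ y)
  set n := y / 8 with hn
  have h1 := hb n (by omega)
  have hny : (y : ℝ) / 16 ≤ n := by
    have : y ≤ 16 * n := by omega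
    have : (y : ℝ) ≤ 16 * n := by exact_mod_cast this
    linarith
  have hly : 0 < Real.log y := Real.log_pos (by linarith)
  unfold X0
  have h2 : ∑ p ∈ (Ioc n (4 * n)).filter Nat.Prime, Real.log p * ((1 / 2) ^ 22 * Real.log y ^ 22 * (1 / 2)) ≤ ∑ m ∈ Icc 1 y, WW y m := by
    refine le_trans (sum_le_sum fun p hp => ?_) (sum_le_sum_of_subset_of_nonneg (s := (Ioc n (4 * n)).filter Nat.Prime) ?_ fun i _ _ => WW_nonneg _ _)
    · simp only [mem_filter, mem_Ioc] at hp
      have hpn : (y : ℝ) / 16 ≤ p := hny.trans (by exact_mod_cast hp.1.1.le)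
      have hp2 : (p : ℝ) ≤ y / 2 := by
        have : 2 * p ≤ y := by omega
        have : (2 : ℝ) * p ≤ y := by exact_mod_cast this
        linarith
      have hp0 : (0 : ℝ) < p := by linarith
      unfold WW
      rw [ArithmeticFunction.vonMangoldt_apply_prime hp.2]
      have hlp : 1 / 2 * Real.log y ≤ Real.log p := by
        have : Real.log y ≤ Real.log ((p : ℝ) ^ 2) := Real.log_le_log (by linarith) (by nlinarith)
        rw [Real.log_pow] at this
        push_cast at this
        linarith
      have ht : 1 / 2 ≤ tri (p / y) := by
        unfold tri
        refine le_trans ?_ (le_max_left _ _)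
        have : (p : ℝ) / y ≤ 1 / 2 := by rw [div_le_iff₀ (by linarith)]; linarith
        linarith
      have : 0 ≤ Real.log p := by linarith
      rw [← mul_pow]
      gcongr
    · intro p hp
      simp only [mem_filter, mem_Ioc] at hp
      rw [mem_Icc]
      have := hp.2.one_lt
      omega
  rw [← sum_mul] at h2
  refine le_trans ?_ h2
  have h3 : (y : ℝ) / 16 ≤ ∑ p ∈ (Ioc n (4 * n)).filter Nat.Prime, Real.log p := hny.trans h1
  have h4 := mul_le_mul_of_nonneg_right h3 (show 0 ≤ ((1 / 2 : ℝ) ^ 22 * Real.log y ^ 22 * (1 / 2)) by positivity)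
  refine le_trans (le_of_eq ?_) h4
  ring

lemma crt_exists (M : ℕ) (hM : 2 ≤ M) (k : ℕ) : ∃ b : ℕ, (1 ≤ k → b.Coprime k) ∧
    ∀ j, k = M * j → M.Coprime j → ∀ n, n ≡ b [MOD k] ↔ n ≡ M - 1 [MOD M] ∧ n ≡ 1 [MOD j] := by
  by_cases h : ∃ j, k = M * j ∧ M.Coprime j
  · obtain ⟨j, rfl, hj⟩ := h
    obtain ⟨b, h1, h2⟩ := Nat.chineseRemainder hj (M - 1) 1
    refine ⟨b, fun _ => ?_, ?_⟩
    · apply Nat.Coprime.mul_right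
      · rw [Nat.Coprime, h1.gcd_eq]
        have : (M - 1).Coprime (M - 1 + 1) := by simp
        rwa [Nat.sub_add_cancel (by omega)] at this
      · rw [Nat.Coprime, h2.gcd_eq]; simp
    · intro j' hj' hc n
      have : j = j' := Nat.eq_of_mul_eq_mul_left (by omega) hj'
      subst this
      rw [← Nat.modEq_and_modEq_iff_modEq_mul hj]
      exact ⟨fun ⟨a, c⟩ => ⟨a.trans h1, c.trans h2⟩, fun ⟨a, c⟩ => ⟨a.trans h1.symm, c.trans h2.symm⟩⟩
  · exact ⟨1, fun _ => by simp, fun j h1 h2 => absurd ⟨j, h1, h2⟩ h⟩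

open Classical in
noncomputable def cw (Y M : ℕ) (i : ℕ × ℕ) : ℝ := if i.2 ≡ M - 1 [MOD M] ∧ i.2 ≡ 1 [MOD i.1] then WW Y i.2 else 0

lemma cw_nonneg (Y M : ℕ) (i : ℕ × ℕ) : 0 ≤ cw Y M i := by
  unfold cw; split_ifs
  · exact WW_nonneg _ _
  · exact le_rfl

lemma A_eval (M Y p d k b : ℕ) (hM : M.Coprime (p * d)) (hpd : p.Coprime d) (hk : k = M * (p * d))
    (hb : ∀ j, k = M * j → M.Coprime j → ∀ n, n ≡ b [MOD k] ↔ n ≡ M - 1 [MOD M] ∧ n ≡ 1 [MOD j]) :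
    ∑ n ∈ Icc 1 Y, cw Y M (p, n) * (if d ∣ n - 1 then 1 else 0) = ∑ n ∈ (Icc 1 Y).filter (fun n => n ≡ b [MOD k]), WW Y n := by
  rw [sum_filter]
  apply sum_congr rfl
  intro n hn
  rw [mem_Icc] at hn
  have h1 : d ∣ n - 1 ↔ n ≡ 1 [MOD d] := by
    rw [Nat.ModEq.comm, Nat.modEq_iff_dvd' hn.1]
  have h2 := hb _ hk hM n
  rw [← Nat.modEq_and_modEq_iff_modEq_mul hpd] at h2
  unfold cw
  simp only [h1, h2]
  by_cases a : n ≡ M - 1 [MOD M] <;> by_cases c : n ≡ 1 [MOD p] <;> by_cases e : n ≡ 1 [MOD d] <;> simp [a, c, e]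

open Classical in
lemma sieve_lower (M : ℕ) (hM : 2 ≤ M) (b : ℕ → ℕ)
    (hb : ∀ k j, k = M * j → M.Coprime j → ∀ n, n ≡ b k [MOD k] ↔ n ≡ M - 1 [MOD M] ∧ n ≡ 1 [MOD j])
    (P : ℕ → Prop) (hP : ∀ p, P p → p.Prime ∧ M.Coprime p) (Y z N : ℕ) (D : ℝ) (hD : 1 ≤ D) (hzD : (z : ℝ) ^ 2 ≤ D)
    (hz : M ≤ z) (hN : (M : ℝ) * (4 * z * D) ≤ N) :
    X0 Y / (M.totient : ℝ) * (∑ p ∈ (Ioc z (4 * z)).filter Nat.Prime, 1 / ((p : ℝ) - 1)) * TV P g1 z false D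
      - ∑ k ∈ Icc 1 N, |(∑ n ∈ (Icc 1 Y).filter (fun n => n ≡ b k [MOD k]), WW Y n) - X0 Y / (k.totient : ℝ)|
    ≤ ∑ i ∈ ((Ioc z (4 * z)).filter Nat.Prime) ×ˢ Icc 1 Y, cw Y M i * sI P z (i.2 - 1) := by
  set Q := (Ioc z (4 * z)).filter Nat.Prime with hQ
  set E : ℕ → ℝ := fun k => (∑ n ∈ (Icc 1 Y).filter (fun n => n ≡ b k [MOD k]), WW Y n) - X0 Y / (k.totient : ℝ) with hE
  have hPp : ∀ p, P p → p.Prime := fun p h => (hP p h).1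
  set A : ℕ → ℝ := fun d => ∑ i ∈ Q ×ˢ Icc 1 Y, cw Y M i * (if d ∣ i.2 - 1 then 1 else 0) with hA
  set G : ℕ → ℝ := fun d => X0 Y / (M.totient : ℝ) * (∑ p ∈ Q, 1 / ((p : ℝ) - 1)) * (1 / (d.totient : ℝ)) with hG
  have hQp : ∀ p ∈ Q, p.Prime ∧ z < p ∧ p ≤ 4 * z ∧ M.Coprime p := by
    intro p hp
    rw [hQ, mem_filter, mem_Ioc] at hp
    refine ⟨hp.2, hp.1.1, hp.1.2, ?_⟩
    rw [Nat.coprime_comm, hp.2.coprime_iff_not_dvd]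
    intro h
    have := Nat.le_of_dvd (by omega) h
    omega
  have hcop : ∀ d ∈ SS P z, M.Coprime d ∧ ∀ p ∈ Q, p.Coprime d := by
    intro d hd
    obtain ⟨h1, h2⟩ := SS_mem P hPp z d hd
    constructor
    · rw [Nat.coprime_comm]
      apply Nat.Coprime.symm
      apply Nat.coprime_of_dvd
      intro q hq hqM hqd
      have := (hP q (h2 q hq hqd).1).2
      rw [Nat.coprime_comm, hq.coprime_iff_not_dvd] at this
      exact this hqM
    · intro p hp
      rw [(hQp p hp).1.coprime_iff_not_dvd]
      intro h
      have := (h2 p (hQp p hp).1 h).2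
      have := (hQp p hp).2.1
      omega
  have hAG : ∀ d ∈ SS P z, A d - G d = ∑ p ∈ Q, E (M * (p * d)) := by
    intro d hd
    obtain ⟨c1, c2⟩ := hcop d hd
    simp only [hA, hE, hG]
    rw [sum_product, sum_sub_distrib]
    congr 1
    · apply sum_congr rfl
      intro p hp
      exact A_eval M Y p d _ _ (Nat.Coprime.mul_right (hQp p hp).2.2.2 c1) (c2 p hp) rfl (hb _)
    · rw [mul_sum, sum_mul]
      apply sum_congr rfl
      intro p hp
      rw [Nat.totient_mul (Nat.Coprime.mul_right (hQp p hp).2.2.2 c1), Nat.totient_mul (c2 p hp), Nat.totient_prime (hQp p hp).1]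
      have := (hQp p hp).1.one_lt
      rw [Nat.cast_mul, Nat.cast_mul, Nat.cast_sub this.le, Nat.cast_one]
      rw [div_mul_div_comm, div_mul_div_comm, mul_one, mul_one, mul_assoc]
  have hT1 : TS P A z false D 1 = TS P G z false D 1 + TS P (fun d => A d - G d) z false D 1 := by
    rw [← TS_add]
    congr 1
    funext d
    ring
  have hcop1 : ∀ q < z, P q → (1 : ℕ).Coprime q := fun q _ _ => by simp
  have hTG : TS P G z false D 1 = X0 Y / (M.totient : ℝ) * (∑ p ∈ Q, 1 / ((p : ℝ) - 1)) * TV P g1 z false D := by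
    rw [TS_mult P hPp G g1 ?_ z false D 1 hcop1]
    · simp [hG]
    · intro e p hp hc
      simp only [hG, g1]
      rw [Nat.totient_mul hc, Nat.totient_prime (hPp p hp), Nat.cast_mul, Nat.cast_sub (hPp p hp).one_lt.le, Nat.cast_one, mul_assoc _ (1 / _) (1 / _),
        div_mul_div_comm, mul_one]
  have hTE : |TS P (fun d => A d - G d) z false D 1| ≤ ∑ k ∈ Icc 1 N, |E k| := by
    refine (TS_abs P hPp _ z false D 1 hD (fun _ => hzD) (by simp)).trans ?_
    rw [← sum_filter]
    calc ∑ d ∈ (SS P z).filter (fun d : ℕ => (d : ℝ) ≤ D), |A (1 * d) - G (1 * d)|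
        ≤ ∑ d ∈ (SS P z).filter (fun d : ℕ => (d : ℝ) ≤ D), ∑ p ∈ Q, |E (M * (p * d))| := by
          apply sum_le_sum
          intro d hd
          rw [one_mul, hAG d (mem_filter.1 hd).1]
          exact abs_sum_le_sum_abs _ _
      _ = ∑ i ∈ (SS P z).filter (fun d : ℕ => (d : ℝ) ≤ D) ×ˢ Q, |E (M * (i.2 * i.1))| := by rw [sum_product]
      _ = ∑ k ∈ ((SS P z).filter (fun d : ℕ => (d : ℝ) ≤ D) ×ˢ Q).image (fun i => M * (i.2 * i.1)), |E k| := by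
          rw [sum_image]
          rintro ⟨d, p⟩ h ⟨d', p'⟩ h' heq
          rw [mem_coe, mem_product, mem_filter] at h h'
          simp only at h h' heq
          have heq := Nat.eq_of_mul_eq_mul_left (by omega) heq
          have hpp : p = p' := by
            have : p ∣ p' * d' := heq ▸ Dvd.intro _ rfl
            rw [(hQp p h.2).1.dvd_mul] at this
            rcases this with h3 | h3
            · exact (Nat.prime_dvd_prime_iff_eq (hQp p h.2).1 (hQp p' h'.2).1).1 h3
            · have := ((SS_mem P hPp z d' h'.1.1).2 p (hQp p h.2).1 h3).2
              have := (hQp p h.2).2.1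
              omega
          subst hpp
          rw [Nat.eq_of_mul_eq_mul_left (hQp p h.2).1.pos heq]
      _ ≤ ∑ k ∈ Icc 1 N, |E k| := by
          apply sum_le_sum_of_subset_of_nonneg
          · intro k hk
            rw [mem_image] at hk
            obtain ⟨⟨d, p⟩, h, rfl⟩ := hk
            rw [mem_product, mem_filter] at h
            simp only at h ⊢
            have h1 := (SS_mem P hPp z d h.1.1).1
            have h2 := hQp p h.2
            rw [mem_Icc]
            refine ⟨Nat.mul_pos (by omega) (Nat.mul_pos h2.1.pos h1), ?_⟩
            have h3 : (p : ℝ) ≤ 4 * z := by exact_mod_cast h2.2.2.1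
            have : ((M * (p * d) : ℕ) : ℝ) ≤ N := by
              refine le_trans ?_ hN
              push_cast
              gcongr
              exact h.1.2
            exact_mod_cast this
          · intro _ _ _; exact abs_nonneg _
  have hTA : TS P A z false D 1 ≤ ∑ i ∈ Q ×ˢ Icc 1 Y, cw Y M i * sI P z (i.2 - 1) := by
    have := TS_sum P (Q ×ˢ Icc 1 Y) (cw Y M) (fun i d => if d ∣ i.2 - 1 then 1 else 0) z false D 1
    have e : TS P A z false D 1 = TS P (fun d => ∑ i ∈ Q ×ˢ Icc 1 Y, cw Y M i * (fun (i : ℕ × ℕ) d => if d ∣ i.2 - 1 then (1 : ℝ) else 0) i d) z false D 1 := rfl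
    rw [e, this]
    apply sum_le_sum
    intro i _
    apply mul_le_mul_of_nonneg_left _ (cw_nonneg Y M i)
    have h := (TS_sieve P hPp (i.2 - 1) z D 1 hcop1).1
    simp only [one_dvd, if_true, one_mul] at h
    convert h using 2
  have := (abs_le.1 hTE).1
  rw [← hTG]
  linarith

def TP (M Y z n : ℕ) : Prop := n ≤ Y ∧ n ≡ M - 1 [MOD M] ∧ IsPrimePow n ∧ (∀ q, q.Prime → q ∣ (n - 1) / 2 → z ≤ q) ∧
  ∃ p, p.Prime ∧ p ≤ 4 * z ∧ p ∣ (n - 1) / 2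

def GP (m0 z q : ℕ) : Prop := q.Prime ∧ Odd ((q - 1) / 2) ∧ Squarefree ((q - 1) / 2) ∧ 2 ≤ ((q - 1) / 2).primeFactors.card ∧
  (∀ p ∈ ((q - 1) / 2).primeFactors, z ≤ p) ∧ ∃ t : ℤ, (q : ℤ) ∣ t ^ 2 - (m0 : ℤ)

lemma mod_M (M n : ℕ) (hM : 4 ≤ M) (h : n ≡ M - 1 [MOD M]) : M ∣ n + 1 := by
  have : n + 1 ≡ M - 1 + 1 [MOD M] := h.add_right 1
  rw [Nat.sub_add_cancel (by omega)] at this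
  exact (Nat.modEq_zero_iff_dvd.1 (this.trans (by simp [Nat.ModEq])))

lemma cw_sI_ne (M Y z p n : ℕ) (hM : 4 ≤ M) (hM4 : 4 ∣ M) (hz : 2 ≤ z) (hn : n ≤ Y) (hp : p.Prime) (hpz : z < p) (hpz4 : p ≤ 4 * z)
    (h : cw Y M (p, n) * sI (fun q => q.Prime ∧ M.Coprime q) z (n - 1) ≠ 0) : TP M Y z n ∧ p ∣ n - 1 := by
  have h1 := left_ne_zero_of_mul h
  have h2 := right_ne_zero_of_mul h
  unfold cw at h1
  unfold sI at h2
  simp only [ne_eq, ite_eq_right_iff, Classical.not_imp] at h1 h2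
  obtain ⟨⟨h3, h4⟩, h5⟩ := h1
  have h2 := h2.1
  have hMn := mod_M M n hM h3
  have h4n := hM4.trans hMn
  have hpn : p ∣ n - 1 := by
    rwa [Nat.ModEq.comm, Nat.modEq_iff_dvd' (by omega)] at h4
  refine ⟨⟨hn, h3, ?_, ?_, p, hp, hpz4, ?_⟩, hpn⟩
  · unfold WW at h5
    exact ArithmeticFunction.vonMangoldt_ne_zero_iff.1 (left_ne_zero_of_mul h5)
  · intro q hq hqm
    by_contra hlt
    have hq1 : q ∣ n - 1 := by
      have : n - 1 = (n - 1) / 2 * 2 := by omega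
      rw [this]; exact hqm.mul_right 2
    refine h2 q (by omega) ⟨hq, ?_⟩ hq1
    rw [Nat.coprime_comm, hq.coprime_iff_not_dvd]
    intro hqM
    have h6 : q ∣ 2 := by
      have : n + 1 - (n - 1) = 2 := by omega
      rw [← this]; exact Nat.dvd_sub (hqM.trans hMn) hq1
    rw [Nat.prime_dvd_prime_iff_eq hq Nat.prime_two] at h6
    subst h6
    omega
  · have : n - 1 = 2 * ((n - 1) / 2) := by omega
    rw [this, hp.dvd_mul] at hpn
    rcases hpn with h | h
    · have := Nat.le_of_dvd (by norm_num) h; omega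
    · exact h

lemma card_small (z n Y : ℕ) (hz : 2 ≤ z) (hn : 1 ≤ n) (hnY : n ≤ Y) (hY : Y < z ^ 7) :
    (((Ioc z (4 * z)).filter Nat.Prime).filter (fun p => p ∣ n)).card ≤ 7 := by
  set R := ((Ioc z (4 * z)).filter Nat.Prime).filter (fun p => p ∣ n) with hR
  have hmem : ∀ p ∈ R, z ≤ p ∧ p.Prime ∧ p ∣ n := by
    intro p hp
    rw [hR, mem_filter, mem_filter, mem_Ioc] at hp
    exact ⟨hp.1.1.1.le, hp.1.2, hp.2⟩
  have h1 : ∏ p ∈ R, p ∣ n := prod_primes_dvd n (fun p hp => (hmem p hp).2.1.prime) (fun p hp => (hmem p hp).2.2)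
  have h2 : z ^ R.card ≤ ∏ p ∈ R, p := by
    rw [← prod_const]
    exact prod_le_prod' (fun p hp => (hmem p hp).1)
  have h3 : z ^ R.card < z ^ 7 := by
    have := Nat.le_of_dvd (by omega) h1
    omega
  exact ((Nat.pow_lt_pow_iff_right (by omega)).1 h3).le

open Classical in
lemma sum_upper (M Y z : ℕ) (hM : 4 ≤ M) (hM4 : 4 ∣ M) (hz : 2 ≤ z) (hY : Y < z ^ 7) :
    ∑ i ∈ ((Ioc z (4 * z)).filter Nat.Prime) ×ˢ Icc 1 Y, cw Y M i * sI (fun q => q.Prime ∧ M.Coprime q) z (i.2 - 1)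
      ≤ 7 * Real.log Y ^ 23 * (((Icc 1 Y).filter (TP M Y z)).card : ℝ) := by
  rw [sum_product_right, card_filter, Nat.cast_sum, mul_sum]
  apply sum_le_sum
  intro n hn
  rw [mem_Icc] at hn
  have hlog : 0 ≤ Real.log Y ^ 23 := pow_nonneg (Real.log_natCast_nonneg Y) _
  by_cases hT : TP M Y z n
  · rw [if_pos hT, Nat.cast_one, mul_one]
    have hn1 : 1 ≤ n - 1 := by
      have := hM4.trans (mod_M M n hM hT.2.1)
      omega
    calc ∑ p ∈ (Ioc z (4 * z)).filter Nat.Prime, cw Y M (p, n) * sI (fun q => q.Prime ∧ M.Coprime q) z (n - 1)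
        ≤ ∑ p ∈ (Ioc z (4 * z)).filter Nat.Prime, if p ∣ n - 1 then Real.log Y ^ 23 else 0 := by
          apply sum_le_sum
          intro p hp
          rw [mem_filter, mem_Ioc] at hp
          by_cases h0 : cw Y M (p, n) * sI (fun q => q.Prime ∧ M.Coprime q) z (n - 1) = 0
          · rw [h0]; split_ifs
            · exact hlog
            · exact le_rfl
          · rw [if_pos (cw_sI_ne M Y z p n hM hM4 hz hn.2 hp.2 hp.1.1 hp.1.2 h0).2]
            have a : cw Y M (p, n) ≤ Real.log Y ^ 23 := by
              unfold cw
              split_ifs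
              · exact WW_le Y n hn.2
              · exact hlog
            have b : sI (fun q => q.Prime ∧ M.Coprime q) z (n - 1) ≤ 1 := by
              unfold sI; split_ifs <;> norm_num
            have c : 0 ≤ sI (fun q => q.Prime ∧ M.Coprime q) z (n - 1) := by
              unfold sI; split_ifs <;> norm_num
            calc _ ≤ Real.log Y ^ 23 * 1 := mul_le_mul a b c hlog
              _ = _ := mul_one _
      _ = ((((Ioc z (4 * z)).filter Nat.Prime).filter (fun p => p ∣ n - 1)).card : ℝ) * Real.log Y ^ 23 := by
          rw [← sum_filter, sum_const, nsmul_eq_mul]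
      _ ≤ 7 * Real.log Y ^ 23 := by
          apply mul_le_mul_of_nonneg_right _ hlog
          exact_mod_cast card_small z (n - 1) Y hz hn1 (by omega) hY
  · rw [if_neg hT, Nat.cast_zero, mul_zero]
    apply le_of_eq
    apply sum_eq_zero
    intro p hp
    rw [mem_filter, mem_Ioc] at hp
    by_contra h0
    exact hT (cw_sI_ne M Y z p n hM hM4 hz hn.2 hp.2 hp.1.1 hp.1.2 h0).1

lemma E1_card (Y : ℕ) : ((Icc 1 Y).filter (fun n => IsPrimePow n ∧ ¬ n.Prime)).card ≤ (Nat.sqrt Y + 1) * (Nat.log 2 Y + 1) := by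
  have : (Icc 1 Y).filter (fun n => IsPrimePow n ∧ ¬ n.Prime) ⊆ (range (Nat.sqrt Y + 1) ×ˢ range (Nat.log 2 Y + 1)).image (fun i => i.1 ^ i.2) := by
    intro n hn
    rw [mem_filter, mem_Icc, isPrimePow_nat_iff] at hn
    obtain ⟨⟨_, hY⟩, ⟨p, k, hp, hk, rfl⟩, hnp⟩ := hn
    have hk2 : 2 ≤ k := by
      by_contra h
      have : k = 1 := by omega
      subst this
      rw [pow_one] at hnp
      exact hnp hp
    rw [mem_image]
    refine ⟨(p, k), ?_, rfl⟩
    rw [mem_product, mem_range, mem_range]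
    constructor
    · rw [Nat.lt_succ_iff, Nat.le_sqrt, ← pow_two]
      exact (Nat.pow_le_pow_right hp.pos hk2).trans hY
    · rw [Nat.lt_succ_iff]
      apply Nat.le_log_of_pow_le (by norm_num)
      exact (Nat.pow_le_pow_left hp.two_le k).trans hY
  refine (card_le_card this).trans (card_image_le.trans ?_)
  rw [card_product, card_range, card_range]

open Classical in
lemma E2_card (Y z : ℕ) (hz : 2 ≤ z) (hzY : z ≤ Y) :
    (((Icc 1 Y).filter (fun n => 2 ≤ n ∧ ∃ q, z ≤ q ∧ q * q ∣ n - 1)).card : ℝ) ≤ Y / ((z : ℝ) - 1) := by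
  have hsub : (Icc 1 Y).filter (fun n => 2 ≤ n ∧ ∃ q, z ≤ q ∧ q * q ∣ n - 1) ⊆
      (Ioc (z - 1) Y).biUnion (fun q => (Icc 1 Y).filter (fun n => 2 ≤ n ∧ q * q ∣ n - 1)) := by
    intro n hn
    rw [mem_filter] at hn
    obtain ⟨h1, h2, q, hq, hd⟩ := hn
    rw [mem_biUnion]
    refine ⟨q, ?_, mem_filter.2 ⟨h1, h2, hd⟩⟩
    rw [mem_Icc] at h1
    have h3 := Nat.le_of_dvd (by omega) hd
    have h4 : q ≤ q * q := Nat.le_mul_self q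
    rw [mem_Ioc]; omega
  have hone : ∀ q ∈ Ioc (z - 1) Y, (((Icc 1 Y).filter (fun n => 2 ≤ n ∧ q * q ∣ n - 1)).card : ℝ) ≤ Y * (1 / (q : ℝ) ^ 2) := by
    intro q hq
    have h1 : ((Icc 1 Y).filter (fun n => 2 ≤ n ∧ q * q ∣ n - 1)).card ≤ ((Ioc 0 Y).filter (fun n => q * q ∣ n)).card := by
      apply card_le_card_of_injOn (fun n => n - 1)
      · intro n hn
        simp only [coe_filter, Set.mem_ofPred_eq, mem_Icc, mem_Ioc] at hn ⊢
        exact ⟨by omega, hn.2.2⟩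
      · intro a ha b hb hab
        simp only [coe_filter, Set.mem_ofPred_eq, mem_Icc] at ha hb hab
        omega
    rw [Nat.Ioc_filter_dvd_card_eq_div] at h1
    have h2 : ((Y / (q * q) : ℕ) : ℝ) ≤ (Y : ℝ) / ((q * q : ℕ) : ℝ) := Nat.cast_div_le
    have h3 : (((Icc 1 Y).filter (fun n => 2 ≤ n ∧ q * q ∣ n - 1)).card : ℝ) ≤ ((Y / (q * q) : ℕ) : ℝ) := by exact_mod_cast h1
    refine h3.trans (h2.trans (le_of_eq ?_))
    push_cast; ring
  calc (((Icc 1 Y).filter (fun n => 2 ≤ n ∧ ∃ q, z ≤ q ∧ q * q ∣ n - 1)).card : ℝ)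
      ≤ ∑ q ∈ Ioc (z - 1) Y, (((Icc 1 Y).filter (fun n => 2 ≤ n ∧ q * q ∣ n - 1)).card : ℝ) := by
        exact_mod_cast (card_le_card hsub).trans card_biUnion_le
    _ ≤ ∑ q ∈ Ioc (z - 1) Y, (Y : ℝ) * (1 / (q : ℝ) ^ 2) := sum_le_sum hone
    _ ≤ Y * (1 / ((z : ℝ) - 1)) := by
        rw [← mul_sum]
        apply mul_le_mul_of_nonneg_left _ (by positivity)
        have h := sum_inv_sq (z - 1) Y (by omega) (by omega)
        rw [Nat.cast_sub (by omega), Nat.cast_one] at h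
        have : 0 ≤ 1 / (Y : ℝ) := by positivity
        linarith
    _ = _ := by ring

open Classical in
lemma T_card (m0 M Y z : ℕ) (hodd : Odd m0) (hM : 4 ≤ M) (hMm : 4 * m0 ∣ M) (hz : 2 ≤ z) (hzY : z ≤ Y) :
    (((Icc 1 Y).filter (TP M Y z)).card : ℝ) ≤ ((Icc 1 Y).filter (GP m0 z)).card + (Nat.sqrt Y + 1) * (Nat.log 2 Y + 1)
      + Y / ((z : ℝ) - 1) + (8 * z + 1) := by
  set S1 := (Icc 1 Y).filter (GP m0 z)
  set S2 := (Icc 1 Y).filter (fun n => IsPrimePow n ∧ ¬ n.Prime) with hS2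
  set S3 := (Icc 1 Y).filter (fun n => 2 ≤ n ∧ ∃ q, z ≤ q ∧ q * q ∣ n - 1)
  set S4 := Icc 1 (8 * z + 1)
  have hsub : (Icc 1 Y).filter (TP M Y z) ⊆ ((S1 ∪ S2) ∪ S3) ∪ S4 := by
    intro n hn
    rw [mem_filter] at hn
    obtain ⟨hI, hT⟩ := hn
    obtain ⟨hnY, hnM, hpp, hz', p, hp, hp4, hpm⟩ := hT
    have hMn := mod_M M n hM hnM
    have h4 : 4 ∣ n + 1 := (Dvd.intro _ rfl : 4 ∣ 4 * m0).trans (hMm.trans hMn)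
    simp only [mem_union]
    by_cases hnp : n.Prime
    swap
    · exact Or.inl (Or.inl (Or.inr (mem_filter.2 ⟨hI, hpp, hnp⟩)))
    by_cases hsf : Squarefree ((n - 1) / 2)
    swap
    · left; right
      rw [Nat.squarefree_iff_prime_squarefree] at hsf
      push Not at hsf
      obtain ⟨q, hq, hqq⟩ := hsf
      refine mem_filter.2 ⟨hI, by omega, q, hz' q hq ((Dvd.intro _ rfl).trans hqq), ?_⟩
      have : n - 1 = (n - 1) / 2 * 2 := by omega
      rw [this]; exact hqq.mul_right 2
    have hm0 : (n - 1) / 2 ≠ 0 := by omega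
    have hpm' : p ∈ ((n - 1) / 2).primeFactors := Nat.mem_primeFactors.2 ⟨hp, hpm, hm0⟩
    by_cases hc : 2 ≤ ((n - 1) / 2).primeFactors.card
    · left; left; left
      refine mem_filter.2 ⟨hI, hnp, ?_, hsf, hc, ?_, qr_exists m0 hodd n hnp (hMm.trans hMn)⟩
      · rw [Nat.odd_iff]; omega
      · intro q hq
        exact hz' q (Nat.prime_of_mem_primeFactors hq) (Nat.dvd_of_mem_primeFactors hq)
    · right
      have h1 : ((n - 1) / 2).primeFactors = {p} := by
        have hc1 : ((n - 1) / 2).primeFactors.card ≤ 1 := by omega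
        exact eq_singleton_iff_unique_mem.2 ⟨hpm', fun q hq => card_le_one.1 hc1 q hq p hpm'⟩
      have h2 := Nat.prod_primeFactors_of_squarefree hsf
      rw [h1, prod_singleton] at h2
      rw [mem_Icc] at hI ⊢
      omega
  have h1 : ((Icc 1 Y).filter (TP M Y z)).card ≤ S1.card + S2.card + S3.card + S4.card := by
    refine (card_le_card hsub).trans ((card_union_le _ _).trans ?_)
    have := card_union_le (S1 ∪ S2) S3
    have := card_union_le S1 S2
    omega
  have h2 : S2.card ≤ (Nat.sqrt Y + 1) * (Nat.log 2 Y + 1) := by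
    convert E1_card Y using 2
  have h3 : (S3.card : ℝ) ≤ Y / ((z : ℝ) - 1) := E2_card Y z hz hzY
  have h4 : S4.card = 8 * z + 1 := by simp [S4]
  have h1' : (((Icc 1 Y).filter (TP M Y z)).card : ℝ) ≤ S1.card + S2.card + S3.card + S4.card := by exact_mod_cast h1
  have h2' : (S2.card : ℝ) ≤ (Nat.sqrt Y + 1) * (Nat.log 2 Y + 1) := by exact_mod_cast h2
  have h4' : (S4.card : ℝ) = 8 * z + 1 := by exact_mod_cast h4
  linarith

lemma rpow_ev (a K : ℝ) (ha : 0 < a) : ∃ n0 : ℕ, ∀ Y : ℕ, n0 ≤ Y → K ≤ (Y : ℝ) ^ a :=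
  Filter.eventually_atTop.1 (((tendsto_rpow_atTop ha).comp tendsto_natCast_atTop_atTop).eventually_ge_atTop K)

lemma log_ev (K : ℝ) : ∃ n0 : ℕ, ∀ Y : ℕ, n0 ≤ Y → K ≤ Real.log (Y : ℝ) :=
  Filter.eventually_atTop.1 ((Real.tendsto_log_atTop.comp tendsto_natCast_atTop_atTop).eventually_ge_atTop K)

lemma err_small (κ α : ℝ) (hκ : 0 < κ) (hα : 1 / 10 ≤ α) (hα1 : α ≤ 1 / 6) : ∃ n0 : ℕ, ∀ Y : ℕ, n0 ≤ Y → ∀ z : ℕ,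
    2 ≤ z → (Y : ℝ) ^ α ≤ z → (z : ℝ) ≤ 2 * (Y : ℝ) ^ α →
    ((Nat.sqrt Y : ℝ) + 1) * ((Nat.log 2 Y : ℝ) + 1) + Y / ((z : ℝ) - 1) + (8 * z + 1) ≤ κ * Y / Real.log Y ^ 3 := by
  obtain ⟨K1, hK1, h1⟩ := L_pow_le (1 / 10) (by norm_num) (by norm_num) 1
  obtain ⟨K2, hK2, h2⟩ := L_pow_le (1 / 20) (by norm_num) (by norm_num) 3
  obtain ⟨n1, hn1⟩ := rpow_ev (1 / 20) ((4 * K1 + 19) * K2 / κ) (by norm_num)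
  refine ⟨n1 + 3, fun Y hY z hz hz1 hz2 => ?_⟩
  have hY1 : (1 : ℝ) ≤ Y := by exact_mod_cast (by omega : 1 ≤ Y)
  have hY2 : (1 : ℝ) < Y := by exact_mod_cast (by omega : 1 < Y)
  have hL : 0 < Real.log Y := Real.log_pos hY2
  set W := (Y : ℝ) ^ (9 / 10 : ℝ) with hW
  have hW1 : 1 ≤ W := Real.one_le_rpow hY1 (by norm_num)
  have hαW : (Y : ℝ) ^ α ≤ W := Real.rpow_le_rpow_of_exponent_le hY1 (by linarith)
  have e1 : ((Nat.sqrt Y : ℝ) + 1) * ((Nat.log 2 Y : ℝ) + 1) ≤ 4 * K1 * W := by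
    have a : (Nat.sqrt Y : ℝ) ≤ (Y : ℝ) ^ (1 / 2 : ℝ) := by
      rw [← Real.sqrt_eq_rpow]; exact Real.nat_sqrt_le_real_sqrt
    have a1 : 1 ≤ (Y : ℝ) ^ (1 / 2 : ℝ) := Real.one_le_rpow hY1 (by norm_num)
    have b : (Nat.log 2 Y : ℝ) ≤ 2 * Real.log Y := by
      refine (Real.natLog_le_logb Y 2).trans ?_
      rw [Real.logb, Nat.cast_ofNat, div_le_iff₀ (Real.log_pos (by norm_num))]
      have := Real.log_two_gt_d9
      nlinarith
    have c := h1 Y hY1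
    rw [pow_one] at c
    calc ((Nat.sqrt Y : ℝ) + 1) * ((Nat.log 2 Y : ℝ) + 1)
        ≤ (2 * (Y : ℝ) ^ (1 / 2 : ℝ)) * (2 * (K1 * (Y : ℝ) ^ (1 / 10 : ℝ))) := by
          apply mul_le_mul <;> first | positivity | linarith
      _ = 4 * K1 * (Y : ℝ) ^ (1 / 2 + 1 / 10 : ℝ) := by rw [Real.rpow_add (by linarith)]; ring
      _ ≤ 4 * K1 * W := by
          apply mul_le_mul_of_nonneg_left _ (by linarith)
          exact Real.rpow_le_rpow_of_exponent_le hY1 (by norm_num)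
  have hz2' : (2 : ℝ) ≤ z := by exact_mod_cast hz
  have e2 : Y / ((z : ℝ) - 1) ≤ 2 * W := by
    rw [div_le_iff₀ (by linarith)]
    have a : (Y : ℝ) ≤ W * (Y : ℝ) ^ α := by
      rw [hW, ← Real.rpow_add (by linarith)]
      calc (Y : ℝ) = (Y : ℝ) ^ (1 : ℝ) := (Real.rpow_one _).symm
        _ ≤ _ := Real.rpow_le_rpow_of_exponent_le hY1 (by linarith)
    have b : W * (Y : ℝ) ^ α ≤ W * z := mul_le_mul_of_nonneg_left hz1 (by linarith)
    nlinarith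
  have hs := hn1 Y (by omega)
  have h3 : Real.log Y ^ 3 ≤ K2 * (Y : ℝ) ^ (1 / 20 : ℝ) :=
    (pow_le_pow_left₀ hL.le (by linarith) 3).trans (h2 Y hY1)
  rw [le_div_iff₀ (by positivity)]
  rw [div_le_iff₀ hκ] at hs
  have hfin : (4 * K1 + 19) * W * Real.log Y ^ 3 ≤ κ * Y := by
    calc (4 * K1 + 19) * W * Real.log Y ^ 3 ≤ (4 * K1 + 19) * W * (K2 * (Y : ℝ) ^ (1 / 20 : ℝ)) := by gcongr
      _ = ((4 * K1 + 19) * K2) * (W * (Y : ℝ) ^ (1 / 20 : ℝ)) := by ring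
      _ ≤ ((Y : ℝ) ^ (1 / 20 : ℝ) * κ) * (W * (Y : ℝ) ^ (1 / 20 : ℝ)) := by gcongr
      _ = κ * (Y : ℝ) ^ (1 / 20 + 9 / 10 + 1 / 20 : ℝ) := by
          rw [Real.rpow_add (by linarith), Real.rpow_add (by linarith)]; ring
      _ = κ * Y := by norm_num
  refine le_trans (mul_le_mul_of_nonneg_right ?_ (by positivity)) hfin
  nlinarith

lemma params (ι : ℝ) (hι : 0 < ι) (hι1 : ι ≤ 1 / 100) (M n1 : ℕ) (hM : 1 ≤ M) : ∃ n0 : ℕ, ∀ Y : ℕ, n0 ≤ Y →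
    ∀ z : ℕ, z = ⌈(Y : ℝ) ^ (1 / 6 - ι)⌉₊ → ∀ N : ℕ, N = ⌈(M : ℝ) * (4 * z * (z : ℝ) ^ (2 + 6 * ι))⌉₊ →
    n1 ≤ z ∧ 2 ≤ z ∧ z ≤ Y ∧ Y < z ^ 7 ∧ (Y : ℝ) ^ (1 / 6 - ι) ≤ z ∧ (z : ℝ) ≤ 2 * (Y : ℝ) ^ (1 / 6 - ι) ∧ N ≤ Y ∧
    (N : ℝ) ≤ 65 * M * (Y : ℝ) ^ (1 / 2 - ι) := by
  obtain ⟨k1, hk1⟩ := rpow_ev (1 / 6 - ι) (n1 + 2) (by linarith)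
  obtain ⟨k2, hk2⟩ := rpow_ev (1 / 2) (65 * M) (by norm_num)
  refine ⟨k1 + k2 + 2, fun Y hY z hz N hN => ?_⟩
  have hM1 : (1 : ℝ) ≤ M := by exact_mod_cast hM
  have hY2 : (2 : ℝ) ≤ Y := by exact_mod_cast (by omega : 2 ≤ Y)
  have hY1 : (1 : ℝ) ≤ Y := by linarith
  have h1 := hk1 Y (by omega)
  have h2 := hk2 Y (by omega)
  set U := (Y : ℝ) ^ (1 / 6 - ι) with hU
  have hn1 : (0 : ℝ) ≤ n1 := Nat.cast_nonneg n1
  have z1 : U ≤ z := hz ▸ Nat.le_ceil U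
  have z2 : (z : ℝ) ≤ 2 * U := by
    have := Nat.ceil_lt_add_one (show 0 ≤ U by linarith)
    rw [← hz] at this; linarith
  have z0 : (0 : ℝ) < z := by linarith
  have hH : (N : ℝ) ≤ 65 * M * (Y : ℝ) ^ (1 / 2 - ι) := by
    have a := Nat.ceil_lt_add_one (show 0 ≤ (M : ℝ) * (4 * z * (z : ℝ) ^ (2 + 6 * ι)) by positivity)
    rw [← hN] at a
    have b : (z : ℝ) * (z : ℝ) ^ (2 + 6 * ι) ≤ 16 * (Y : ℝ) ^ (1 / 2 - ι) := by
      calc (z : ℝ) * (z : ℝ) ^ (2 + 6 * ι) = (z : ℝ) ^ (1 + (2 + 6 * ι)) := by rw [Real.rpow_add z0 1, Real.rpow_one]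
        _ ≤ (2 * U) ^ (1 + (2 + 6 * ι)) := Real.rpow_le_rpow z0.le z2 (by linarith)
        _ = 2 ^ (1 + (2 + 6 * ι)) * (Y : ℝ) ^ ((1 / 6 - ι) * (1 + (2 + 6 * ι))) := by
            rw [Real.mul_rpow (by norm_num) (by linarith), hU, ← Real.rpow_mul (by linarith)]
        _ ≤ 2 ^ (4 : ℝ) * (Y : ℝ) ^ (1 / 2 - ι) := by
            apply mul_le_mul
            · exact Real.rpow_le_rpow_of_exponent_le (by norm_num) (by linarith)
            · exact Real.rpow_le_rpow_of_exponent_le hY1 (by nlinarith)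
            · positivity
            · positivity
        _ = _ := by norm_num
    have c : 1 ≤ (Y : ℝ) ^ (1 / 2 - ι) := Real.one_le_rpow hY1 (by linarith)
    nlinarith
  refine ⟨?_, ?_, ?_, ?_, z1, z2, ?_, hH⟩
  · have : (n1 : ℝ) ≤ z := by linarith
    exact_mod_cast this
  · have : (2 : ℝ) ≤ z := by linarith
    exact_mod_cast this
  · have : U ≤ Y := by
      calc U ≤ (Y : ℝ) ^ (1 : ℝ) := Real.rpow_le_rpow_of_exponent_le hY1 (by linarith)
        _ = Y := Real.rpow_one _
    rw [hz]; exact Nat.ceil_le.2 this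
  · have : (Y : ℝ) < (z : ℝ) ^ 7 := by
      calc (Y : ℝ) = (Y : ℝ) ^ (1 : ℝ) := (Real.rpow_one _).symm
        _ < (Y : ℝ) ^ ((1 / 6 - ι) * 7) := Real.rpow_lt_rpow_of_exponent_lt (by linarith) (by linarith)
        _ = U ^ 7 := by rw [Real.rpow_mul (by linarith), ← hU]; norm_cast
        _ ≤ _ := by gcongr
    exact_mod_cast this
  · have : (N : ℝ) ≤ Y := by
      refine hH.trans ?_
      calc 65 * (M : ℝ) * (Y : ℝ) ^ (1 / 2 - ι) ≤ (Y : ℝ) ^ (1 / 2 : ℝ) * (Y : ℝ) ^ (1 / 2 : ℝ) := by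
            apply mul_le_mul h2 _ (by positivity) (by positivity)
            exact Real.rpow_le_rpow_of_exponent_le hY1 (by linarith)
        _ = Y := by rw [← Real.rpow_add (by linarith)]; norm_num
    exact_mod_cast this

open Classical in
lemma main_nat (m0 : ℕ) (hm0 : 0 < m0) (hodd : Odd m0) (ι : ℝ) (hι : 0 < ι) (hι1 : ι ≤ 1 / 100) : ∃ c : ℝ, 0 < c ∧ ∃ n0 : ℕ,
    ∀ Y : ℕ, n0 ≤ Y → c * Y / Real.log Y ^ 3 ≤ ((Icc 1 Y).filter (GP m0 ⌈(Y : ℝ) ^ (1 / 6 - ι)⌉₊)).card := by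
  obtain ⟨u0, hu0, c1, hc1, hsv⟩ := lin_sieve (6 * ι) (by linarith) (by linarith)
  set M := 4 * m0 * u0.factorial with hMdef
  have hM4 : 4 ∣ M := by rw [hMdef, mul_assoc]; exact Dvd.intro _ rfl
  have hMm : 4 * m0 ∣ M := Dvd.intro _ rfl
  have hMpos : 0 < M := by have := Nat.factorial_pos u0; positivity
  have hM : 4 ≤ M := Nat.le_of_dvd hMpos hM4
  have hM1 : (1 : ℝ) ≤ M := by exact_mod_cast hMpos
  set P : ℕ → Prop := fun q => q.Prime ∧ M.Coprime q with hPdef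
  have hPu : ∀ p, P p → p.Prime ∧ u0 ≤ p := by
    rintro p ⟨hp, hc⟩
    refine ⟨hp, ?_⟩
    by_contra hlt
    rw [Nat.coprime_comm, hp.coprime_iff_not_dvd] at hc
    exact hc (((Nat.Prime.dvd_factorial hp).2 (by omega)).trans (Dvd.intro_left _ rfl))
  obtain ⟨C, hC, hbv⟩ := bv_main ι (65 * M) hι (by linarith) (by linarith)
  obtain ⟨np, hnp, hps⟩ := p1_sum
  obtain ⟨c2, hc2, nx, hX0⟩ := X0_ge
  choose b hb1 hb2 using crt_exists M (by omega)
  have hφ : (0 : ℝ) < M.totient := by exact_mod_cast Nat.totient_pos.2 hMpos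
  set c4 : ℝ := c2 * c1 / (12 * M.totient) with hc4
  have hc4p : 0 < c4 := by positivity
  obtain ⟨ne, hne⟩ := err_small (c4 / 28) (1 / 6 - ι) (by positivity) (by linarith) (by linarith)
  obtain ⟨nq, hnq⟩ := params ι hι hι1 M (M + np) hMpos
  obtain ⟨nl, hnl⟩ := log_ev (1 + 2 ^ 20 * C / c4)
  refine ⟨c4 / 28, by positivity, nx + ne + nq + nl + 3, fun Y hY => ?_⟩
  set z := ⌈(Y : ℝ) ^ (1 / 6 - ι)⌉₊ with hz
  set D := (z : ℝ) ^ (2 + 6 * ι) with hD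
  set N := ⌈(M : ℝ) * (4 * z * D)⌉₊ with hN
  obtain ⟨q1, q2, q3, q4, q5, q6, q7, q8⟩ := hnq Y (by omega) z rfl N rfl
  have hz2 : (2 : ℝ) ≤ z := by exact_mod_cast q2
  have hY0 : (0 : ℝ) < Y := by exact_mod_cast (by omega : 0 < Y)
  have hD1 : 1 ≤ D := Real.one_le_rpow (by linarith) (by linarith)
  have hzD : (z : ℝ) ^ 2 ≤ D := by
    rw [← Real.rpow_natCast]
    apply Real.rpow_le_rpow_of_exponent_le (by linarith)
    push_cast; linarith
  have hlow := sieve_lower M (by omega) b hb2 P (fun p h => h) Y z N D hD1 hzD (by omega) (Nat.le_ceil _)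
  have hup := sum_upper M Y z hM hM4 q2 q4
  have herr := hbv Y (by omega) N q7 q8 b hb1
  have hT := T_card m0 M Y z hodd hM hMm q2 q3
  have hE := hne Y (by omega) z q2 q5 q6
  have hL := hnl Y (by omega)
  have hx := hX0 Y (by omega)
  have hp1 := hps z (by omega)
  have htv := hsv P hPu z D q2 le_rfl
  set L := Real.log Y with hLdef
  have hCc : 0 < 2 ^ 20 * C / c4 := by positivity
  have hL1 : 1 ≤ L := by linarith
  have hlz : 0 < Real.log z := Real.log_pos (by linarith)
  have hlzL : Real.log z ≤ L := Real.log_le_log (by linarith) (by exact_mod_cast q3)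
  have hmain : c4 * Y * L ^ 20 ≤ X0 Y / (M.totient : ℝ) * (∑ p ∈ (Ioc z (4 * z)).filter Nat.Prime, 1 / ((p : ℝ) - 1)) * TV P g1 z false D := by
    have a1 : 1 / (12 * L) ≤ ∑ p ∈ (Ioc z (4 * z)).filter Nat.Prime, 1 / ((p : ℝ) - 1) :=
      (one_div_le_one_div_of_le (by positivity) (by linarith)).trans hp1
    have a2 : c1 / L ≤ TV P g1 z false D := (div_le_div_of_nonneg_left hc1.le hlz hlzL).trans htv
    have a3 : c2 * Y * L ^ 22 / (M.totient : ℝ) ≤ X0 Y / (M.totient : ℝ) := div_le_div_of_nonneg_right hx hφ.le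
    calc c4 * Y * L ^ 20 = c2 * Y * L ^ 22 / (M.totient : ℝ) * (1 / (12 * L)) * (c1 / L) := by
          rw [hc4]; field_simp
      _ ≤ _ := by
          have p1 : 0 ≤ c2 * Y * L ^ 22 / (M.totient : ℝ) := by positivity
          have p2 : 0 ≤ 1 / (12 * L) := by positivity
          have p3 : 0 ≤ c1 / L := by positivity
          exact mul_le_mul (mul_le_mul a3 a1 p2 (p1.trans a3)) a2 p3 (mul_nonneg (p1.trans a3) (p2.trans a1))
  have hE2 : C * Y * (1 + L) ^ 19 ≤ c4 / 2 * Y * L ^ 20 := by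
    have a : (1 + L) ^ 19 ≤ (2 * L) ^ 19 := pow_le_pow_left₀ (by linarith) (by linarith) 19
    have h' : 2 ^ 20 * C ≤ L * c4 := by
      rw [← div_le_iff₀ hc4p]; linarith
    calc C * Y * (1 + L) ^ 19 ≤ C * Y * (2 * L) ^ 19 := by gcongr
      _ = (2 ^ 20 * C) * (Y * L ^ 19 / 2) := by ring
      _ ≤ (L * c4) * (Y * L ^ 19 / 2) := by gcongr
      _ = _ := by ring
  set T := (((Icc 1 Y).filter (TP M Y z)).card : ℝ)
  have hTT : c4 / 2 * Y * L ^ 20 ≤ 7 * L ^ 23 * T := by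
    have : c4 / 2 * Y * L ^ 20 = c4 * Y * L ^ 20 - c4 / 2 * Y * L ^ 20 := by ring
    rw [this]
    linarith
  have hTT2 : c4 / 14 * Y / L ^ 3 ≤ T := by
    rw [div_le_iff₀ (by positivity)]
    have h20 : 0 < 7 * L ^ 20 := by positivity
    refine le_of_mul_le_mul_right ?_ h20
    calc c4 / 14 * Y * (7 * L ^ 20) = c4 / 2 * Y * L ^ 20 := by ring
      _ ≤ _ := hTT
      _ = _ := by ring
  have : c4 / 14 * Y / L ^ 3 = c4 / 28 * Y / L ^ 3 + c4 / 28 * Y / L ^ 3 := by ring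
  linarith

end SPC

theorem seed_primes_count
    (m₀ : ℕ) (hm₀ : 0 < m₀) (hodd : Odd m₀) (hsf : Squarefree m₀)
    (ι : ℝ) (hι : 0 < ι) :
    ∃ c : ℝ, 0 < c ∧ ∃ y₀ : ℝ, ∀ y : ℝ, y₀ ≤ y →
      c * y / (Real.log y) ^ 3 ≤
        (({q : ℕ | q.Prime ∧ (q : ℝ) ≤ y ∧
            Odd ((q - 1) / 2) ∧ Squarefree ((q - 1) / 2) ∧
            2 ≤ ((q - 1) / 2).primeFactors.card ∧
            (∀ p ∈ ((q - 1) / 2).primeFactors, y ^ ((1 : ℝ) / 6 - ι) ≤ (p : ℝ)) ∧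
            ∃ t : ℤ, (q : ℤ) ∣ t ^ 2 - (m₀ : ℤ)}).ncard : ℝ) := by
  classical
  set κ := min (ι / 2) (1 / 100) with hκ
  have hκ0 : 0 < κ := by rw [hκ]; apply lt_min <;> linarith
  have hκ1 : κ ≤ 1 / 100 := min_le_right _ _
  have hκ2 : 2 * κ ≤ ι := by have := min_le_left (ι / 2) (1 / 100); linarith
  obtain ⟨c, hc, n0, hmain⟩ := SPC.main_nat m₀ hm₀ hodd κ hκ0 hκ1
  obtain ⟨k, hk⟩ := Filter.eventually_atTop.1 ((tendsto_rpow_atTop hκ0).eventually_ge_atTop 2)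
  refine ⟨c / 2, by positivity, max k (n0 + 4), fun y hy => ?_⟩
  have hyk := hk y ((le_max_left _ _).trans hy)
  have hyn : (n0 : ℝ) + 4 ≤ y := (le_max_right _ _).trans hy
  have hn00 : (0 : ℝ) ≤ n0 := Nat.cast_nonneg _
  set Y := ⌊y⌋₊ with hYdef
  have hY1 : (Y : ℝ) ≤ y := Nat.floor_le (by linarith)
  have hY2 : y / 2 ≤ Y := by
    have := Nat.lt_floor_add_one y
    rw [← hYdef] at this
    linarith
  have hYn : n0 ≤ Y := Nat.le_floor (by linarith)
  have hY3 : (2 : ℝ) ≤ Y := by linarith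
  refine le_trans ?_ ((hmain Y hYn).trans ?_)
  · have a : 0 < Real.log Y := Real.log_pos (by linarith)
    have b : Real.log Y ≤ Real.log y := Real.log_le_log (by linarith) hY1
    apply div_le_div₀
    · positivity
    · nlinarith
    · positivity
    · exact pow_le_pow_left₀ a.le b 3
  · rw [← Set.ncard_coe_finset]
    apply Nat.cast_le.2
    apply Set.ncard_le_ncard
    · intro q hq
      rw [Finset.mem_coe, Finset.mem_filter, Finset.mem_Icc] at hq
      obtain ⟨⟨_, hqY⟩, g1, g2, g3, g4, g5, g6⟩ := hq
      refine ⟨g1, le_trans (by exact_mod_cast hqY) hY1, g2, g3, g4, fun p hp => ?_, g6⟩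
      have h1 : (Y : ℝ) ^ (1 / 6 - κ) ≤ p := Nat.ceil_le.1 (g5 p hp)
      refine le_trans ?_ h1
      have hy0 : 0 < y := by linarith
      calc y ^ ((1 : ℝ) / 6 - ι) ≤ y ^ (1 / 6 - κ - κ) := Real.rpow_le_rpow_of_exponent_le (by linarith) (by linarith)
        _ = y ^ (1 / 6 - κ) / y ^ κ := Real.rpow_sub hy0 _ _
        _ ≤ y ^ (1 / 6 - κ) / 2 := by gcongr
        _ ≤ y ^ (1 / 6 - κ) / 2 ^ (1 / 6 - κ) := by
            apply div_le_div_of_nonneg_left (by positivity) (by positivity)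
            calc (2 : ℝ) ^ (1 / 6 - κ) ≤ 2 ^ (1 : ℝ) := Real.rpow_le_rpow_of_exponent_le (by norm_num) (by linarith)
              _ = 2 := Real.rpow_one _
        _ = (y / 2) ^ (1 / 6 - κ) := (Real.div_rpow hy0.le (by norm_num) _).symm
        _ ≤ (Y : ℝ) ^ (1 / 6 - κ) := Real.rpow_le_rpow (by positivity) hY2 (by linarith)
    · apply (Set.finite_Iic Y).subset
      rintro q ⟨_, h, _⟩
      exact Nat.le_floor h
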